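/- Fix β > 1/2 with β ∉ {3/2, 5/2, 7/2, …}, and let (P_n), C, a_r, A_r be as in the context. Then for every fixed real t < 0, lim_{N→∞} P_N(t) / Q_N(t) = 1, where Q_N(t) := (−1)^N (2π)^{−1/2} (−t C N^{1/β})^{−1/4} · exp( (−t)^β sec(πβ)/2 ) · exp( (N^{1−1/(2β)}/√(πC)) ∑_{r=0}^{⌊β−1/2⌋} (−1)^r A_r (−t)^{r+1/2} (C N^{1/β})^{−r} ). -/

import Mathlib

open MeasureTheory Real Filter Topology Polynomial

/-- `C(β) = 4 (Γ(β)²/Γ(2β))^{1/β}`. -/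
noncomputable def Ccoef (β : ℝ) : ℝ :=
  4 * (Real.Gamma β ^ 2 / Real.Gamma (2 * β)) ^ (1 / β)

/-- `a_r = Γ(r+1/2)/((r+1/2) Γ(r+1))`. -/
noncomputable def aCoef (r : ℕ) : ℝ :=
  Real.Gamma ((r : ℝ) + 1/2) / (((r : ℝ) + 1/2) * Real.Gamma ((r : ℝ) + 1))

/-- `A_r = a_r + (Γ(1/2−β)/2) ∑_{s=0}^r (Γ(s−1/2)/Γ(s+1)) (1−β)_{r−s} / Γ(3/2−β+r−s)`. -/
noncomputable def ACoef (β : ℝ) (r : ℕ) : ℝ :=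
  aCoef r + (Real.Gamma (1/2 - β) / 2) *
    ∑ s ∈ Finset.range (r + 1),
      (Real.Gamma ((s : ℝ) - 1/2) / Real.Gamma ((s : ℝ) + 1)) *
        (ascPochhammer ℝ (r - s)).eval (1 - β) /
        Real.Gamma (3/2 - β + ((r - s : ℕ) : ℝ))

noncomputable section
open Set (Ioi Ioo Ioc Iic Icc Iio Ici indicator_of_mem indicator_of_notMem)
open ENNReal (toReal_ofReal ofReal ofReal_lt_top ofReal_mul)
open Finset (range mul_sum sum_range_succ sum_congr)
open Complex (norm_real normSq_apply normSq_eq_norm_sq ofRealHom ofReal_add ofReal_pow)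
local notation "pz" => (by positivity)
local notation "lz" => (by linarith)
local notation "fz" => (by fun_prop)
local notation "nz" => (by norm_num)
local notation "oz" => (by omega)
local notation "sz" => (by simp)
local notation "J01" => Set.Ioo (0:ℝ) 1
local notation "hlf" => 1/2
set_option hygiene false
local notation "wB" => wM β
local notation "bm1" => (β - 1)
local notation "bmh" => (β - hlf)
local notation "bsg" => (b + σ)
local notation "ykp" => (y + κ)⁻¹
local notation "uvp" => (u * v)
local notation "xsg" => (x + σ)
local notation "ukp" => (u + κ)
local notation "RX" => ℝ[X]
local notation "bbN" => bN β N
local notation "zr" => (0:ℝ)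
local notation "PE" x:max => (P N).eval x
local notation "nSr" => ((n + 1 : ℕ) : ℝ)
local notation "icm" => integral_const_mul
local notation "mIoo" => measurableSet_Ioo
local notation "mIoi" => measurableSet_Ioi
local notation "icn" => integrable_const
local notation "mas" => Measurable.aestronglyMeasurable
local notation "icae" => integral_congr_ae
local notation "nonn" => norm_of_nonneg
local notation "iad" => integral_add
local notation "egt" => eventually_gt_atTop
variable {β σ κ : ℝ} {P : ℕ → RX} (hβ : hlf < β) (hσ : 0 < σ)
def arcM : Measure ℝ :=
  (ofReal π⁻¹) • (volume.restrict (Ioc 0 π)).map (fun θ ↦ (1 + cos θ) / 2)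
lemma arc_integral (g : ℝ → ℝ) (hg : Measurable g) :
    ∫ v, g v ∂arcM = π⁻¹ * ∫ θ in zr..π, g ((1 + cos θ) / 2) := by
  rw [arcM, integral_smul_measure, integral_map fz hg.aestronglyMeasurable,
    intervalIntegral.integral_of_le pi_pos.le, toReal_ofReal pz, smul_eq_mul]
lemma arc_integrable (g : ℝ → ℝ) (hg : Measurable g)
    (h : IntervalIntegrable (fun θ ↦ g ((1 + cos θ) / 2)) volume 0 π) :
    Integrable g arcM := by
  rw [arcM]
  refine Integrable.smul_measure ?_ sz
  rw [integrable_map_measure hg.aestronglyMeasurable fz]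
  exact (intervalIntegrable_iff_integrableOn_Ioc_of_le pi_pos.le).1 h
instance : IsProbabilityMeasure arcM := ⟨by
  rw [arcM, Measure.smul_apply, Measure.map_apply fz MeasurableSet.univ]
  simp only [Set.preimage_univ, Measure.restrict_apply_univ, Real.volume_Ioc, sub_zero, smul_eq_mul]
  rw [← ofReal_mul pz, inv_mul_cancel₀ pi_ne_zero, ENNReal.ofReal_one]⟩
lemma arc_log (η : ℂ) : Integrable (fun v : ℝ ↦ log ‖(v:ℂ) - η‖) arcM ∧
    ∃ X : ℝ, 1 ≤ X ∧ X + 1 / X = 2 * (‖η‖ + ‖η - 1‖) ∧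
      ∫ v, log ‖(v:ℂ) - η‖ ∂arcM = log (X / 4) := by
  have hm : Measurable (fun v : ℝ ↦ log ‖(v:ℂ) - η‖) := fz
  obtain ⟨z, hz0, hz⟩ : ∃ z : ℂ, z ≠ 0 ∧ z + 1 / z = 4 * η - 2 ∧ 1 ≤ ‖z‖ := by
    obtain ⟨w, hw⟩ := IsAlgClosed.exists_pow_nat_eq ((2 * η - 1) ^ 2 - 1) (n := 2) nz
    have h1 : (2 * η - 1 + w) * (2 * η - 1 - w) = 1 := by linear_combination -hw
    have ha : (2 * η - 1 + w) ≠ 0 := left_ne_zero_of_mul_eq_one h1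
    have hb : (2 * η - 1 - w) ≠ 0 := right_ne_zero_of_mul_eq_one h1
    by_cases h : 1 ≤ ‖2 * η - 1 + w‖
    · refine ⟨_, ha, ?_, h⟩
      field_simp; linear_combination h1 * (-1 : ℂ)
    · refine ⟨_, hb, ?_, ?_⟩
      · field_simp; linear_combination h1 * (-1 : ℂ)
      · have := congrArg norm h1
        rw [norm_mul, norm_one] at this
        push Not at h
        nlinarith [norm_nonneg (2 * η - 1 - w), norm_nonneg (2 * η - 1 + w)]
  obtain ⟨hz, hz1⟩ := hz
  have hzp : 0 < ‖z‖ := norm_pos_iff.2 hz0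
  have e1 : ∀ x ∈ Metric.sphere (0:ℂ) |1|, (fun x : ℂ ↦ log ‖(1 + (x + x⁻¹)/2)/2 - η‖) x =
      (fun x : ℂ ↦ log ‖x - z‖ + log ‖x - z⁻¹‖ + log (1/4)) x ∨ x = z ∨ x = z⁻¹ := by
    intro x hx
    by_cases h1 : x = z
    · exact Or.inr (Or.inl h1)
    by_cases h2 : x = z⁻¹
    · exact Or.inr (Or.inr h2)
    left
    have hx1 : ‖x‖ = 1 := by simpa using hx
    have hx0 : x ≠ 0 := by rintro rfl; simp at hx1
    have : (1 + (x + x⁻¹)/2)/2 - η = (x - z) * (x - z⁻¹) * (1/4) * x⁻¹ := by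
      have : η = (z + 1/z + 2)/4 := by rw [hz]; ring
      rw [this]; field_simp; ring
    simp only [this, norm_mul, norm_inv, hx1, inv_one, mul_one]
    rw [log_mul, log_mul]
    · norm_num
    all_goals simp [sub_eq_zero, h1, h2]
  have hI1 : CircleIntegrable (fun x : ℂ ↦ log ‖x - z‖) 0 1 := circleIntegrable_log_norm_sub_const 1
  have hI2 : CircleIntegrable (fun x : ℂ ↦ log ‖x - z⁻¹‖) 0 1 :=
    circleIntegrable_log_norm_sub_const 1
  have hcod : (fun x : ℂ ↦ log ‖x - z‖ + log ‖x - z⁻¹‖ + log (1/4)) =ᶠ[codiscreteWithin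
      (Metric.sphere (0:ℂ) |1|)] (fun x : ℂ ↦ log ‖(1 + (x + x⁻¹)/2)/2 - η‖) := by
    have : {x : ℂ | x ≠ z ∧ x ≠ z⁻¹} ∈ codiscreteWithin (Metric.sphere (0:ℂ) |1|) := by
      have hf : ({z, z⁻¹} : Set ℂ)ᶜ ∈ codiscreteWithin (Metric.sphere (0:ℂ) |1|) :=
        codiscreteWithin_mono (Set.subset_univ _) (Set.toFinite {z, z⁻¹}).compl_mem_codiscrete
      filter_upwards [hf] with x hx
      simpa using hx
    filter_upwards [this, self_mem_codiscreteWithin _] with x hx hx2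
    rcases e1 x hx2 with h | h | h
    · exact h.symm
    · exact absurd h hx.1
    · exact absurd h hx.2
  have hI12 : CircleIntegrable (fun x : ℂ ↦ log ‖x - z‖ + log ‖x - z⁻¹‖) 0 1 := hI1.add hI2
  have hI3 : CircleIntegrable (fun x : ℂ ↦ log ‖x - z‖ + log ‖x - z⁻¹‖ + log (1/4)) 0 1 :=
    (hI1.add hI2).add (circleIntegrable_const _ _ _)
  have hI : CircleIntegrable (fun x : ℂ ↦ log ‖(1 + (x + x⁻¹)/2)/2 - η‖) 0 1 :=
    hI3.congr_codiscreteWithin hcod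
  have hav : circleAverage (fun x : ℂ ↦ log ‖(1 + (x + x⁻¹)/2)/2 - η‖) 0 1 = log (‖z‖ / 4) := by
    rw [← circleAverage_congr_codiscreteWithin hcod one_ne_zero, circleAverage_fun_add hI12
      (circleIntegrable_const _ _ _), circleAverage_fun_add hI1 hI2,
      circleAverage_log_norm_sub_const_eq_posLog, circleAverage_log_norm_sub_const_eq_posLog,
      circleAverage_const, posLog_eq_log (by simpa using hz1), (posLog_eq_zero_iff _).2, add_zero,
      ← log_mul hzp.ne' nz, mul_one_div]
    rw [norm_inv, abs_of_nonneg pz]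
    exact inv_le_one_of_one_le₀ hz1
  have hcm : ∀ θ : ℝ, log ‖(1 + (circleMap 0 1 θ + (circleMap 0 1 θ)⁻¹)/2)/2 - η‖ =
      log ‖(((1 + cos θ) / 2 : ℝ):ℂ) - η‖ := by
    intro θ
    congr 3
    have : Complex.exp (θ * Complex.I) + (Complex.exp (θ * Complex.I))⁻¹ = 2 * Complex.cos θ := by
      rw [← Complex.exp_neg, Complex.two_cos]; ring_nf
    simp only [circleMap, Complex.ofReal_one, one_mul, zero_add, this]
    push_cast; ring
  have hII : IntervalIntegrable (fun θ : ℝ ↦ log ‖(((1 + cos θ) / 2 : ℝ):ℂ) - η‖)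
      volume 0 (2*π) := by
    have := hI
    unfold CircleIntegrable at this
    simpa only [hcm] using this
  have h1 : IntervalIntegrable (fun θ : ℝ ↦ log ‖(((1 + cos θ) / 2 : ℝ):ℂ) - η‖)
      volume 0 π := hII.mono_set (by
        rw [Set.uIcc_of_le pi_pos.le, Set.uIcc_of_le pz]
        exact Set.Icc_subset_Icc le_rfl (by linarith [pi_pos]))
  have h2 : IntervalIntegrable (fun θ : ℝ ↦ log ‖(((1 + cos θ) / 2 : ℝ):ℂ) - η‖)
      volume π (2*π) := hII.mono_set (by
        rw [Set.uIcc_of_le (by linarith [pi_pos]), Set.uIcc_of_le pz]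
        exact Set.Icc_subset_Icc pi_pos.le le_rfl)
  refine ⟨arc_integrable _ hm h1, ‖z‖, hz1, ?_, ?_⟩
  · have a1 : η = (z + 1) ^ 2 / (4 * z) := by
      have : η = (z + 1/z + 2)/4 := by rw [hz]; ring
      rw [this]; field_simp; ring
    have a2 : η - 1 = (z - 1) ^ 2 / (4 * z) := by
      rw [a1]; field_simp; ring
    rw [a2, a1, norm_div, norm_div, norm_pow, norm_pow, norm_mul]
    have a3 := parallelogram_law_with_norm ℝ z 1
    simp only [norm_one, Complex.norm_ofNat] at a3 ⊢
    field_simp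
    nlinarith
  · rw [arc_integral _ hm, ← hav, circleAverage_def]
    simp only [hcm]
    rw [← intervalIntegral.integral_add_adjacent_intervals h1 h2]
    have : ∫ θ in π..(2*π), log ‖(((1 + cos θ) / 2 : ℝ):ℂ) - η‖ =
        ∫ θ in zr..π, log ‖(((1 + cos θ) / 2 : ℝ):ℂ) - η‖ := by
      have := intervalIntegral.integral_comp_sub_left (a := 0) (b := π)
        (fun θ : ℝ ↦ log ‖(((1 + cos θ) / 2 : ℝ):ℂ) - η‖) (2*π)
      rw [sub_zero, show 2 * π - π = π by ring] at this
      rw [← this]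
      simp only [Real.cos_two_pi_sub]
    rw [this, smul_eq_mul]; field_simp; ring
lemma arc_eq_density : arcM = (volume.restrict (J01)).withDensity
    (fun v ↦ ofReal (1 / (π * √(v * (1 - v))))) := by
  refine Measure.ext_of_lintegral _ fun g hg ↦ ?_
  rw [lintegral_withDensity_eq_lintegral_mul _ fz hg, arcM, lintegral_smul_measure,
    lintegral_map hg fz, setLIntegral_congr (Ioo_ae_eq_Ioc (a := 0) (b := π)).symm]
  have himg : (fun θ ↦ (1 + cos θ) / 2) '' Ioo 0 π = Ioo 0 1 := by
    ext v
    constructor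
    · rintro ⟨θ, hθ, rfl⟩
      have h1 : cos π < cos θ := Real.cos_lt_cos_of_nonneg_of_le_pi hθ.1.le le_rfl hθ.2
      have h2 : cos θ < cos 0 := Real.cos_lt_cos_of_nonneg_of_le_pi le_rfl hθ.2.le hθ.1
      simp only [Real.cos_pi, Real.cos_zero] at h1 h2
      constructor <;> dsimp only <;> linarith
    · intro hv
      refine ⟨Real.arccos (2 * v - 1), ⟨?_, ?_⟩, ?_⟩
      · rw [Real.arccos_pos]; linarith [hv.2]
      · rw [Real.arccos_lt_pi]; linarith [hv.1]
      · dsimp only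
        rw [Real.cos_arccos (by linarith [hv.1]) (by linarith [hv.2])]; ring
  rw [← himg, lintegral_image_eq_lintegral_abs_deriv_mul (f' := fun θ ↦ -sin θ / 2)
    mIoo]
  · rw [smul_eq_mul, ← lintegral_const_mul _ fz]
    refine setLIntegral_congr_fun mIoo fun θ hθ ↦ ?_
    have hs := Real.sin_pos_of_pos_of_lt_pi hθ.1 hθ.2
    have : √((1 + cos θ) / 2 * (1 - (1 + cos θ) / 2)) = sin θ / 2 := by
      rw [show (1 + cos θ) / 2 * (1 - (1 + cos θ) / 2) = (sin θ / 2) ^ 2 by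
        rw [div_pow, Real.sin_sq]; ring, Real.sqrt_sq pz]
    simp only [Pi.mul_apply, this]
    rw [← mul_assoc, ← ofReal_mul (abs_nonneg _)]
    congr 2
    rw [neg_div, abs_neg, abs_of_pos pz]
    field_simp
  · intro θ _
    exact ((((Real.hasDerivAt_cos θ).const_add 1).div_const 2)).hasDerivWithinAt
  · intro a ha b hb h
    exact Real.injOn_cos ⟨ha.1.le, ha.2.le⟩ ⟨hb.1.le, hb.2.le⟩ (by dsimp only at h; linarith)
lemma arc_ae : ∀ᵐ v ∂arcM, v ∈ J01 := by
  rw [arc_eq_density]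
  exact (withDensity_absolutelyContinuous _ _).ae_le (ae_restrict_mem mIoo)
lemma arc_integral_density (g : ℝ → ℝ) :
    ∫ v, g v ∂arcM = ∫ v in J01, 1 / (π * √(v * (1 - v))) * g v := by
  rw [arc_eq_density, integral_withDensity_eq_integral_toReal_smul fz
    (ae_of_all _ fun _ ↦ ofReal_lt_top)]
  refine icae (ae_of_all _ fun v ↦ ?_)
  simp only [smul_eq_mul]
  rw [toReal_ofReal pz]
lemma arc_integrable_density (g : ℝ → ℝ) : Integrable g arcM ↔
    IntegrableOn (fun v ↦ 1 / (π * √(v * (1 - v))) * g v) (Ioo 0 1) := by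
  rw [arc_eq_density, integrable_withDensity_iff_integrable_smul' fz
    (ae_of_all _ fun _ ↦ ofReal_lt_top)]
  refine integrable_congr (ae_of_all _ fun v ↦ ?_)
  simp only [smul_eq_mul]
  rw [toReal_ofReal pz]
lemma arc_intble_bdd {g : ℝ → ℝ} (hg : AEStronglyMeasurable g arcM) (C : ℝ)
    (h : ∀ v ∈ J01, |g v| ≤ C) : Integrable g arcM :=
  Integrable.of_bound hg C (arc_ae.mono fun v hv ↦ h v hv)
lemma joukow_le {q x y : ℝ} (hx : 0 < x) (hy : 0 < y) (hqx : q ≤ x) (hq : 0 ≤ q)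
    (h : y + q ^ 2 / y ≤ x + q ^ 2 / x) : y ≤ x := by
  by_contra! hc
  have e : (x + q ^ 2 / x) - (y + q ^ 2 / y) = (x - y) * (x * y - q ^ 2) / (x * y) := by
    field_simp; ring
  have : (x - y) * (x * y - q ^ 2) / (x * y) < 0 := by
    apply div_neg_of_neg_of_pos _ pz
    apply mul_neg_of_neg_of_pos lz
    nlinarith
  linarith
lemma arc_log_eq (η : ℂ) (Y : ℝ) (hY : 1 ≤ Y) (h : Y + 1 / Y = 2 * (‖η‖ + ‖η - 1‖)) :
    ∫ v, log ‖(v:ℂ) - η‖ ∂arcM = log (Y / 4) := by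
  obtain ⟨X, hX, h1, h2⟩ := (arc_log η).2
  have : X = Y := by
    apply le_antisymm
    · exact joukow_le (q := 1) lz lz hY nz (by norm_num; norm_num at h h1; linarith)
    · exact joukow_le (q := 1) lz lz hX nz (by norm_num; norm_num at h h1; linarith)
  rw [h2, this]
lemma arc_log_ge (η : ℂ) : - log 4 ≤ ∫ v, log ‖(v:ℂ) - η‖ ∂arcM := by
  obtain ⟨X, hX, h1, h2⟩ := (arc_log η).2
  rw [h2, log_div lz nz]
  linarith [log_nonneg hX]
lemma arc_log_real (η : ℝ) (h : η ≤ 0 ∨ 1 ≤ η) :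
    ∫ v, log |v - η| ∂arcM = 2 * log (√|η| + √|η - 1|) - log 4 := by
  have h1 : √|η| ^ 2 = |η| := sq_sqrt (abs_nonneg _)
  have h2 : √|η - 1| ^ 2 = |η - 1| := sq_sqrt (abs_nonneg _)
  have h3 : 1 ≤ |η| + |η - 1| := by
    rcases h with h | h
    · rw [abs_of_nonpos (by linarith : η - 1 ≤ 0), abs_of_nonpos h]; linarith
    · rw [abs_of_nonneg (by linarith : 0 ≤ η - 1), abs_of_nonneg lz]; linarith
  have hd : (|η| - |η - 1|) ^ 2 = 1 := by
    rcases h with h | h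
    · rw [abs_of_nonpos (by linarith : η - 1 ≤ 0), abs_of_nonpos h]; ring
    · rw [abs_of_nonneg (by linarith : 0 ≤ η - 1), abs_of_nonneg lz]; ring
  have hY : 1 ≤ (√|η| + √|η - 1|) ^ 2 := by nlinarith [sqrt_nonneg |η|, sqrt_nonneg |η - 1|]
  have := arc_log_eq (η : ℂ) _ hY (by
    have e : (√|η| + √|η - 1|) ^ 2 * (√|η| - √|η - 1|) ^ 2 = 1 := by
      rw [← mul_pow, show (√|η| + √|η - 1|) * (√|η| - √|η - 1|) = |η| - |η - 1| by
        linear_combination h1 - h2, hd]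
    have e2 : 1 / (√|η| + √|η - 1|) ^ 2 = (√|η| - √|η - 1|) ^ 2 := by
      rw [eq_comm, eq_div_iff lz, mul_comm]; exact e
    rw [e2, norm_real, norm_eq_abs, show ((η:ℂ) - 1) = ((η - 1 : ℝ) : ℂ) by push_cast; ring,
      norm_real, norm_eq_abs]
    nlinarith)
  rw [log_div lz nz, log_pow] at this
  push_cast at this
  rw [← this]
  refine icae (ae_of_all _ fun v ↦ ?_)
  dsimp only
  rw [← Complex.ofReal_sub, norm_real, norm_eq_abs]
lemma arc_log_real_intble (η : ℝ) : Integrable (fun v ↦ log |v - η|) arcM := by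
  refine (arc_log (η : ℂ)).1.congr (ae_of_all _ fun v ↦ ?_)
  dsimp only
  rw [← Complex.ofReal_sub, norm_real, norm_eq_abs]
def mob (b σ v : ℝ) : ℝ := b * σ * v / (b * (1 - v) + σ)
def Tb (b σ : ℝ) : ℝ := (√bsg + √σ) / √b
lemma Tb_ge {b : ℝ} (hb : 0 < b) (hσ : 0 < σ) : 1 ≤ Tb b σ := by
  rw [Tb, one_le_div pz]
  have := sqrt_le_sqrt (show b ≤ b + σ by linarith)
  linarith [sqrt_nonneg σ]
lemma mob_den {b : ℝ} (hb : 0 < b) (hσ : 0 < σ) {v : ℝ} (hv : v ∈ J01) :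
    0 < b * (1 - v) + σ := by
  have : 0 < 1 - v := by linarith [hv.2]
  positivity
lemma mob_mem {b : ℝ} (hb : 0 < b) (hσ : 0 < σ) {v : ℝ} (hv : v ∈ J01) :
    mob b σ v ∈ Ioo 0 b := by
  have h := mob_den hb hσ hv
  have := hv.1
  constructor
  · unfold mob; positivity
  · unfold mob; rw [div_lt_iff₀ h]
    have : 0 < (1 - v) := by linarith [hv.2]
    have := mul_pos (mul_pos hb (by linarith : 0 < b + σ)) this
    nlinarith
lemma Tb_log {b : ℝ} (hb : 0 < b) (hσ : 0 < σ) :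
    Integrable (fun v ↦ log (b * (1 - v) + σ)) arcM ∧
    ∫ v, log (b * (1 - v) + σ) ∂arcM = log (b / 4) + 2 * log (Tb b σ) := by
  have e : (fun v ↦ log (b * (1 - v) + σ)) =ᵐ[arcM] fun v ↦ log b + log |v - bsg / b| := by
    filter_upwards [arc_ae] with v hv
    have h := mob_den hb hσ hv
    have : v - bsg / b = - ((b * (1 - v) + σ) / b) := by field_simp; ring
    rw [this, abs_neg, abs_of_pos pz, log_div h.ne' hb.ne']; ring
  have hi := arc_log_real_intble (bsg / b)
  refine ⟨((icn _).add hi).congr e.symm, ?_⟩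
  have h1 : 1 ≤ bsg / b := by rw [one_le_div hb]; linarith
  rw [icae e, iad (icn _) hi, arc_log_real _ (Or.inr h1),
    abs_of_nonneg lz, abs_of_nonneg lz,
    show bsg / b - 1 = σ / b by field_simp; ring, sqrt_div lz, sqrt_div hσ.le, ← add_div,
    ← Tb, log_div hb.ne' nz]
  simp; ring
lemma mob_add {b : ℝ} (c2 : ℂ) {v : ℝ} (h : b * (1 - v) + σ ≠ 0) :
    (mob b σ v : ℂ) + c2 = (b * (σ - c2) * v + c2 * bsg) / ((b * (1 - v) + σ : ℝ) : ℂ) := by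
  have h' : ((b * (1 - v) + σ : ℝ) : ℂ) ≠ 0 := by exact_mod_cast h
  unfold mob
  push_cast at h' ⊢
  field_simp; ring
lemma pav_log {b : ℝ} (hb : 0 < b) (hσ : 0 < σ) (c : ℂ) :
    Integrable (fun v ↦ log ‖(mob b σ v : ℂ) + c ^ 2‖) arcM ∧
    ∃ m : ℝ, 0 < m ∧ ‖σ - c ^ 2‖ ≤ m ∧
      m + ‖σ - c ^ 2‖ ^ 2 / m = 2 * (‖c‖ ^ 2 * (bsg / b) + σ * (‖c ^ 2 + b‖ / b)) ∧
      ∫ v, log ‖(mob b σ v : ℂ) + c ^ 2‖ ∂arcM = log m - 2 * log (Tb b σ) := by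
  have hbs : 0 < b + σ := lz
  have hbsC : (b + σ : ℂ) ≠ 0 := by exact_mod_cast hbs.ne'
  have hbC : (b : ℂ) ≠ 0 := by exact_mod_cast hb.ne'
  obtain ⟨hT1, hT2⟩ := Tb_log hb hσ
  by_cases hq : (σ : ℂ) - c ^ 2 = 0
  · have e : (fun v : ℝ ↦ log ‖(mob b σ v : ℂ) + c ^ 2‖) =ᵐ[arcM]
        fun v ↦ log (σ * bsg) - log (b * (1 - v) + σ) := by
      filter_upwards [arc_ae] with v hv
      have h := mob_den hb hσ hv
      rw [mob_add _ h.ne', hq, mul_zero, zero_mul, zero_add, ← sub_eq_zero.1 hq, norm_div,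
        norm_real, nonn h.le,
        show (σ : ℂ) * bsg = ((σ * bsg : ℝ) : ℂ) by push_cast; ring, norm_real,
        nonn pz, log_div pz h.ne']
    refine ⟨((icn _).sub hT1).congr e.symm, 4 * σ * (bsg / b), pz, ?_, ?_, ?_⟩
    · rw [hq, norm_zero]; positivity
    · have h1 : ‖c‖ ^ 2 = σ := by
        rw [← norm_pow, ← sub_eq_zero.1 hq, norm_real, nonn hσ.le]
      have h2 : ‖c ^ 2 + b‖ = b + σ := by
        rw [← sub_eq_zero.1 hq, ← ofReal_add, norm_real, nonn]
        · ring
        · linarith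
      rw [h1, h2, hq, norm_zero]; ring
    · rw [icae e, integral_sub (icn _) hT1, hT2]
      simp only [integral_const, probReal_univ, one_smul]
      rw [show 4 * σ * (bsg / b) = σ * bsg / (b / 4) by field_simp,
        log_div (x := σ * bsg) pz pz]
      ring
  · have hqp : 0 < ‖(σ : ℂ) - c ^ 2‖ := norm_pos_iff.2 hq
    set η : ℂ := - (c ^ 2 * bsg) / (b * (σ - c ^ 2)) with hη
    obtain ⟨hi, X, hX, h1, h2⟩ := arc_log η
    have hne : ∀ᵐ v : ℝ ∂arcM, (v : ℂ) - η ≠ 0 := by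
      have h0 : arcM ({η.re} : Set ℝ) = 0 := by
        rw [arc_eq_density]
        exact withDensity_absolutelyContinuous _ _ sz
      filter_upwards [compl_mem_ae_iff.2 h0] with v hv h
      apply hv
      have := congrArg Complex.re (sub_eq_zero.1 h)
      simpa using this
    have e : (fun v : ℝ ↦ log ‖(mob b σ v : ℂ) + c ^ 2‖) =ᵐ[arcM]
        fun v ↦ (log (b * ‖(σ : ℂ) - c ^ 2‖) + log ‖(v : ℂ) - η‖) - log (b * (1 - v) + σ) := by
      filter_upwards [arc_ae, hne] with v hv hv2
      have h := mob_den hb hσ hv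
      have e2 : (b * (σ - c ^ 2) * v + c ^ 2 * bsg) = b * (σ - c ^ 2) * (v - η) := by
        rw [hη]; field_simp; ring
      rw [mob_add _ h.ne', e2, norm_div, norm_mul, norm_mul, norm_real, norm_real,
        nonn h.le, nonn hb.le, log_div _ h.ne', log_mul]
      · positivity
      · exact norm_ne_zero_iff.2 hv2
      · exact mul_ne_zero pz (norm_ne_zero_iff.2 hv2)
    refine ⟨(((icn _).add hi).sub hT1).congr e.symm, ‖(σ : ℂ) - c ^ 2‖ * X,
      by positivity, ?_, ?_, ?_⟩
    · nlinarith
    · have h3 : ‖(σ : ℂ) - c ^ 2‖ * X + ‖(σ : ℂ) - c ^ 2‖ ^ 2 / (‖(σ : ℂ) - c ^ 2‖ * X) =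
          ‖(σ : ℂ) - c ^ 2‖ * (X + 1 / X) := by field_simp
      have h4 : ‖η‖ = ‖c‖ ^ 2 * bsg / (b * ‖(σ : ℂ) - c ^ 2‖) := by
        rw [hη, norm_div, norm_neg, norm_mul, norm_mul, norm_pow, ← ofReal_add,
          norm_real, norm_real, nonn hbs.le, nonn hb.le]
      have h5 : ‖η - 1‖ = σ * ‖c ^ 2 + b‖ / (b * ‖(σ : ℂ) - c ^ 2‖) := by
        have : η - 1 = - (σ * (c ^ 2 + b)) / (b * (σ - c ^ 2)) := by
          rw [hη]; field_simp; ring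
        rw [this, norm_div, norm_neg, norm_mul, norm_mul,
          norm_real, norm_real, nonn hσ.le, nonn hb.le]
      rw [h3, h1, h4, h5]; field_simp
    · have hi2 : Integrable (fun v : ℝ ↦ log (b * ‖(σ : ℂ) - c ^ 2‖) + log ‖(v : ℂ) - η‖) arcM :=
        (icn _).add hi
      rw [icae e, integral_sub hi2 hT1,
        iad (icn _) hi, h2, hT2]
      simp only [integral_const, probReal_univ, one_smul]
      rw [log_mul hb.ne' hqp.ne', log_mul hqp.ne' lz, log_div lz nz,
        log_div hb.ne' nz]
      ring
lemma arc_singleton (x : ℝ) : arcM ({x} : Set ℝ) = 0 := by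
  rw [arc_eq_density]
  exact withDensity_absolutelyContinuous _ _ sz
lemma mob_ne {b : ℝ} (hb : 0 < b) (hσ : 0 < σ) (ζ : ℂ) :
    ∀ᵐ v : ℝ ∂arcM, (mob b σ v : ℂ) - ζ ≠ 0 := by
  filter_upwards [compl_mem_ae_iff.2 (arc_singleton (ζ.re * bsg / (b * (ζ.re + σ)))), arc_ae]
    with v hv hv1 h
  apply hv
  have h1 := congrArg Complex.re (sub_eq_zero.1 h)
  rw [Complex.ofReal_re] at h1
  have h2 := mob_den hb hσ hv1
  have h3 := (mob_mem hb hσ hv1).1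
  rw [← h1, Set.mem_singleton_iff, eq_div_iff pz]
  rw [mob]; field_simp; ring
lemma norm_add_sq_le {s : ℝ} (hs : 0 < s) (hσ : σ = s ^ 2) {b : ℝ} (hb : 0 < b) (c : ℂ) {m : ℝ}
    (hm : 0 < m) (hqm : ‖(σ:ℂ) - c ^ 2‖ ≤ m)
    (h : m + ‖(σ:ℂ) - c ^ 2‖ ^ 2 / m = 2 * (‖c‖ ^ 2 * (bsg / b) + σ * (‖c ^ 2 + b‖ / b))) :
    ‖s + c‖ ^ 2 ≤ m := by
  by_cases h0 : ‖s + c‖ = 0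
  · rw [h0]; simpa using hm.le
  have hp : 0 < ‖s + c‖ := lt_of_le_of_ne (norm_nonneg _) (Ne.symm h0)
  refine joukow_le hm pz hqm (norm_nonneg _) ?_
  rw [h]
  have e1 : (σ : ℂ) - c ^ 2 = (s + c) * (s - c) := by rw [hσ]; push_cast; ring
  have e2 := parallelogram_law_with_norm ℝ (s : ℂ) c
  rw [norm_real, nonn hs.le] at e2
  have e3 : ‖s + c‖ ^ 2 + ‖(σ:ℂ) - c ^ 2‖ ^ 2 / ‖s + c‖ ^ 2 = 2 * (‖c‖ ^ 2 + σ) := by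
    rw [e1, norm_mul, hσ]; field_simp; nlinarith
  rw [e3]
  have e4 : b ≤ ‖c‖ ^ 2 + ‖c ^ 2 + b‖ := by
    have := norm_sub_le (c ^ 2 + b) (c ^ 2)
    rw [add_sub_cancel_left, norm_real, nonn hb.le, norm_pow] at this
    linarith
  have e5 : 0 ≤ σ * (‖c‖ ^ 2 + ‖c ^ 2 + b‖ - b) / b := by
    rw [hσ]
    have : 0 ≤ ‖c‖ ^ 2 + ‖c ^ 2 + b‖ - b := lz
    positivity
  have e6 : ‖c‖ ^ 2 * (bsg / b) + σ * (‖c ^ 2 + b‖ / b) = ‖c‖ ^ 2 + σ + σ * (‖c‖ ^ 2 + ‖c ^ 2 + b‖ - b) / b := by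
    field_simp; ring
  rw [e6]; linarith
lemma log_mprod (S : Multiset ℝ) (h : ∀ a ∈ S, a ≠ 0) : log S.prod = (S.map log).sum := by
  induction S using Multiset.induction_on with
  | empty => simp
  | cons a S ih =>
    rw [Multiset.prod_cons, Multiset.map_cons, Multiset.sum_cons, log_mul (h a sz),
      ih (fun b hb ↦ h b (by simp [hb]))]
    rw [Ne, Multiset.prod_eq_zero_iff]
    exact fun h0 ↦ h 0 (by simp [h0]) rfl
lemma multi_log {s b : ℝ} (hs : 0 < s) (hσ : σ = s ^ 2) (hb : 0 < b) (S : Multiset ℂ) :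
    Integrable (fun v ↦ (S.map (fun κ ↦ log ‖(mob b σ v : ℂ) - κ ^ 2‖)).sum) arcM ∧
    (S.map (fun κ ↦ ‖Complex.I * s - κ‖ ^ 2)).prod ≤
      exp (∫ v, (S.map (fun κ ↦ log ‖(mob b σ v : ℂ) - κ ^ 2‖)).sum ∂arcM) *
        Tb b σ ^ (2 * S.card) := by
  have hσp : 0 < σ := by rw [hσ]; positivity
  have hT := Tb_ge hb hσp
  induction S using Multiset.induction_on with
  | empty => simp
  | cons κ S ih =>
    obtain ⟨i1, i2⟩ := ih
    obtain ⟨hi, m, hm, hqm, h1, h2⟩ := pav_log hb hσp (Complex.I * κ)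
    have e : ∀ x : ℂ, x + (Complex.I * κ) ^ 2 = x - κ ^ 2 := by
      intro x; rw [mul_pow, Complex.I_sq]; ring
    have h3 := norm_add_sq_le hs hσ hb _ hm hqm h1
    have e2 : ‖s + Complex.I * κ‖ = ‖Complex.I * s - κ‖ := by
      rw [show Complex.I * s - κ = Complex.I * (s + Complex.I * κ) by
        rw [mul_add, ← mul_assoc, Complex.I_mul_I]; ring, norm_mul, Complex.norm_I, one_mul]
    simp only [e] at hi h2
    simp only [Multiset.map_cons, Multiset.sum_cons, Multiset.prod_cons, Multiset.card_cons]
    refine ⟨hi.add i1, ?_⟩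
    rw [iad hi i1, h2, exp_add, exp_sub, exp_log hm, two_mul (log _), exp_add,
      exp_log lz]
    rw [← e2]
    calc _ ≤ m * (exp (∫ v, (S.map (fun κ ↦ log ‖(mob b σ v : ℂ) - κ ^ 2‖)).sum ∂arcM) *
        Tb b σ ^ (2 * S.card)) := by
          have : 0 ≤ (S.map (fun κ ↦ ‖Complex.I * s - κ‖ ^ 2)).prod :=
            Multiset.prod_nonneg (by
              intro a ha; obtain ⟨κ, _, rfl⟩ := Multiset.mem_map.1 ha; positivity)
          gcongr
      _ = _ := by rw [mul_add, pow_add]; field_simp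
def Fab (A B : RX) (x : ℝ) : ℝ := A.eval x ^ 2 + x * B.eval x ^ 2
lemma U0 {s b : ℝ} (hs : 0 < s) (hσ : σ = s ^ 2) (hb : 0 < b) (N : ℕ) (A B : RX)
    (hA : A.natDegree ≤ N) (hB : B = 0 ∨ B.natDegree + 1 ≤ N) (h0 : A ≠ 0 ∨ B ≠ 0) :
    (∀ᵐ v ∂arcM, 0 < Fab A B (mob b σ v)) ∧
    Integrable (fun v ↦ log (Fab A B (mob b σ v))) arcM ∧
    (A.eval (-σ) + s * B.eval (-σ)) ^ 2 ≤
      exp (∫ v, log (Fab A B (mob b σ v)) ∂arcM) * Tb b σ ^ (4 * N) := by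
  have hσp : 0 < σ := by rw [hσ]; positivity
  have hT := Tb_ge hb hσp
  set Ac := A.map ofRealHom
  set Bc := B.map ofRealHom
  set p : ℂ[X] := Ac.comp (X ^ 2) - C Complex.I * (X * Bc.comp (X ^ 2)) with hp
  have evA : ∀ x : ℝ, Ac.eval (x : ℂ) = ((A.eval x : ℝ) : ℂ) := fun x ↦ by
    simpa using Polynomial.eval_map_apply ofRealHom (p := A) x
  have evB : ∀ x : ℝ, Bc.eval (x : ℂ) = ((B.eval x : ℝ) : ℂ) := fun x ↦ by
    simpa using Polynomial.eval_map_apply ofRealHom (p := B) x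
  have ev : ∀ y : ℝ, p.eval (y : ℂ) = ((A.eval (y ^ 2) : ℝ) : ℂ) - Complex.I * (y * ((B.eval (y ^ 2) : ℝ) : ℂ)) := by
    intro y
    simp only [hp, eval_sub, eval_mul, eval_C, eval_X, eval_comp, eval_pow, ← ofReal_pow,
      evA, evB]
  have evn : ∀ y : ℝ, ‖p.eval (y : ℂ)‖ ^ 2 = Fab A B (y ^ 2) := by
    intro y
    rw [ev, ← normSq_eq_norm_sq, normSq_apply, Fab]
    simp; ring
  have evi : p.eval (Complex.I * s) = ((A.eval (-σ) + s * B.eval (-σ) : ℝ) : ℂ) := by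
    have e : (Complex.I * s) ^ 2 = ((-σ : ℝ) : ℂ) := by rw [mul_pow, Complex.I_sq, hσ]; push_cast; ring
    simp only [hp, eval_sub, eval_mul, eval_C, eval_X, eval_comp, eval_pow, e, evA, evB]
    push_cast
    linear_combination (- (s * ((B.eval (-σ) : ℝ) : ℂ))) * Complex.I_mul_I
  have hdeg : p.natDegree ≤ 2 * N := by
    have d1 : (Ac.comp (X ^ 2)).natDegree ≤ 2 * N := by
      rw [natDegree_comp, natDegree_X_pow, mul_comm]
      exact Nat.mul_le_mul_left _ ((natDegree_map_le).trans hA)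
    have d2 : (C Complex.I * (X * Bc.comp (X ^ 2))).natDegree ≤ 2 * N := by
      rcases hB with hB | hB
      · simp [Bc, hB]
      · refine (natDegree_C_mul_le _ _).trans ((natDegree_mul_le).trans ?_)
        rw [natDegree_comp, natDegree_X_pow, natDegree_X]
        have : Bc.natDegree ≤ B.natDegree := natDegree_map_le
        omega
    exact (natDegree_sub_le _ _).trans (max_le d1 d2)
  have hp0 : p ≠ 0 := by
    intro hpz
    have key : ∀ x : ℝ, 0 < x → A.eval x = 0 ∧ B.eval x = 0 := by
      intro x hx
      have h1 := evn (√x)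
      rw [hpz, eval_zero, norm_zero, sq_sqrt hx.le, Fab] at h1
      constructor <;> by_contra hc
      · have := sq_pos_of_ne_zero hc
        nlinarith [mul_nonneg hx.le (sq_nonneg (B.eval x))]
      · have := mul_pos hx (sq_pos_of_ne_zero hc)
        nlinarith [(sq_nonneg (A.eval x))]
    rcases h0 with h0 | h0
    · exact h0 (eq_zero_of_infinite_isRoot _ ((Set.Ioi_infinite zr).mono fun x hx ↦ (key x hx).1))
    · exact h0 (eq_zero_of_infinite_isRoot _ ((Set.Ioi_infinite zr).mono fun x hx ↦ (key x hx).2))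
  have hL : 0 < ‖p.leadingCoeff‖ := by simpa using hp0
  have hfac : ∀ z : ℂ, p.eval z = p.leadingCoeff * (p.roots.map (fun κ ↦ z - κ)).prod := by
    intro z
    conv_lhs => rw [(IsAlgClosed.splits p).eq_prod_roots]
    rw [eval_mul, eval_C, eval_multiset_prod, Multiset.map_map]
    simp
  have hnorm : ∀ z : ℂ, ‖p.eval z‖ = ‖p.leadingCoeff‖ * (p.roots.map (fun κ ↦ ‖z - κ‖)).prod := by
    intro z
    rw [hfac, norm_mul]
    congr 1
    rw [show (fun κ ↦ ‖z - κ‖) = (fun z : ℂ ↦ ‖z‖) ∘ (fun κ ↦ z - κ) from rfl, ← Multiset.map_map]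
    exact (map_multiset_prod (normHom : ℂ →*₀ ℝ) _)
  have hF : ∀ x : ℝ, 0 ≤ x → Fab A B x = ‖p.leadingCoeff‖ ^ 2 *
      (p.roots.map (fun κ ↦ ‖(x:ℂ) - κ ^ 2‖)).prod := by
    intro x hx
    have h1 : ‖p.eval ((√x : ℝ) : ℂ)‖ = ‖p.eval ((-√x : ℝ) : ℂ)‖ := by
      have a := evn (√x)
      have b' := evn (-√x)
      rw [neg_sq, ← a] at b'
      exact ((sq_eq_sq₀ (norm_nonneg _) (norm_nonneg _)).1 b').symm
    have h2 := evn (√x)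
    rw [sq_sqrt hx] at h2
    rw [← h2, sq]
    nth_rewrite 2 [h1]
    rw [hnorm, hnorm, show ∀ a b c d : ℝ, a * b * (c * d) = a * c * (b * d) by intros; ring, ← sq,
      ← Multiset.prod_map_mul]
    congr 2
    apply Multiset.map_congr rfl
    intro κ _
    rw [← norm_mul, ← norm_neg]
    congr 1
    have : ((√x : ℝ) : ℂ) ^ 2 = x := by rw [← ofReal_pow, sq_sqrt hx]
    push_cast
    linear_combination this
  have hne : ∀ᵐ v ∂arcM, ∀ κ ∈ p.roots, ‖(mob b σ v : ℂ) - κ ^ 2‖ ≠ 0 := by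
    have : ∀ᵐ v ∂arcM, ∀ κ : p.roots.toFinset, ‖(mob b σ v : ℂ) - (κ : ℂ) ^ 2‖ ≠ 0 := by
      rw [ae_all_iff]
      intro κ
      filter_upwards [mob_ne hb hσp ((κ : ℂ) ^ 2)] with v hv
      exact norm_ne_zero_iff.2 hv
    filter_upwards [this] with v hv κ hκ
    exact hv ⟨κ, Multiset.mem_toFinset.2 hκ⟩
  have hlog : ∀ᵐ v ∂arcM, 0 < Fab A B (mob b σ v) ∧ log (Fab A B (mob b σ v)) =
      2 * log ‖p.leadingCoeff‖ + (p.roots.map (fun κ ↦ log ‖(mob b σ v : ℂ) - κ ^ 2‖)).sum := by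
    filter_upwards [hne, arc_ae] with v hv hv1
    have h1 : (p.roots.map (fun κ ↦ ‖(mob b σ v : ℂ) - κ ^ 2‖)).prod ≠ 0 := by
      rw [Ne, Multiset.prod_eq_zero_iff]
      intro hc
      obtain ⟨κ, hκ, h2⟩ := Multiset.mem_map.1 hc
      exact hv κ hκ h2
    have h2 : 0 ≤ (p.roots.map (fun κ ↦ ‖(mob b σ v : ℂ) - κ ^ 2‖)).prod :=
      Multiset.prod_nonneg (by intro a ha; obtain ⟨κ, _, rfl⟩ := Multiset.mem_map.1 ha; positivity)
    have h3 := lt_of_le_of_ne h2 (Ne.symm h1)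
    rw [hF _ (mob_mem hb hσp hv1).1.le]
    refine ⟨pz, ?_⟩
    rw [log_mul pz h1, log_pow, log_mprod _ (by
      intro a ha
      obtain ⟨κ, hκ, rfl⟩ := Multiset.mem_map.1 ha
      exact hv κ hκ), Multiset.map_map]
    simp
  obtain ⟨j1, j2⟩ := multi_log hs hσ hb p.roots
  have hlog2 := hlog.mono fun v hv ↦ hv.2
  refine ⟨hlog.mono fun v hv ↦ hv.1, ((icn _).add j1).congr (by
    filter_upwards [hlog2] with v hv; rw [hv]; rfl), ?_⟩
  have h1 := hnorm (Complex.I * s)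
  rw [evi, norm_real, norm_eq_abs] at h1
  rw [← sq_abs, h1, mul_pow, ← Multiset.prod_map_pow, icae hlog2,
    iad (icn _) j1, exp_add]
  simp only [integral_const, probReal_univ, one_smul]
  rw [two_mul (log _), exp_add, exp_log hL, mul_assoc, sq]
  gcongr
  refine j2.trans ?_
  exact mul_le_mul_of_nonneg_left (pow_le_pow_right₀ hT (by have := card_roots' p; omega)) (exp_pos _).le
lemma arc_lintegral (f : ℝ → ENNReal) (hf : Measurable f) :
    ∫⁻ v, f v ∂arcM = ∫⁻ v in J01, ofReal (1 / (π * √(v * (1 - v)))) * f v := by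
  rw [arc_eq_density, lintegral_withDensity_eq_lintegral_mul _ fz hf]
  rfl
lemma arc_cov (f : ℝ → ENNReal) (hf : Measurable f) (φ φ' d : ℝ → ℝ) (J : Set ℝ)
    (hφm : Measurable φ)
    (hφ : ∀ v ∈ J01, HasDerivAt φ (φ' v) v) (hφ0 : ∀ v ∈ J01, 0 < φ' v)
    (hJ : φ '' J01 = J)
    (hinj : Set.InjOn φ (J01))
    (hd : ∀ v ∈ J01, φ' v * d (φ v) = 1 / (π * √(v * (1 - v)))) :
    ∫⁻ v, f (φ v) ∂arcM = ∫⁻ x in J, ofReal (d x) * f x := by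
  rw [arc_lintegral (fun v ↦ f (φ v)) (hf.comp hφm), ← hJ, lintegral_image_eq_lintegral_abs_deriv_mul mIoo
    (fun v hv ↦ (hφ v hv).hasDerivWithinAt) hinj]
  refine setLIntegral_congr_fun mIoo fun v hv ↦ ?_
  rw [← hd v hv, abs_of_pos (hφ0 v hv), ofReal_mul (hφ0 v hv).le, mul_assoc]
lemma arc_scale {u : ℝ} (hu : 0 < u) (f : ℝ → ENNReal) (hf : Measurable f) :
    ∫⁻ v, f uvp ∂arcM =
      ∫⁻ x in Ioo zr u, ofReal (1 / (π * √(x * (u - x)))) * f x := by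
  refine arc_cov f hf (fun v ↦ u * v) (fun _ ↦ u) _ _ fz (fun v _ ↦ ?_) (fun _ _ ↦ hu) ?_ ?_ ?_
  · simpa using (hasDerivAt_id v).const_mul u
  · ext x
    simp only [Set.mem_image, Set.mem_Ioo]
    constructor
    · rintro ⟨v, ⟨h1, h2⟩, rfl⟩
      exact ⟨pz, by nlinarith⟩
    · rintro ⟨h1, h2⟩
      exact ⟨x / u, ⟨pz, by rw [div_lt_one hu]; exact h2⟩, by field_simp⟩
  · intro a _ b _ h
    exact mul_left_cancel₀ hu.ne' h
  · intro v hv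
    rw [show u * v * (u - u * v) = u ^ 2 * (v * (1 - v)) by ring, sqrt_mul pz,
      sqrt_sq hu.le]
    have h1 : 0 < v * (1 - v) := mul_pos hv.1 (by linarith [hv.2])
    have h2 : 0 < √(v * (1 - v)) := pz
    field_simp
lemma mob_hasDeriv {b : ℝ} (hb : 0 < b) (hσ : 0 < σ) {v : ℝ} (hv : v ∈ J01) :
    HasDerivAt (mob b σ) (b * σ * bsg / (b * (1 - v) + σ) ^ 2) v := by
  have h := mob_den hb hσ hv
  have := ((hasDerivAt_id v).const_mul (b * σ)).div
    ((((hasDerivAt_id v).const_sub 1).const_mul b).add_const σ) h.ne'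
  refine this.congr_deriv ?_
  simp only [id]
  congr 1
  ring
@[fun_prop] lemma mob_meas (b σ : ℝ) : Measurable (mob b σ) := by
  unfold mob; fun_prop
lemma mob_law {b : ℝ} (hb : 0 < b) (hσ : 0 < σ) (f : ℝ → ENNReal) (hf : Measurable f) :
    ∫⁻ v, f (mob b σ v) ∂arcM =
      ∫⁻ x in Ioo zr b,
        ofReal (√σ * √bsg / (π * xsg * √(x * (b - x)))) * f x := by
  refine arc_cov f hf (mob b σ) (fun v ↦ b * σ * bsg / (b * (1 - v) + σ) ^ 2) _ _ fz
    (fun v hv ↦ mob_hasDeriv hb hσ hv) (fun v hv ↦ ?_) ?_ ?_ ?_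
  · have h := mob_den hb hσ hv
    positivity
  · ext x
    simp only [Set.mem_image]
    constructor
    · rintro ⟨v, hv, rfl⟩
      exact mob_mem hb hσ hv
    · rintro ⟨h1, h2⟩
      refine ⟨x * bsg / (b * xsg), ⟨pz, ?_⟩, ?_⟩
      · rw [div_lt_one pz]; nlinarith
      · rw [mob]
        have : b * (1 - x * bsg / (b * xsg)) + σ = σ * bsg / xsg := by
          field_simp; ring
        rw [this]; field_simp
  · intro x hx y hy h
    have h1 := mob_den hb hσ hx
    have h2 := mob_den hb hσ hy
    rw [mob, mob, div_eq_div_iff h1.ne' h2.ne'] at h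
    have h3 : (b * σ * bsg) * x = (b * σ * bsg) * y := by linear_combination h
    exact mul_left_cancel₀ pz h3
  · intro v hv
    have h := mob_den hb hσ hv
    have e1 : mob b σ v + σ = σ * bsg / (b * (1 - v) + σ) := by
      rw [mob]; field_simp; ring
    have e2 : mob b σ v * (b - mob b σ v) =
        (b / (b * (1 - v) + σ)) ^ 2 * ((σ * bsg) * (v * (1 - v))) := by
      rw [mob]; field_simp; ring
    have h1 : 0 < v * (1 - v) := mul_pos hv.1 (by linarith [hv.2])
    rw [e1, e2, sqrt_mul pz, sqrt_mul pz, sqrt_sq pz,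
      sqrt_mul hσ.le]
    have h2 : 0 < √(v * (1 - v)) := pz
    have h3 : 0 < √bsg := pz
    have h4 : 0 < √σ := pz
    field_simp
def mobI (σ v : ℝ) : ℝ := σ * v / (1 - v)
@[fun_prop] lemma mobI_meas (σ : ℝ) : Measurable (mobI σ) := by
  unfold mobI; fun_prop
include hσ
lemma mobI_law (f : ℝ → ENNReal) (hf : Measurable f) :
    ∫⁻ v, f (mobI σ v) ∂arcM =
      ∫⁻ x in Ioi zr, ofReal (√σ / (π * xsg * √x)) * f x := by
  have hd : ∀ v ∈ J01, 0 < 1 - v := fun v hv ↦ by linarith [hv.2]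
  refine arc_cov f hf (mobI σ) (fun v ↦ σ / (1 - v) ^ 2) _ _ fz
    (fun v hv ↦ ?_) (fun v hv ↦ ?_) ?_ ?_ ?_
  · have := ((hasDerivAt_id v).const_mul σ).div ((hasDerivAt_id v).const_sub 1) (hd v hv).ne'
    refine this.congr_deriv ?_
    simp only [id]
    congr 1
    ring
  · have := hd v hv
    positivity
  · ext x
    simp only [Set.mem_image, Set.mem_Ioi]
    constructor
    · rintro ⟨v, hv, rfl⟩
      have := hd v hv
      have := hv.1
      rw [mobI]; positivity
    · intro h1
      refine ⟨x / xsg, ⟨pz, ?_⟩, ?_⟩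
      · rw [div_lt_one pz]; linarith
      · rw [mobI]
        have : 1 - x / xsg = σ / xsg := by
          field_simp; ring
        rw [this]; field_simp
  · intro x hx y hy h
    have h1 := hd _ hx
    have h2 := hd _ hy
    rw [mobI, mobI, div_eq_div_iff h1.ne' h2.ne'] at h
    have h3 : σ * x = σ * y := by linear_combination h
    exact mul_left_cancel₀ pz h3
  · intro v hv
    have h := hd v hv
    have h0 := hv.1
    have e1 : mobI σ v + σ = σ / (1 - v) := by
      rw [mobI]; field_simp; ring
    have e2 : mobI σ v = (1 / (1 - v)) ^ 2 * (σ * (v * (1 - v))) := by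
      rw [mobI]; field_simp
    have h1 : 0 < v * (1 - v) := mul_pos hv.1 (by linarith [hv.2])
    rw [e1, e2, sqrt_mul pz, sqrt_sq pz,
      sqrt_mul hσ.le]
    have h2 : 0 < √(v * (1 - v)) := pz
    have h4 : 0 < √σ := pz
    field_simp
omit hσ
def kap (σ u : ℝ) : ℝ := √σ / 2 * (1 / ((u + σ) * √(u + σ)))
include hσ
lemma kap_deriv {x u : ℝ} (hx : 0 < x) (hu : x < u) :
    HasDerivAt (fun u ↦ √σ * √(u - x) / (xsg * √(u + σ))) (kap σ u * (1 / √(u - x))) u := by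
  have h1 : 0 < u - x := lz
  have h2 : 0 < u + σ := lz
  have d1 := ((hasDerivAt_id u).sub_const x).sqrt h1.ne'
  have d2 := ((hasDerivAt_id u).add_const σ).sqrt h2.ne'
  have := (d1.const_mul (√σ)).div (d2.const_mul xsg) (by simp only [id]; positivity)
  refine this.congr_deriv ?_
  simp only [id, kap]
  have e1 : u = √(u - x) ^ 2 + x := by rw [sq_sqrt h1.le]; ring
  have e2 : √(u + σ) ^ 2 = u + σ := sq_sqrt h2.le
  have p1 : 0 < √(u - x) := pz
  have p2 : 0 < √(u + σ) := pz
  have e3 : √(u + σ) ^ 2 = √(u - x) ^ 2 + x + σ := by rw [e2]; linarith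
  rw [show (u + σ) * √(u + σ) = √(u + σ) ^ 3 by rw [pow_succ, e2]]
  field_simp
  rw [e3]; ring
lemma kap_nonneg {u : ℝ} (hu : 0 < u) : 0 < kap σ u := by
  rw [kap]; positivity
omit hσ
@[fun_prop] lemma kap_meas (σ : ℝ) : Measurable (kap σ) := by
  unfold kap; fun_prop
include hσ
lemma kap_fin {x b : ℝ} (hx : 0 < x) (hb : x < b) :
    ∫⁻ u in Ioo x b, ofReal (kap σ u * (1 / √(u - x))) =
      ofReal (√σ * √(b - x) / (xsg * √bsg)) := by
  have hcont : ContinuousOn (fun u ↦ √σ * √(u - x) / (xsg * √(u + σ))) (Icc x b) := by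
    refine ContinuousOn.div fz fz fun u hu ↦ ?_
    have : 0 < u + σ := by linarith [hu.1]
    positivity
  have hint : IntegrableOn (fun u ↦ kap σ u * (1 / √(u - x))) (Ioc x b) :=
    intervalIntegral.integrableOn_deriv_of_nonneg hcont (fun u hu ↦ kap_deriv hσ hx hu.1)
      (fun u hu ↦ mul_nonneg (kap_nonneg hσ (by linarith [hu.1])).le pz)
  have h1 := intervalIntegral.integral_eq_sub_of_hasDerivAt_of_le hb.le hcont
    (fun u hu ↦ kap_deriv hσ hx hu.1) ((intervalIntegrable_iff_integrableOn_Ioc_of_le hb.le).2 hint)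
  rw [intervalIntegral.integral_of_le hb.le] at h1
  rw [setLIntegral_congr Ioo_ae_eq_Ioc, ← ofReal_integral_eq_lintegral_ofReal hint, h1]
  · simp
  · filter_upwards [ae_restrict_mem measurableSet_Ioc] with u hu
    exact mul_nonneg (kap_nonneg hσ (by linarith [hu.1])).le pz
lemma kap_inf {x : ℝ} (hx : 0 < x) :
    ∫⁻ u in Ioi x, ofReal (kap σ u * (1 / √(u - x))) =
      ofReal (√σ / xsg) := by
  have hcont : ContinuousWithinAt (fun u ↦ √σ * √(u - x) / (xsg * √(u + σ))) (Ici x) x := by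
    refine ContinuousAt.continuousWithinAt (ContinuousAt.div fz fz ?_)
    positivity
  have hlim : Tendsto (fun u ↦ √σ * √(u - x) / (xsg * √(u + σ))) atTop (𝓝 (√σ / xsg)) := by
    have h0 : Tendsto (fun u : ℝ ↦ 1 - xsg / (u + σ)) atTop (𝓝 (1 - 0)) :=
      tendsto_const_nhds.sub (Tendsto.div_atTop tendsto_const_nhds (tendsto_atTop_add_const_right _ _ tendsto_id))
    have h1 := ((continuous_sqrt.tendsto _).comp h0).const_mul (√σ / xsg)
    simp only [sub_zero, sqrt_one, mul_one] at h1
    refine h1.congr' ?_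
    filter_upwards [egt x] with u hu
    have h2 : 0 < u + σ := lz
    simp only [Function.comp]
    rw [show 1 - xsg / (u + σ) = (u - x) / (u + σ) by field_simp; ring, sqrt_div lz]
    field_simp
  have hpos : ∀ u ∈ Ioi x, 0 ≤ kap σ u * (1 / √(u - x)) := fun u hu ↦
    mul_nonneg (kap_nonneg hσ (by linarith [Set.mem_Ioi.1 hu])).le pz
  have hint := integrableOn_Ioi_deriv_of_nonneg hcont (fun u hu ↦ kap_deriv hσ hx hu) hpos hlim
  have h1 := integral_Ioi_of_hasDerivAt_of_nonneg hcont (fun u hu ↦ kap_deriv hσ hx hu) hpos hlim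
  rw [← ofReal_integral_eq_lintegral_ofReal hint, h1]
  · simp
  · filter_upwards [ae_restrict_mem mIoi] with u hu
    exact hpos u hu
lemma ton_gen (U : Set ℝ) (hU : MeasurableSet U) (hU0 : U ⊆ Ioi 0)
    (f : ℝ → ENNReal) (hf : Measurable f) :
    ∫⁻ u in U, ofReal (kap σ u) * ∫⁻ v, f uvp ∂arcM =
    ∫⁻ x in Ioi zr, (∫⁻ u in U ∩ Ioi x, ofReal (kap σ u * (1 / √(u - x)))) *
      (ofReal (1 / (π * √x)) * f x) := by
  have hm : Measurable (fun p : ℝ × ℝ ↦ ({q : ℝ × ℝ | q.2 < q.1}.indicator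
      (fun q ↦ ofReal (kap σ q.1 * (1 / √(q.1 - q.2))) *
        (ofReal (1 / (π * √q.2)) * f q.2))) p) := by
    refine Measurable.indicator ?_ (measurableSet_lt measurable_snd measurable_fst)
    have h1 : Measurable (fun q : ℝ × ℝ ↦ kap σ q.1) := (kap_meas σ).comp measurable_fst
    have h2 : Measurable (fun q : ℝ × ℝ ↦ f q.2) := hf.comp measurable_snd
    fun_prop
  have h1 : ∫⁻ u in U, ofReal (kap σ u) * ∫⁻ v, f uvp ∂arcM =
      ∫⁻ u in U, ∫⁻ x in Ioi zr, ({q : ℝ × ℝ | q.2 < q.1}.indicator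
      (fun q ↦ ofReal (kap σ q.1 * (1 / √(q.1 - q.2))) *
        (ofReal (1 / (π * √q.2)) * f q.2))) (u, x) := by
    refine setLIntegral_congr_fun hU fun u hu ↦ ?_
    have hu0 : 0 < u := hU0 hu
    rw [arc_scale hu0 f hf, ← lintegral_const_mul _ fz]
    have : ∀ x : ℝ, ({q : ℝ × ℝ | q.2 < q.1}.indicator
      (fun q ↦ ofReal (kap σ q.1 * (1 / √(q.1 - q.2))) *
        (ofReal (1 / (π * √q.2)) * f q.2))) (u, x) = (Iio u).indicator
        (fun x ↦ ofReal (kap σ u * (1 / √(u - x))) *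
        (ofReal (1 / (π * √x)) * f x)) x := by
      intro x; simp [Set.indicator]
    simp only [this]
    rw [lintegral_indicator measurableSet_Iio, Measure.restrict_restrict measurableSet_Iio,
      Set.inter_comm, Set.Ioi_inter_Iio]
    refine setLIntegral_congr_fun mIoo fun x hx ↦ ?_
    rw [← mul_assoc, ← mul_assoc, ← ofReal_mul (kap_nonneg hσ hu0).le, ← ofReal_mul
      (mul_nonneg (kap_nonneg hσ hu0).le pz), sqrt_mul hx.1.le]
    congr 2
    have a1 : 0 < √x := sqrt_pos.2 hx.1
    have a2 : 0 < √(u - x) := sqrt_pos.2 (by linarith [hx.2])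
    field_simp
  rw [h1, lintegral_lintegral_swap hm.aemeasurable]
  refine setLIntegral_congr_fun mIoi fun x hx ↦ ?_
  have : ∀ u : ℝ, ({q : ℝ × ℝ | q.2 < q.1}.indicator
      (fun q ↦ ofReal (kap σ q.1 * (1 / √(q.1 - q.2))) *
        (ofReal (1 / (π * √q.2)) * f q.2))) (u, x) = (Ioi x).indicator
        (fun u ↦ ofReal (kap σ u * (1 / √(u - x))) *
        (ofReal (1 / (π * √x)) * f x)) u := by
    intro u; simp [Set.indicator]
  simp only [this]
  rw [lintegral_indicator mIoi, Measure.restrict_restrict mIoi,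
    Set.inter_comm, lintegral_mul_const _ fz]
lemma ton_inf (f : ℝ → ENNReal) (hf : Measurable f) :
    ∫⁻ v, f (mobI σ v) ∂arcM =
      ∫⁻ u in Ioi zr, ofReal (kap σ u) * ∫⁻ v, f uvp ∂arcM := by
  rw [ton_gen hσ _ mIoi subset_rfl f hf, mobI_law hσ f hf]
  refine setLIntegral_congr_fun mIoi fun x hx ↦ ?_
  have hx : 0 < x := hx
  rw [Set.inter_eq_self_of_subset_right (Set.Ioi_subset_Ioi hx.le), kap_inf hσ hx, ← mul_assoc,
    ← ofReal_mul pz]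
  congr 2
  field_simp
omit hσ
lemma ton_fin {b : ℝ} (hb : 0 < b) (hσ : 0 < σ) (f : ℝ → ENNReal) (hf : Measurable f) :
    ∫⁻ v, f (mob b σ v) ∂arcM =
      (∫⁻ u in Ioo zr b, ofReal (kap σ u) * ∫⁻ v, f uvp ∂arcM) +
      ofReal (√σ / √bsg) * ∫⁻ v, f (b * v) ∂arcM := by
  rw [ton_gen hσ _ mIoo Set.Ioo_subset_Ioi_self f hf, mob_law hb hσ f hf,
    arc_scale hb f hf, ← lintegral_const_mul _ fz]
  have : ∫⁻ x in Ioi zr, (∫⁻ u in Ioo 0 b ∩ Ioi x, ofReal (kap σ u * (1 / √(u - x)))) *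
      (ofReal (1 / (π * √x)) * f x) = ∫⁻ x in Ioo zr b,
        ofReal (√σ * √(b - x) / (xsg * √bsg)) *
      (ofReal (1 / (π * √x)) * f x) := by
    rw [show volume.restrict (Ioo 0 b) = (volume.restrict (Ioi 0)).restrict (Iio b) by
        rw [Measure.restrict_restrict measurableSet_Iio, Set.inter_comm, Set.Ioi_inter_Iio],
      ← lintegral_indicator measurableSet_Iio]
    refine setLIntegral_congr_fun mIoi fun x hx ↦ ?_
    have hx : 0 < x := hx
    by_cases hxb : x < b
    · have e : Ioo 0 b ∩ Ioi x = Ioo x b := by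
        ext y; simp only [Set.mem_inter_iff, Set.mem_Ioo, Set.mem_Ioi]
        exact ⟨fun h ↦ ⟨h.2, h.1.2⟩, fun h ↦ ⟨⟨hx.trans h.1, h.2⟩, h.1⟩⟩
      rw [indicator_of_mem (by exact hxb), e, kap_fin hσ hx hxb]
    · rw [indicator_of_notMem (by exact hxb)]
      have : Ioo 0 b ∩ Ioi x = ∅ := by
        ext y; simp; intro _ h; linarith
      simp [this]
  rw [this, ← lintegral_add_left fz]
  refine setLIntegral_congr_fun mIoo fun x hx ↦ ?_
  have hx0 := hx.1
  have a1 : 0 < √x := sqrt_pos.2 hx.1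
  have a2 : 0 < √(b - x) := sqrt_pos.2 (by linarith [hx.2])
  have a3 : 0 < √bsg := pz
  rw [← mul_assoc, ← mul_assoc, ← ofReal_mul pz, ← ofReal_mul pz,
    ← add_mul, ← ENNReal.ofReal_add pz pz, sqrt_mul hx0.le]
  congr 2
  have e1 : √(b - x) ^ 2 = b - x := sq_sqrt (by linarith [hx.2])
  have e2 : √bsg ^ 2 = b + σ := sq_sqrt lz
  field_simp
  rw [e1, e2]; ring
lemma beta_int {α γ : ℝ} (hα : 0 < α) (hγ : 0 < γ) :
    IntegrableOn (fun x : ℝ ↦ x ^ (α - 1) * (1 - x) ^ (γ - 1)) (Ioo 0 1) ∧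
    ∫ x in J01, x ^ (α - 1) * (1 - x) ^ (γ - 1) = Gamma α * Gamma γ / Gamma (α + γ) := by
  have hb := ProbabilityTheory.beta_pos hα hγ
  have h := ProbabilityTheory.lintegral_betaPDF_eq_one hα hγ
  rw [ProbabilityTheory.lintegral_betaPDF] at h
  have hnn : ∀ x ∈ J01, 0 ≤ x ^ (α - 1) * (1 - x) ^ (γ - 1) := fun x hx ↦
    mul_nonneg (rpow_nonneg hx.1.le _) (rpow_nonneg (by linarith [hx.2]) _)
  have hm : Measurable (fun x : ℝ ↦ x ^ (α - 1) * (1 - x) ^ (γ - 1)) := fz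
  have e : ∫⁻ x in J01, ofReal (x ^ (α - 1) * (1 - x) ^ (γ - 1)) =
      ofReal (ProbabilityTheory.beta α γ) := by
    rw [← mul_one (ofReal (ProbabilityTheory.beta α γ)), ← h,
      ← lintegral_const_mul _ fz]
    refine setLIntegral_congr_fun mIoo fun x _ ↦ ?_
    rw [← ofReal_mul hb.le]
    congr 1
    field_simp
  have hae : 0 ≤ᵐ[volume.restrict (J01)] fun x : ℝ ↦ x ^ (α - 1) * (1 - x) ^ (γ - 1) := by
    filter_upwards [ae_restrict_mem mIoo] with x hx using hnn x hx
  constructor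
  · refine ⟨hm.aestronglyMeasurable, ?_⟩
    rw [hasFiniteIntegral_iff_ofReal hae, e]
    exact ofReal_lt_top
  · rw [integral_eq_lintegral_of_nonneg_ae hae hm.aestronglyMeasurable, e,
      toReal_ofReal hb.le]
    rfl
def m0 (β : ℝ) : ℝ := ∫ v, v ^ β ∂arcM
lemma arc_rpow (hβ : -(hlf) < β) : Integrable (fun v : ℝ ↦ v ^ β) arcM ∧
    m0 β = Gamma (β + hlf) / (√π * Gamma (β + 1)) := by
  have e : ∀ v ∈ J01, 1 / (π * √(v * (1 - v))) * v ^ β =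
      1 / π * (v ^ (β + hlf - 1) * (1 - v) ^ ((hlf : ℝ) - 1)) := by
    intro v hv
    have h1 : 0 < 1 - v := by linarith [hv.2]
    rw [sqrt_mul hv.1.le, show β + hlf - 1 = β - hlf by ring, rpow_sub hv.1, ← sqrt_eq_rpow,
      show (hlf:ℝ) - 1 = -(hlf) by norm_num, rpow_neg h1.le, ← sqrt_eq_rpow]
    field_simp
  obtain ⟨h1, h2⟩ := beta_int (α := β + hlf) (γ := 1/2) lz nz
  constructor
  · rw [arc_integrable_density]
    exact (Integrable.const_mul h1 (1 / π)).congr (by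
      filter_upwards [ae_restrict_mem mIoo] with v hv using (e v hv).symm)
  · rw [m0, arc_integral_density, setIntegral_congr_fun mIoo e, icm, h2,
      Gamma_one_half_eq, show β + hlf + hlf = β + 1 by ring]
    have := Gamma_pos_of_pos (show 0 < β + 1 by linarith)
    have e2 : √π ^ 2 = π := sq_sqrt pi_pos.le
    field_simp
    rw [e2]; ring
include hβ
lemma m0_pos : 0 < m0 β := by
  rw [(arc_rpow lz).2]
  have := Gamma_pos_of_pos (show 0 < β + 1 by linarith)
  have := Gamma_pos_of_pos (show 0 < β + hlf by linarith)
  positivity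
lemma m0_beta :
    ∫ x in J01, x ^ bm1 * (1 - x) ^ ((hlf : ℝ) - 1) = 1 / (β * m0 β) := by
  rw [(beta_int lz nz).2, (arc_rpow lz).2, Gamma_one_half_eq,
    Gamma_add_one lz]
  have := Gamma_pos_of_pos (show 0 < β by linarith)
  have := Gamma_pos_of_pos (show 0 < β + hlf by linarith)
  field_simp
omit hβ
def mH (β : ℝ) : Measure ℝ := (volume.restrict (J01)).withDensity
    (fun u ↦ ofReal (β * u ^ bm1))
lemma mH_ae (β : ℝ) : ∀ᵐ u ∂(mH β), u ∈ J01 :=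
  (withDensity_absolutelyContinuous _ _).ae_le (ae_restrict_mem mIoo)
lemma mH_integral (hβ : 0 < β) (g : ℝ → ℝ) :
    ∫ u, g u ∂(mH β) = ∫ u in J01, β * u ^ bm1 * g u := by
  rw [mH, integral_withDensity_eq_integral_toReal_smul fz
    (ae_of_all _ fun _ ↦ ofReal_lt_top)]
  refine setIntegral_congr_fun mIoo fun u hu ↦ ?_
  have : 0 ≤ β * u ^ bm1 := mul_nonneg hβ.le (rpow_nonneg hu.1.le _)
  simp only [toReal_ofReal this, smul_eq_mul]
lemma mH_integrable (hβ : 0 < β) (g : ℝ → ℝ) :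
    Integrable g (mH β) ↔ IntegrableOn (fun u ↦ β * u ^ bm1 * g u) (J01) := by
  rw [mH, integrable_withDensity_iff_integrable_smul' fz
    (ae_of_all _ fun _ ↦ ofReal_lt_top), IntegrableOn]
  refine integrable_congr ?_
  filter_upwards [ae_restrict_mem mIoo] with u hu
  have : 0 ≤ β * u ^ bm1 := mul_nonneg hβ.le (rpow_nonneg hu.1.le _)
  simp only [toReal_ofReal this, smul_eq_mul]
lemma rpow_int01 (hβ : 0 < β) : IntegrableOn (fun u : ℝ ↦ u ^ bm1) (Ioo 0 1) ∧
    ∫ u in J01, u ^ bm1 = 1 / β := by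
  obtain ⟨h1, h2⟩ := beta_int hβ one_pos
  simp only [sub_self, rpow_zero, mul_one] at h1 h2
  refine ⟨h1, h2.trans ?_⟩
  rw [Gamma_add_one hβ.ne', Gamma_one]
  have := Gamma_pos_of_pos hβ
  field_simp
lemma mH_prob (hβ : 0 < β) : IsProbabilityMeasure (mH β) := by
  constructor
  rw [mH, withDensity_apply _ MeasurableSet.univ, Measure.restrict_univ,
    ← ofReal_integral_eq_lintegral_ofReal ((rpow_int01 hβ).1.const_mul β), icm,
    (rpow_int01 hβ).2]
  · field_simp; simp
  · filter_upwards [ae_restrict_mem mIoo] with u hu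
    exact mul_nonneg hβ.le (rpow_nonneg hu.1.le _)
include hβ
lemma byparts (L ℓ : ℝ → ℝ) (K L1 : ℝ) (hm : Measurable L)
    (hd : ∀ u ∈ J01, HasDerivAt L (-ℓ u) u)
    (hL : ∀ u ∈ J01, 0 ≤ L u ∧ L u ≤ K * u ^ (-(hlf) : ℝ))
    (h1 : Tendsto L (𝓝[<] 1) (𝓝 L1))
    (hℓ : IntegrableOn (fun u ↦ u ^ β * ℓ u) (Ioo 0 1)) :
    Integrable L (mH β) ∧ ∫ u, L u ∂(mH β) = L1 + ∫ u in J01, u ^ β * ℓ u := by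
  have hβ0 : 0 < β := lz
  have hi : IntegrableOn (fun u ↦ β * u ^ bm1 * L u) (J01) := by
    refine Integrable.mono' ((rpow_int01 (β := β - hlf) lz).1.const_mul (β * K))
      fz ?_
    filter_upwards [ae_restrict_mem mIoo] with u hu
    have h2 := hL u hu
    have h3 : 0 ≤ β * u ^ bm1 := mul_nonneg hβ0.le (rpow_nonneg hu.1.le _)
    rw [norm_mul, nonn h3, nonn h2.1]
    calc _ ≤ β * u ^ bm1 * (K * u ^ (-(hlf) : ℝ)) := by gcongr; exact h2.2
      _ = β * K * (u ^ bm1 * u ^ (-(hlf) : ℝ)) := by ring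
      _ = _ := by rw [← rpow_add hu.1]; congr 2; ring
  refine ⟨(mH_integrable hβ0 L).2 hi, ?_⟩
  rw [mH_integral hβ0]
  have hs := hi.sub hℓ
  have key := intervalIntegral.integral_eq_sub_of_hasDerivAt_of_tendsto (a := 0) (b := 1)
    (f := fun u ↦ u ^ β * L u) (f' := fun u ↦ β * u ^ bm1 * L u - u ^ β * ℓ u)
    one_pos (fun u hu ↦ ?_) ?_ (fa := 0) (fb := L1) ?_ ?_
  · rw [intervalIntegral.integral_of_le zero_le_one, integral_Ioc_eq_integral_Ioo,
      integral_sub hi hℓ] at key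
    linarith
  · have := (hasDerivAt_rpow_const (p := β) (Or.inl hu.1.ne')).mul (hd u hu)
    exact this.congr_deriv (by ring)
  · rw [intervalIntegrable_iff_integrableOn_Ioo_of_le zero_le_one]
    exact hs
  · have hK : Tendsto (fun u : ℝ ↦ K * u ^ bmh) (𝓝[>] 0) (𝓝 0) := by
      have : ContinuousAt (fun u : ℝ ↦ K * u ^ bmh) 0 :=
        continuousAt_const.mul (continuousAt_rpow_const _ _ (Or.inr lz))
      have h2 := this.tendsto
      rw [zero_rpow lz, mul_zero] at h2
      exact h2.mono_left nhdsWithin_le_nhds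
    refine tendsto_of_tendsto_of_tendsto_of_le_of_le' tendsto_const_nhds hK ?_ ?_
    · filter_upwards [Ioo_mem_nhdsGT one_pos] with u hu
      exact mul_nonneg (rpow_nonneg hu.1.le _) (hL u hu).1
    · filter_upwards [Ioo_mem_nhdsGT one_pos] with u hu
      calc u ^ β * L u ≤ u ^ β * (K * u ^ (-(hlf) : ℝ)) := by
            have := (hL u hu).2; gcongr; exact rpow_nonneg hu.1.le _
        _ = K * (u ^ β * u ^ (-(hlf) : ℝ)) := by ring
        _ = _ := by rw [← rpow_add hu.1]; congr 2
  · have : Tendsto (fun u : ℝ ↦ u ^ β) (𝓝[<] 1) (𝓝 1) := by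
      have h2 := (continuousAt_rpow_const (1:ℝ) β (Or.inl one_ne_zero)).tendsto
      rw [one_rpow] at h2
      exact h2.mono_left nhdsWithin_le_nhds
    simpa using this.mul h1
omit hβ
lemma arsinh_le_self {x : ℝ} (hx : 0 ≤ x) : arsinh x ≤ x := by
  have : x ≤ sinh x := self_le_sinh_iff.2 hx
  calc arsinh x ≤ arsinh (sinh x) := arsinh_le_arsinh.2 this
    _ = x := arsinh_sinh x
def Jk (β κ : ℝ) : ℝ := ∫ u in J01, u ^ bm1 / √ukp
def eK (β κ : ℝ) : ℝ := ∫ u, 4 * arsinh (√(κ / u)) ∂(mH β)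
include hβ
lemma Jk_int (hκ : 0 < κ) :
    IntegrableOn (fun u : ℝ ↦ u ^ bm1 / √ukp) (Ioo 0 1) := by
  refine Integrable.mono' ((rpow_int01 (β := β) lz).1.const_mul (1 / √κ))
      (mas fz) ?_
  filter_upwards [ae_restrict_mem mIoo] with u hu
  have h3 : 0 ≤ u ^ bm1 := (rpow_nonneg hu.1.le _)
  rw [norm_div, nonn h3, nonn (sqrt_nonneg _), one_div, mul_comm, ← div_eq_mul_inv]
  gcongr
  linarith [hu.1]
lemma eK_eq (hκ : 0 < κ) :
    Integrable (fun u ↦ arsinh (√(κ / u))) (mH β) ∧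
    eK β κ = 4 * arsinh (√κ) + 2 * √κ * Jk β κ := by
  have e : ∀ u ∈ J01, u ^ β * (√κ / (2 * u * √ukp)) = √κ / 2 * (u ^ bm1 / √ukp) := by
    intro u hu
    have := hu.1
    rw [rpow_sub_one hu.1.ne']
    field_simp
  have := byparts hβ (fun u ↦ arsinh (√(κ / u))) (fun u ↦ √κ / (2 * u * √ukp)) (√κ) (arsinh (√κ))
    (continuous_arsinh.measurable.comp fz) (fun u hu ↦ ?_) (fun u hu ↦ ⟨?_, ?_⟩) ?_ ?_
  · refine ⟨this.1, ?_⟩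
    rw [eK, icm, this.2, setIntegral_congr_fun mIoo e, icm, Jk]
    ring
  · have hu0 := hu.1
    have d1 := ((hasDerivAt_inv hu0.ne').const_mul κ).sqrt pz
    have d2 := d1.arsinh
    simp only [← div_eq_mul_inv] at d2
    refine d2.congr_deriv ?_
    rw [sq_sqrt pz, show 1 + κ / u = ukp / u by field_simp,
      sqrt_div pz, sqrt_div pz]
    have h1 : √u ^ 2 = u := sq_sqrt hu0.le
    have h2 : √κ ^ 2 = κ := sq_sqrt hκ.le
    have h3 : 0 < √u := pz
    have h4 : 0 < √κ := pz
    rw [smul_eq_mul]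
    field_simp
    rw [h2]; ring_nf; try rw [h1]
    try ring
  · exact arsinh_nonneg_iff.2 (sqrt_nonneg _)
  · refine (arsinh_le_self (sqrt_nonneg _)).trans (le_of_eq ?_)
    rw [sqrt_div hκ.le, rpow_neg hu.1.le, ← sqrt_eq_rpow]; rfl
  · have : ContinuousAt (fun u ↦ arsinh (√(κ / u))) 1 := by
      refine continuous_arsinh.continuousAt.comp (continuous_sqrt.continuousAt.comp ?_)
      exact continuousAt_const.div continuousAt_id one_ne_zero
    have h := this.tendsto
    rw [div_one] at h
    exact h.mono_left nhdsWithin_le_nhds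
  · exact ((Jk_int hβ hκ).const_mul (√κ / 2)).congr (by
      filter_upwards [ae_restrict_mem mIoo] with v hv using (e v hv).symm)
omit hβ
def ach (η : ℝ) : ℝ := log (√η + √(η - 1))
include hβ
lemma ach_eq :
    Integrable (fun u ↦ ach (1 / u)) (mH β) ∧
    ∫ u, ach (1 / u) ∂(mH β) = 1 / (2 * (β * m0 β)) := by
  have e : ∀ u ∈ J01, u ^ β * (1 / (2 * u * √(1 - u))) =
      1 / 2 * (u ^ bm1 * (1 - u) ^ ((hlf : ℝ) - 1)) := by
    intro u hu
    have := hu.1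
    have h1 : 0 < 1 - u := by linarith [hu.2]
    rw [rpow_sub_one hu.1.ne', show (hlf:ℝ) - 1 = -(hlf) by norm_num, rpow_neg h1.le, ← sqrt_eq_rpow]
    field_simp
  have := byparts hβ (fun u ↦ ach (1 / u)) (fun u ↦ 1 / (2 * u * √(1 - u))) 2 0
    (by unfold ach; fun_prop) (fun u hu ↦ ?_) (fun u hu ↦ ⟨?_, ?_⟩) ?_ ?_
  · refine ⟨this.1, ?_⟩
    rw [this.2, setIntegral_congr_fun mIoo e, icm, m0_beta hβ]
    field_simp; ring
  · have hu0 := hu.1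
    have h1 : 0 < 1 - u := by linarith [hu.2]
    have h2 : u⁻¹ - 1 = (1 - u) / u := by field_simp
    have d0 := (hasDerivAt_inv hu0.ne')
    have d1 := (d0.sqrt pz).add ((d0.sub_const 1).sqrt (by rw [h2]; positivity))
    have h5 : 0 < √(1 - u) := pz
    have h3 : 0 < √u := pz
    have d2 := d1.log (by simp only [Pi.add_apply]; positivity)
    simp only [ach, one_div]
    refine d2.congr_deriv ?_
    simp only [Pi.add_apply]
    rw [h2, sqrt_inv, sqrt_div h1.le]
    have h6 : √u ^ 2 = u := sq_sqrt hu0.le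
    field_simp
    rw [h6]; try ring
  · have : 1 ≤ 1 / u := by rw [le_div_iff₀ hu.1]; linarith [hu.2]
    exact log_nonneg (by linarith [one_le_sqrt.2 this, sqrt_nonneg (1 / u - 1)])
  · have h0 := hu.1
    have h7 : 0 < √(1 / u) := pz
    have h8 := sqrt_le_sqrt (show 1 / u - 1 ≤ 1 / u by linarith)
    refine (log_le_self pz).trans ?_
    rw [rpow_neg h0.le, ← sqrt_eq_rpow, ← sqrt_inv, ← one_div]
    linarith
  · have : ContinuousAt (fun u : ℝ ↦ ach (1 / u)) 1 := by
      unfold ach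
      refine ContinuousAt.log ?_ sz
      have : ContinuousAt (fun u : ℝ ↦ 1 / u) 1 := continuousAt_const.div continuousAt_id one_ne_zero
      exact (this.sqrt).add ((this.sub continuousAt_const).sqrt)
    have h := this.tendsto
    simp only [ach, div_one, sub_self, sqrt_zero, add_zero, sqrt_one, log_one] at h
    exact h.mono_left nhdsWithin_le_nhds
  · exact ((beta_int (α := β) (γ := 1/2) lz nz).1.const_mul (1 / 2)).congr (by
      filter_upwards [ae_restrict_mem mIoo] with v hv using (e v hv).symm)
omit hβ
lemma log_Tb {b : ℝ} (hb : 0 < b) (hσ : 0 < σ) : log (Tb b σ) = arsinh (√(σ / b)) := by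
  rw [arsinh, Tb, sq_sqrt pz, sqrt_div hσ.le, add_div, add_comm,
    show 1 + σ / b = bsg / b by field_simp, sqrt_div pz]
include hβ
lemma Jk_parts (hκ : 0 < κ) :
    IntegrableOn (fun u ↦ u ^ β * kap κ u) (Ioo 0 1) ∧
    β * (√κ * Jk β κ) = √κ / √(1 + κ) + ∫ u in J01, u ^ β * kap κ u := by
  have hβ0 : 0 < β := lz
  have hi : IntegrableOn (fun u ↦ u ^ β * kap κ u) (Ioo 0 1) := by
    refine Integrable.mono' ((rpow_int01 (β := β) lz).1.const_mul 1)
      (mas (by have := kap_meas κ; fun_prop)) ?_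
    filter_upwards [ae_restrict_mem mIoo] with u hu
    have h1 := hu.1
    have h3 : 0 ≤ u ^ bm1 := (rpow_nonneg hu.1.le _)
    have hk := kap_nonneg hκ h1
    rw [norm_mul, nonn (rpow_nonneg h1.le _), nonn hk.le,
      show u ^ β = u ^ bm1 * u by rw [← rpow_add_one h1.ne']; congr 1; ring, mul_assoc, mul_comm 1]
    gcongr
    rw [kap]
    have h4 : √κ ≤ √ukp := sqrt_le_sqrt lz
    have h5 : 0 < √ukp := pz
    calc u * (√κ / 2 * (1 / (ukp * √ukp))) = (u / ukp) * (√κ / √ukp) * (hlf) := by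
          field_simp
      _ ≤ 1 * 1 * (hlf) := by
          gcongr
          · exact div_le_one_of_le₀ lz pz
          · exact div_le_one_of_le₀ h4 h5.le
      _ ≤ 1 := nz
  refine ⟨hi, ?_⟩
  have := byparts hβ (fun u ↦ √κ / √ukp) (kap κ) (√κ) (√κ / √(1 + κ)) fz
    (fun u hu ↦ ?_) (fun u hu ↦ ⟨pz, ?_⟩) ?_ hi
  · rw [← this.2, mH_integral hβ0, Jk, ← icm, ← icm]
    refine setIntegral_congr_fun mIoo fun u hu ↦ ?_
    ring
  · have h1 := hu.1
    have h5 : 0 < √ukp := pz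
    have d := (((hasDerivAt_id u).add_const κ).sqrt (by simp only [id]; positivity)).inv
      (by simp only [id]; positivity) |>.const_mul (√κ)
    simp only [id] at d
    refine (d.congr_of_eventuallyEq ?_).congr_deriv ?_
    · exact Eventually.of_forall fun x ↦ by simp [div_eq_mul_inv]
    · rw [kap]
      have h6 : √ukp ^ 2 = u + κ := sq_sqrt pz
      rw [h6]; field_simp
  · have h1 := hu.1
    rw [rpow_neg h1.le, ← sqrt_eq_rpow, ← div_eq_mul_inv]
    gcongr
    linarith
  · have : ContinuousAt (fun u ↦ √κ / √ukp) 1 := by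
      refine continuousAt_const.div ?_ pz
      fun_prop
    exact this.tendsto.mono_left nhdsWithin_le_nhds
omit hβ
lemma mob_scale {b v : ℝ} (hb : 0 < b) : mob b σ v = b * mob 1 (σ / b) v := by
  rw [mob, mob]
  rw [show b * (1 - v) + σ = b * (1 * (1 - v) + σ / b) by field_simp]
  rw [show b * σ * v = b * (b * (1 * (σ / b) * v)) by field_simp, mul_div_mul_left _ _ hb.ne',
    mul_div_assoc]
include hβ
lemma mob1_rpow (hκ : 0 < κ) :
    Integrable (fun v ↦ mob 1 κ v ^ β) arcM ∧
    ∫ v, mob 1 κ v ^ β ∂arcM = m0 β * (β * (√κ * Jk β κ)) := by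
  have hm := m0_pos hβ
  have hmm := mob_meas 1 κ
  have hi : Integrable (fun v ↦ mob 1 κ v ^ β) arcM := by
    refine arc_intble_bdd (mas fz) 1 fun v hv ↦ ?_
    have := mob_mem one_pos hκ hv
    rw [abs_of_nonneg (rpow_nonneg this.1.le _)]
    exact rpow_le_one this.1.le this.2.le lz
  have hnn : 0 ≤ᵐ[arcM] fun v ↦ mob 1 κ v ^ β := by
    filter_upwards [arc_ae] with v hv using rpow_nonneg (mob_mem one_pos hκ hv).1.le _
  refine ⟨hi, ?_⟩
  have hu : ∀ u : ℝ, 0 < u → ∫⁻ v, ofReal (uvp ^ β) ∂arcM = ofReal (u ^ β * m0 β) := by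
    intro u hu
    rw [m0, ← icm, ofReal_integral_eq_lintegral_ofReal
      ((arc_rpow lz).1.const_mul _)]
    · refine lintegral_congr_ae ?_
      filter_upwards [arc_ae] with v hv
      rw [mul_rpow hu.le hv.1.le]
    · filter_upwards [arc_ae] with v hv
      exact mul_nonneg (rpow_nonneg hu.le _) (rpow_nonneg hv.1.le _)
  have h := ton_fin one_pos hκ (fun x ↦ ofReal (x ^ β)) fz
  rw [hu 1 one_pos, ← ofReal_integral_eq_lintegral_ofReal hi hnn] at h
  obtain ⟨j1, j2⟩ := Jk_parts hβ hκ
  have e : ∫⁻ u in J01, ofReal (kap κ u) * ∫⁻ v, ofReal (uvp ^ β) ∂arcM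
      = ofReal (∫ u in J01, m0 β * (u ^ β * kap κ u)) := by
    rw [ofReal_integral_eq_lintegral_ofReal (j1.const_mul _)]
    · refine setLIntegral_congr_fun mIoo fun u hu' ↦ ?_
      rw [hu u hu'.1, ← ofReal_mul (kap_nonneg hκ hu'.1).le]
      congr 1; ring
    · filter_upwards [ae_restrict_mem mIoo] with u hu
      exact mul_nonneg hm.le (mul_nonneg (rpow_nonneg hu.1.le _) (kap_nonneg hκ hu.1).le)
  have hnn2 : 0 ≤ ∫ u in J01, m0 β * (u ^ β * kap κ u) := by
    refine setIntegral_nonneg mIoo fun u hu ↦ ?_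
    exact mul_nonneg hm.le (mul_nonneg (rpow_nonneg hu.1.le _) (kap_nonneg hκ hu.1).le)
  rw [e, ← ofReal_mul pz, ← ENNReal.ofReal_add hnn2 (by simp; positivity),
    ENNReal.ofReal_eq_ofReal_iff (integral_nonneg_of_ae hnn) (by simp; positivity)] at h
  rw [h, j2, icm, one_rpow]; ring
include hσ
lemma mob_rpow {b : ℝ} (hb : 0 < b) (N : ℝ)
    (hN : β * m0 β * b ^ β = 2 * N) :
    Integrable (fun v ↦ mob b σ v ^ β) arcM ∧
    ∫ v, mob b σ v ^ β ∂arcM + 4 * N * log (Tb b σ) = N * eK β (σ / b) := by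
  have hκ : 0 < σ / b := pz
  obtain ⟨h1, h2⟩ := mob1_rpow hβ hκ
  have e : ∀ᵐ v ∂arcM, mob b σ v ^ β = b ^ β * mob 1 (σ / b) v ^ β := by
    filter_upwards [arc_ae] with v hv
    rw [mob_scale hb, mul_rpow hb.le (mob_mem one_pos hκ hv).1.le]
  refine ⟨(h1.const_mul _).congr (by filter_upwards [e] with v hv using hv.symm), ?_⟩
  rw [icae e, icm, h2, log_Tb hb hσ, (eK_eq hβ hκ).2]
  linear_combination (√(σ / b) * Jk β (σ / b)) * hN
omit hβ hσ
def wM (β : ℝ) : Measure ℝ := (volume.restrict (Ioi zr)).withDensity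
    (fun x ↦ ofReal (exp (-(x ^ β))))
lemma wM_ae (β : ℝ) : ∀ᵐ u ∂wB, 0 < u :=
  (withDensity_absolutelyContinuous _ _).ae_le (ae_restrict_mem mIoi)
lemma wM_integral (β : ℝ) (g : ℝ → ℝ) :
    ∫ u, g u ∂wB = ∫ x in Ioi zr, g x * exp (-(x ^ β)) := by
  rw [wM, integral_withDensity_eq_integral_toReal_smul fz
    (ae_of_all _ fun _ ↦ ofReal_lt_top)]
  refine setIntegral_congr_fun mIoi fun u hu ↦ ?_
  simp only [toReal_ofReal (exp_pos _).le, smul_eq_mul, mul_comm]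
lemma wM_integrable (β : ℝ) (g : ℝ → ℝ) :
    Integrable g wB ↔ IntegrableOn (fun x ↦ g x * exp (-(x ^ β))) (Ioi zr) := by
  rw [wM, integrable_withDensity_iff_integrable_smul' fz
    (ae_of_all _ fun _ ↦ ofReal_lt_top), IntegrableOn]
  simp only [toReal_ofReal (exp_pos _).le, smul_eq_mul, mul_comm]
include hβ
lemma wM_int {a : ℝ} (c : ℝ) (ha : -1 < a) :
    Integrable (fun x ↦ x ^ a * exp (c * √x)) wB := by
  have hβ0 : 0 < β := lz
  have h0 : IntegrableOn (fun x : ℝ ↦ x ^ a * exp (-(hlf) * x ^ β)) (Ioi 0) := by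
    by_contra h
    have h1 := integral_rpow_mul_exp_neg_mul_rpow hβ0 ha (b := 1/2) nz
    rw [integral_undef h] at h1
    have := Gamma_pos_of_pos (show 0 < (a + 1) / β by apply div_pos <;> linarith)
    have : 0 < (hlf:ℝ) ^ (-(a + 1) / β) * (1 / β) * Gamma ((a + 1) / β) := pz
    linarith
  obtain ⟨K, hK⟩ : ∃ K : ℝ, ∀ x : ℝ, 0 < x → c * √x - 1/2 * x ^ β ≤ K := by
    refine ⟨|c| * (2 * |c| + 1) ^ (1 / (2 * bmh)), fun x hx ↦ ?_⟩
    have hc := abs_nonneg c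
    have hg : 0 < β - hlf := lz
    set R : ℝ := (2 * |c| + 1) ^ (1 / (2 * bmh)) with hR
    have hR0 : 0 < R := pz
    have hcc : c * √x ≤ |c| * √x := by gcongr; exact le_abs_self c
    by_cases h : √x ≤ R
    · have : 0 ≤ x ^ β := rpow_nonneg hx.le _
      have : |c| * √x ≤ |c| * R := by gcongr
      linarith
    · push Not at h
      have h1 : 2 * |c| + 1 ≤ x ^ bmh := by
        have : R ^ (2 * bmh) ≤ (√x) ^ (2 * bmh) := by gcongr
        rw [hR, ← rpow_mul pz, one_div_mul_cancel pz, rpow_one, rpow_mul (sqrt_nonneg _)] at this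
        norm_num at this
        rw [sq_sqrt hx.le] at this
        convert this using 2
      have h2 : x ^ β = x ^ bmh * √x := by
        rw [sqrt_eq_rpow, ← rpow_add hx]; congr 1; ring
      rw [h2]
      have : 0 ≤ |c| * R := pz
      nlinarith [sqrt_nonneg x]
  rw [wM_integrable]
  refine Integrable.mono' (h0.const_mul (exp K)) (mas fz) ?_
  filter_upwards [ae_restrict_mem mIoi] with x hx
  have hxa : 0 ≤ x ^ a := rpow_nonneg (le_of_lt hx) _
  rw [nonn pz, mul_assoc, ← exp_add, mul_left_comm, ← exp_add]
  refine mul_le_mul_of_nonneg_left (exp_le_exp.2 ?_) hxa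
  have := hK x hx
  linarith
lemma wM_poly (p : RX) : Integrable (fun x ↦ p.eval x) wB := by
  simp only [eval_eq_sum_range]
  refine integrable_finsetSum _ fun i _ ↦ Integrable.const_mul ?_ _
  have := wM_int hβ (a := i) 0 (by linarith [i.cast_nonneg (α := ℝ)])
  simpa using this
include hσ
lemma wM_poly_div (p : RX) :
    Integrable (fun x ↦ p.eval x / xsg) wB := by
  refine Integrable.mono' ((wM_poly hβ p).norm.const_mul (1 / σ))
    (mas (by have := p.continuous.measurable; fun_prop)) ?_
  filter_upwards [wM_ae β] with x hx
  rw [norm_div, nonn (by linarith : zr ≤ x + σ), one_div, mul_comm, ← div_eq_mul_inv]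
  gcongr; linarith
lemma wM_Fab (A B : RX) :
    Integrable (fun x ↦ Fab A B x / xsg) wB := by
  have := wM_poly_div hβ hσ (A ^ 2 + X * B ^ 2)
  simpa [Fab] using this
omit hβ hσ
lemma Elog_mob {b : ℝ} (hb : 0 < b) (hσ : 0 < σ) :
    Integrable (fun v ↦ log (√(mob b σ v * (b - mob b σ v)) / (√σ * √bsg))) arcM ∧
    ∫ v, log (√(mob b σ v * (b - mob b σ v)) / (√σ * √bsg)) ∂arcM = - 2 * log (Tb b σ) := by
  obtain ⟨t1, t2⟩ := Tb_log hb hσ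
  have a1 := arc_log_real_intble 0
  have a2 := arc_log_real 0 sz
  have b1 := arc_log_real_intble 1
  have b2 := arc_log_real 1 sz
  simp only [sub_zero, abs_zero, sqrt_zero, zero_add, zero_sub, abs_neg, abs_one, sqrt_one, log_one, mul_zero, sub_self, add_zero] at a1 a2 b2
  have e : ∀ᵐ v ∂arcM, log (√(mob b σ v * (b - mob b σ v)) / (√σ * √bsg)) =
      1/2 * (log |v| + log |v - 1|) + (log b - log (b * (1 - v) + σ)) := by
    filter_upwards [arc_ae] with v hv
    have hd := mob_den hb hσ hv
    have h1 : 0 < 1 - v := by linarith [hv.2]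
    have h2 := hv.1
    have e1 : mob b σ v * (b - mob b σ v) = σ * bsg * (v * (1 - v) * (b / (b * (1 - v) + σ)) ^ 2) := by
      rw [mob]; field_simp; ring
    rw [e1, ← sqrt_mul hσ.le, sqrt_mul pz, mul_div_cancel_left₀ _ pz,
      sqrt_mul pz, sqrt_sq pz, log_mul pz pz,
      log_sqrt pz, log_mul pz pz, log_div hb.ne' hd.ne',
      abs_of_pos h2, abs_of_neg lz, neg_sub]
    ring
  have i1 : Integrable (fun v ↦ 1/2 * (log |v| + log |v - 1|)) arcM := (a1.add b1).const_mul _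
  have i2 : Integrable (fun v ↦ log b - log (b * (1 - v) + σ)) arcM := (icn _).sub t1
  have hi := i1.add i2
  refine ⟨hi.congr (by filter_upwards [e] with v hv using hv.symm), ?_⟩
  rw [icae e, iad i1 i2,
    icm, iad a1 b1, integral_sub (icn _) t1, t2, a2, b2,
    log_div hb.ne' nz]
  simp
  ring
include hβ
lemma U1 {s b : ℝ} (hs : 0 < s) (hσ : σ = s ^ 2) (hb : 0 < b) (N : ℕ)
    (hN : β * m0 β * b ^ β = 2 * N) (A B : RX)
    (hA : A.natDegree ≤ N) (hB : B = 0 ∨ B.natDegree + 1 ≤ N) :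
    (A.eval (-σ) + s * B.eval (-σ)) ^ 2 ≤ 1 / π * exp (N * eK β (σ / b)) * Tb b σ ^ 2 *
      ∫ x, Fab A B x / xsg ∂wB := by
  have hσ0 : 0 < σ := by rw [hσ]; positivity
  have hT := Tb_ge hb hσ0
  by_cases h0 : A ≠ 0 ∨ B ≠ 0
  swap
  · push Not at h0
    simp [h0.1, h0.2, Fab]
  obtain ⟨u1, u2, u3⟩ := U0 hs hσ hb N A B hA hB h0
  obtain ⟨v1, v2⟩ := mob_rpow hβ hσ0 hb N hN
  obtain ⟨e1, e2⟩ := Elog_mob hb hσ0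
  have hFm : Measurable (Fab A B) := by
    unfold Fab
    have := A.continuous.measurable
    have := B.continuous.measurable
    fun_prop
  have hmm := mob_meas b σ
  have hFnn : ∀ x, 0 < x → 0 ≤ Fab A B x := fun x hx ↦ by unfold Fab; positivity
  set h : ℝ → ℝ := fun x ↦ Fab A B x * exp (-(x ^ β)) * (π * (√(x * (b - x)) / (√σ * √bsg))) with hh
  have hhm : Measurable h := fz
  have hW := wM_Fab hβ hσ0 A B
  have hW' := (wM_integrable _ _).1 hW
  have hlin : ∫⁻ v, ofReal (h (mob b σ v)) ∂arcM ≤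
      ofReal (∫ x, Fab A B x / xsg ∂wB) := by
    rw [mob_law hb hσ0 (fun x ↦ ofReal (h x)) fz, wM_integral,
      ofReal_integral_eq_lintegral_ofReal hW']
    · refine le_trans (le_of_eq ?_) (lintegral_mono_set (show Ioo 0 b ⊆ Ioi zr from fun x hx ↦ hx.1))
      refine setLIntegral_congr_fun mIoo fun x hx ↦ ?_
      have hx0 := hx.1
      have hx1 : 0 < b - x := by linarith [hx.2]
      rw [← ofReal_mul pz]
      congr 1
      rw [hh]
      have : 0 < √(x * (b - x)) := pz
      field_simp
    · filter_upwards [ae_restrict_mem mIoi] with x hx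
      have hx0 : zr < x := hx
      exact mul_nonneg (div_nonneg (hFnn x hx0) lz) (exp_pos _).le
  have hhnn : 0 ≤ᵐ[arcM] fun v ↦ h (mob b σ v) := by
    filter_upwards [arc_ae] with v hv
    have := hFnn _ (mob_mem hb hσ0 hv).1
    simp only [hh, Pi.zero_apply]; positivity
  have hhi : Integrable (fun v ↦ h (mob b σ v)) arcM := by
    refine ⟨(hhm.comp hmm).aestronglyMeasurable, ?_⟩
    rw [hasFiniteIntegral_iff_ofReal hhnn]
    exact hlin.trans_lt ofReal_lt_top
  have hle : ∫ v, h (mob b σ v) ∂arcM ≤ ∫ x, Fab A B x / xsg ∂wB := by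
    rw [integral_eq_lintegral_of_nonneg_ae hhnn hhi.1]
    refine (ENNReal.toReal_mono ENNReal.ofReal_ne_top hlin).trans (le_of_eq (toReal_ofReal ?_))
    refine integral_nonneg_of_ae ?_
    filter_upwards [wM_ae β] with x hx using div_nonneg (hFnn x hx) lz
  set G : ℝ → ℝ := fun v ↦ log (Fab A B (mob b σ v)) - mob b σ v ^ β +
    (log π + log (√(mob b σ v * (b - mob b σ v)) / (√σ * √bsg))) with hG
  have i1 : Integrable (fun v ↦ log (Fab A B (mob b σ v)) - mob b σ v ^ β) arcM := u2.sub v1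
  have i2 : Integrable (fun v ↦ log π + log (√(mob b σ v * (b - mob b σ v)) / (√σ * √bsg))) arcM :=
    (icn _).add e1
  have hGi : Integrable G arcM := i1.add i2
  have hexp : ∀ᵐ v ∂arcM, exp (G v) = h (mob b σ v) := by
    filter_upwards [arc_ae, u1] with v hv hF
    have hm := mob_mem hb hσ0 hv
    have h1 := hm.1
    have hx1 : 0 < b - mob b σ v := by linarith [hm.2]
    rw [hG]; simp only
    rw [exp_add, exp_sub, exp_log hF, exp_add, exp_log pi_pos, exp_log pz, hh]
    simp only
    rw [exp_neg]; ring
  have hJ := convexOn_exp.map_integral_le (μ := arcM) (f := G) continuous_exp.continuousOn isClosed_univ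
    sz hGi (hhi.congr (by filter_upwards [hexp] with v hv using hv.symm))
  rw [icae hexp] at hJ
  have hGv : ∫ v, G v ∂arcM = ∫ v, log (Fab A B (mob b σ v)) ∂arcM - ∫ v, mob b σ v ^ β ∂arcM + (log π - 2 * log (Tb b σ)) := by
    rw [hG, iad i1 i2, integral_sub u2 v1,
      iad (icn _) e1, e2]
    simp; ring
  have hJ2 := hJ.trans hle
  set Z := ∫ x, Fab A B x / xsg ∂wB
  have hT0 : 0 < Tb b σ := lz
  calc _ ≤ _ := u3
    _ = exp (∫ v, G v ∂arcM) * (1 / π * exp (N * eK β (σ / b)) * Tb b σ ^ 2) := by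
        rw [hGv, ← v2]
        have hp : ∀ k : ℕ, Tb b σ ^ k = exp (k * log (Tb b σ)) := fun k ↦ by
          rw [mul_comm, exp_mul, exp_log hT0, rpow_natCast]
        rw [hp, hp, show (1 / π : ℝ) = exp (- log π) by rw [exp_neg, exp_log pi_pos, one_div],
          ← exp_add, ← exp_add, ← exp_add, ← exp_add]
        congr 1; push_cast; ring
    _ ≤ Z * _ := by gcongr
    _ = _ := by ring
omit hβ
include hσ
lemma mobI_pos {v : ℝ} (hv : v ∈ J01) : 0 < mobI σ v :=
  div_pos (mul_pos hσ hv.1) (by linarith [hv.2])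
omit hσ
lemma mobI_log {s : ℝ} (hs : 0 < s) (hσ : σ = s ^ 2) (c : ℂ) (hc : 0 ≤ c.re) :
    Integrable (fun v ↦ log ‖(mobI σ v : ℂ) + c ^ 2‖) arcM ∧
    ∫ v, log ‖(mobI σ v : ℂ) + c ^ 2‖ ∂arcM = 2 * log ‖(s:ℂ) + c‖ := by
  have hσ0 : 0 < σ := by rw [hσ]; positivity
  have b1 := arc_log_real_intble 1
  have b2 := arc_log_real 1 sz
  simp only [abs_one, sqrt_one, sub_self, abs_zero, sqrt_zero, add_zero, log_one, mul_zero, zero_sub] at b2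
  have hsc : (s:ℂ) + c ≠ 0 := by
    intro h
    have := congrArg Complex.re h
    simp at this; linarith
  by_cases h0 : (s:ℂ) - c = 0
  · have hcs : c = s := (sub_eq_zero.1 h0).symm
    have e : ∀ᵐ v ∂arcM, log ‖(mobI σ v : ℂ) + c ^ 2‖ = log σ - log |v - 1| := by
      filter_upwards [arc_ae] with v hv
      have h1 : 0 < 1 - v := by linarith [hv.2]
      have : (mobI σ v : ℂ) + c ^ 2 = ((σ / (1 - v) : ℝ) : ℂ) := by
        rw [hcs, ← ofReal_pow, ← hσ, ← ofReal_add, mobI]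
        congr 1; field_simp; ring
      rw [this, norm_real, nonn pz, log_div hσ0.ne' h1.ne',
        abs_of_neg lz, neg_sub]
    refine ⟨((icn _).sub b1).congr (by filter_upwards [e] with v hv using hv.symm), ?_⟩
    rw [icae e, integral_sub (icn _) b1, b2, hcs, ← ofReal_add,
      norm_real, nonn pz, hσ, log_pow, ← two_mul,
      log_mul nz hs.ne', show (4:ℝ) = 2 ^ 2 by norm_num, log_pow]
    simp; ring
  · have hd : c ^ 2 - (σ:ℂ) ≠ 0 := by
      rw [hσ, ofReal_pow, show c ^ 2 - (s:ℂ) ^ 2 = -((s - c) * (s + c)) by ring]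
      exact neg_ne_zero.2 (mul_ne_zero h0 hsc)
    have hdn : ‖c ^ 2 - (σ:ℂ)‖ = ‖(s:ℂ) - c‖ * ‖(s:ℂ) + c‖ := by
      rw [hσ, ofReal_pow, show c ^ 2 - (s:ℂ) ^ 2 = -((s - c) * (s + c)) by ring, norm_neg, norm_mul]
    have hp1 : 0 < ‖(s:ℂ) - c‖ := norm_pos_iff.2 h0
    have hp2 : 0 < ‖(s:ℂ) + c‖ := norm_pos_iff.2 hsc
    have n1 : ‖(s:ℂ) + c‖ ^ 2 = σ + ‖c‖ ^ 2 + 2 * (s * c.re) := by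
      rw [← normSq_eq_norm_sq, ← normSq_eq_norm_sq, normSq_apply, normSq_apply, hσ]
      simp; ring
    have n2 : ‖(s:ℂ) - c‖ ^ 2 = σ + ‖c‖ ^ 2 - 2 * (s * c.re) := by
      rw [← normSq_eq_norm_sq, ← normSq_eq_norm_sq, normSq_apply, normSq_apply, hσ]
      simp; ring
    set η : ℂ := c ^ 2 / (c ^ 2 - σ) with hη
    have hη1 : η - 1 = σ / (c ^ 2 - σ) := by rw [hη]; field_simp; ring
    have hle : ‖(s:ℂ) - c‖ ≤ ‖(s:ℂ) + c‖ := by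
      refine (sq_le_sq₀ hp1.le hp2.le).1 ?_
      rw [n1, n2]; nlinarith
    have hl := arc_log_eq η (‖(s:ℂ) + c‖ / ‖(s:ℂ) - c‖) ((one_le_div hp1).2 hle) (by
      rw [hη1, hη, norm_div, norm_div, hdn, norm_pow, norm_real, nonn hσ0.le]
      field_simp
      rw [n1, n2]; ring)
    have li := (arc_log η).1
    have e : ∀ᵐ v ∂arcM, log ‖(mobI σ v : ℂ) + c ^ 2‖ =
        log ‖c ^ 2 - (σ:ℂ)‖ + log ‖(v:ℂ) - η‖ - log |v - 1| := by
      have hne : ∀ᵐ v : ℝ ∂arcM, (v:ℂ) - η ≠ 0 := by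
        have := arc_singleton η.re
        rw [measure_eq_zero_iff_ae_notMem] at this
        filter_upwards [this] with v hv h
        apply hv
        have := congrArg Complex.re h
        simp at this
        simp; linarith
      filter_upwards [arc_ae, hne] with v hv hn
      have h1 : 0 < 1 - v := by linarith [hv.2]
      have : (mobI σ v : ℂ) + c ^ 2 = (-(c ^ 2 - σ) * (v - η)) / ((1 - v : ℝ) : ℂ) := by
        have h1' : ((1 - v : ℝ) : ℂ) ≠ 0 := by exact_mod_cast h1.ne'
        rw [hη, mobI]
        push_cast at h1' ⊢
        field_simp; ring
      rw [this, norm_div, norm_mul, norm_neg, norm_real, nonn h1.le,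
        log_div (mul_ne_zero (norm_ne_zero_iff.2 hd) (norm_ne_zero_iff.2 hn)) h1.ne', log_mul (norm_ne_zero_iff.2 hd) (norm_ne_zero_iff.2 hn),
        abs_of_neg lz, neg_sub]
    have i1 : Integrable (fun v : ℝ ↦ log ‖c ^ 2 - (σ:ℂ)‖ + log ‖(v:ℂ) - η‖) arcM := (icn _).add li
    refine ⟨(i1.sub b1).congr (by filter_upwards [e] with v hv using hv.symm), ?_⟩
    rw [icae e, integral_sub i1 b1, iad (icn _) li, hl, b2, hdn,
      log_mul hp1.ne' hp2.ne', log_div pz nz, log_div hp2.ne' hp1.ne']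
    simp; ring
def LukP (σ s : ℝ) (ρ : RX) : Prop := ∃ A B : RX, ρ = A ^ 2 + X * B ^ 2 ∧
  2 * A.natDegree ≤ ρ.natDegree ∧ 2 * (X * B).natDegree ≤ ρ.natDegree + 1 ∧
  Integrable (fun v ↦ log (ρ.eval (mobI σ v))) arcM ∧
  exp (∫ v, log (ρ.eval (mobI σ v)) ∂arcM) = (A.eval (-σ) + s * B.eval (-σ)) ^ 2
lemma LukP.mul {s : ℝ} (hs : 0 < s) (hσ : σ = s ^ 2) {ρ τ : RX}
    (hρ : ∀ x, 0 ≤ x → 0 < ρ.eval x) (hτ : ∀ x, 0 ≤ x → 0 < τ.eval x)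
    (h1 : LukP σ s ρ) (h2 : LukP σ s τ) : LukP σ s (ρ * τ) := by
  obtain ⟨A, B, e1, a1, b1, i1, j1⟩ := h1
  obtain ⟨C, D, e2, a2, b2, i2, j2⟩ := h2
  have hσ0 : 0 < σ := by rw [hσ]; positivity
  have n1 : ρ ≠ 0 := by rintro rfl; simpa using hρ 0 le_rfl
  have n2 : τ ≠ 0 := by rintro rfl; simpa using hτ 0 le_rfl
  have hd : (ρ * τ).natDegree = ρ.natDegree + τ.natDegree := natDegree_mul n1 n2
  refine ⟨A * C - X * B * D, A * D + B * C, by rw [e1, e2]; ring, ?_, ?_, ?_, ?_⟩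
  · rw [hd]
    have k1 : (A * C).natDegree ≤ A.natDegree + C.natDegree := natDegree_mul_le
    have k2 : 2 * (X * B * D).natDegree ≤ ρ.natDegree + τ.natDegree := by
      by_cases hB : D = 0
      · simp [hB]
      have := natDegree_mul_le (p := X * B) (q := D)
      rw [natDegree_X_mul hB] at b2
      omega
    have := natDegree_sub_le (A * C) (X * B * D)
    omega
  · rw [hd, show X * (A * D + B * C) = A * (X * D) + X * B * C by ring]
    have k1 := natDegree_mul_le (p := A) (q := X * D)
    have k2 := natDegree_mul_le (p := X * B) (q := C)
    have := natDegree_add_le (A * (X * D)) (X * B * C)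
    omega
  · refine (i1.add i2).congr ?_
    filter_upwards [arc_ae] with v hv
    have := mobI_pos hσ0 hv
    rw [eval_mul, log_mul (hρ _ this.le).ne' (hτ _ this.le).ne']; rfl
  · have e : ∀ᵐ v ∂arcM, log ((ρ * τ).eval (mobI σ v)) = log (ρ.eval (mobI σ v)) + log (τ.eval (mobI σ v)) := by
      filter_upwards [arc_ae] with v hv
      have := mobI_pos hσ0 hv
      rw [eval_mul, log_mul (hρ _ this.le).ne' (hτ _ this.le).ne']
    rw [icae e, iad i1 i2, exp_add, j1, j2]
    simp only [eval_sub, eval_mul, eval_add, eval_X]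
    rw [hσ]; ring
lemma lukacs {s : ℝ} (hs : 0 < s) (hσ : σ = s ^ 2) (ρ : RX)
    (hρ : ∀ x, 0 ≤ x → 0 < ρ.eval x) : LukP σ s ρ := by
  have hσ0 : 0 < σ := by rw [hσ]; positivity
  induction hn : ρ.natDegree using Nat.strong_induction_on generalizing ρ with
  | _ n ih =>
  rcases Nat.eq_zero_or_pos n with h0 | hpos
  · rw [h0] at hn
    obtain ⟨c, hc⟩ : ∃ c, ρ = C c := ⟨_, eq_C_of_natDegree_eq_zero hn⟩
    have hcp : 0 < c := by simpa [hc] using hρ 0 le_rfl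
    refine ⟨C √c, 0, ?_, sz, sz, ?_, ?_⟩
    · rw [hc, ← C_pow, sq_sqrt hcp.le]; simp
    · simp [hc]
    · simp [hc, exp_log hcp, sq_sqrt hcp.le]
  · have hρ0 : ρ ≠ 0 := by rintro rfl; simpa using hρ 0 le_rfl
    obtain ⟨ζ, hζ⟩ := IsAlgClosed.exists_aeval_eq_zero ℂ ρ (by
      intro h; rw [degree_eq_natDegree hρ0, hn] at h; norm_cast at h; omega)
    have step : ∀ q : RX, (∀ x, 0 ≤ x → 0 < q.eval x) → q ∣ ρ → LukP σ s q → 0 < q.natDegree →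
        LukP σ s ρ := by
      rintro q hq ⟨τ, rfl⟩ hl hd
      have hτ : ∀ x, 0 ≤ x → 0 < τ.eval x := fun x hx ↦ by
        have := hρ x hx
        rw [eval_mul] at this
        exact (pos_iff_pos_of_mul_pos this).1 (hq x hx)
      refine hl.mul hs hσ hq hτ (ih τ.natDegree ?_ τ hτ rfl)
      rw [natDegree_mul (left_ne_zero_of_mul hρ0) (right_ne_zero_of_mul hρ0)] at hn
      omega
    by_cases hi : ζ.im = 0
    · have hr : ρ.IsRoot ζ.re := by
        have : ζ = (ζ.re : ℂ) := Complex.ext rfl (by simp [hi])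
        rw [this] at hζ
        have h2 : aeval ((algebraMap ℝ ℂ) ζ.re) ρ = 0 := hζ
        rw [aeval_algebraMap_apply] at h2
        simpa using h2
      have hneg : ζ.re < 0 := by
        by_contra h
        have := hρ _ (not_lt.1 h)
        rw [hr] at this; exact lt_irrefl _ this
      have hm : zr < - ζ.re := lz
      have hsq : √(-ζ.re) ^ 2 = - ζ.re := sq_sqrt hm.le
      refine step (X - C ζ.re) (fun x hx ↦ by simp; linarith) (dvd_iff_isRoot.2 hr) ?_ sz
      obtain ⟨l1, l2⟩ := mobI_log hs hσ (√(-ζ.re) : ℂ) sz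
      have e : ∀ᵐ v ∂arcM, log ‖(mobI σ v : ℂ) + (√(-ζ.re) : ℂ) ^ 2‖ = log ((X - C ζ.re).eval (mobI σ v)) := by
        filter_upwards [arc_ae] with v hv
        have := mobI_pos hσ0 hv
        rw [← ofReal_pow, hsq, ← ofReal_add, norm_real, nonn lz]
        simp [sub_eq_add_neg]
      refine ⟨C √(-ζ.re), 1, ?_, sz, sz, l1.congr e, ?_⟩
      · rw [← C_pow, hsq]; simp; ring
      · rw [← icae e, l2, ← ofReal_add, norm_real, nonn pz,
          mul_comm, exp_mul, exp_log pz]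
        simp; ring
    · have hq : (fun x : ℝ ↦ (X ^ 2 - C (2 * ζ.re) * X + C (‖ζ‖ ^ 2)).eval x) = fun x : ℝ ↦ ‖(x:ℂ) - ζ‖ ^ 2 := by
        ext x
        rw [← normSq_eq_norm_sq, ← normSq_eq_norm_sq, normSq_apply, normSq_apply]
        simp; ring
      have hne : ∀ x : ℝ, 0 < ‖(x:ℂ) - ζ‖ := fun x ↦ norm_pos_iff.2 fun h ↦ hi (by
        have := congrArg Complex.im h; simpa using this)
      have hdeg : (X ^ 2 - C (2 * ζ.re) * X + C (‖ζ‖ ^ 2)).natDegree = 2 := by compute_degree!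
      refine step _ (fun x hx ↦ by rw [congrFun hq x]; have := hne x; positivity)
        (quadratic_dvd_of_aeval_eq_zero_im_ne_zero ρ hζ hi) ?_ (by rw [hdeg]; norm_num)
      set c : ℂ := (-ζ) ^ (hlf : ℂ) with hc
      have hc2 : c ^ 2 = -ζ := by
        rw [hc, ← Complex.cpow_nat_mul]; norm_num
      have hz : ‖ζ‖ = ‖c‖ ^ 2 := by rw [← norm_pow, hc2, norm_neg]
      have hre : ζ.re = c.im ^ 2 - c.re ^ 2 := by
        have := congrArg Complex.re hc2
        simp [sq] at this; linarith
      have hcn : ‖c‖ ^ 2 = c.re ^ 2 + c.im ^ 2 := by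
        rw [← normSq_eq_norm_sq, normSq_apply]; ring
      have hcre : 0 ≤ c.re := by
        have hz0 : -ζ ≠ 0 := by
          intro h; apply hi; rw [neg_eq_zero.1 h]; rfl
        rw [hc, Complex.cpow_def_of_ne_zero hz0, Complex.exp_re]
        refine mul_nonneg (exp_pos _).le (cos_nonneg_of_mem_Icc ?_)
        have h1 := Complex.arg_le_pi (-ζ)
        have h2 := Complex.neg_pi_lt_arg (-ζ)
        have : (Complex.log (-ζ) * (hlf)).im = Complex.arg (-ζ) / 2 := by
          rw [Complex.mul_im, Complex.log_im]; simp; ring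
        rw [this]
        constructor <;> linarith
      obtain ⟨l1, l2⟩ := mobI_log hs hσ c hcre
      have e : ∀ v, 2 * log ‖(mobI σ v : ℂ) + c ^ 2‖ = log ((X ^ 2 - C (2 * ζ.re) * X + C (‖ζ‖ ^ 2)).eval (mobI σ v)) := by
        intro v
        rw [congrFun hq (mobI σ v), log_pow, hc2, ← sub_eq_add_neg]; norm_num
      refine ⟨C ‖ζ‖ - X, C (2 * c.re), ?_, ?_, ?_, (l1.const_mul 2).congr (ae_of_all _ e), ?_⟩
      · rw [hz, hcn, hre]
        simp only [C_mul, C_pow, C_sub, C_add]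
        rw [show (C 2 : RX) = 2 from rfl]
        ring
      · rw [hdeg]
        have : (C ‖ζ‖ - X).natDegree ≤ 1 := by compute_degree
        omega
      · rw [hdeg]
        have : (X * C (2 * c.re)).natDegree ≤ 1 := by compute_degree
        omega
      · simp_rw [← e]
        rw [icm, l2]
        have hp2 : 0 < ‖(s:ℂ) + c‖ := norm_pos_iff.2 (by
          intro h
          have := congrArg Complex.re h
          simp at this; linarith)
        rw [show 2 * (2 * log ‖(s:ℂ) + c‖) = log ‖(s:ℂ) + c‖ * 4 by ring, exp_mul, exp_log hp2]
        have n1 : ‖(s:ℂ) + c‖ ^ 2 = σ + ‖c‖ ^ 2 + 2 * (s * c.re) := by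
          rw [← normSq_eq_norm_sq, ← normSq_eq_norm_sq, normSq_apply, normSq_apply, hσ]
          simp; ring
        rw [show (4:ℝ) = ((4:ℕ):ℝ) by norm_num, rpow_natCast, show 4 = 2 * 2 by norm_num, pow_mul, n1]
        simp only [eval_sub, eval_C, eval_X]
        rw [hz]; ring
lemma mH_scale {r : ℝ} (hβ : 0 < β) (hr : 0 < r) (hr1 : r ≤ 1) (g : ℝ → ℝ) :
    ∫ u in Iio r, g u ∂(mH β) = r ^ β * ∫ u, g (r * u) ∂(mH β) := by
  rw [← integral_indicator measurableSet_Iio, mH_integral hβ, mH_integral hβ]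
  have e1 : ∫ u in J01, β * u ^ bm1 * (Iio r).indicator g u =
      ∫ u in zr..r, β * u ^ bm1 * g u := by
    rw [intervalIntegral.integral_of_le hr.le, integral_Ioc_eq_integral_Ioo,
      ← integral_indicator mIoo, ← integral_indicator mIoo]
    congr 1; ext u
    by_cases h1 : u ∈ Ioo 0 r
    · have h3 : u ∈ J01 := ⟨h1.1, h1.2.trans_le hr1⟩
      have h4 : u ∈ Iio r := h1.2
      rw [indicator_of_mem h1, indicator_of_mem h3, indicator_of_mem h4]
    · rw [indicator_of_notMem h1]
      by_cases h2 : u ∈ J01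
      · have h4 : u ∉ Iio r := fun h ↦ h1 ⟨h2.1, h⟩
        rw [indicator_of_mem h2, indicator_of_notMem h4, mul_zero]
      · rw [indicator_of_notMem h2]
  have e2 : ∫ u in J01, β * u ^ bm1 * g (r * u) =
      ∫ u in zr..1, r ^ (1 - β) * (β * (r * u) ^ bm1 * g (r * u)) := by
    rw [intervalIntegral.integral_of_le zero_le_one, integral_Ioc_eq_integral_Ioo]
    refine setIntegral_congr_fun mIoo fun u hu ↦ ?_
    rw [mul_rpow hr.le hu.1.le]
    have : r ^ (1 - β) * r ^ bm1 = 1 := by rw [← rpow_add hr]; simp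
    linear_combination (-(β * u ^ bm1 * g (r * u))) * this
  rw [e1, e2, intervalIntegral.integral_const_mul,
    intervalIntegral.integral_comp_mul_left (fun y ↦ β * y ^ bm1 * g y) hr.ne']
  simp only [mul_zero, mul_one, smul_eq_mul]
  have : r ^ β * r ^ (1 - β) * r⁻¹ = 1 := by rw [← rpow_add hr]; simp [hr.ne']
  linear_combination (-(∫ x in zr..r, β * x ^ bm1 * g x)) * this
def achp (η : ℝ) : ℝ := ach (max η 1)
lemma achp_nonneg (η : ℝ) : 0 ≤ achp η :=
  log_nonneg (by linarith [one_le_sqrt.2 (le_max_right η 1), sqrt_nonneg (max η 1 - 1)])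
lemma achp_cont : Continuous achp := by
  unfold achp ach
  refine Continuous.log fz fun η ↦ ?_
  have := one_le_sqrt.2 (le_max_right η 1)
  have := sqrt_nonneg (max η 1 - 1)
  positivity
include hβ
lemma achp_le {x : ℝ} (hx : 0 < x) :
    Integrable (fun u ↦ achp (x / u)) (mH β) ∧
    ∫ u, achp (x / u) ∂(mH β) ≤ x ^ β / (2 * (β * m0 β)) := by
  obtain ⟨a1, a2⟩ := ach_eq hβ
  have hβ0 : 0 < β := lz
  have hm := m0_pos hβ
  have hprob := mH_prob hβ0
  have hp1 : ∀ u ∈ J01, achp (1 / u) = ach (1 / u) := fun u hu ↦ by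
    rw [achp, max_eq_left]; rw [le_div_iff₀ hu.1]; linarith [hu.2]
  have hint : Integrable (fun u ↦ achp (x / u)) (mH β) := by
    have ha : Integrable (fun u ↦ log (√(max x 1)) + ach (1 / u) + log 2) (mH β) :=
      ((icn _).add a1).add (icn _)
    refine ha.mono' (mas (achp_cont.measurable.comp fz)) ?_
    filter_upwards [mH_ae β] with u hu
    have hu0 := hu.1
    rw [nonn (achp_nonneg _), achp, ach, ach]
    have h1 : 1 ≤ max x 1 := le_max_right _ _
    have h2 : 0 < √(max x 1) := pz
    have h3 : 0 < √(1 / u) := pz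
    rw [← log_mul pz pz, ← log_mul pz nz]
    have h4 : max (x / u) 1 ≤ max x 1 * (1 / u) := by
      refine max_le ?_ ?_
      · rw [mul_one_div]; gcongr; exact le_max_left _ _
      · rw [mul_one_div, le_div_iff₀ hu0]; linarith [hu.2]
    have h6 : √(max (x / u) 1) ≤ √(max x 1) * √(1 / u) := by
      rw [← sqrt_mul pz]; exact sqrt_le_sqrt h4
    have h7 : √(max (x / u) 1 - 1) ≤ √(max (x / u) 1) := sqrt_le_sqrt lz
    refine log_le_log pz ?_
    nlinarith [sqrt_nonneg (1 / u - 1)]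
  refine ⟨hint, ?_⟩
  have key : ∀ r : ℝ, 0 < r → r ≤ 1 → ∀ y : ℝ, ∫ u in Iio r, achp (y / u) ∂(mH β) =
      r ^ β * ∫ u, achp ((y / r) / u) ∂(mH β) := fun r hr hr1 y ↦ by
    rw [mH_scale hβ0 hr hr1]; simp only [div_div]
  have h1 : ∫ u, achp (1 / u) ∂(mH β) = 1 / (2 * (β * m0 β)) := by
    rw [← a2]; refine icae ?_
    filter_upwards [mH_ae β] with u hu using hp1 u hu
  rcases le_or_gt x 1 with hx1 | hx1
  · have h2 := key x hx hx1 x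
    rw [div_self hx.ne', h1] at h2
    have h3 : ∫ u in Iio x, achp (x / u) ∂(mH β) = ∫ u, achp (x / u) ∂(mH β) := by
      refine setIntegral_eq_integral_of_ae_compl_eq_zero ?_
      filter_upwards [mH_ae β] with u hu h
      have : x / u ≤ 1 := by rw [div_le_one hu.1]; simpa using h
      rw [achp, max_eq_right this]; simp [ach]
    rw [← h3, h2]; exact le_of_eq (by ring)
  · have hxi : 0 < 1 / x := pz
    have h2 := key (1 / x) hxi (by rw [div_le_one hx]; exact hx1.le) 1
    rw [show (1:ℝ) / (1 / x) = x by field_simp] at h2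
    have h3 : ∫ u in Iio (1 / x), achp (1 / u) ∂(mH β) ≤ ∫ u, achp (1 / u) ∂(mH β) :=
      setIntegral_le_integral (a1.congr (by
        filter_upwards [mH_ae β] with u hu using (hp1 u hu).symm)) (ae_of_all _ fun u ↦ achp_nonneg _)
    rw [h2, h1] at h3
    have h4 : x ^ β * (1 / x) ^ β = 1 := by rw [← mul_rpow hx.le hxi.le]; simp [hx.ne']
    have h5 : 0 < x ^ β := rpow_pos_of_pos hx _
    calc _ = x ^ β * ((1 / x) ^ β * ∫ u, achp (x / u) ∂(mH β)) := by rw [← mul_assoc, h4, one_mul]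
      _ ≤ x ^ β * (1 / (2 * (β * m0 β))) := by gcongr
      _ = _ := by ring
omit hβ
lemma arcX {η0 δ : ℝ} (hδ : 0 ≤ δ) (η : ℂ)
    (h : ‖η‖ + ‖η - 1‖ ≤ η0 + |η0 - 1| + 2 * δ) :
    ∫ v, log ‖(v:ℂ) - η‖ ∂arcM ≤ - log 4 + 2 * achp η0 + 2 * √δ := by
  obtain ⟨-, Y, hY, hYe, hYi⟩ := arc_log η
  have hm : (1:ℝ) ≤ max η0 1 := le_max_right _ _
  set m := max η0 1 with hmdef
  have hm2 : η0 + |η0 - 1| = 2 * m - 1 := by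
    rcases le_total η0 1 with h | h
    · rw [hmdef, max_eq_right h, abs_of_nonpos lz]; ring
    · rw [hmdef, max_eq_left h, abs_of_nonneg lz]; ring
  set X : ℝ := √m + √(m - 1) with hX
  have s1 : √m ^ 2 = m := sq_sqrt lz
  have s2 : √(m - 1) ^ 2 = m - 1 := sq_sqrt lz
  have hX1 : 1 ≤ X := by linarith [one_le_sqrt.2 hm, sqrt_nonneg (m - 1)]
  have hX0 : 0 < X := lz
  have hinv : 1 / X = √m - √(m - 1) := by
    rw [div_eq_iff hX0.ne', hX]; nlinarith
  have hXX : X ^ 2 + 1 / X ^ 2 = 2 * (2 * m - 1) := by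
    rw [show 1 / X ^ 2 = (1 / X) ^ 2 by ring, hinv, hX]; nlinarith
  set τ := 2 * √δ with hτ
  have hτ0 : 0 ≤ τ := pz
  set Z := exp τ with hZ
  have hZ1 : 1 ≤ Z := one_le_exp hτ0
  have hZ0 : 0 < Z := exp_pos _
  have hZZ : (Z - 1) * (1 - 1 / Z) ≥ 4 * δ := by
    have e : (Z - 1) * (1 - 1 / Z) = 2 * (cosh τ - 1) := by
      rw [cosh_eq, exp_neg, ← hZ]; field_simp; ring
    have hc : 1 + τ ^ 2 / 2 ≤ cosh τ := by
      have h1 := cosh_sq' (τ / 2)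
      have h2 := cosh_two_mul (τ / 2)
      have h3 : τ / 2 ≤ sinh (τ / 2) := self_le_sinh_iff.2 lz
      rw [show 2 * (τ / 2) = τ by ring] at h2
      nlinarith
    have : τ ^ 2 = 4 * δ := by rw [hτ, mul_pow, sq_sqrt hδ]; norm_num
    rw [e]; linarith
  have hle : Y ≤ X ^ 2 * Z := by
    have hW : 1 ≤ X ^ 2 * Z := by nlinarith [one_le_pow₀ hX1 (n := 2)]
    refine joukow_le (q := 1) pz lz hW zero_le_one ?_
    rw [one_pow, hYe]
    have e : X ^ 2 * Z + 1 / (X ^ 2 * Z) = X ^ 2 + 1 / X ^ 2 + (Z - 1) * (X ^ 2 - 1 / (X ^ 2 * Z)) := by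
      field_simp; ring
    have h5 : (Z - 1) * (1 - 1 / Z) ≤ (Z - 1) * (X ^ 2 - 1 / (X ^ 2 * Z)) := by
      refine mul_le_mul_of_nonneg_left ?_ lz
      have h6 := one_le_pow₀ hX1 (n := 2)
      have : 1 / (X ^ 2 * Z) ≤ 1 / Z := one_div_le_one_div_of_le hZ0 (by nlinarith)
      linarith
    rw [e, hXX]
    linarith
  rw [hYi, log_div lz nz]
  have : log Y ≤ log (X ^ 2 * Z) := log_le_log lz hle
  rw [log_mul pz hZ0.ne', log_pow, hZ, log_exp] at this
  have e3 : achp η0 = log X := rfl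
  rw [e3]
  push_cast at this
  linarith
def nuH (β : ℝ) : Measure ℝ := ((mH β).prod arcM).map (fun p ↦ p.1 * p.2)
lemma nuH_prob (hβ : 0 < β) : IsProbabilityMeasure (nuH β) := by
  have := mH_prob hβ
  exact Measure.isProbabilityMeasure_map fz
lemma nuH_prod_ae (hβ : 0 < β) : ∀ᵐ p ∂((mH β).prod arcM), p.1 ∈ J01 ∧ p.2 ∈ J01 := by
  have := mH_prob hβ
  have a := (Measure.quasiMeasurePreserving_fst (μ := mH β) (ν := arcM)).ae (mH_ae β)
  have b := (Measure.quasiMeasurePreserving_snd (μ := mH β) (ν := arcM)).ae arc_ae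
  filter_upwards [a, b] with p h1 h2 using ⟨h1, h2⟩
lemma nuH_ae (hβ : 0 < β) : ∀ᵐ y ∂(nuH β), y ∈ J01 := by
  rw [nuH, ae_map_iff (p := fun y ↦ y ∈ J01) fz mIoo]
  filter_upwards [nuH_prod_ae hβ] with p hp
  exact ⟨mul_pos hp.1.1 hp.2.1, by nlinarith [hp.1.1, hp.1.2, hp.2.1, hp.2.2]⟩
lemma nuH_singleton (hβ : 0 < β) (y : ℝ) : nuH β {y} = 0 := by
  have := mH_prob hβ
  rw [nuH, Measure.map_apply fz (measurableSet_singleton y),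
    Measure.prod_apply ((by fun_prop : Measurable fun p : ℝ × ℝ ↦ p.1 * p.2) (measurableSet_singleton y)),
    lintegral_eq_zero_iff' (by exact (measurable_measure_prodMk_left ((by fun_prop : Measurable fun p : ℝ × ℝ ↦ p.1 * p.2) (measurableSet_singleton y))).aemeasurable)]
  filter_upwards [mH_ae β] with u hu
  refine measure_mono_null ?_ (arc_singleton (y / u))
  intro v hv
  simp only [Set.mem_preimage, Set.mem_singleton_iff] at hv ⊢
  rw [eq_div_iff hu.1.ne']; linarith
lemma nuH_integral (hβ : 0 < β) (g : ℝ → ℝ) (hg : Measurable g) (K : ℝ)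
    (hK : ∀ y ∈ J01, |g y| ≤ K) :
    Integrable g (nuH β) ∧ Integrable (fun u ↦ ∫ v, g uvp ∂arcM) (mH β) ∧
    ∫ y, g y ∂(nuH β) = ∫ u, ∫ v, g uvp ∂arcM ∂(mH β) := by
  have := mH_prob hβ
  have := nuH_prob hβ
  have hi : Integrable g (nuH β) := Integrable.mono' (icn K) hg.aestronglyMeasurable (by
    filter_upwards [nuH_ae hβ] with y hy using hK y hy)
  have hi2 : Integrable (fun p : ℝ × ℝ ↦ g (p.1 * p.2)) ((mH β).prod arcM) := hi.comp_measurable fz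
  refine ⟨hi, hi2.integral_prod_left, ?_⟩
  rw [nuH, integral_map fz hg.aestronglyMeasurable, integral_prod _ hi2]
lemma quantiles (hβ : 0 < β) (n : ℕ) (hn : 0 < n) : ∃ q : ℕ → ℝ, q 0 = 0 ∧ q n = 1 ∧
    (∀ i < n, q i < q (i + 1)) ∧ (∀ i ≤ n, q i ∈ Icc zr 1) ∧
    (∀ i < n, (nuH β).real (Ioc (q i) (q (i + 1))) = 1 / n) := by
  have := nuH_prob hβ
  set ν := nuH β
  set F := ProbabilityTheory.cdf ν with hF
  have hFm : Monotone F := ProbabilityTheory.monotone_cdf ν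
  have hc : Continuous F := by
    rw [continuous_iff_continuousAt]
    intro x
    rw [hFm.continuousAt_iff_leftLim_eq_rightLim]
    have h1 := F.measure_singleton x
    rw [hF, ProbabilityTheory.measure_cdf, nuH_singleton hβ] at h1
    have h2 := ENNReal.ofReal_eq_zero.1 h1.symm
    rw [← hF] at h2
    have h3 := hFm.leftLim_le (le_refl x)
    rw [F.rightLim_eq]; linarith
  have hF0 : F 0 = 0 := by
    rw [hF, ProbabilityTheory.cdf_eq_real, measureReal_eq_zero_iff]
    refine measure_mono_null (t := (J01)ᶜ) (fun y hy h ↦ ?_) (nuH_ae hβ)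
    exact absurd h.1 (not_lt.2 hy)
  have hF1 : F 1 = 1 := by
    rw [hF, ProbabilityTheory.cdf_eq_real, Measure.real, (mem_ae_iff_prob_eq_one measurableSet_Iic).1, ENNReal.toReal_one]
    filter_upwards [nuH_ae hβ] with y hy using hy.2.le
  have hex : ∀ i : ℕ, ∃ y : ℝ, i ≤ n → y ∈ Icc zr 1 ∧ F y = i / n := by
    intro i
    by_cases hi : i ≤ n
    · have := intermediate_value_Icc (zero_le_one (α := ℝ)) hc.continuousOn
      obtain ⟨y, hy, hy2⟩ := this (show (i / n : ℝ) ∈ Icc (F 0) (F 1) by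
        rw [hF0, hF1]; exact ⟨pz, div_le_one_of_le₀ (by exact_mod_cast hi) pz⟩)
      exact ⟨y, fun _ ↦ ⟨hy, hy2⟩⟩
    · exact ⟨0, fun h ↦ absurd h hi⟩
  choose q0 hq0 using hex
  have hn' : zr < n := by exact_mod_cast hn
  set q : ℕ → ℝ := fun i ↦ if i = 0 then 0 else if i = n then 1 else q0 i with hq
  have hqF : ∀ i ≤ n, q i ∈ Icc zr 1 ∧ F (q i) = i / n := by
    intro i hi
    simp only [hq]
    split_ifs with h1 h2
    · subst h1; simp [hF0]
    · subst h2; simp [hF1, hn.ne']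
    · exact hq0 i hi
  have hlt : ∀ i < n, q i < q (i + 1) := by
    intro i hi
    by_contra h
    have := hFm (not_lt.1 h)
    rw [(hqF i hi.le).2, (hqF (i + 1) hi).2] at this
    push_cast at this
    rw [div_le_div_iff_of_pos_right hn'] at this
    linarith
  refine ⟨q, by simp [hq], by simp [hq, hn.ne'], hlt, fun i hi ↦ (hqF i hi).1, fun i hi ↦ ?_⟩
  have : ν.real (Ioc (q i) (q (i + 1))) = F (q (i + 1)) - F (q i) := by
    rw [hF, ProbabilityTheory.cdf_eq_real, ProbabilityTheory.cdf_eq_real, ← Set.Iic_sdiff_Iic,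
      measureReal_sdiff (Set.Iic_subset_Iic.2 (hlt i hi).le) measurableSet_Iic]
  rw [this, (hqF i hi.le).2, (hqF (i + 1) hi).2]
  push_cast; ring
lemma cells_sum {ν : Measure ℝ} (q : ℕ → ℝ) (g : ℝ → ℝ) (hg : Integrable g ν) (n : ℕ) (hq : ∀ i < n, q i < q (i + 1))
    (m : ℕ) (hm : m ≤ n) :
    q 0 ≤ q m ∧ ∑ i ∈ range m, ∫ y in Ioc (q i) (q (i + 1)), g y ∂ν = ∫ y in Ioc (q 0) (q m), g y ∂ν := by
  induction m with
  | zero => simp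
  | succ m ih =>
    obtain ⟨h1, h2⟩ := ih oz
    have h3 := hq m oz
    refine ⟨h1.trans h3.le, ?_⟩
    rw [sum_range_succ, h2, ← Set.Ioc_union_Ioc_eq_Ioc h1 h3.le,
      setIntegral_union (Set.Ioc_disjoint_Ioc_of_le le_rfl) measurableSet_Ioc hg.integrableOn hg.integrableOn]
lemma cells_le {ν : Measure ℝ} [IsProbabilityMeasure ν] (q : ℕ → ℝ) (g : ℝ → ℝ) (hg : Integrable g ν) (n : ℕ) (hn : 0 < n)
    (hq : ∀ i < n, q i < q (i + 1)) (hν : ∀ i < n, ν.real (Ioc (q i) (q (i + 1))) = 1 / n)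
    (c : ℕ → ℝ) (m : ℕ) (hm : m ≤ n)
    (hc : ∀ i < m, ∀ y ∈ Ioc (q i) (q (i + 1)), c i ≤ g y) :
    ∑ i ∈ range m, c i ≤ n * ∫ y in Ioc (q 0) (q m), g y ∂ν := by
  rw [← (cells_sum q g hg n hq m hm).2, mul_sum]
  refine Finset.sum_le_sum fun i hi ↦ ?_
  have hi' := Finset.mem_range.1 hi
  have h1 : ∫ y in Ioc (q i) (q (i + 1)), c i ∂ν ≤ ∫ y in Ioc (q i) (q (i + 1)), g y ∂ν :=
    setIntegral_mono_on (icn _).integrableOn hg.integrableOn measurableSet_Ioc (hc i hi')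
  rw [setIntegral_const, hν i oz, smul_eq_mul] at h1
  have hn' : zr < n := by exact_mod_cast hn
  calc c i = n * (1 / n * c i) := by field_simp
    _ ≤ _ := by gcongr
include hβ
lemma mH_log : Integrable (fun u ↦ log u) (mH β) ∧ ∫ u, log u ∂(mH β) = -(1 / β) := by
  have hβ0 : 0 < β := lz
  have h := byparts hβ (fun u ↦ - log u) (fun u ↦ 1 / u) 2 0 fz
    (fun u hu ↦ by rw [one_div]; exact (hasDerivAt_log hu.1.ne').neg)
    (fun u hu ↦ by
      have h1 : 0 ≤ - log u := by linarith [log_nonpos hu.1.le hu.2.le]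
      refine ⟨h1, ?_⟩
      have h2 := log_le_sub_one_of_pos (rpow_pos_of_pos hu.1 (-(hlf) : ℝ))
      rw [log_rpow hu.1] at h2
      linarith)
    (by
      have : Tendsto (fun u ↦ - log u) (𝓝[<] 1) (𝓝 (- log 1)) :=
        ((continuousAt_log one_ne_zero).neg.tendsto).mono_left nhdsWithin_le_nhds
      simpa using this)
    ((rpow_int01 hβ0).1.congr_fun (fun u hu ↦ by
      show u ^ bm1 = _
      rw [rpow_sub_one hu.1.ne']; ring) mIoo)
  obtain ⟨h1, h2⟩ := h
  refine ⟨by simpa using h1.neg, ?_⟩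
  have e : ∫ u in J01, u ^ β * (1 / u) = 1 / β := by
    rw [← (rpow_int01 hβ0).2]
    exact setIntegral_congr_fun mIoo (fun u hu ↦ by
      rw [rpow_sub_one hu.1.ne']; ring)
  rw [integral_neg, e] at h2
  linarith
lemma mH_rsqrt : Integrable (fun u ↦ 1 / √u) (mH β) ∧
    ∫ u, 1 / √u ∂(mH β) = β / bmh := by
  have hβ0 : 0 < β := lz
  obtain ⟨h1, h2⟩ := rpow_int01 (β := β - hlf) lz
  have e : ∀ u ∈ J01, β * u ^ (β - hlf - 1) = β * u ^ bm1 * (1 / √u) := fun u hu ↦ by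
    rw [sqrt_eq_rpow, show β - hlf - 1 = bm1 + (-(hlf)) by ring, rpow_add hu.1, rpow_neg hu.1.le]
    ring
  rw [mH_integrable hβ0, mH_integral hβ0]
  refine ⟨IntegrableOn.congr_fun (h1.const_mul β) e mIoo, ?_⟩
  rw [← setIntegral_congr_fun mIoo e, icm, h2]; ring
lemma pot_up {x ε : ℝ} (hx : 0 < x) (hε : 0 < ε) :
    ∫ y, hlf * log ((x - y) ^ 2 + ε ^ 2) ∂(nuH β) ≤
      -(1 / β) - log 4 + 2 * ∫ u, achp (x / u) ∂(mH β) + 2 * √ε * (β / bmh) := by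
  have hβ0 : 0 < β := lz
  have hprob := mH_prob hβ0
  have hc : Continuous fun y ↦ 1/2 * log ((x - y) ^ 2 + ε ^ 2) :=
    continuous_const.mul (Continuous.log fz fun y ↦ by positivity)
  obtain ⟨K, hK⟩ := isCompact_Icc.exists_bound_of_continuousOn (s := Icc zr 1) hc.continuousOn
  obtain ⟨-, h2, h3⟩ := nuH_integral hβ0 _ hc.measurable K (fun y hy ↦ hK y ⟨hy.1.le, hy.2.le⟩)
  rw [h3]
  obtain ⟨l1, l2⟩ := mH_log hβ
  obtain ⟨r1, r2⟩ := mH_rsqrt hβ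
  obtain ⟨a1, -⟩ := achp_le hβ hx
  have hR1 : Integrable (fun u ↦ log u - log 4) (mH β) := l1.sub (icn _)
  have hR2 : Integrable (fun u ↦ log u - log 4 + 2 * achp (x / u)) (mH β) := hR1.add (a1.const_mul 2)
  have hR : Integrable (fun u ↦ log u - log 4 + 2 * achp (x / u) + 2 * √ε * (1 / √u)) (mH β) :=
    hR2.add (r1.const_mul _)
  refine (integral_mono_ae h2 hR ?_).trans (le_of_eq ?_)
  · filter_upwards [mH_ae β] with u hu
    have hu0 := hu.1
    set η : ℂ := (((x / u : ℝ) : ℂ) + ((ε / u : ℝ) : ℂ) * Complex.I) with hη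
    have e : ∀ v : ℝ, hlf * log ((x - u * v) ^ 2 + ε ^ 2) = log u + log ‖(v:ℂ) - η‖ := fun v ↦ by
      have h4 : ‖(v:ℂ) - η‖ ^ 2 = (v - x / u) ^ 2 + (ε / u) ^ 2 := by
        rw [Complex.sq_norm, normSq_apply]; simp [hη]; ring
      have h5 : (x - u * v) ^ 2 + ε ^ 2 = (u * ‖(v:ℂ) - η‖) ^ 2 := by
        rw [mul_pow, h4]; field_simp; ring
      have h6 : 0 < ‖(v:ℂ) - η‖ := by
        have : 0 < ‖(v:ℂ) - η‖ ^ 2 := by rw [h4]; positivity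
        exact (norm_nonneg _).lt_of_ne' (fun h0 ↦ by rw [h0] at this; norm_num at this)
      rw [h5, log_pow, log_mul hu0.ne' h6.ne']; push_cast; ring
    simp_rw [e]
    rw [iad (icn _) (arc_log η).1, integral_const, probReal_univ, one_smul]
    have h7 := arcX (η0 := x / u) (δ := ε / u) pz η (by
      have n1 : ‖((ε / u : ℝ) : ℂ) * Complex.I‖ = ε / u := by
        rw [norm_mul, Complex.norm_I, mul_one, norm_real, nonn pz]
      have n2 : ‖η‖ ≤ x / u + ε / u := by
        refine (norm_add_le _ _).trans ?_
        rw [n1, norm_real, nonn pz]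
      have n3 : ‖η - 1‖ ≤ |x / u - 1| + ε / u := by
        rw [show η - 1 = ((x / u - 1 : ℝ) : ℂ) + ((ε / u : ℝ) : ℂ) * Complex.I by rw [hη]; push_cast; ring]
        refine (norm_add_le _ _).trans ?_
        rw [n1, norm_real, norm_eq_abs]
      linarith)
    rw [sqrt_div hε.le] at h7
    have : 2 * √ε * (1 / √u) = 2 * (√ε / √u) := by ring
    linarith
  · rw [iad hR2 (r1.const_mul _),
      iad hR1 (a1.const_mul 2), integral_sub l1 (icn _),
      icm, icm, l2, r2]
    simp
lemma pot_neg (hκ : 0 < κ) : Integrable (fun y ↦ log (κ + y)) (nuH β) ∧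
    ∫ y, log (κ + y) ∂(nuH β) = -(1 / β) - log 4 + eK β κ / 2 := by
  have hβ0 : 0 < β := lz
  have hprob := mH_prob hβ0
  have hK : ∀ y ∈ J01, |log (κ + y)| ≤ |log κ| + |log (κ + 1)| := fun y hy ↦ by
    have h1 : log κ ≤ log (κ + y) := log_le_log hκ (by linarith [hy.1])
    have h2 : log (κ + y) ≤ log (κ + 1) := log_le_log (by linarith [hy.1]) (by linarith [hy.2])
    rw [abs_le]
    constructor
    · linarith [neg_abs_le (log κ), abs_nonneg (log (κ + 1))]
    · linarith [le_abs_self (log (κ + 1)), abs_nonneg (log κ)]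
  obtain ⟨h1, h2, h3⟩ := nuH_integral hβ0 (fun y ↦ log (κ + y)) fz _ hK
  refine ⟨h1, ?_⟩
  rw [h3]
  obtain ⟨l1, l2⟩ := mH_log hβ
  obtain ⟨a1, -⟩ := eK_eq hβ hκ
  have hR1 : Integrable (fun u ↦ log u - log 4) (mH β) := l1.sub (icn _)
  have e : ∫ u, ∫ v, log (κ + u * v) ∂arcM ∂(mH β) = ∫ u, (log u - log 4) + 2 * arsinh (√(κ / u)) ∂(mH β) := by
    refine icae ?_
    filter_upwards [mH_ae β] with u hu
    have hu0 := hu.1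
    have e1 : ∫ v, log (κ + u * v) ∂arcM = ∫ v, log u + log |v - (-(κ / u))| ∂arcM := by
      refine icae ?_
      filter_upwards [arc_ae] with v hv
      have hv0 := hv.1
      rw [abs_of_pos (by rw [sub_neg_eq_add]; positivity), ← log_mul hu0.ne' (by rw [sub_neg_eq_add]; positivity)]
      congr 1; field_simp; ring
    have hp : 0 < κ / u := pz
    rw [e1, iad (icn _) (arc_log_real_intble _), integral_const, probReal_univ, one_smul,
      arc_log_real _ (Or.inl lz), abs_neg, abs_of_pos hp,
      abs_of_neg lz, arsinh, sq_sqrt hp.le, show -(-(κ / u) - 1) = 1 + κ / u by ring]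
    ring
  rw [e, iad hR1 (a1.const_mul 2), icm, integral_sub l1 (icn _), l2, eK,
    icm]
  simp
  ring
omit hβ
lemma disc_up (hβ : 0 < β) {n : ℕ} (hn : 0 < n) (q : ℕ → ℝ) (q0 : q 0 = 0) (qn : q n = 1)
    (hq : ∀ i < n, q i < q (i + 1)) (hq1 : ∀ i ≤ n, q i ∈ Icc zr 1)
    (hν : ∀ i < n, (nuH β).real (Ioc (q i) (q (i + 1))) = 1 / n) {x ε : ℝ} (hx : 0 < x) (hε : 0 < ε) (hε1 : ε ≤ 1) :
    ∑ i ∈ range n, hlf * log ((x - q (i + 1)) ^ 2 + ε ^ 2) ≤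
      n * ∫ y, hlf * log ((x - y) ^ 2 + ε ^ 2) ∂(nuH β) + log (2 / ε) := by
  have hprob := nuH_prob hβ
  set g : ℝ → ℝ := fun y ↦ 1/2 * log ((x - y) ^ 2 + ε ^ 2) with hg
  set gm : ℝ → ℝ := fun y ↦ g (min y x) - log ε with hgm
  set gp : ℝ → ℝ := fun y ↦ g (max y x) - log ε with hgp
  have hc : Continuous g := continuous_const.mul (Continuous.log fz fun y ↦ by positivity)
  have hcm : Continuous gm := (hc.comp fz).sub continuous_const
  have hcp : Continuous gp := (hc.comp fz).sub continuous_const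
  have gx : g x = log ε := by simp only [hg, sub_self]; rw [zero_pow two_ne_zero, zero_add, log_pow]; push_cast; ring
  have gmono : ∀ y z, |x - y| ≤ |x - z| → g y ≤ g z := fun y z h ↦ by
    simp only [hg]
    have := sq_le_sq.2 h
    have : log ((x - y) ^ 2 + ε ^ 2) ≤ log ((x - z) ^ 2 + ε ^ 2) := log_le_log pz lz
    linarith
  have anti : ∀ y z, y ≤ z → gm z ≤ gm y := fun y z h ↦ by
    simp only [hgm]
    have := gmono (min z x) (min y x) (by
      rw [abs_of_nonneg (by linarith [min_le_right z x]), abs_of_nonneg (by linarith [min_le_right y x])]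
      linarith [min_le_min_right x h])
    linarith
  have mono : ∀ y z, y ≤ z → gp y ≤ gp z := fun y z h ↦ by
    simp only [hgp]
    have := gmono (max y x) (max z x) (by
      rw [abs_of_nonpos (by linarith [le_max_right y x]), abs_of_nonpos (by linarith [le_max_right z x])]
      linarith [max_le_max_right x h])
    linarith
  have dec : ∀ y, g y = log ε + gm y + gp y := fun y ↦ by
    simp only [hgm, hgp]
    rcases le_total y x with h | h
    · rw [min_eq_left h, max_eq_right h, gx]; ring
    · rw [min_eq_right h, max_eq_left h, gx]; ring
  have gp0 : ∀ y, 0 ≤ gp y := fun y ↦ by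
    simp only [hgp]; rw [← gx]; linarith [gmono x (max y x) sz]
  have int : ∀ f : ℝ → ℝ, Continuous f → Integrable f (nuH β) := fun f hf ↦ by
    obtain ⟨K, hK⟩ := isCompact_Icc.exists_bound_of_continuousOn (s := Icc zr 1) hf.continuousOn
    exact (nuH_integral hβ f hf.measurable K (fun y hy ↦ hK y ⟨hy.1.le, hy.2.le⟩)).1
  have full : ∀ f : ℝ → ℝ, ∫ y in Ioc (q 0) (q n), f y ∂(nuH β) = ∫ y, f y ∂(nuH β) := fun f ↦ by
    refine setIntegral_eq_integral_of_ae_compl_eq_zero ?_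
    filter_upwards [nuH_ae hβ] with y hy h
    rw [q0, qn] at h
    exact absurd ⟨hy.1, hy.2.le⟩ h
  have s1 := cells_le q gm (int gm hcm) n hn hq hν (fun i ↦ gm (q (i + 1))) n le_rfl
    (fun i hi y hy ↦ anti _ _ hy.2)
  obtain ⟨k, rfl⟩ : ∃ k, n = k + 1 := ⟨n - 1, oz⟩
  have s2 := cells_le (fun i ↦ q i) gp (int gp hcp) (k + 1) hn hq hν (fun i ↦ gp (q i)) (k + 1) le_rfl
    (fun i hi y hy ↦ mono _ _ hy.1.le)
  rw [full] at s1 s2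
  have s3 : ∑ i ∈ range (k + 1), gp (q (i + 1)) ≤ ∑ i ∈ range (k + 1), gp (q i) + gp 1 := by
    have := sum_range_succ (fun i ↦ gp (q i)) (k + 1)
    rw [Finset.sum_range_succ', qn] at this
    linarith [gp0 (q 0)]
  have s4 : gp 1 ≤ log (2 / ε) := by
    rw [log_div two_ne_zero hε.ne']
    simp only [hgp]
    have h5 : |x - max 1 x| ≤ 1 := by
      rw [abs_le]; rcases le_total 1 x with h | h
      · rw [max_eq_right h]; simp
      · rw [max_eq_left h]; constructor <;> linarith
    have h6 : (x - max 1 x) ^ 2 + ε ^ 2 ≤ 2 ^ 2 := by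
      have := (sq_le_one_iff_abs_le_one _).2 h5
      nlinarith
    have h7 := log_le_log pz h6
    rw [log_pow] at h7
    simp only [hg]; push_cast at h7; linarith
  have e1 : ∑ i ∈ range (k + 1), g (q (i + 1)) = (k + 1) * log ε + ∑ i ∈ range (k + 1), gm (q (i + 1))
      + ∑ i ∈ range (k + 1), gp (q (i + 1)) := by
    simp_rw [dec, Finset.sum_add_distrib]; simp
  have e2 : ∫ y, g y ∂(nuH β) = log ε + ∫ y, gm y ∂(nuH β) + ∫ y, gp y ∂(nuH β) := by
    have h8 : Integrable (fun y ↦ log ε + gm y) (nuH β) := (icn _).add (int gm hcm)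
    simp_rw [dec]
    rw [iad h8 (int gp hcp), iad (icn _) (int gm hcm)]; simp
  rw [e1, e2]
  push_cast at s1 s2 ⊢
  linarith
lemma prod_exp (n : ℕ) (b : ℝ) (hb : 0 < b) (f : ℕ → ℝ) (hf : ∀ i < n, 0 < f i) :
    ∏ i ∈ range n, (b ^ 2 * f i) = exp (2 * n * log b + ∑ i ∈ range n, log (f i)) := by
  rw [exp_add, exp_sum, Finset.prod_mul_distrib, Finset.prod_const, Finset.card_range]
  congr 1
  · rw [← pow_mul, ← exp_log (pow_pos hb _), log_pow]; push_cast; rfl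
  · exact Finset.prod_congr rfl fun i hi ↦ (exp_log (hf i (Finset.mem_range.1 hi))).symm
def Lam (β : ℝ) (n : ℕ) (b : ℝ) : ℝ := exp (2 * n * (log b - 1 / β - log 4))
include hβ
lemma Gpoly : ∃ C > 0, ∀ n : ℕ, 1 ≤ n → ∀ b : ℝ, 0 < b →
    β * m0 β * b ^ β = 2 * ((n:ℝ) + 1) → ∃ G : RX, G.Monic ∧ G.natDegree = n ∧
    (∫ x, G.eval x ^ 2 ∂wB ≤ C * n ^ 4 * b * Lam β n b) ∧
    (∀ κ : ℝ, 0 < κ → Lam β n b * exp (n * eK β κ) ≤ G.eval (-(κ * b)) ^ 2) := by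
  have hβ0 : 0 < β := lz
  have hm := m0_pos hβ
  have hprob := mH_prob hβ0
  have hprob2 := nuH_prob hβ0
  refine ⟨4 * exp (4 * (β / bmh)) * (2 * π), pz, fun n hn b hb hN ↦ ?_⟩
  obtain ⟨q, q0, qn, hq, hq1, hν⟩ := quantiles hβ0 n hn
  have hn' : (1:ℝ) ≤ n := by exact_mod_cast hn
  set G : RX := ∏ i ∈ range n, (X - C (b * q (i + 1))) with hG
  have hGe : ∀ y, G.eval y = ∏ i ∈ range n, (y - b * q (i + 1)) := fun y ↦ by
    rw [hG, eval_prod]; simp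
  have hqp : ∀ i < n, 0 < q (i + 1) := fun i hi ↦ (hq1 i hi.le).1.trans_lt (hq i hi)
  refine ⟨G, monic_prod_of_monic _ _ fun i _ ↦ monic_X_sub_C _, by
    rw [hG, natDegree_prod_of_monic _ _ fun i _ ↦ monic_X_sub_C _]; simp_rw [natDegree_X_sub_C]; simp, ?_, fun κ hκ ↦ ?_⟩
  · have key : ∀ x, 0 < x → G.eval x ^ 2 * exp (-(x ^ β)) ≤
        4 * exp (4 * (β / bmh)) * n ^ 4 * Lam β n b * (2 * (1 + (x / b) ^ 2)⁻¹) := by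
      intro x hx
      set y := x / b with hy
      have hy0 : 0 < y := pz
      set ε : ℝ := 1 / n ^ 2 with hε
      have hε0 : 0 < ε := pz
      have hε1 : ε ≤ 1 := by rw [hε, div_le_one pz]; exact one_le_pow₀ hn'
      have h1 : G.eval x ^ 2 ≤ exp (2 * n * log b + ∑ i ∈ range n, log ((y - q (i + 1)) ^ 2 + ε ^ 2)) := by
        rw [← prod_exp n b hb _ (fun i _ ↦ by positivity), hGe, ← Finset.prod_pow]
        refine Finset.prod_le_prod (fun i _ ↦ by positivity) fun i _ ↦ ?_
        rw [show x - b * q (i + 1) = b * (y - q (i + 1)) by rw [hy]; field_simp, mul_pow]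
        gcongr; linarith [sq_nonneg ε]
      have h2 := disc_up hβ0 hn q q0 qn hq hq1 hν hy0 hε0 hε1
      have h3 := pot_up hβ hy0 hε0
      obtain ⟨a1, a2⟩ := achp_le hβ hy0
      set J := ∫ u, achp (y / u) ∂(mH β) with hJ
      have h4 : 4 * ((n:ℝ) + 1) * J ≤ x ^ β := by
        have e : x ^ β = y ^ β * b ^ β := by rw [← mul_rpow hy0.le hb.le, hy, div_mul_cancel₀ _ hb.ne']
        rw [le_div_iff₀ pz] at a2
        have hb' : 0 < b ^ β := rpow_pos_of_pos hb _
        rw [e]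
        have : 4 * ((n:ℝ) + 1) * J = J * (2 * (β * m0 β)) * b ^ β := by linear_combination (-2 * J) * hN
        rw [this]; gcongr
      have h5 : 1/2 * log (max y 1) ≤ J := by
        have : ∫ u, hlf * log (max y 1) ∂(mH β) ≤ J := by
          refine integral_mono_ae (icn _) a1 ?_
          filter_upwards [mH_ae β] with u hu
          have hu0 := hu.1
          rw [achp, ach]
          have h6 : max y 1 ≤ max (y / u) 1 := max_le_max_right _ (by rw [le_div_iff₀ hu0]; nlinarith [hu.2])
          have h7 : 0 < max y 1 := pz
          have h8 : log (√(max y 1)) ≤ log (√(max (y / u) 1) + √(max (y / u) 1 - 1)) :=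
            log_le_log pz (by linarith [sqrt_le_sqrt h6, sqrt_nonneg (max (y / u) 1 - 1)])
          rw [log_sqrt h7.le] at h8
          linarith
        simpa using this
      have h9 : √ε * n = 1 := by
        rw [hε, one_div, sqrt_inv, sqrt_sq pz]; field_simp
      have hl : log (2 / ε) = log 2 + 2 * log n := by
        rw [hε, div_div_eq_mul_div, div_one, log_mul two_ne_zero pz, log_pow]; push_cast; ring
      have h10 : ∑ i ∈ range n, log ((y - q (i + 1)) ^ 2 + ε ^ 2) ≤
          2 * n * (-(1 / β) - log 4) + 4 * n * J + 4 * (β / bmh) + log 4 + 4 * log n := by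
        rw [← mul_sum] at h2
        have h11 := mul_le_mul_of_nonneg_left h3 (by positivity : zr ≤ n)
        have e2 : (n:ℝ) * (2 * √ε * (β / bmh)) = 2 * (β / bmh) := by
          linear_combination (2 * (β / bmh)) * h9
        have e3 : log 4 = 2 * log 2 := by rw [show (4:ℝ) = 2 ^ 2 by norm_num, log_pow]; push_cast; ring
        rw [hl] at h2
        nlinarith
      have h12 : G.eval x ^ 2 * exp (-(x ^ β)) ≤ exp (2 * n * (log b - 1 / β - log 4) + 4 * (β / bmh) + log 4
          + 4 * log n - 2 * log (max y 1)) := by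
        refine (mul_le_mul_of_nonneg_right h1 (exp_pos _).le).trans ?_
        rw [← exp_add, exp_le_exp]
        linarith
      refine h12.trans ?_
      have h13 : exp (- (2 * log (max y 1))) ≤ 2 * (1 + y ^ 2)⁻¹ := by
        have hM : 1 ≤ max y 1 := le_max_right _ _
        have e4 : exp (2 * log (max y 1)) = max y 1 ^ 2 := by
          rw [← exp_log (show 0 < max y 1 ^ 2 by positivity), log_pow]; push_cast; rfl
        rw [exp_neg, e4, ← div_eq_mul_inv, ← one_div, div_le_div_iff₀ pz pz]
        nlinarith [pow_le_pow_left₀ hy0.le (le_max_left y 1) 2]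
      have e5 : exp (4 * log n) = (n:ℝ) ^ 4 := by
        rw [← exp_log (show zr < n ^ 4 by positivity), log_pow]; push_cast; rfl
      rw [sub_eq_add_neg _ (2 * log (max y 1)), exp_add, exp_add, exp_add, exp_add, exp_log nz, e5, Lam]
      calc _ ≤ _ := mul_le_mul_of_nonneg_left h13 pz
        _ = _ := by ring
    rw [wM_integral]
    have hi : Integrable fun x : ℝ ↦ 4 * exp (4 * (β / bmh)) * n ^ 4 * Lam β n b * (2 * (1 + (x / b) ^ 2)⁻¹) :=
      ((integrable_inv_one_add_sq.comp_div hb.ne').const_mul 2).const_mul _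
    have hl : 0 < Lam β n b := exp_pos _
    calc ∫ x in Ioi 0, G.eval x ^ 2 * exp (-(x ^ β))
        ≤ ∫ x in Ioi 0, 4 * exp (4 * (β / bmh)) * n ^ 4 * Lam β n b * (2 * (1 + (x / b) ^ 2)⁻¹) := by
          refine integral_mono_of_nonneg (ae_of_all _ fun x ↦ by positivity) hi.integrableOn ?_
          filter_upwards [ae_restrict_mem mIoi] with x hx using key x hx
      _ ≤ ∫ x, 4 * exp (4 * (β / bmh)) * n ^ 4 * Lam β n b * (2 * (1 + (x / b) ^ 2)⁻¹) :=
          setIntegral_le_integral hi (ae_of_all _ fun x ↦ by positivity)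
      _ = _ := by
          rw [icm, icm, Measure.integral_comp_div (fun x ↦ (1 + x ^ 2)⁻¹) b,
            integral_univ_inv_one_add_sq, abs_of_pos hb, smul_eq_mul]
          ring
  · obtain ⟨p1, p2⟩ := pot_neg hβ hκ
    have hs := cells_le q (fun y ↦ - log (κ + y)) p1.neg n hn hq hν (fun i ↦ - log (κ + q (i + 1))) n le_rfl
      (fun i hi y hy ↦ by
        have h0 := (hq1 i hi.le).1
        have := log_le_log (by linarith [hy.1]) (show κ + y ≤ κ + q (i + 1) by linarith [hy.2])
        linarith)
    have full : ∫ y in Ioc (q 0) (q n), - log (κ + y) ∂(nuH β) = ∫ y, - log (κ + y) ∂(nuH β) := by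
      refine setIntegral_eq_integral_of_ae_compl_eq_zero ?_
      filter_upwards [nuH_ae hβ0] with y hy h
      rw [q0, qn] at h
      exact absurd ⟨hy.1, hy.2.le⟩ h
    rw [full, integral_neg, p2, Finset.sum_neg_distrib] at hs
    have e : G.eval (-(κ * b)) ^ 2 = exp (2 * n * log b + ∑ i ∈ range n, log ((κ + q (i + 1)) ^ 2)) := by
      rw [← prod_exp n b hb _ (fun i hi ↦ by have := hqp i hi; positivity), hGe, ← Finset.prod_pow]
      exact Finset.prod_congr rfl fun i _ ↦ by ring
    rw [e, Lam, ← exp_add, exp_le_exp]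
    simp_rw [log_pow]
    rw [← mul_sum]
    push_cast
    linarith
omit hβ
lemma cs_int {μ : Measure ℝ} {f g : ℝ → ℝ} (hf : Integrable (fun x ↦ f x ^ 2) μ)
    (hg : Integrable (fun x ↦ g x ^ 2) μ) (hfg : Integrable (fun x ↦ f x * g x) μ) :
    (∫ x, f x * g x ∂μ) ^ 2 ≤ (∫ x, f x ^ 2 ∂μ) * ∫ x, g x ^ 2 ∂μ := by
  have h : ∀ y : ℝ, 0 ≤ (∫ x, g x ^ 2 ∂μ) * (y * y) + (2 * ∫ x, f x * g x ∂μ) * y + ∫ x, f x ^ 2 ∂μ := by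
    intro y
    have h1 : Integrable (fun x ↦ y * y * g x ^ 2) μ := hg.const_mul _
    have h2 : Integrable (fun x ↦ 2 * y * (f x * g x)) μ := hfg.const_mul _
    have h3 : Integrable (fun x ↦ y * y * g x ^ 2 + 2 * y * (f x * g x)) μ := h1.add h2
    have : ∫ x, (f x + y * g x) ^ 2 ∂μ = y * y * (∫ x, g x ^ 2 ∂μ) + 2 * y * (∫ x, f x * g x ∂μ) + ∫ x, f x ^ 2 ∂μ := by
      rw [← icm, ← icm, ← iad h1 h2, ← iad h3 hf]
      congr 1; ext x; ring
    have h4 : 0 ≤ ∫ x, (f x + y * g x) ^ 2 ∂μ := integral_nonneg fun x ↦ sq_nonneg _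
    linarith
  have := discrim_le_zero h
  rw [discrim] at this
  linarith
def ONP (β : ℝ) (P : ℕ → RX) : Prop := (∀ n, (P n).natDegree = n) ∧ (∀ n, 0 < (P n).leadingCoeff) ∧
  ∀ m n, ∫ x, (P m).eval x * (P n).eval x ∂wB = if m = n then 1 else 0
variable (hP : ONP β P) (hκ : 0 < κ)
def Ist (β : ℝ) (p : RX) (σ : ℝ) : ℝ := ∫ x, p.eval x ^ 2 / xsg ∂wB
include hβ
lemma wM_pmul (p q : RX) : Integrable (fun x ↦ p.eval x * q.eval x) wB := by
  have := wM_poly hβ (p * q)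
  simp only [eval_mul] at this; exact this
lemma wM_psq (p : RX) : Integrable (fun x ↦ p.eval x ^ 2) wB := by
  have := wM_poly hβ (p ^ 2)
  simp only [eval_pow] at this; exact this
include hσ
lemma wM_psq_div (p : RX) :
    Integrable (fun x ↦ p.eval x ^ 2 / xsg) wB := by
  have := wM_poly_div hβ hσ (p ^ 2)
  simp only [eval_pow] at this; exact this
omit hβ hσ
lemma wM_pos {g : ℝ → ℝ} {p : RX} (hp : p ≠ 0) (hi : Integrable g wB) (h0 : ∀ x > 0, 0 ≤ g x)
    (hg : ∀ x > 0, g x = 0 → p.eval x = 0) : 0 < ∫ x, g x ∂wB := by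
  have hn : 0 ≤ᵐ[wM β] g := by filter_upwards [wM_ae β] with x hx using h0 x hx
  refine (integral_nonneg_of_ae hn).lt_of_ne' fun h ↦ ?_
  rw [integral_eq_zero_iff_of_nonneg_ae hn hi] at h
  have h1 : ∀ᵐ x ∂wB, p.eval x = 0 := by
    filter_upwards [h, wM_ae β] with x h1 h2 using hg x h2 h1
  have h2 : volume (Ioi zr) = 0 := by
    have h3 := (ae_withDensity_iff fz).1 h1
    have h4 : ∀ᵐ x ∂(volume.restrict (Ioi zr)), p.eval x = 0 := by
      filter_upwards [h3] with x hx using hx (ENNReal.ofReal_pos.2 (exp_pos _)).ne'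
    have h5 : ∀ᵐ x ∂(volume.restrict (Ioi zr)), p.eval x ≠ 0 := by
      refine ae_restrict_of_ae ?_
      have : {x : ℝ | ¬ p.eval x ≠ 0} ⊆ (p.roots.toFinset : Set ℝ) := fun x hx ↦ by
        have hx' : p.eval x = 0 := not_not.1 hx
        simpa [hp] using hx'
      exact measure_mono_null this (p.roots.toFinset.measure_zero volume)
    have h6 : ∀ᵐ x ∂(volume.restrict (Ioi zr)), False := by
      filter_upwards [h4, h5] with x a b using b a
    rw [← Measure.restrict_apply_univ, Measure.measure_univ_eq_zero, ← ae_eq_bot, ← Filter.eventually_false_iff_eq_bot]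
    exact h6
  simp at h2
include hβ hσ
lemma Ist_pos {p : RX} (hp : p ≠ 0) : 0 < Ist β p σ :=
  wM_pos hp (wM_psq_div hβ hσ p) (fun x hx ↦ by positivity) (fun x hx h ↦ by
    rcases div_eq_zero_iff.1 h with h | h
    · exact pow_eq_zero_iff two_ne_zero |>.1 h
    · linarith)
omit hβ hσ
include hP
lemma onp_ne0 (n : ℕ) : P n ≠ 0 := fun h ↦ by
  have := hP.2.1 n
  rw [h] at this; simp at this
include hβ
lemma onp_low (N : ℕ) :
    ∀ n ≤ N, ∀ p : RX, p.degree < n → ∫ x, PE x * p.eval x ∂wB = 0 := by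
  intro n
  induction n with
  | zero => intro _ p hp; have : p = 0 := by simpa using hp
            simp [this]
  | succ k ih =>
    intro hk p hp
    set c := p.coeff k / (P k).leadingCoeff with hc
    have hl := (hP.2.1 k).ne'
    have h1 : (p - C c * P k).degree < k := by
      rw [degree_lt_iff_coeff_zero]
      intro m hm
      rcases hm.eq_or_lt with h | h
      · subst h
        rw [coeff_sub, coeff_C_mul, hc]
        have : (P k).coeff k = (P k).leadingCoeff := by rw [leadingCoeff, hP.1]
        rw [this, div_mul_cancel₀ _ hl, sub_self]
      · rw [coeff_sub, coeff_C_mul, coeff_eq_zero_of_natDegree_lt (p := P k) (by rw [hP.1]; exact h), mul_zero, sub_zero]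
        exact (degree_lt_iff_coeff_zero _ _).1 hp m h
    have h2 := ih oz _ h1
    have h3 : ∫ x, PE x * p.eval x ∂wB = ∫ x, (PE x * (p - C c * P k).eval x +
        c * (PE x * (P k).eval x)) ∂wB := by
      congr 1; ext x; simp; ring
    rw [h3, iad (wM_pmul hβ _ _) ((wM_pmul hβ _ _).const_mul c), h2, icm, hP.2.2,
      if_neg oz, mul_zero, add_zero]
lemma onp_lead (n : ℕ) (G : RX) (hG : G.Monic)
    (hd : G.natDegree = n) : 1 ≤ (P n).leadingCoeff ^ 2 * ∫ x, G.eval x ^ 2 ∂wB := by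
  set γ := (P n).leadingCoeff with hγ
  have h1 : (C γ * G - P n).degree < n := by
    rw [degree_lt_iff_coeff_zero]
    intro m hm
    rw [coeff_sub, coeff_C_mul]
    rcases hm.eq_or_lt with h | h
    · subst h
      have e1 : (P n).coeff n = γ := by rw [hγ, leadingCoeff, hP.1]
      have e2 : G.coeff n = 1 := by rw [← hd]; exact hG
      rw [e1, e2]; ring
    · rw [coeff_eq_zero_of_natDegree_lt (p := P n) (by rw [hP.1]; exact h), coeff_eq_zero_of_natDegree_lt (p := G) (by rw [hd]; exact h)]
      ring
  have h2 := onp_low hβ hP n n le_rfl _ h1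
  have h3 : γ * ∫ x, (P n).eval x * G.eval x ∂wB = 1 := by
    have e := hP.2.2 n n
    rw [if_pos rfl] at e
    rw [← icm]
    calc _ = ∫ x, ((P n).eval x * (C γ * G - P n).eval x + (P n).eval x * (P n).eval x) ∂wB := by
          congr 1; ext x; simp; ring
      _ = 1 := by rw [iad (wM_pmul hβ _ _) (wM_pmul hβ _ _), h2, e, zero_add]
  have h4 := cs_int (wM_psq hβ (P n)) (wM_psq hβ G) (wM_pmul hβ _ _)
  have e := hP.2.2 n n
  rw [if_pos rfl] at e
  simp_rw [← pow_two] at e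
  rw [e, one_mul] at h4
  nlinarith [sq_nonneg γ]
include hσ
lemma onp_eval (N : ℕ) (p : RX)
    (hp : p.natDegree ≤ N) :
    PE (-σ) * ∫ x, PE x * p.eval x / xsg ∂wB = p.eval (-σ) * Ist β (P N) σ := by
  set r := C (PE (-σ)) * p - C (p.eval (-σ)) * P N with hr
  have hroot : r.IsRoot (-σ) := by simp [hr, IsRoot]; ring
  obtain ⟨q, hq⟩ := dvd_iff_isRoot.2 hroot
  have hqd : q.degree < N := by
    by_cases h0 : q = 0
    · rw [h0, degree_zero]; exact WithBot.bot_lt_coe _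
    have h1 : r.natDegree ≤ N := by
      rw [hr]; refine (natDegree_sub_le _ _).trans (max_le ?_ ?_)
      · exact (natDegree_C_mul_le _ _).trans hp
      · exact (natDegree_C_mul_le _ _).trans (hP.1 N).le
    rw [hq, natDegree_mul (X_sub_C_ne_zero _) h0, natDegree_X_sub_C] at h1
    rw [degree_eq_natDegree h0]; exact_mod_cast (by omega : q.natDegree < N)
  have h2 := onp_low hβ hP N N le_rfl q hqd
  have i1 : Integrable (fun x ↦ PE x * p.eval x / xsg) wB := by
    have := wM_poly_div hβ hσ (P N * p)
    simp only [eval_mul] at this; exact this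
  have h3 : ∫ x, (PE (-σ) * (PE x * p.eval x / xsg) -
      p.eval (-σ) * (PE x ^ 2 / xsg)) ∂wB = 0 := by
    rw [← h2]
    refine icae ?_
    filter_upwards [wM_ae β] with x hx
    have h4 : r.eval x = xsg * q.eval x := by rw [hq]; simp
    have h5 : r.eval x = PE (-σ) * p.eval x - p.eval (-σ) * PE x := by simp [hr]
    have : x + σ ≠ 0 := lz
    field_simp
    linear_combination (PE x) * (h4 - h5)
  rw [integral_sub (i1.const_mul _) ((wM_psq_div hβ hσ _).const_mul _), icm, icm] at h3
  rw [Ist]; linarith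
lemma onp_ne (N : ℕ) :
    PE (-σ) ≠ 0 := fun h ↦ by
  have h1 := onp_eval hβ hσ hP N 1 sz
  rw [h] at h1
  have := Ist_pos hβ hσ (onp_ne0 hP N)
  simp at h1; linarith
lemma onp_E1 (N : ℕ) (p : RX)
    (hp : p.natDegree ≤ N) : p.eval (-σ) ^ 2 * Ist β (P N) σ ≤ PE (-σ) ^ 2 * Ist β p σ := by
  have h1 := onp_eval hβ hσ hP N p hp
  have hI := Ist_pos hβ hσ (onp_ne0 hP N)
  have e : ∀ q : RX, ∀ᵐ x ∂wB, (q.eval x / √xsg) ^ 2 = q.eval x ^ 2 / xsg := fun q ↦ by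
    filter_upwards [wM_ae β] with x hx
    rw [div_pow, sq_sqrt lz]
  have e2 : ∀ᵐ x ∂wB, (PE x / √xsg) * (p.eval x / √xsg) = PE x * p.eval x / xsg := by
    filter_upwards [wM_ae β] with x hx
    rw [div_mul_div_comm, mul_self_sqrt lz]
  have i1 : Integrable (fun x ↦ PE x * p.eval x / xsg) wB := by
    have := wM_poly_div hβ hσ (P N * p)
    simp only [eval_mul] at this; exact this
  have h2 := cs_int (f := fun x ↦ PE x / √xsg) (g := fun x ↦ p.eval x / √xsg)
    ((wM_psq_div hβ hσ (P N)).congr (by filter_upwards [e (P N)] with x hx using hx.symm))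
    ((wM_psq_div hβ hσ p).congr (by filter_upwards [e p] with x hx using hx.symm))
    (i1.congr (by filter_upwards [e2] with x hx using hx.symm))
  rw [icae (e (P N)), icae (e p), icae e2] at h2
  change _ ≤ Ist β (P N) σ * Ist β p σ at h2
  set W := ∫ x, PE x * p.eval x / xsg ∂wB
  have h3 : (p.eval (-σ) ^ 2 * Ist β (P N) σ) * Ist β (P N) σ ≤ (PE (-σ) ^ 2 * Ist β p σ) * Ist β (P N) σ := by
    calc _ = (PE (-σ)) ^ 2 * W ^ 2 := by rw [← mul_pow, h1]; ring
      _ ≤ (PE (-σ)) ^ 2 * (Ist β (P N) σ * Ist β p σ) := by gcongr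
      _ = _ := by ring
  exact le_of_mul_le_mul_right h3 hI
omit hβ hσ hP
def kM (σ : ℝ) : Measure ℝ := (volume.restrict (Ioi zr)).withDensity
    (fun x ↦ ofReal (kap σ x))
lemma kM_ae (σ : ℝ) : ∀ᵐ u ∂(kM σ), 0 < u :=
  (withDensity_absolutelyContinuous _ _).ae_le (ae_restrict_mem mIoi)
include hσ
lemma kM_lint (f : ℝ → ENNReal) (hf : Measurable f) :
    ∫⁻ v, f (mobI σ v) ∂arcM = ∫⁻ u, ∫⁻ v, f uvp ∂arcM ∂(kM σ) := by
  rw [ton_inf hσ f hf, kM, lintegral_withDensity_eq_lintegral_mul _ fz]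
  · rfl
  · exact Measurable.lintegral_prod_right' (f := fun p : ℝ × ℝ ↦ f (p.1 * p.2)) fz
lemma kM_prob : IsProbabilityMeasure (kM σ) := by
  constructor
  have := kM_lint hσ (fun _ ↦ 1) measurable_const
  simp only [lintegral_const, measure_univ, one_mul] at this
  exact this.symm
lemma kM_map :
    ((kM σ).prod arcM).map (fun p ↦ p.1 * p.2) = arcM.map (mobI σ) := by
  have := kM_prob hσ
  refine Measure.ext_of_lintegral _ fun f hf ↦ ?_
  rw [lintegral_map hf fz, lintegral_map hf fz, kM_lint hσ f hf,
    lintegral_prod _ fz]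
lemma kM_ton {g : ℝ → ℝ} (hg : Measurable g)
    (hi : Integrable (fun v ↦ g (mobI σ v)) arcM) :
    Integrable (fun u ↦ ∫ v, g uvp ∂arcM) (kM σ) ∧
    ∫ v, g (mobI σ v) ∂arcM = ∫ u, ∫ v, g uvp ∂arcM ∂(kM σ) ∧
    ∀ᵐ u ∂(kM σ), Integrable (fun v ↦ g uvp) arcM := by
  have := kM_prob hσ
  have h1 : Integrable g (arcM.map (mobI σ)) :=
    (integrable_map_measure hg.aestronglyMeasurable fz).2 hi
  rw [← kM_map hσ, integrable_map_measure hg.aestronglyMeasurable fz] at h1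
  refine ⟨h1.integral_prod_left, ?_, h1.prod_right_ae⟩
  have h2 := integral_prod _ h1
  simp only [Function.comp_apply] at h2
  rw [← h2]
  have e1 := integral_map (μ := (kM σ).prod arcM) (φ := fun p ↦ p.1 * p.2) (f := g) fz
    hg.aestronglyMeasurable
  rw [kM_map hσ, integral_map fz hg.aestronglyMeasurable] at e1
  exact e1
lemma kM_integrable (g : ℝ → ℝ) {S : Set ℝ} (hS : MeasurableSet S) (h0 : S ⊆ Ioi 0) :
    IntegrableOn g S (kM σ) ↔ IntegrableOn (fun x ↦ g x * kap σ x) S := by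
  rw [IntegrableOn, kM, restrict_withDensity hS, integrable_withDensity_iff_integrable_smul' fz
    (ae_of_all _ fun _ ↦ ofReal_lt_top), Measure.restrict_restrict hS,
    Set.inter_eq_left.2 h0, ← IntegrableOn]
  refine integrableOn_congr_fun (fun x hx ↦ ?_) hS
  rw [toReal_ofReal (kap_nonneg hσ (h0 hx)).le, smul_eq_mul, mul_comm]
lemma kM_integral (g : ℝ → ℝ) {S : Set ℝ} (hS : MeasurableSet S) (h0 : S ⊆ Ioi 0) :
    ∫ u in S, g u ∂(kM σ) = ∫ x in S, g x * kap σ x := by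
  rw [kM, restrict_withDensity hS, integral_withDensity_eq_integral_toReal_smul fz
    (ae_of_all _ fun _ ↦ ofReal_lt_top), Measure.restrict_restrict hS,
    Set.inter_eq_left.2 h0]
  refine setIntegral_congr_fun hS (fun x hx ↦ ?_)
  rw [toReal_ofReal (kap_nonneg hσ (h0 hx)).le, smul_eq_mul, mul_comm]
lemma kap_tail {b : ℝ} (hb : 0 < b) :
    IntegrableOn (kap σ) (Ioi b) ∧ ∫ u in Ioi b, kap σ u = √σ / √bsg := by
  have hd : ∀ x ∈ Ioi b, HasDerivAt (fun u ↦ -(√σ / √(u + σ))) (kap σ x) x := by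
    intro x hx
    have h1 : 0 < x + σ := by have := Set.mem_Ioi.1 hx; linarith
    have h2 := (((hasDerivAt_id x).add_const σ).sqrt h1.ne')
    have h3 := ((hasDerivAt_const x (√σ)).div h2 (sqrt_pos.2 h1).ne').neg
    refine HasDerivAt.congr_deriv (f := fun u ↦ -(√σ / √(u + σ))) h3 ?_
    simp only [kap, id]
    have := sqrt_pos.2 h1
    field_simp
    rw [sq_sqrt h1.le]; ring
  have hc : ContinuousWithinAt (fun u ↦ -(√σ / √(u + σ))) (Ici b) b := by
    refine ContinuousAt.continuousWithinAt (ContinuousAt.neg (ContinuousAt.div fz fz ?_))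
    exact (sqrt_pos.2 lz).ne'
  have hp : ∀ x ∈ Ioi b, 0 ≤ kap σ x := fun x hx ↦ (kap_nonneg hσ (hb.trans hx)).le
  have hl : Tendsto (fun u ↦ -(√σ / √(u + σ))) atTop (𝓝 0) := by
    have : Tendsto (fun u : ℝ ↦ √(u + σ)) atTop atTop :=
      tendsto_sqrt_atTop.comp (tendsto_atTop_add_const_right _ _ tendsto_id)
    simpa using (this.const_div_atTop (√σ)).neg
  refine ⟨integrableOn_Ioi_deriv_of_nonneg hc hd hp hl, ?_⟩
  rw [integral_Ioi_of_hasDerivAt_of_nonneg hc hd hp hl]; ring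
lemma kap_tail_log {b : ℝ} (hb : 0 < b) :
    IntegrableOn (fun u ↦ log (u / b) * kap σ u) (Ioi b) ∧
    ∫ u in Ioi b, log (u / b) * kap σ u = 2 * arsinh √(σ / b) := by
  have hd : ∀ x ∈ Ioi b, HasDerivAt (fun u ↦ -(√σ / √(u + σ)) * log (u / b) - 2 * arsinh √(σ / u))
      (log (x / b) * kap σ x) x := by
    intro x hx
    have hx0 : 0 < x := hb.trans hx
    have h1 : 0 < x + σ := lz
    have h2 := (((hasDerivAt_id x).add_const σ).sqrt h1.ne')
    have h3 := ((hasDerivAt_const x (√σ)).div h2 (sqrt_pos.2 h1).ne').neg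
    have h4 := ((hasDerivAt_id x).div_const b).log (div_pos hx0 hb).ne'
    have h5 := (((hasDerivAt_const x σ).div (hasDerivAt_id x) hx0.ne').sqrt (div_pos hσ hx0).ne').arsinh
    refine HasDerivAt.congr_deriv (f := fun u ↦ -(√σ / √(u + σ)) * log (u / b) - 2 * arsinh √(σ / u))
      ((h3.mul h4).sub (h5.const_mul 2)) ?_
    simp only [kap, id, Pi.neg_apply, Pi.div_apply]
    have e1 : 1 + √(σ / x) ^ 2 = xsg / x := by
      rw [sq_sqrt (div_pos hσ hx0).le]; field_simp
    rw [e1, sqrt_div h1.le, sqrt_div hσ.le]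
    have a1 := sqrt_pos.2 h1
    have a2 := sqrt_pos.2 hx0
    have a3 := sqrt_pos.2 hσ
    have a4 : √x ^ 2 = x := sq_sqrt hx0.le
    have a5 : √σ ^ 2 = σ := sq_sqrt hσ.le
    have a6 : √xsg ^ 2 = x + σ := sq_sqrt h1.le
    have e2 : xsg = √xsg ^ 2 := a6.symm
    generalize √xsg = r at *
    generalize √x = y at *
    generalize √σ = s at *
    subst a4; subst a5
    simp only [smul_eq_mul]
    rw [← e2]
    field_simp
    rw [e2]
    ring
  have hc : ContinuousWithinAt (fun u ↦ -(√σ / √(u + σ)) * log (u / b) - 2 * arsinh √(σ / u)) (Ici b) b := by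
    refine ContinuousAt.continuousWithinAt (ContinuousAt.sub (ContinuousAt.mul (ContinuousAt.neg
      (ContinuousAt.div fz fz ?_)) ?_) ?_)
    · exact (sqrt_pos.2 lz).ne'
    · exact ContinuousAt.log fz (by rw [div_self hb.ne']; norm_num)
    · have : ContinuousAt (fun u : ℝ ↦ σ / u) b := ContinuousAt.div fz fz hb.ne'
      exact continuousAt_const.mul (continuous_arsinh.continuousAt.comp (continuous_sqrt.continuousAt.comp this))
  have hp : ∀ x ∈ Ioi b, 0 ≤ log (x / b) * kap σ x := fun x hx ↦
    mul_nonneg (log_nonneg ((one_le_div hb).2 (le_of_lt hx))) (kap_nonneg hσ (hb.trans hx)).le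
  have hl : Tendsto (fun u ↦ -(√σ / √(u + σ)) * log (u / b) - 2 * arsinh √(σ / u)) atTop (𝓝 0) := by
    have h1 : Tendsto (fun u : ℝ ↦ arsinh √(σ / u)) atTop (𝓝 0) := by
      have : Tendsto (fun u : ℝ ↦ σ / u) atTop (𝓝 0) := tendsto_id.const_div_atTop σ
      have h2 := (continuous_arsinh.comp continuous_sqrt).tendsto 0
      simp only [Function.comp_apply, sqrt_zero, arsinh_zero] at h2
      exact h2.comp this
    have h2 : Tendsto (fun u : ℝ ↦ √σ / √(u + σ) * log (u / b)) atTop (𝓝 0) := by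
      have h3 : Tendsto (fun u : ℝ ↦ (log u * √σ) / u ^ (hlf : ℝ) - (log b * √σ) / u ^ (hlf:ℝ)) atTop (𝓝 0) := by
        have a := ((isLittleO_log_rpow_atTop (show zr < hlf by norm_num)).tendsto_div_nhds_zero.mul_const (√σ))
        have c := (tendsto_rpow_atTop (show zr < hlf by norm_num)).const_div_atTop (log b * √σ)
        have := a.sub c
        simp only [zero_mul, sub_zero] at this
        refine this.congr fun u ↦ ?_
        ring
      refine squeeze_zero' ?_ ?_ h3
      · filter_upwards [eventually_ge_atTop b] with u hu
        have := log_nonneg ((one_le_div hb).2 hu)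
        positivity
      · filter_upwards [eventually_ge_atTop b] with u hu
        have hl := log_nonneg ((one_le_div hb).2 hu)
        have hu0 : 0 < u := hb.trans_le hu
        have := sqrt_pos.2 hu0
        rw [← sqrt_eq_rpow, ← sub_div, ← sub_mul, ← log_div hu0.ne' hb.ne', mul_comm, ← mul_div_assoc]
        exact div_le_div_of_nonneg_left pz this (sqrt_le_sqrt lz)
    have := h2.neg.sub (h1.const_mul 2)
    simp only [neg_zero, mul_zero, sub_zero] at this
    refine this.congr fun u ↦ ?_
    ring
  refine ⟨integrableOn_Ioi_deriv_of_nonneg hc hd hp hl, ?_⟩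
  rw [integral_Ioi_of_hasDerivAt_of_nonneg hc hd hp hl, div_self hb.ne']; simp
omit hσ
def Psi (β b N u : ℝ) : ℝ := if u < b then m0 β * u ^ β else 2 * N / β + 2 * N * log (u / b)
include hβ hσ
lemma Psi_int {b N : ℝ} (hb : 0 < b) (hN : β * m0 β * b ^ β = 2 * N) :
    Integrable (Psi β b N) (kM σ) ∧ ∫ u, Psi β b N u ∂(kM σ) = N * eK β (σ / b) := by
  have hβ0 : 0 < β := lz
  have hκ : 0 < σ / b := div_pos hσ hb
  obtain ⟨p1, p2⟩ := Jk_parts hβ hκ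
  obtain ⟨t1, t2⟩ := kap_tail hσ hb
  obtain ⟨l1, l2⟩ := kap_tail_log hσ hb
  have hk : ∀ w, 0 < w → kap (σ / b) w = b * kap σ (w * b) := by
    intro w hw
    have h1 : w * b + σ = b * (w + σ / b) := by field_simp
    have h2 : 0 < w + σ / b := pz
    rw [kap, kap, h1, sqrt_mul hb.le, sqrt_div hσ.le]
    have := sqrt_pos.2 hb; have := sqrt_pos.2 h2
    have e : √b ^ 2 = b := sq_sqrt hb.le
    field_simp
    try rw [e]
  have himg : (fun w : ℝ ↦ w * b) '' Ioo 0 1 = Ioo 0 b := by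
    rw [Set.image_mul_right_Ioo 0 1 hb]; simp
  have hder : ∀ w ∈ J01, HasDerivWithinAt (fun w : ℝ ↦ w * b) b (Ioo 0 1) w :=
    fun w _ ↦ by simpa using ((hasDerivAt_id w).mul_const b).hasDerivWithinAt
  have hinj : Set.InjOn (fun w : ℝ ↦ w * b) (Ioo 0 1) := fun x _ y _ h ↦ mul_right_cancel₀ hb.ne' h
  have e1 : ∀ w ∈ J01, |b| • ((fun u ↦ u ^ β * kap σ u) (w * b)) = b ^ β * (w ^ β * kap (σ / b) w) := by
    intro w hw
    simp only [smul_eq_mul]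
    rw [abs_of_pos hb, hk w hw.1, mul_rpow hw.1.le hb.le]; ring
  have q1 : IntegrableOn (fun u ↦ u ^ β * kap σ u) (Ioo 0 b) := by
    rw [← himg, integrableOn_image_iff_integrableOn_abs_deriv_smul mIoo hder hinj]
    exact (integrableOn_congr_fun e1 mIoo).2 (p1.const_mul _)
  have q2 : ∫ u in Ioo 0 b, u ^ β * kap σ u = b ^ β * ∫ u in J01, u ^ β * kap (σ / b) u := by
    rw [← himg, integral_image_eq_integral_abs_deriv_smul mIoo hder hinj,
      setIntegral_congr_fun mIoo e1, icm]
  have hs : Ioo 0 b ⊆ Ioi zr := fun x hx ↦ hx.1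
  have hs2 : Ioi b ⊆ Ioi zr := fun x hx ↦ hb.trans hx
  have c1 : ∀ u ∈ Ioo 0 b, Psi β b N u = m0 β * u ^ β := fun u hu ↦ if_pos hu.2
  have c2 : ∀ u ∈ Ioi b, Psi β b N u = 2 * N / β + 2 * N * log (u / b) :=
    fun u hu ↦ if_neg (not_lt.2 (le_of_lt hu))
  have i1 : IntegrableOn (Psi β b N) (Ioo 0 b) (kM σ) := by
    rw [integrableOn_congr_fun c1 mIoo, kM_integrable hσ _ mIoo hs]
    simp only [mul_assoc]; exact q1.const_mul _
  have j2 : IntegrableOn (fun u ↦ 2 * N * (log (u / b) * kap σ u)) (Ioi b) := l1.const_mul _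
  have j1 : IntegrableOn (fun u ↦ 2 * N / β * kap σ u) (Ioi b) := t1.const_mul _
  have i2 : IntegrableOn (Psi β b N) (Ioi b) (kM σ) := by
    rw [integrableOn_congr_fun c2 mIoi, kM_integrable hσ _ mIoi hs2]
    simp only [add_mul, mul_assoc]
    simp only [mul_assoc] at j2
    exact j1.add j2
  have hu : (Ioo 0 b ∪ Ioi b : Set ℝ) =ᵐ[kM σ] Set.univ := by
    refine eventuallyEq_univ.2 ?_
    have h0 : ∀ᵐ u ∂(kM σ), u ≠ b :=
      (withDensity_absolutelyContinuous _ _).ae_le (ae_restrict_of_ae (Measure.ae_ne volume b))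
    filter_upwards [kM_ae σ, h0] with u a1 a2
    rcases lt_or_gt_of_ne a2 with h | h
    exacts [Or.inl ⟨a1, h⟩, Or.inr h]
  have i3 : IntegrableOn (Psi β b N) Set.univ (kM σ) := (i1.union i2).congr_set_ae hu.symm
  refine ⟨integrableOn_univ.1 i3, ?_⟩
  rw [← setIntegral_univ, ← setIntegral_congr_set hu, setIntegral_union (by
    rw [Set.disjoint_left]; intro x h1 h2; exact absurd h1.2 (not_lt.2 (le_of_lt h2))) mIoi i1 i2,
    setIntegral_congr_fun mIoo c1, setIntegral_congr_fun mIoi c2,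
    kM_integral hσ _ mIoo hs, kM_integral hσ _ mIoi hs2]
  simp only [add_mul, mul_assoc]
  simp only [mul_assoc] at j2
  rw [icm, q2, iad j1 j2, icm, icm,
    icm, l2, t2, (eK_eq hβ hκ).2]
  have e3 : √(σ / b) / √(1 + σ / b) = √σ / √bsg := by
    rw [show 1 + σ / b = bsg / b by field_simp, sqrt_div hσ.le, sqrt_div lz]
    have := sqrt_pos.2 hb; have := sqrt_pos.2 (show 0 < b + σ by linarith)
    field_simp
  rw [← e3]
  have e4 : m0 β * (b ^ β * ∫ u in J01, u ^ β * kap (σ / b) u) =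
    2 * N / β * (β * (√(σ / b) * Jk β (σ / b)) - √(σ / b) / √(1 + σ / b)) := by
    rw [p2, ← hN]; field_simp; ring
  rw [e4]
  field_simp
  ring
omit hβ hσ
lemma arc_mlog {u : ℝ} (hu : 0 < u) (S : Multiset ℂ) :
    (∀ᵐ v ∂arcM, 0 < (S.map (fun z ↦ ‖((u * v : ℝ) : ℂ) - z‖)).prod) ∧
    Integrable (fun v ↦ log (S.map (fun z ↦ ‖((u * v : ℝ) : ℂ) - z‖)).prod) arcM ∧
    S.card * log (u / 4) ≤ ∫ v, log (S.map (fun z ↦ ‖((u * v : ℝ) : ℂ) - z‖)).prod ∂arcM := by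
  induction S using Multiset.induction_on with
  | empty => simp
  | cons z S ih =>
    obtain ⟨i1, i2, i3⟩ := ih
    have e : ∀ v : ℝ, ‖((u * v : ℝ) : ℂ) - z‖ = u * ‖(v : ℂ) - z / u‖ := fun v ↦ by
      have hu' : (u : ℂ) ≠ 0 := by exact_mod_cast hu.ne'
      rw [show ((u * v : ℝ) : ℂ) - z = u * (v - z / u) by push_cast; field_simp, norm_mul,
        norm_real, norm_eq_abs, abs_of_pos hu]
    have hz : ∀ᵐ v : ℝ ∂arcM, 0 < ‖(v : ℂ) - z / u‖ := by
      have h := measure_eq_zero_iff_ae_notMem.1 (arc_singleton (z / u).re)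
      filter_upwards [h] with v hv
      refine norm_pos_iff.2 fun h0 ↦ hv ?_
      rw [← sub_eq_zero.1 h0]; simp
    have hl : ∀ᵐ v ∂arcM, log ((z ::ₘ S).map (fun z ↦ ‖((u * v : ℝ) : ℂ) - z‖)).prod =
        (log u + log ‖(v:ℂ) - z / u‖) + log (S.map (fun z ↦ ‖((u * v : ℝ) : ℂ) - z‖)).prod := by
      filter_upwards [i1, hz] with v h1 h2
      rw [Multiset.map_cons, Multiset.prod_cons, e, log_mul pz h1.ne', log_mul hu.ne' h2.ne']
    have j1 : Integrable (fun v : ℝ ↦ log u + log ‖(v:ℂ) - z / u‖) arcM := (icn _).add (arc_log _).1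
    refine ⟨?_, (j1.add i2).congr (hl.mono fun v h ↦ h.symm), ?_⟩
    · filter_upwards [i1, hz] with v h1 h2
      rw [Multiset.map_cons, Multiset.prod_cons, e]; positivity
    · rw [icae hl, iad j1 i2, iad (icn _) (arc_log _).1,
        Multiset.card_cons]
      have := arc_log_ge (z / u)
      simp only [integral_const, probReal_univ, one_smul]
      have h4 : log (u / 4) = log u - log 4 := log_div hu.ne' nz
      rw [Nat.cast_add, Nat.cast_one]
      linarith
lemma poly_arc {p : RX} (hp : p ≠ 0) {u : ℝ} (hu : 0 < u) :
    (∀ᵐ v ∂arcM, p.eval uvp ≠ 0) ∧ Integrable (fun v ↦ log (p.eval uvp ^ 2)) arcM ∧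
    2 * p.natDegree * log (u / 4) + log (p.leadingCoeff ^ 2) ≤ ∫ v, log (p.eval uvp ^ 2) ∂arcM := by
  set q := p.map ofRealHom
  have hL : p.leadingCoeff ≠ 0 := leadingCoeff_ne_zero.2 hp
  have hc : q.roots.card = p.natDegree := by
    rw [← natDegree_map_eq_of_injective (ofRealHom.injective) p]
    exact (splits_iff_card_roots.1 (IsAlgClosed.splits q))
  have hn : ∀ x : ℝ, |p.eval x| = |p.leadingCoeff| * (q.roots.map (fun z ↦ ‖(x : ℂ) - z‖)).prod := by
    intro x
    have h1 : q.eval (x : ℂ) = ((p.eval x : ℝ) : ℂ) := by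
      simp only [q, eval_map]; exact eval₂_at_apply ofRealHom x
    have h2 := congrArg (eval (x:ℂ)) ((IsAlgClosed.splits q).eq_prod_roots)
    rw [h1, eval_mul, eval_C, eval_multiset_prod, Multiset.map_map] at h2
    have h3 := congrArg norm h2
    rw [norm_mul, norm_real, norm_eq_abs] at h3
    rw [h3]
    congr 1
    · have : q.leadingCoeff = (p.leadingCoeff : ℂ) := leadingCoeff_map_of_injective (ofRealHom.injective) p
      rw [this, norm_real, norm_eq_abs]
    · refine (map_multiset_prod (normHom : ℂ →*₀ ℝ) _).trans ?_
      rw [Multiset.map_map]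
      simp [normHom, Function.comp_def]
  obtain ⟨i1, i2, i3⟩ := arc_mlog hu q.roots
  have hl : ∀ᵐ v ∂arcM, log (p.eval uvp ^ 2) = log (p.leadingCoeff ^ 2) +
      2 * log (q.roots.map (fun z ↦ ‖((u * v : ℝ) : ℂ) - z‖)).prod := by
    filter_upwards [i1] with v h
    rw [log_pow, ← log_abs, hn, log_mul (abs_pos.2 hL).ne' h.ne', log_pow, log_abs]; push_cast; ring
  refine ⟨?_, ((icn _).add (i2.const_mul 2)).congr (hl.mono fun v h ↦ h.symm), ?_⟩
  · filter_upwards [i1] with v h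
    rw [← abs_pos, hn]; have := abs_pos.2 hL; positivity
  · rw [icae hl, iad (icn _) (i2.const_mul 2), icm]
    rw [hc] at i3
    simp only [integral_const, probReal_univ, one_smul]
    linarith
def bN (β x : ℝ) : ℝ := (2 * x / (β * m0 β)) ^ (1 / β)
include hβ
lemma bN_pos {x : ℝ} (hx : 0 < x) : 0 < bN β x := by
  have := m0_pos hβ
  rw [bN]; have : 0 < β := lz
  positivity
lemma bN_eq {x : ℝ} (hx : 0 ≤ x) : β * m0 β * bN β x ^ β = 2 * x := by
  have hm := m0_pos hβ
  have hβ0 : 0 < β := lz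
  rw [bN, ← rpow_mul pz, one_div_mul_cancel hβ0.ne', rpow_one]
  field_simp
lemma bN_le {x u : ℝ} (hx : 0 ≤ x) (hu : 0 ≤ u) (h : 2 * x ≤ β * m0 β * u ^ β) : bN β x ≤ u := by
  have hm := m0_pos hβ
  have hβ0 : 0 < β := lz
  rw [← bN_eq hβ hx, mul_le_mul_iff_right₀ pz] at h
  exact (rpow_le_rpow_iff (by rw [bN]; positivity) hu hβ0).1 h
lemma le_bN {x u : ℝ} (hx : 0 ≤ x) (hu : 0 ≤ u) (h : β * m0 β * u ^ β ≤ 2 * x) : u ≤ bN β x := by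
  have hm := m0_pos hβ
  have hβ0 : 0 < β := lz
  rw [← bN_eq hβ hx, mul_le_mul_iff_right₀ pz] at h
  exact (rpow_le_rpow_iff hu (by rw [bN]; positivity) hβ0).1 h
lemma bN_lim : Tendsto (bN β) atTop atTop := by
  have hm := m0_pos hβ
  have hβ0 : 0 < β := lz
  exact (tendsto_rpow_atTop pz).comp
    ((tendsto_id.const_mul_atTop (by norm_num : zr < 2)).atTop_div_const pz)
lemma arc_logP : ∃ D > 0, ∀ P, ONP β P → ∀ n : ℕ, 1 ≤ n → ∀ u > 0,
    2 * n * log (u / bN β (n + 1)) + 2 * n / β - log (D * n ^ 4 * bN β (n + 1)) ≤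
      ∫ v, log ((P n).eval uvp ^ 2) ∂arcM := by
  obtain ⟨D, hD, hG⟩ := Gpoly hβ
  refine ⟨D, hD, fun P hP n hn u hu ↦ ?_⟩
  have hb := bN_pos hβ (show zr < n + 1 by positivity)
  obtain ⟨G, g1, g2, g3, -⟩ := hG n hn _ hb (bN_eq hβ pz)
  set b := bN β (n + 1)
  have h1 := onp_lead hβ hP n G g1 g2
  have hγ := hP.2.1 n
  have hn0 : zr < n := by exact_mod_cast hn
  have hLam : 0 < Lam β n b := exp_pos _
  have h2 : 1 ≤ (P n).leadingCoeff ^ 2 * ((D * n ^ 4 * b) * Lam β n b) :=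
    h1.trans (mul_le_mul_of_nonneg_left g3 (sq_nonneg _))
  have h3 := log_nonneg h2
  rw [log_mul pz pz, log_mul pz hLam.ne', Lam, log_exp] at h3
  have h4 := (poly_arc (onp_ne0 hP n) hu).2.2
  rw [hP.1 n, log_div hu.ne' nz] at h4
  rw [log_div hu.ne' hb.ne']
  have : 2 * n * (log b - 1 / β - log 4) = 2 * n * log b - 2 * n / β - 2 * n * log 4 := by ring
  rw [this] at h3
  linarith
lemma psi_low : ∃ C1 C2 R0 : ℝ, 0 ≤ C2 ∧ 1 ≤ R0 ∧ ∀ P, ONP β P → ∀ N : ℕ, 2 ≤ N → ∀ u ≥ R0,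
    ∃ n : ℕ, 1 ≤ n ∧ n + 1 ≤ N ∧ Psi β (bbN) N u - C1 - C2 * log u ≤
      ∫ v, log ((P n).eval uvp ^ 2) ∂arcM - 2 * log (n + 1) := by
  obtain ⟨D, hD, hP'⟩ := arc_logP hβ
  have hm := m0_pos hβ
  have hβ0 : 0 < β := lz
  have hbm : 0 < β * m0 β := pz
  refine ⟨4 / β + log D + 6 * log (β * m0 β / 2) + |log (bN β 1)|, 6 * β + 3, max 1 (bN β 2), pz,
    le_max_left _ _, fun P hP N hN u hu ↦ ?_⟩
  have hu1 : 1 ≤ u := (le_max_left _ _).trans hu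
  have hu2 : bN β 2 ≤ u := (le_max_right _ _).trans hu
  have hu0 : 0 < u := lz
  have hlu := log_nonneg hu1
  set y := β * m0 β * u ^ β / 2 with hy
  have hy2 : 2 ≤ y := by
    have h1 := bN_eq hβ (show zr ≤ 2 by norm_num)
    have h2 : bN β 2 ^ β ≤ u ^ β := rpow_le_rpow (bN_pos hβ nz).le hu2 hβ0.le
    have := mul_le_mul_of_nonneg_left h2 hbm.le
    rw [hy]; linarith
  have hly : log y = log (β * m0 β / 2) + β * log u := by
    rw [hy, mul_div_right_comm, log_mul pz pz, log_rpow hu0]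
  have key : ∀ n : ℕ, 1 ≤ n → (n:ℝ) + 1 ≤ y →
      2 * n * log (u / bN β (n + 1)) + 2 * n / β - log D - 6 * log y - log (bN β (n + 1)) ≤
      ∫ v, log ((P n).eval uvp ^ 2) ∂arcM - 2 * log (n + 1) := by
    intro n hn hny
    have hn0 : (1:ℝ) ≤ n := by exact_mod_cast hn
    have h1 := hP' P hP n hn u hu0
    have hb := bN_pos hβ (show zr < n + 1 by positivity)
    rw [log_mul pz hb.ne', log_mul hD.ne' pz, log_pow] at h1
    have h2 : log n ≤ log y := log_le_log lz lz
    have h3 : log ((n:ℝ) + 1) ≤ log y := log_le_log lz hny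
    push_cast at h1
    linarith
  by_cases hub : u < bbN
  · have hyN : y < N := by
      have h1 := bN_eq hβ (Nat.cast_nonneg (α := ℝ) N)
      have h2 : u ^ β < bbN ^ β := rpow_lt_rpow hu0.le hub hβ0
      have := mul_lt_mul_of_pos_left h2 hbm
      rw [hy]; linarith
    have hf2 : 2 ≤ ⌊y⌋₊ := Nat.le_floor (by exact_mod_cast hy2)
    have hfN : ⌊y⌋₊ < N := (Nat.floor_lt lz).2 hyN
    obtain ⟨n, hn⟩ : ∃ n, ⌊y⌋₊ = n + 1 := ⟨⌊y⌋₊ - 1, oz⟩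
    have hfy : (n:ℝ) + 1 ≤ y := by
      have := Nat.floor_le (show 0 ≤ y by linarith)
      rw [hn] at this; exact_mod_cast this
    have hfy2 : y < n + 1 + 1 := by
      have := Nat.lt_floor_add_one y
      rw [hn] at this; exact_mod_cast this
    refine ⟨n, oz, oz, le_trans ?_ (key n oz hfy)⟩
    have hb := bN_pos hβ (show zr < n + 1 by positivity)
    have hbu : bN β (n + 1) ≤ u := bN_le hβ pz hu0.le (by rw [hy] at hfy; linarith)
    have h1 := log_nonneg ((one_le_div hb).2 hbu)
    have h2 := log_le_log hb hbu
    rw [Psi, if_pos hub, hly]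
    have h3 : m0 β * u ^ β ≤ 2 * n / β + 4 / β := by
      rw [← add_div, le_div_iff₀ hβ0]
      rw [hy] at hfy2; linarith
    have h4 : 0 ≤ 2 * n * log (u / bN β (n + 1)) := pz
    have h5 := abs_nonneg (log (bN β 1))
    nlinarith
  · obtain ⟨n, rfl⟩ : ∃ n, N = n + 1 := ⟨N - 1, oz⟩
    have hN0 : zr < (n:ℝ) + 1 := pz
    have hb := bN_pos hβ hN0
    push_cast at hub ⊢
    have hub' : bN β (n + 1) ≤ u := not_lt.1 hub
    have hNy : (n:ℝ) + 1 ≤ y := by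
      have h1 := bN_eq hβ hN0.le
      have h2 : bN β (n + 1) ^ β ≤ u ^ β := rpow_le_rpow hb.le hub' hβ0.le
      have := mul_le_mul_of_nonneg_left h2 hbm.le
      rw [hy]; linarith
    refine ⟨n, oz, le_rfl, le_trans ?_ (key n oz hNy)⟩
    have h1 : bN β 1 ≤ bN β (n + 1) := le_bN hβ hN0.le (bN_pos hβ one_pos).le
      (by rw [bN_eq hβ zero_le_one]; have := Nat.cast_nonneg (α := ℝ) n; linarith)
    have h2 := log_le_log (bN_pos hβ one_pos) h1
    have h3 := neg_abs_le (log (bN β 1))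
    rw [Psi, if_neg hub, hly, log_div hu0.ne' hb.ne']
    have h4 : 2 * ((n:ℝ) + 1) / β = 2 * n / β + 2 / β := by ring
    have h5 : 4 / β = 2 / β + 2 / β := by ring
    have h6 : 0 < 2 / β := pz
    rw [h4, h5]
    nlinarith
omit hβ
def fS (β σ c x : ℝ) : ℝ := exp (x ^ β) / (√(x + c ^ 2) * xsg)
def rho (P : ℕ → RX) (Q : RX) (δ δ' : ℝ) (N : ℕ) : RX :=
  Q ^ 2 + C δ' + ∑ n ∈ Finset.Ico 1 N, C (δ / ((n:ℝ) + 1) ^ 2) * P n ^ 2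
lemma rho_eval (P : ℕ → RX) (Q : RX) (δ δ' : ℝ) (N : ℕ) (x : ℝ) : (rho P Q δ δ' N).eval x =
    Q.eval x ^ 2 + δ' + ∑ n ∈ Finset.Ico 1 N, δ / ((n:ℝ) + 1) ^ 2 * (P n).eval x ^ 2 := by
  simp [rho, eval_finsetSum]
lemma log_sq_lb {f q d : ℝ} (hf : 0 < f) (hq : 0 ≤ q) (hd : 0 < d) : log f - |f - q| / d ≤ log (q + d) := by
  have h0 : 0 < q + d := lz
  have h1 := log_le_sub_one_of_pos (div_pos hf h0)
  rw [log_div hf.ne' h0.ne'] at h1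
  have h2 : f / (q + d) - 1 ≤ |f - q| / d := by
    rw [div_sub_one h0.ne']
    by_cases h : f - (q + d) ≤ 0
    · exact (div_nonpos_of_nonpos_of_nonneg h h0.le).trans pz
    · push Not at h
      exact div_le_div₀ (abs_nonneg _) ((by linarith : f - (q + d) ≤ f - q).trans (le_abs_self _)) hd lz
  linarith
include hσ
lemma kM_tail_int {R : ℝ} (hR : 0 < R) (a b : ℝ) :
    IntegrableOn (fun u ↦ a + b * log u) (Ioi R) (kM σ) := by
  have hs2 : Ioi R ⊆ Ioi zr := fun x hx ↦ hR.trans hx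
  have := kM_prob hσ
  have h1 : IntegrableOn (fun u ↦ log (u / R)) (Ioi R) (kM σ) :=
    (kM_integrable hσ _ mIoi hs2).2 (kap_tail_log hσ hR).1
  have h2 : IntegrableOn (fun u ↦ (a + b * log R) + b * log (u / R)) (Ioi R) (kM σ) :=
    (icn _).add (h1.const_mul b)
  refine (integrableOn_congr_fun (fun u hu ↦ ?_) mIoi).1 h2
  rw [log_div (hR.trans hu).ne' hR.ne']; ring
omit hσ
include hβ
lemma star_core {s c δ δ' R C1 C2 R0 : ℝ} (hs : 0 < s) (hσ : σ = s ^ 2) (hc : 0 < c)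
    (hδ : 0 < δ) (hδ' : 0 < δ') (hR : R0 ≤ R) (hR4 : 4 ≤ R) (Q : RX)
    (N : ℕ) (hbN : R < bbN) (hP : ONP β P)
    (hlow : ∀ u ≥ R0, ∃ n : ℕ, 1 ≤ n ∧ n + 1 ≤ N ∧ Psi β (bbN) N u - C1 - C2 * log u ≤
      ∫ v, log ((P n).eval uvp ^ 2) ∂arcM - 2 * log (n + 1))
    (hg : Integrable (fun v ↦ (Iic R).indicator (fun x ↦ |fS β σ c x - Q.eval x ^ 2|) (mobI σ v)) arcM) :
    N * eK β (σ / bbN) - log (s + c) - 2 * log (2 * s)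
      - (∫ v, (Iic R).indicator (fun x ↦ |fS β σ c x - Q.eval x ^ 2|) (mobI σ v) ∂arcM) / δ'
      - ∫ u in Ioi R, (C1 - log δ) + C2 * log u ∂(kM σ)
      ≤ ∫ v, log ((rho P Q δ δ' N).eval (mobI σ v)) ∂arcM := by
  have hσ0 : 0 < σ := by rw [hσ]; positivity
  have hβ0 : 0 < β := lz
  have hR0 : 0 < R := lz
  have hb0 : 0 < bbN := hR0.trans hbN
  have := kM_prob hσ0
  set ρ := rho P Q δ δ' N with hρ
  have hsum : ∀ x, 0 ≤ ∑ n ∈ Finset.Ico 1 N, δ / ((n:ℝ) + 1) ^ 2 * (P n).eval x ^ 2 :=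
    fun x ↦ Finset.sum_nonneg fun n _ ↦ by positivity
  have hρ0 : ∀ x, 0 < ρ.eval x := fun x ↦ by
    rw [hρ, rho_eval]; have := hsum x; positivity
  have hρm : Measurable (fun x ↦ log (ρ.eval x)) := measurable_log.comp ρ.continuous.measurable
  obtain ⟨-, -, -, -, -, hLi, -⟩ := lukacs hs hσ ρ fun x _ ↦ hρ0 x
  obtain ⟨l1, l2, l3⟩ := kM_ton hσ0 hρm hLi
  set g := (Iic R).indicator (fun x ↦ |fS β σ c x - Q.eval x ^ 2|) with hgd
  have hgm : Measurable g := by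
    refine Measurable.indicator ?_ measurableSet_Iic
    have := Q.continuous.measurable
    unfold fS; fun_prop
  have hg0 : ∀ x, 0 ≤ g x := fun x ↦ Set.indicator_nonneg (fun _ _ ↦ abs_nonneg _) x
  obtain ⟨g1, g2, g3⟩ := kM_ton hσ0 hgm hg
  have hmob : ∀ v ∈ J01, 0 < mobI σ v := fun v hv ↦ by
    rw [mobI]; have := hv.1; have : 0 < 1 - v := by linarith [hv.2]
    positivity
  have nrm : ∀ d : ℝ, 0 ≤ d → Integrable (fun v ↦ log (mobI σ v + d ^ 2)) arcM ∧
      ∫ v, log (mobI σ v + d ^ 2) ∂arcM = 2 * log (s + d) := by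
    intro d hd
    obtain ⟨h1, h2⟩ := mobI_log hs hσ (d : ℂ) (by simpa using hd)
    have e : (fun v ↦ log ‖(mobI σ v : ℂ) + (d:ℂ) ^ 2‖) =ᵐ[arcM] fun v ↦ log (mobI σ v + d ^ 2) := by
      filter_upwards [arc_ae] with v hv
      have := hmob v hv
      rw [show (mobI σ v : ℂ) + (d:ℂ) ^ 2 = ((mobI σ v + d ^ 2 : ℝ) : ℂ) by push_cast; rfl, norm_real,
        norm_eq_abs, abs_of_pos pz]
    refine ⟨h1.congr e, ?_⟩
    rw [← icae e, h2, ← ofReal_add, norm_real, norm_eq_abs,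
      abs_of_pos pz]
  obtain ⟨n1, n2⟩ := nrm c hc.le
  obtain ⟨n3, n4⟩ := nrm s hs.le
  rw [← hσ] at n3 n4
  set f1 : ℝ → ℝ := fun x ↦ 1/2 * log (x + c ^ 2) + log xsg with hf1
  have f1i : Integrable (fun v ↦ f1 (mobI σ v)) arcM := (n1.const_mul (hlf)).add n3
  have f1e : ∫ v, f1 (mobI σ v) ∂arcM = log (s + c) + 2 * log (2 * s) := by
    simp only [hf1]
    rw [iad (n1.const_mul (hlf)) n3, icm, n2, n4, ← two_mul]; ring
  obtain ⟨k1, k2, k3⟩ := kM_ton hσ0 (by fun_prop : Measurable f1) f1i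
  obtain ⟨p1, p2⟩ := Psi_int hβ hσ0 hb0 (bN_eq hβ (Nat.cast_nonneg N))
  have ti := kM_tail_int hσ0 hR0 (C1 - log δ) C2
  set T := (Ioi R).indicator (fun u ↦ (C1 - log δ) + C2 * log u)
  have ti' : Integrable T (kM σ) := (integrable_indicator_iff mIoi).2 ti
  have key : ∀ᵐ u ∂(kM σ), Psi β (bbN) N u - (∫ v, f1 uvp ∂arcM) - (∫ v, g uvp ∂arcM) / δ' - T u ≤
      ∫ v, log (ρ.eval uvp) ∂arcM := by
    filter_upwards [kM_ae σ, l3, g3, k3] with u hu0 m1 m2 m3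
    have hgi : 0 ≤ (∫ v, g uvp ∂arcM) / δ' := div_nonneg (integral_nonneg fun v ↦ hg0 _) hδ'.le
    rcases le_or_gt u R with hu | hu
    · have hT : T u = 0 := indicator_of_notMem (by simpa using hu) _
      rw [hT, sub_zero, Psi, if_pos (hu.trans_lt hbN)]
      have e1 : m0 β * u ^ β = ∫ v, u ^ β * v ^ β ∂arcM := by rw [icm, m0, mul_comm]
      have i1 : Integrable (fun v : ℝ ↦ u ^ β * v ^ β) arcM := (arc_rpow lz).1.const_mul _
      have i2 : Integrable (fun v ↦ u ^ β * v ^ β - f1 uvp) arcM := i1.sub m3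
      rw [e1, ← integral_sub i1 m3, ← integral_div, ← integral_sub i2 (m2.div_const _)]
      refine integral_mono_ae (i2.sub (m2.div_const _)) m1 ?_
      filter_upwards [arc_ae] with v hv
      have hx : 0 < u * v := mul_pos hu0 hv.1
      have hxR : u * v ≤ R := by nlinarith [hv.1, hv.2]
      have e2 : g uvp = |fS β σ c uvp - Q.eval uvp ^ 2| := indicator_of_mem (by simpa using hxR) _
      have hf : 0 < fS β σ c uvp := by unfold fS; positivity
      have e3 : log (fS β σ c uvp) = u ^ β * v ^ β - f1 uvp := by
        rw [fS, log_div pz pz, log_mul pz pz, log_exp,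
          log_sqrt pz, mul_rpow hu0.le hv.1.le]
        simp only [hf1]; ring
      show u ^ β * v ^ β - f1 uvp - g uvp / δ' ≤ _
      rw [← e3, e2]
      refine (log_sq_lb hf (sq_nonneg _) hδ').trans (log_le_log pz ?_)
      rw [hρ, rho_eval]; linarith [hsum uvp]
    · have hT : T u = (C1 - log δ) + C2 * log u := indicator_of_mem (by simpa using hu) _
      obtain ⟨n, hn1, hn2, hn3⟩ := hlow u (hR.trans hu.le)
      obtain ⟨q1, q2, -⟩ := poly_arc (onp_ne0 hP n) hu0
      have hF : 0 ≤ ∫ v, f1 uvp ∂arcM := by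
        have b1 := arc_log_real_intble 0
        have b2 := arc_log_real 0 sz
        simp only [sub_zero, abs_zero, sqrt_zero, zero_sub, abs_neg, abs_one, sqrt_one, zero_add, log_one, mul_zero] at b1 b2
        have b3 : Integrable (fun v : ℝ ↦ 3/2 * (log u + log |v|)) arcM := ((icn _).add b1).const_mul _
        have b4 : ∫ v, 3/2 * (log u + log |v|) ∂arcM = 3/2 * (log u - log 4) := by
          rw [icm, iad (icn _) b1, b2]; simp; ring
        have b5 : log 4 ≤ log u := log_le_log nz lz
        refine le_trans ?_ (b4 ▸ integral_mono_ae b3 m3 ?_)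
        · linarith
        · filter_upwards [arc_ae] with v hv
          have hv0 := hv.1
          have := mul_pos hu0 hv0
          rw [abs_of_pos hv0, ← log_mul hu0.ne' hv0.ne']
          have a1 : log uvp ≤ log (u * v + c ^ 2) := log_le_log this (by linarith [sq_nonneg c])
          have a2 : log uvp ≤ log (u * v + σ) := log_le_log this lz
          simp only [hf1]; linarith
      have hlb : ∫ v, log ((P n).eval uvp ^ 2) ∂arcM + (log δ - 2 * log (n + 1)) ≤ ∫ v, log (ρ.eval uvp) ∂arcM := by
        have i0 : Integrable (fun v ↦ log ((P n).eval uvp ^ 2) + (log δ - 2 * log ((n:ℝ) + 1))) arcM :=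
          q2.add (icn _)
        have e : ∫ v, log ((P n).eval uvp ^ 2) ∂arcM + (log δ - 2 * log (n + 1)) =
          ∫ v, log ((P n).eval uvp ^ 2) + (log δ - 2 * log ((n:ℝ) + 1)) ∂arcM := by
          rw [iad q2 (icn _)]; simp
        rw [e]
        refine integral_mono_ae i0 m1 ?_
        filter_upwards [q1] with v hv
        have h1 : log ((P n).eval uvp ^ 2) + (log δ - 2 * log ((n:ℝ) + 1)) =
            log (δ / ((n:ℝ) + 1) ^ 2 * (P n).eval uvp ^ 2) := by
          rw [log_mul pz pz, log_div hδ.ne' pz, log_pow ((n:ℝ) + 1)]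
          push_cast; ring
        show log ((P n).eval uvp ^ 2) + (log δ - 2 * log ((n:ℝ) + 1)) ≤ _
        rw [h1]
        refine log_le_log pz ?_
        rw [hρ, rho_eval]
        have h2 := Finset.single_le_sum (f := fun n : ℕ ↦ δ / ((n:ℝ) + 1) ^ 2 * (P n).eval uvp ^ 2)
          (fun i _ ↦ by positivity) (Finset.mem_Ico.2 ⟨hn1, hn2⟩)
        have h3 := sq_nonneg (Q.eval uvp)
        linarith
      rw [hT]
      linarith
  rw [l2]
  have i1 : Integrable (fun u ↦ Psi β (bbN) N u - (∫ v, f1 uvp ∂arcM)) (kM σ) := p1.sub k1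
  have i2 : Integrable (fun u ↦ Psi β (bbN) N u - (∫ v, f1 uvp ∂arcM) - (∫ v, g uvp ∂arcM) / δ') (kM σ) :=
    i1.sub (g1.div_const _)
  refine le_trans (le_of_eq ?_) (integral_mono_ae (i2.sub ti') l1 key)
  have e := integral_sub i2 ti'
  rw [integral_sub i1 (g1.div_const _), integral_sub p1 k1, p2, ← k2, f1e, integral_div, ← g2,
    integral_indicator mIoi] at e
  refine Eq.trans ?_ e.symm
  ring
omit hβ
def qw (x : ℝ) : ℝ := x ^ zr + x ^ (-(hlf) : ℝ)
lemma qw_nonneg {x : ℝ} (hx : 0 < x) : 0 ≤ qw x := by unfold qw; positivity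
include hβ
lemma qw_int (a c : ℝ) : Integrable (fun x ↦ a * exp (c * √x) * qw x) wB := by
  have h1 := wM_int hβ (a := 0) c nz
  have h2 := wM_int hβ (a := -(hlf)) c nz
  refine ((h1.add h2).const_mul a).congr (ae_of_all _ fun x ↦ ?_)
  simp only [qw, Pi.add_apply]; ring
omit hβ
def cosT (ξ : ℝ) (K : ℕ) : RX :=
  ∑ k ∈ range K, C ((-1) ^ k * ξ ^ (2 * k) / (2 * k).factorial) * X ^ k
lemma cosT_eval (ξ : ℝ) (K : ℕ) {x : ℝ} (hx : 0 ≤ x) : (cosT ξ K).eval x =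
    ∑ k ∈ range K, (-1) ^ k * (ξ * √x) ^ (2 * k) / (2 * k).factorial := by
  rw [cosT, eval_finsetSum]
  refine sum_congr rfl fun k _ ↦ ?_
  rw [eval_mul, eval_C, eval_pow, eval_X, mul_pow, pow_mul (√x), sq_sqrt hx]; ring
lemma cosT_lim (ξ : ℝ) {x : ℝ} (hx : 0 ≤ x) : Tendsto (fun K ↦ (cosT ξ K).eval x) atTop (𝓝 (cos (ξ * √x))) := by
  simp only [cosT_eval ξ _ hx]
  exact (Real.hasSum_cos (ξ * √x)).tendsto_sum_nat
lemma cosT_le {ξ : ℝ} (hξ : 0 ≤ ξ) (K : ℕ) {x : ℝ} (hx : 0 ≤ x) : |(cosT ξ K).eval x| ≤ exp (ξ * √x) := by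
  rw [cosT_eval ξ _ hx]
  have h1 := sum_le_hasSum (range K) (fun i _ ↦ by positivity) (Real.hasSum_cosh (ξ * √x))
  refine (Finset.abs_sum_le_sum_abs _ _).trans ((Finset.sum_le_sum fun k _ ↦ ?_).trans (h1.trans ?_))
  · rw [abs_div, abs_mul, abs_pow, abs_neg, abs_one, one_pow, one_mul, abs_of_nonneg pz,
      abs_of_nonneg pz]
  · rw [cosh_eq]
    have : exp (-(ξ * √x)) ≤ exp (ξ * √x) := exp_le_exp.2 (by have : 0 ≤ ξ * √x := pz
                                                              linarith)
    linarith
lemma poly_bd (h : RX) : ∃ A : ℝ, 0 ≤ A ∧ ∀ y E : ℝ, 1 ≤ E → |y| ≤ E → |h.eval y| ≤ A * E ^ h.natDegree := by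
  refine ⟨∑ i ∈ range (h.natDegree + 1), |h.coeff i|, pz, fun y E hE hy ↦ ?_⟩
  rw [eval_eq_sum_range, Finset.sum_mul]
  refine (Finset.abs_sum_le_sum_abs _ _).trans (Finset.sum_le_sum fun i hi ↦ ?_)
  rw [abs_mul, abs_pow]
  refine mul_le_mul_of_nonneg_left ?_ (abs_nonneg _)
  exact (pow_le_pow_left₀ (abs_nonneg _) hy i).trans (pow_le_pow_right₀ hE (by simp at hi; omega))
include hβ
lemma dens {h0 : ℝ → ℝ} (hc : Continuous h0) {M A : ℝ} (hM : ∀ x, |h0 x| ≤ M)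
    (hA : ∀ x ≥ A, h0 x = 0) {ε : ℝ} (hε : 0 < ε) :
    ∃ Q : RX, ∫ x, (Q.eval x - h0 x) ^ 2 * qw x ∂wB < ε := by
  have hM0 : 0 ≤ M := (abs_nonneg _).trans (hM 0)
  have iq : Integrable qw wB := (qw_int hβ 1 0).congr (ae_of_all _ fun x ↦ by simp)
  have hnn : 0 ≤ ∫ x, qw x ∂wB := integral_nonneg_of_ae ((wM_ae β).mono fun x hx ↦ qw_nonneg hx)
  have htail : Tendsto (fun L : ℝ ↦ ∫ x in Ioi (L ^ 2), qw x ∂wB) atTop (𝓝 0) := by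
    have h1 := tendsto_setIntegral_of_antitone (μ := wM β) (f := qw) (s := fun L : ℝ ↦ Ioi L)
      (fun _ ↦ mIoi) (fun a b hab ↦ Set.Ioi_subset_Ioi hab) ⟨0, iq.integrableOn⟩
    have h2 : ⋂ n : ℝ, Ioi n = ∅ := by
      ext x; simp only [Set.mem_iInter, Set.mem_Ioi, Set.mem_empty_iff_false, iff_false, not_forall, not_lt]
      exact ⟨x, le_rfl⟩
    rw [h2, setIntegral_empty] at h1
    exact h1.comp (tendsto_pow_atTop two_ne_zero)
  set J := ∫ x, qw x ∂wB
  obtain ⟨η, hη, hη1, hηJ⟩ : ∃ η > 0, η ≤ 1 ∧ η ^ 2 * J < ε / 2 := by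
    refine ⟨min 1 (ε / (4 * (J + 1))), pz, min_le_left _ _, ?_⟩
    have a := min_le_left 1 (ε / (4 * (J + 1)))
    have b := min_le_right 1 (ε / (4 * (J + 1)))
    have c : 0 < min 1 (ε / (4 * (J + 1))) := pz
    rw [le_div_iff₀ pz] at b
    nlinarith
  obtain ⟨L, hL1, hLA, hLt⟩ : ∃ L : ℝ, 1 ≤ L ∧ A ≤ L ^ 2 ∧ (M + 1) ^ 2 * ∫ x in Ioi (L ^ 2), qw x ∂wB < ε / 2 := by
    have h1 := (htail.const_mul ((M + 1) ^ 2))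
    rw [mul_zero] at h1
    obtain ⟨L, h1, h2, h3⟩ := ((eventually_ge_atTop (1:ℝ)).and (((tendsto_pow_atTop (two_ne_zero)).eventually_ge_atTop A).and
      (h1.eventually (gt_mem_nhds (half_pos hε))))).exists
    exact ⟨L, h1, h2, h3⟩
  set ξ := π / L
  have hL0 : 0 < L := lz
  have hξ : 0 < ξ := pz
  obtain ⟨h, hh⟩ := exists_polynomial_near_of_continuousOn (-1) 1 (fun y ↦ h0 ((arccos y / ξ) ^ 2))
    (hc.comp (by have := continuous_arccos; fun_prop)).continuousOn η hη
  have hcosb : ∀ x : ℝ, |h.eval (cos (ξ * √x))| ≤ M + 1 := fun x ↦ by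
    have h1 := (hh (cos (ξ * √x)) ⟨neg_one_le_cos _, cos_le_one _⟩).le
    have h2 := hM ((arccos (cos (ξ * √x)) / ξ) ^ 2)
    have h3 := abs_add_le (h.eval (cos (ξ * √x)) - h0 ((arccos (cos (ξ * √x)) / ξ) ^ 2)) (h0 ((arccos (cos (ξ * √x)) / ξ) ^ 2))
    rw [sub_add_cancel] at h3
    linarith
  have hnear : ∀ x : ℝ, 0 < x → x ≤ L ^ 2 → |h.eval (cos (ξ * √x)) - h0 x| ≤ η := fun x hx hxL ↦ by
    have h1 := (hh (cos (ξ * √x)) ⟨neg_one_le_cos _, cos_le_one _⟩).le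
    have h2 : ξ * √x ≤ π := by
      have : √x ≤ L := sqrt_le_left hL0.le |>.2 hxL
      calc ξ * √x ≤ ξ * L := by gcongr
        _ = π := by simp only [ξ]; field_simp
    rw [arccos_cos pz h2, mul_div_cancel_left₀ _ hξ.ne', sq_sqrt hx.le] at h1
    exact h1
  obtain ⟨B, hB, hBd⟩ := poly_bd h
  have hdom : ∀ (K : ℕ) (x : ℝ), 0 < x → ‖((h.comp (cosT ξ K)).eval x - h0 x) ^ 2 * qw x‖ ≤
      (B + M) ^ 2 * exp ((2 * h.natDegree * ξ) * √x) * qw x := by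
    intro K x hx
    have hq := qw_nonneg hx
    rw [norm_mul, norm_pow, norm_eq_abs, norm_eq_abs, abs_of_nonneg hq]
    refine mul_le_mul_of_nonneg_right ?_ hq
    have h1 : 1 ≤ exp (ξ * √x) := one_le_exp pz
    have h2 := hBd _ _ h1 (cosT_le hξ.le K hx.le)
    rw [eval_comp]
    have h3 : (1:ℝ) ≤ exp (ξ * √x) ^ h.natDegree := one_le_pow₀ h1
    have h4 : |eval (eval x (cosT ξ K)) h - h0 x| ≤ (B + M) * exp (ξ * √x) ^ h.natDegree := by
      refine (abs_sub _ _).trans ?_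
      have := hM x
      nlinarith
    calc _ ≤ ((B + M) * exp (ξ * √x) ^ h.natDegree) ^ 2 := pow_le_pow_left₀ (abs_nonneg _) h4 2
      _ = _ := by rw [mul_pow, ← pow_mul, ← exp_nat_mul]; push_cast; ring_nf
  have hq : Measurable qw := by unfold qw; fun_prop
  have hlim := tendsto_integral_of_dominated_convergence (μ := wM β)
    (F := fun K x ↦ ((h.comp (cosT ξ K)).eval x - h0 x) ^ 2 * qw x)
    (f := fun x ↦ (h.eval (cos (ξ * √x)) - h0 x) ^ 2 * qw x) _
    (fun K ↦ mas (by
      have := (h.comp (cosT ξ K)).continuous.measurable; have := hc.measurable; fun_prop))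
    (qw_int hβ ((B + M) ^ 2) (2 * h.natDegree * ξ)) (fun K ↦ (wM_ae β).mono fun x hx ↦ hdom K x hx)
    ((wM_ae β).mono fun x hx ↦ by
      simp only [eval_comp]
      exact (((h.continuous.tendsto _).comp (cosT_lim ξ hx.le)).sub_const _).pow 2 |>.mul_const _)
  have hlt : ∫ x, (h.eval (cos (ξ * √x)) - h0 x) ^ 2 * qw x ∂wB < ε := by
    have i1 : Integrable (fun x ↦ η ^ 2 * qw x) wB := iq.const_mul _
    have i2 : Integrable ((Ioi (L ^ 2)).indicator (fun x ↦ (M + 1) ^ 2 * qw x)) wB :=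
      (iq.const_mul _).indicator mIoi
    have : ∫ x, (h.eval (cos (ξ * √x)) - h0 x) ^ 2 * qw x ∂wB ≤
        ∫ x, η ^ 2 * qw x + (Ioi (L ^ 2)).indicator (fun x ↦ (M + 1) ^ 2 * qw x) x ∂wB := by
      refine integral_mono_of_nonneg ((wM_ae β).mono fun x hx ↦ mul_nonneg (sq_nonneg _) (qw_nonneg hx)) (i1.add i2)
        ((wM_ae β).mono fun x hx ↦ ?_)
      have hq := qw_nonneg hx
      show (h.eval (cos (ξ * √x)) - h0 x) ^ 2 * qw x ≤ η ^ 2 * qw x + (Ioi (L ^ 2)).indicator (fun x ↦ (M + 1) ^ 2 * qw x) x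
      rw [← sq_abs]
      rcases le_or_gt x (L ^ 2) with hxl | hxl
      · rw [indicator_of_notMem (s := Ioi (L ^ 2)) (by simpa using hxl), add_zero]
        exact mul_le_mul_of_nonneg_right (pow_le_pow_left₀ (abs_nonneg _) (hnear x hx hxl) 2) hq
      · rw [indicator_of_mem (s := Ioi (L ^ 2)) (by simpa using hxl), hA x (hLA.trans hxl.le), sub_zero]
        have := mul_le_mul_of_nonneg_right (pow_le_pow_left₀ (abs_nonneg _) (hcosb x) 2) hq
        have h3 : 0 ≤ η ^ 2 * qw x := pz
        linarith
    rw [iad i1 i2, icm, integral_indicator mIoi, icm] at this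
    linarith
  obtain ⟨K, hK⟩ := (hlim.eventually (gt_mem_nhds hlt)).exists
  exact ⟨h.comp (cosT ξ K), hK⟩
omit hβ
def md (σ x : ℝ) : ℝ := √σ / (π * xsg * √x)
lemma md_meas (σ : ℝ) : Measurable (md σ) := by unfold md; fun_prop
include hσ
lemma md_nonneg {x : ℝ} (hx : 0 < x) : 0 ≤ md σ x := by unfold md; positivity
lemma mobI_map : arcM.map (mobI σ) =
    (volume.restrict (Ioi zr)).withDensity (fun x ↦ ofReal (md σ x)) := by
  refine Measure.ext_of_lintegral _ fun f hf ↦ ?_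
  rw [lintegral_map hf (mobI_meas σ), mobI_law hσ f hf, lintegral_withDensity_eq_lintegral_mul _
    (md_meas σ).ennreal_ofReal hf]
  rfl
lemma mobI_int {g : ℝ → ℝ} (hg : Measurable g) :
    (Integrable (fun v ↦ g (mobI σ v)) arcM ↔ IntegrableOn (fun x ↦ md σ x * g x) (Ioi 0)) ∧
    ∫ v, g (mobI σ v) ∂arcM = ∫ x in Ioi zr, md σ x * g x := by
  have hm := (md_meas σ).ennreal_ofReal
  have hr : ∀ᵐ x ∂(volume.restrict (Ioi zr)), (ofReal (md σ x)).toReal • g x = md σ x * g x :=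
    (ae_restrict_mem mIoi).mono fun x hx ↦ by
      rw [toReal_ofReal (md_nonneg hσ hx), smul_eq_mul]
  have h1 : Integrable (fun v ↦ g (mobI σ v)) arcM ↔ Integrable g (arcM.map (mobI σ)) :=
    (integrable_map_measure hg.aestronglyMeasurable (mobI_meas σ).aemeasurable).symm
  have h2 : ∫ v, g (mobI σ v) ∂arcM = ∫ x, g x ∂(arcM.map (mobI σ)) :=
    (integral_map (mobI_meas σ).aemeasurable hg.aestronglyMeasurable).symm
  rw [h1, h2, mobI_map hσ]
  constructor
  · rw [integrable_withDensity_iff_integrable_smul' hm (ae_of_all _ fun _ ↦ ofReal_lt_top)]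
    exact integrable_congr hr
  · rw [integral_withDensity_eq_integral_toReal_smul hm (ae_of_all _ fun _ ↦ ofReal_lt_top)]
    exact icae hr
lemma md_one : IntegrableOn (md σ) (Ioi 0) ∧ ∫ x in Ioi zr, md σ x = 1 := by
  have h := mobI_int hσ (g := fun _ ↦ (1:ℝ)) measurable_const
  simp only [mul_one] at h
  exact ⟨h.1.1 (icn _), by rw [← h.2]; simp⟩
omit hσ
lemma fS_le {s c x : ℝ} (hs : 0 < s) (hσ : σ = s ^ 2) (hx : 0 < x) :
    0 ≤ fS β σ c x ∧ fS β σ c x * exp (-(x ^ β)) ≤ π / s * md σ x := by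
  have hσ0 : 0 < σ := by rw [hσ]; positivity
  have hq : 0 < √x := sqrt_pos.2 hx
  have hq2 : √x ≤ √(x + c ^ 2) := sqrt_le_sqrt (by nlinarith)
  have he : √σ = s := by rw [hσ, sqrt_sq hs.le]
  refine ⟨by unfold fS; positivity, ?_⟩
  rw [fS, md, he, div_mul_eq_mul_div, ← exp_add, add_neg_cancel, exp_zero]
  have : π / s * (s / (π * xsg * √x)) = 1 / (√x * xsg) := by
    have := pi_pos; field_simp
  rw [this]
  gcongr
include hβ
lemma dens_int {h0 : ℝ → ℝ} (hh0c : Continuous h0) {M : ℝ} (hM : ∀ x, |h0 x| ≤ M) (Q : RX) :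
    Integrable (fun x ↦ (Q.eval x - h0 x) ^ 2 * qw x) wB := by
  have hqm : Measurable qw := by unfold qw; fun_prop
  obtain ⟨B, hB, hBd⟩ := poly_bd Q
  refine (qw_int hβ (2 * B ^ 2 + 2 * M ^ 2) (4 * Q.natDegree)).mono' (by
    have := hh0c.measurable; have := Q.continuous.measurable
    exact mas fz) ((wM_ae β).mono fun x hx ↦ ?_)
  rw [nonn (mul_nonneg (sq_nonneg _) (qw_nonneg hx))]
  refine mul_le_mul_of_nonneg_right ?_ (qw_nonneg hx)
  have h1 : |x| ≤ exp (2 * √x) := by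
    rw [abs_of_pos hx, two_mul, exp_add]
    have := add_one_le_exp √x
    have h2 := sqrt_nonneg x
    nlinarith [mul_self_sqrt hx.le]
  have h2 := hBd x _ (one_le_exp pz) h1
  have h3 : exp (2 * √x) ^ Q.natDegree = exp (2 * Q.natDegree * √x) := by rw [← exp_nat_mul]; ring_nf
  have h4 : exp (4 * Q.natDegree * √x) = exp (2 * Q.natDegree * √x) ^ 2 := by rw [← exp_nat_mul]; push_cast; ring_nf
  have h5 : 1 ≤ exp (2 * Q.natDegree * √x) := one_le_exp pz
  rw [h3] at h2
  have h6 := pow_le_pow_left₀ (abs_nonneg _) h2 2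
  have h7 := pow_le_pow_left₀ (abs_nonneg _) (hM x) 2
  rw [sq_abs] at h6 h7
  rw [h4]
  nlinarith [sq_nonneg (Q.eval x + h0 x), sq_nonneg M, mul_self_nonneg (exp (2 * Q.natDegree * √x) - 1)]
omit hβ
lemma abs_sq_sub {η : ℝ} (hη : 0 < η) : ∀ q h : ℝ, |h ^ 2 - q ^ 2| ≤ (1 + 1 / η) * (q - h) ^ 2 + η * h ^ 2 := by
  intro q h
  have h1 : 2 * |q - h| * |h| ≤ 1 / η * (q - h) ^ 2 + η * h ^ 2 := by
    have := sq_nonneg (|q - h| - η * |h|)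
    rw [← sq_abs (q - h), ← sq_abs h]
    rw [← mul_le_mul_iff_right₀ hη]
    field_simp; nlinarith
  have h2 : h ^ 2 - q ^ 2 = -((q - h) * (q - h) + 2 * (q - h) * h) := by ring
  rw [h2, abs_neg]
  calc _ ≤ |(q-h)*(q-h)| + |2 * (q - h) * h| := abs_add_le _ _
    _ = (q - h) ^ 2 + 2 * |q - h| * |h| := by rw [abs_mul_self, abs_mul, abs_mul, abs_two]; ring
    _ ≤ _ := lz
include hβ
lemma starQ {s c R ε : ℝ} (hs : 0 < s) (hσ : σ = s ^ 2) (hc : 0 < c) (hR : 0 < R)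
    (hε : 0 < ε) : ∃ Q : RX, ∫ x, Q.eval x ^ 2 ∂wB ≤ π / s + ε ∧
      Integrable (fun v ↦ (Iic R).indicator (fun x ↦ |fS β σ c x - Q.eval x ^ 2|) (mobI σ v)) arcM ∧
      ∫ v, (Iic R).indicator (fun x ↦ |fS β σ c x - Q.eval x ^ 2|) (mobI σ v) ∂arcM ≤ ε := by
  have hσ0 : 0 < σ := by rw [hσ]; positivity
  have hβ0 : 0 < β := lz
  have hπ := pi_pos
  have he : √σ = s := by rw [hσ, sqrt_sq hs.le]
  set χ : ℝ → ℝ := fun x ↦ max 0 (min 1 (R + 1 - |x|)) with hχ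
  have hχ0 : ∀ x, 0 ≤ χ x := fun x ↦ le_max_left _ _
  have hχ1 : ∀ x, χ x ≤ 1 := fun x ↦ max_le zero_le_one (min_le_left _ _)
  set h0 : ℝ → ℝ := fun x ↦ √(fS β σ c |x|) * χ x with hh0
  have hh0c : Continuous h0 := by
    simp only [hh0, hχ, fS]
    have : ∀ x : ℝ, √(|x| + c ^ 2) * (|x| + σ) ≠ 0 := fun x ↦ by positivity
    have h2 : Continuous fun x : ℝ ↦ |x| ^ β := continuous_abs.rpow_const fun x ↦ Or.inr hβ0.le
    fun_prop (disch := assumption)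
  have hA : ∀ x ≥ R + 1, h0 x = 0 := fun x hx ↦ by
    simp only [hh0, hχ]
    rw [abs_of_pos lz, max_eq_left (by rw [min_le_iff]; right; linarith), mul_zero]
  obtain ⟨M, hM⟩ : ∃ M, ∀ x, |h0 x| ≤ M := by
    obtain ⟨M, hM⟩ := (isCompact_Icc (a := -(R+1)) (b := R+1)).exists_bound_of_continuousOn hh0c.continuousOn
    refine ⟨max M 0, fun x ↦ ?_⟩
    by_cases hx : x ∈ Icc (-(R+1)) (R+1)
    · exact (hM x hx).trans (le_max_left _ _)
    · have : χ x = 0 := by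
        simp only [hχ]
        refine max_eq_left ?_
        rw [min_le_iff]; right
        rw [Set.mem_Icc, ← abs_le] at hx; push Not at hx; linarith
      simp only [hh0, this]; simp
  have hsq : ∀ x > 0, h0 x ^ 2 ≤ fS β σ c x := fun x hx ↦ by
    have h1 := (fS_le (β := β) (c := c) hs hσ hx).1
    simp only [hh0]; rw [abs_of_pos hx, mul_pow, sq_sqrt h1]
    exact mul_le_of_le_one_right h1 (pow_le_one₀ (hχ0 x) (hχ1 x))
  have hsq1 : ∀ x > 0, x ≤ R → h0 x ^ 2 = fS β σ c x := fun x hx hxR ↦ by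
    have h1 := (fS_le (β := β) (c := c) hs hσ hx).1
    have : χ x = 1 := by
      simp only [hχ]; rw [abs_of_pos hx, min_eq_left lz]; simp
    simp only [hh0]; rw [this, abs_of_pos hx, mul_one, sq_sqrt h1]
  have iq : Integrable qw wB := (qw_int hβ 1 0).congr (ae_of_all _ fun x ↦ by simp)
  have hqm : Measurable qw := by unfold qw; fun_prop
  have ihq : Integrable (fun x ↦ h0 x ^ 2 * qw x) wB := by
    refine (iq.const_mul (M ^ 2)).mono' (by have := hh0c.measurable; exact mas fz) ((wM_ae β).mono fun x hx ↦ ?_)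
    rw [nonn (mul_nonneg (sq_nonneg _) (qw_nonneg hx)), ← sq_abs]
    exact mul_le_mul_of_nonneg_right (pow_le_pow_left₀ (abs_nonneg _) (hM x) 2) (qw_nonneg hx)
  set W := ∫ x, h0 x ^ 2 * qw x ∂wB with hW
  have hW0 : 0 ≤ W := integral_nonneg_of_ae ((wM_ae β).mono fun x hx ↦ mul_nonneg (sq_nonneg _) (qw_nonneg hx))
  set K := exp (R ^ β) / (π * s) with hK
  have hK0 : 0 < K := pz
  obtain ⟨η, hη, hη1⟩ : ∃ η > 0, η * ((K + 1) * (W + 1) + 1) ≤ ε / 2 :=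
    ⟨ε / 2 / ((K + 1) * (W + 1) + 1), pz, by field_simp; rfl⟩
  have hη2 : η * (K * W) ≤ ε / 2 := hη1.trans' (by gcongr; nlinarith)
  have hη3 : η * W ≤ ε / 2 := hη1.trans' (by gcongr; nlinarith)
  obtain ⟨Q, hQ⟩ := dens hβ hh0c hM hA (ε := ε / 2 / ((K + 1) * (1 + 1 / η))) pz
  set D := ∫ x, (Q.eval x - h0 x) ^ 2 * qw x ∂wB with hD
  have hD0 : 0 ≤ D := integral_nonneg_of_ae ((wM_ae β).mono fun x hx ↦ mul_nonneg (sq_nonneg _) (qw_nonneg hx))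
  have hDK : (K + 1) * ((1 + 1 / η) * D) ≤ ε / 2 := by
    rw [lt_div_iff₀ pz] at hQ; linarith
  have h1η : 0 ≤ (1 + 1 / η) * D := pz
  have idq : Integrable (fun x ↦ (Q.eval x - h0 x) ^ 2 * qw x) wB :=
    dens_int hβ hh0c hM Q
  have hqw1 : ∀ x > 0, 1 ≤ qw x := fun x hx ↦ by
    have := rpow_nonneg hx.le (-(hlf))
    unfold qw; rw [rpow_zero]; linarith
  have key := abs_sq_sub hη
  have ikey : Integrable (fun x ↦ (1 + 1 / η) * ((Q.eval x - h0 x) ^ 2 * qw x) + η * (h0 x ^ 2 * qw x)) wB :=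
    (idq.const_mul _).add (ihq.const_mul _)
  have Ikey : ∫ x, (1 + 1 / η) * ((Q.eval x - h0 x) ^ 2 * qw x) + η * (h0 x ^ 2 * qw x) ∂wB =
      (1 + 1 / η) * D + η * W := by
    rw [iad (idq.const_mul _) (ihq.const_mul _), icm, icm]
  have iH : Integrable (fun x ↦ h0 x ^ 2) wB :=
    ihq.mono' (hh0c.pow 2).aestronglyMeasurable ((wM_ae β).mono fun x hx ↦ by
      rw [nonn (sq_nonneg _)]; nlinarith [hqw1 x hx, sq_nonneg (h0 x)])
  have IH : ∫ x, h0 x ^ 2 ∂wB ≤ π / s := by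
    have e : π / s = ∫ x in Ioi zr, π / s * md σ x := by
      rw [icm, (md_one hσ0).2, mul_one]
    rw [e, wM_integral]
    refine setIntegral_mono_on ((wM_integrable _ _).1 iH) ((md_one hσ0).1.const_mul _) mIoi fun x hx ↦ ?_
    exact (mul_le_mul_of_nonneg_right (hsq x hx) (exp_pos _).le).trans (fS_le hs hσ hx).2
  refine ⟨Q, ?_, ?_⟩
  · have : ∫ x, Q.eval x ^ 2 ∂wB ≤ ∫ x, h0 x ^ 2 + ((1 + 1 / η) * ((Q.eval x - h0 x) ^ 2 * qw x) + η * (h0 x ^ 2 * qw x)) ∂wB := by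
      refine integral_mono_ae (wM_psq hβ Q) (iH.add ikey) ((wM_ae β).mono fun x hx ↦ ?_)
      show Q.eval x ^ 2 ≤ h0 x ^ 2 + ((1 + 1 / η) * ((Q.eval x - h0 x) ^ 2 * qw x) + η * (h0 x ^ 2 * qw x))
      have h1 := (neg_le_abs _).trans (key (Q.eval x) (h0 x))
      have h2 := hqw1 x hx
      have h3 : 0 ≤ (1 + 1 / η) * (Q.eval x - h0 x) ^ 2 + η * h0 x ^ 2 := pz
      nlinarith
    rw [iad iH ikey, Ikey] at this
    nlinarith
  · have hgm : Measurable ((Iic R).indicator (fun x ↦ |fS β σ c x - Q.eval x ^ 2|)) := by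
      refine Measurable.indicator ?_ measurableSet_Iic
      have := Q.continuous.measurable
      unfold fS; fun_prop
    have hle : ∀ x > 0, md σ x * (Iic R).indicator (fun x ↦ |fS β σ c x - Q.eval x ^ 2|) x ≤
        K * (((1 + 1 / η) * ((Q.eval x - h0 x) ^ 2 * qw x) + η * (h0 x ^ 2 * qw x)) * exp (-(x ^ β))) := fun x hx ↦ by
      have hq0 := qw_nonneg hx
      by_cases hxR : x ≤ R
      · rw [indicator_of_mem (s := Iic R) hxR, ← hsq1 x hx hxR]
        have h1 := key (Q.eval x) (h0 x)
        have h2 : md σ x ≤ K * (qw x * exp (-(x ^ β))) := by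
          have h3 : x ^ (-(hlf) : ℝ) = (√x)⁻¹ := by rw [rpow_neg hx.le, sqrt_eq_rpow]
          have h4 : (√x)⁻¹ ≤ qw x := by unfold qw; rw [rpow_zero, h3]; linarith
          have h5 : 1 ≤ exp (R ^ β) * exp (-(x ^ β)) := by
            rw [← exp_add]; exact one_le_exp (by have := rpow_le_rpow hx.le hxR hβ0.le; linarith)
          have h6 : 0 < √x := sqrt_pos.2 hx
          calc md σ x ≤ s / (π * (0 + s ^ 2) * √x) := by rw [md, he, hσ]; gcongr
            _ = 1 / (π * s) * (√x)⁻¹ := by field_simp; ring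
            _ ≤ 1 / (π * s) * qw x * (exp (R ^ β) * exp (-(x ^ β))) := by
              refine (mul_le_mul_of_nonneg_left h4 pz).trans (le_mul_of_one_le_right pz h5)
            _ = _ := by rw [hK]; ring
        calc _ ≤ K * (qw x * exp (-(x ^ β))) * ((1 + 1 / η) * (Q.eval x - h0 x) ^ 2 + η * h0 x ^ 2) :=
            mul_le_mul h2 h1 (abs_nonneg _) pz
          _ = _ := by ring
      · rw [indicator_of_notMem (s := Iic R) hxR, mul_zero]; positivity
    have hnn : ∀ x > 0, 0 ≤ md σ x * (Iic R).indicator (fun x ↦ |fS β σ c x - Q.eval x ^ 2|) x := fun x hx ↦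
      mul_nonneg (md_nonneg hσ0 hx) (Set.indicator_nonneg (fun _ _ ↦ abs_nonneg _) _)
    have hii := ((wM_integrable _ _).1 ikey).const_mul K
    obtain ⟨e1, e2⟩ := mobI_int hσ0 hgm
    have hint : IntegrableOn (fun x ↦ md σ x * (Iic R).indicator (fun x ↦ |fS β σ c x - Q.eval x ^ 2|) x) (Ioi 0) :=
      hii.mono' ((md_meas σ).mul hgm).aestronglyMeasurable ((ae_restrict_mem mIoi).mono fun x hx ↦ by
        rw [nonn (hnn x hx)]; exact hle x hx)
    refine ⟨e1.2 hint, ?_⟩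
    rw [e2]
    calc _ ≤ _ := setIntegral_mono_on hint hii mIoi fun x hx ↦ hle x hx
      _ = K * ((1 + 1 / η) * D + η * W) := by rw [icm, ← wM_integral, Ikey]
      _ ≤ ε := by nlinarith
include hP
lemma rho_intg (Q : RX) {δ δ' : ℝ} (hδ : 0 ≤ δ) (N : ℕ) :
    ∫ x, (rho P Q δ δ' N).eval x ∂wB ≤ ∫ x, Q.eval x ^ 2 ∂wB + δ' * ∫ _, (1:ℝ) ∂wB + δ := by
  simp only [rho_eval]
  have i1 : Integrable (fun x ↦ Q.eval x ^ 2) wB := wM_psq hβ Q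
  have i2 : Integrable (fun _ : ℝ ↦ δ') wB := by have := wM_poly hβ (C δ'); simpa using this
  have i3 : ∀ n ∈ Finset.Ico 1 N, Integrable (fun x ↦ δ / ((n:ℝ) + 1) ^ 2 * (P n).eval x ^ 2) wB :=
    fun n _ ↦ (wM_psq hβ _).const_mul _
  have i12 : Integrable (fun x ↦ Q.eval x ^ 2 + δ') wB := i1.add i2
  rw [iad i12 (integrable_finsetSum _ i3), iad i1 i2, integral_finsetSum _ i3]
  have e : ∀ n, ∫ x, (P n).eval x ^ 2 ∂wB = 1 := fun n ↦ by
    have := hP.2.2 n n; rw [if_pos rfl] at this; rw [← this]; simp only [sq]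
  simp only [icm, e, mul_one]
  have h2 : ∫ _, δ' ∂wB = δ' * ∫ _, (1:ℝ) ∂wB := by rw [← icm]; simp
  have h3 : ∀ N : ℕ, 1 ≤ N → ∑ n ∈ Finset.Ico 1 N, δ / ((n:ℝ) + 1) ^ 2 ≤ δ * (1 - 1 / N) := fun N hN ↦ by
    induction N, hN using Nat.le_induction with
    | base => simp
    | succ n hn ih =>
      rw [Finset.sum_Ico_succ_top hn]
      have hn0 : zr < n := by exact_mod_cast hn
      have : 1 / ((n:ℝ) + 1) ^ 2 ≤ 1 / n - 1 / (n + 1) := by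
        rw [div_sub_div _ _ hn0.ne' pz, div_le_div_iff₀ pz pz]; nlinarith
      have h5 := mul_le_mul_of_nonneg_left this hδ
      rw [mul_one_div] at h5
      push_cast; linarith
  have h4 : ∑ n ∈ Finset.Ico 1 N, δ / ((n:ℝ) + 1) ^ 2 ≤ δ := by
    rcases Nat.eq_zero_or_pos N with h | h
    · simp [h, hδ]
    · refine (h3 N h).trans (mul_le_of_le_one_right hδ ?_)
      have : 0 ≤ 1 / (N:ℝ) := pz
      linarith
  linarith
omit hP
lemma star {s ε : ℝ} (hs : 0 < s) (hσ : σ = s ^ 2) (hε : 0 < ε) (hε1 : ε < 1)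
    (hP : ONP β P) : ∀ᶠ N : ℕ in atTop, ∃ ρ : RX, ρ.natDegree + 2 ≤ 2 * N ∧ (∀ x, 0 < ρ.eval x) ∧
      (1 - ε) * (exp (N * eK β (σ / bbN)) / π * ∫ x, ρ.eval x ∂wB) ≤
        4 * σ * exp (∫ v, log (ρ.eval (mobI σ v)) ∂arcM) := by
  have hσ0 : 0 < σ := by rw [hσ]; positivity
  have hπ := pi_pos
  obtain ⟨C1, C2, R0, hC2, hR0, hlow⟩ := psi_low hβ
  set η := ε / 10 with hη
  have hη0 : 0 < η := pz
  set δ := η * (π / s) with hδ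
  have hδ0 : 0 < δ := pz
  have := kM_prob hσ0
  obtain ⟨R, hRR, hR4, hT⟩ : ∃ R, R0 ≤ R ∧ 4 ≤ R ∧ ∫ u in Ioi R, (C1 - log δ) + C2 * log u ∂(kM σ) < η := by
    have h := tendsto_setIntegral_of_antitone (μ := kM σ) (f := fun u ↦ (C1 - log δ) + C2 * log u)
      (s := fun R : ℝ ↦ Ioi R) (fun _ ↦ mIoi) (fun a b h ↦ Set.Ioi_subset_Ioi h)
      ⟨1, kM_tail_int hσ0 one_pos _ _⟩
    have h0 : (⋂ n : ℝ, Ioi n) = ∅ := by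
      ext x; simp only [Set.mem_iInter, Set.mem_Ioi, Set.mem_empty_iff_false, iff_false, not_forall]
      exact ⟨x, lt_irrefl x⟩
    rw [h0, Measure.restrict_empty, integral_zero_measure] at h
    obtain ⟨R, h1, h2⟩ := ((h.eventually (gt_mem_nhds hη0)).and (eventually_ge_atTop (max R0 4))).exists
    exact ⟨R, (le_max_left _ _).trans h2, (le_max_right _ _).trans h2, h1⟩
  set W := ∫ _, (1:ℝ) ∂wB with hW
  have hW0 : 0 ≤ W := integral_nonneg fun _ ↦ zero_le_one
  set δ' := η * (π / s) / (W + 1) with hδ'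
  have hδ'0 : 0 < δ' := pz
  have hδW : δ' * W ≤ η * (π / s) := by
    rw [hδ', div_mul_eq_mul_div, div_le_iff₀ pz]; nlinarith [show 0 < η * (π / s) by positivity]
  obtain ⟨Q, hQ1, hQ2, hQ3⟩ := starQ (c := η * s) (R := R) (ε := min δ (η * δ')) hβ hs hσ pz lz
    pz
  have hlimN : Tendsto (fun N : ℕ ↦ bbN) atTop atTop := (bN_lim hβ).comp tendsto_natCast_atTop_atTop
  filter_upwards [hlimN.eventually_gt_atTop R, eventually_ge_atTop 2, eventually_ge_atTop (Q.natDegree + 1)] with N hN1 hN2 hN3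
  have hcore := star_core hβ hs hσ (c := η * s) pz hδ0 hδ'0 hRR hR4 Q N hN1 hP (hlow P hP N hN2) hQ2
  refine ⟨rho P Q δ δ' N, ?_, fun x ↦ ?_, ?_⟩
  · have : (rho P Q δ δ' N).natDegree ≤ 2 * (N - 1) := by
      unfold rho
      refine natDegree_add_le_of_degree_le (natDegree_add_le_of_degree_le (natDegree_pow_le.trans ?_) sz)
        (natDegree_sum_le_of_forall_le _ _ fun n hn ↦ ?_)
      · omega
      · refine (natDegree_C_mul_le _ _).trans (natDegree_pow_le.trans ?_)
        rw [hP.1]; rw [Finset.mem_Ico] at hn; omega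
    omega
  · rw [rho_eval]
    have : 0 ≤ ∑ n ∈ Finset.Ico 1 N, δ / ((n:ℝ) + 1) ^ 2 * (P n).eval x ^ 2 :=
      Finset.sum_nonneg fun n _ ↦ by positivity
    positivity
  · set L := ∫ v, log ((rho P Q δ δ' N).eval (mobI σ v)) ∂arcM
    set E := N * eK β (σ / bbN)
    set J := ∫ v, (Iic R).indicator (fun x ↦ |fS β σ (η * s) x - Q.eval x ^ 2|) (mobI σ v) ∂arcM
    have hJ : J / δ' ≤ η := by rw [div_le_iff₀ hδ'0]; exact hQ3.trans (min_le_right _ _)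
    have hI := rho_intg hβ hP Q hδ0.le N (δ' := δ')
    have hI2 : ∫ x, (rho P Q δ δ' N).eval x ∂wB ≤ π / s * (1 + 3 * η) := by
      have := min_le_left δ (η * δ'); linarith
    have hL : exp (E - log (s + η * s) - 2 * log (2 * s)) * (1 - 2 * η) ≤ exp L := by
      calc _ ≤ exp (E - log (s + η * s) - 2 * log (2 * s)) * exp (-2 * η) := by
            gcongr; linarith [add_one_le_exp (-2 * η)]
        _ = exp (E - log (s + η * s) - 2 * log (2 * s) - 2 * η) := by rw [← exp_add]; ring_nf
        _ ≤ _ := exp_le_exp.2 lz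
    have e1 : exp (E - log (s + η * s) - 2 * log (2 * s)) = exp E / (s * (1 + η)) / (4 * σ) := by
      rw [exp_sub, exp_sub, exp_log pz, show 2 * log (2 * s) = log ((2 * s) ^ 2) by rw [log_pow]; norm_cast,
        exp_log pz, hσ]; ring
    rw [e1] at hL
    have hpol : (1 - ε) * (1 + 3 * η) * (1 + η) ≤ 1 - 2 * η := by
      have : ε = 10 * η := by rw [hη]; ring
      rw [this]; nlinarith [mul_pos hη0 hη0, mul_pos (mul_pos hη0 hη0) hη0]
    calc _ ≤ (1 - ε) * (exp E / π * (π / s * (1 + 3 * η))) := by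
          have : 0 ≤ 1 - ε := lz
          gcongr
      _ = exp E / (s * (1 + η)) * ((1 - ε) * (1 + 3 * η) * (1 + η)) := by field_simp
      _ ≤ exp E / (s * (1 + η)) * (1 - 2 * η) := by gcongr
      _ = 4 * σ * (exp E / (s * (1 + η)) / (4 * σ) * (1 - 2 * η)) := by field_simp
      _ ≤ _ := by gcongr
omit hβ
def EN (β : ℝ) (N : ℕ) (σ : ℝ) : ℝ := N * eK β (σ / bbN)
def KN (β : ℝ) (P : ℕ → RX) (N : ℕ) (σ : ℝ) : ℝ := PE (-σ) ^ 2 / Ist β (P N) σ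
include hβ
lemma U1c {s : ℝ} (hs : 0 < s) (hσ : σ = s ^ 2) {N : ℕ} (hN : 0 < N) (A B : RX)
    (hA : A.natDegree ≤ N) (hB : B = 0 ∨ B.natDegree + 1 ≤ N) (x y : ℝ) :
    (x * A.eval (-σ) + y * (s * B.eval (-σ))) ^ 2 ≤ exp (EN β N σ) / π * Tb (bbN) σ ^ 2 *
      (x ^ 2 * Ist β A σ + y ^ 2 * ∫ u, u * B.eval u ^ 2 / (u + σ) ∂wB) := by
  have hσ0 : 0 < σ := by rw [hσ]; positivity
  have hN' : zr < N := by exact_mod_cast hN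
  have h := U1 hβ hs hσ (bN_pos hβ hN') N (bN_eq hβ hN'.le) (C x * A) (C y * B)
    ((natDegree_C_mul_le _ _).trans hA) (by
      rcases hB with h | h
      · left; rw [h, mul_zero]
      · right; have := natDegree_C_mul_le y B; omega)
  have i1 := wM_psq_div hβ hσ0 A
  have i2 : Integrable (fun u ↦ u * B.eval u ^ 2 / (u + σ)) wB := by
    have := wM_poly_div hβ hσ0 (X * B ^ 2)
    simp only [eval_mul, eval_X, eval_pow] at this; exact this
  have e : ∫ u, Fab (C x * A) (C y * B) u / (u + σ) ∂wB =
      x ^ 2 * Ist β A σ + y ^ 2 * ∫ u, u * B.eval u ^ 2 / (u + σ) ∂wB := by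
    rw [Ist, ← icm, ← icm, ← iad (i1.const_mul _) (i2.const_mul _)]
    refine icae (ae_of_all _ fun u ↦ ?_)
    simp only [Fab, eval_mul, eval_C]; ring
  rw [e] at h
  simp only [eval_mul, eval_C] at h
  rw [EN]
  convert h using 1 <;> ring
omit hβ
lemma halves_alg {ε γ τ M v p a b I : ℝ} (hε1 : ε < 1) (ha : 0 < a) (hb : 0 < b) (hI : 0 < I) (hM : 0 < M) (hτ : 1 ≤ τ)
    (hγ : 0 ≤ γ) (hγ2 : 1 - (1 - ε) / τ ≤ γ ^ 2)
    (u1 : ∀ x y : ℝ, (x * v + y * v) ^ 2 ≤ M * τ * (x ^ 2 * a + y ^ 2 * b))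
    (u2 : ∀ x y : ℝ, (x * p + y * v) ^ 2 ≤ M * τ * (x ^ 2 * I + y ^ 2 * b))
    (hst : (1 - ε) * (M * (a + b)) ≤ 4 * v ^ 2) (hv0 : 0 < v ^ 2) (hE1 : v ^ 2 * I ≤ p ^ 2 * a) :
    (1 - ε) / (2 * (1 + γ)) ≤ p ^ 2 / I / M ∧ p ^ 2 / I / M ≤ τ - (1 - ε) / (2 * (1 + γ)) := by
  have hτ0 : 0 < τ := lz
  have w1 : v ^ 2 * (a + b) ≤ M * τ * (a * b) := by
    have := u1 b a
    have h2 : (v ^ 2 * (a + b)) * (a + b) ≤ (M * τ * (a * b)) * (a + b) := by nlinarith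
    exact le_of_mul_le_mul_right h2 pz
  have w2 : (1 - ε) * (a + b) ^ 2 ≤ 4 * τ * (a * b) := by
    have h2 : M * ((1 - ε) * (a + b) ^ 2) ≤ M * (4 * τ * (a * b)) := by nlinarith
    exact le_of_mul_le_mul_left h2 hM
  have w3 : (a - b) ^ 2 ≤ (γ * (a + b)) ^ 2 := by
    have h3 : (1 - ε) / τ * (a + b) ^ 2 ≤ 4 * (a * b) := by
      rw [div_mul_eq_mul_div, div_le_iff₀ hτ0]; linarith
    nlinarith [sq_nonneg (a + b)]
  have w4 := abs_le.1 (abs_le_of_sq_le_sq w3 pz)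
  have hε0 : 0 < 1 - ε := lz
  have hlow : ∀ z > 0, 2 * z ≤ (1 + γ) * (a + b) → (1 - ε) / (2 * (1 + γ)) * M ≤ v ^ 2 / z := fun z hz h ↦ by
    rw [le_div_iff₀ hz, div_mul_eq_mul_div, div_mul_eq_mul_div, div_le_iff₀ pz]
    have : (1 - ε) * M * (2 * z) ≤ (1 - ε) * M * ((1 + γ) * (a + b)) := by gcongr
    nlinarith
  constructor
  · rw [le_div_iff₀ hM]
    refine (hlow a ha (by linarith [w4.2])).trans ?_
    rw [div_le_div_iff₀ ha hI]; exact hE1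
  · rw [div_le_iff₀ hM, sub_mul]
    have h1 := hlow b hb (by linarith [w4.1])
    have h2 := u2 (p / I) (v / b)
    have h3 : p / I * p + v / b * v = p ^ 2 / I + v ^ 2 / b := by ring
    have h4 : (p / I) ^ 2 * I + (v / b) ^ 2 * b = p ^ 2 / I + v ^ 2 / b := by field_simp
    rw [h3, h4, sq] at h2
    have h5 : 0 < p ^ 2 / I + v ^ 2 / b := pz
    have h6 := le_of_mul_le_mul_right h2 h5
    linarith
include hβ
lemma halves_core {s ε γ : ℝ} (hs : 0 < s) (hσ : σ = s ^ 2) (hε1 : ε < 1) (hP : ONP β P) (N : ℕ) (ρ : RX) (hd : ρ.natDegree + 2 ≤ 2 * N) (hρ : ∀ x, 0 < ρ.eval x)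
    (hst : (1 - ε) * (exp (EN β N σ) / π * ∫ x, ρ.eval x ∂wB) ≤ 4 * σ * exp (∫ v, log (ρ.eval (mobI σ v)) ∂arcM))
    (hγ : 0 ≤ γ) (hγ2 : 1 - (1 - ε) / Tb (bbN) σ ^ 2 ≤ γ ^ 2) :
    (1 - ε) / (2 * (1 + γ)) ≤ KN β P N σ / (exp (EN β N σ) / π) ∧
      KN β P N σ / (exp (EN β N σ) / π) ≤ Tb (bbN) σ ^ 2 - (1 - ε) / (2 * (1 + γ)) := by
  have hσ0 : 0 < σ := by rw [hσ]; positivity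
  have hN : 0 < N := oz
  have hN' : zr < N := by exact_mod_cast hN
  obtain ⟨A1, B1, hAB, hA1, hB1, -, hL⟩ := lukacs hs hσ ρ fun x _ ↦ hρ x
  rw [hL] at hst
  have hL0 : 0 < (A1.eval (-σ) + s * B1.eval (-σ)) ^ 2 := by rw [← hL]; positivity
  have hM : 0 < exp (EN β N σ) / π := by have := pi_pos; positivity
  have hτ : 1 ≤ Tb (bbN) σ ^ 2 := one_le_pow₀ (Tb_ge (bN_pos hβ hN') hσ0)
  have hu := fun A B hA hB ↦ U1c hβ hs hσ hN A B hA hB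
  rw [KN]
  set M := exp (EN β N σ) / π
  set τ := Tb (bbN) σ ^ 2
  set A := C s * A1 - X * B1 with hAd
  set B := A1 + C s * B1 with hBd
  have hBX : B1.natDegree ≤ (X * B1).natDegree := by
    by_cases h : B1 = 0
    · simp [h]
    · rw [natDegree_X_mul h]; omega
  have hAdeg : A.natDegree ≤ N := by
    refine (natDegree_sub_le _ _).trans (max_le ((natDegree_C_mul_le _ _).trans ?_) ?_) <;> omega
  have hBdeg : B.natDegree + 1 ≤ N := by
    have : B.natDegree ≤ N - 1 := (natDegree_add_le _ _).trans (max_le oz ((natDegree_C_mul_le _ _).trans oz))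
    omega
  set v := s * B.eval (-σ) with hv
  have hAv : A.eval (-σ) = v := by simp [hAd, hv, hBd, hσ]; ring
  have hv2 : v ^ 2 = σ * (A1.eval (-σ) + s * B1.eval (-σ)) ^ 2 := by simp [hv, hBd, hσ]; ring
  have hv0 : 0 < v ^ 2 := by rw [hv2]; positivity
  have hvn : v ≠ 0 := fun h ↦ by rw [h] at hv0; simp at hv0
  have hA0 : A ≠ 0 := fun h ↦ hvn (by rw [← hAv, h, eval_zero])
  have hB0 : B ≠ 0 := fun h ↦ hvn (by rw [hv, h, eval_zero, mul_zero])
  have ha := Ist_pos hβ hσ0 hA0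
  have i2 : Integrable (fun u ↦ u * B.eval u ^ 2 / (u + σ)) wB := by
    have := wM_poly_div hβ hσ0 (X * B ^ 2)
    simp only [eval_mul, eval_X, eval_pow] at this; exact this
  have hb : 0 < ∫ u, u * B.eval u ^ 2 / (u + σ) ∂wB :=
    wM_pos hB0 i2 (fun x hx ↦ by positivity) (fun x hx h ↦ by
      rcases div_eq_zero_iff.1 h with h | h
      · rcases mul_eq_zero.1 h with h | h
        · exact absurd h hx.ne'
        · exact pow_eq_zero_iff two_ne_zero |>.1 h
      · linarith)
  have hS : ∫ x, ρ.eval x ∂wB = Ist β A σ + ∫ u, u * B.eval u ^ 2 / (u + σ) ∂wB := by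
    rw [Ist, ← iad (wM_psq_div hβ hσ0 A) i2]
    refine icae ((wM_ae β).mono fun x hx ↦ ?_)
    have : x + σ ≠ 0 := pz
    simp only [hAB, hAd, hBd, eval_add, eval_mul, eval_sub, eval_pow, eval_C, eval_X]
    field_simp
    rw [hσ]; ring
  have hE1 := onp_E1 hβ hσ0 hP N A hAdeg
  have hI := Ist_pos hβ hσ0 (onp_ne0 hP N)
  have u1 := fun x y ↦ hu A B hAdeg (Or.inr hBdeg) x y
  have u2 := fun x y ↦ hu (P N) B (hP.1 N).le (Or.inr hBdeg) x y
  rw [hS, mul_assoc 4, ← hv2] at hst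
  simp only [hAv] at hE1 u1
  simp only [← hv] at u1 u2
  set a := Ist β A σ
  set b := ∫ u, u * B.eval u ^ 2 / (u + σ) ∂wB
  set I := Ist β (P N) σ
  set p := PE (-σ)
  exact halves_alg hε1 ha hb hI hM hτ hγ hγ2 u1 u2 hst hv0 hE1
lemma Tb_lim (σ : ℝ) (hσ : 0 < σ) : Tendsto (fun N : ℕ ↦ Tb (bbN) σ) atTop (𝓝 1) := by
  have hl : Tendsto (fun N : ℕ ↦ bbN) atTop atTop := (bN_lim hβ).comp tendsto_natCast_atTop_atTop
  have h1 : Tendsto (fun N : ℕ ↦ σ / bbN) atTop (𝓝 0) := hl.const_div_atTop σ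
  have h2 : Tendsto (fun N : ℕ ↦ √(1 + σ / bbN) + √(σ / bbN)) atTop (𝓝 (√(1 + 0) + √0)) :=
    ((h1.const_add 1).sqrt).add h1.sqrt
  rw [add_zero, sqrt_one, sqrt_zero, add_zero] at h2
  refine h2.congr' ?_
  filter_upwards [hl.eventually_gt_atTop 0] with N hN
  rw [Tb, add_div, ← sqrt_div pz, ← sqrt_div hσ.le, add_div, div_self hN.ne']
lemma KN_lim (hσ0 : 0 < σ) (hP : ONP β P) :
    Tendsto (fun N : ℕ ↦ KN β P N σ / (exp (EN β N σ) / π)) atTop (𝓝 (hlf)) := by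
  obtain ⟨s, hs, hσ⟩ : ∃ s > 0, σ = s ^ 2 := ⟨√σ, sqrt_pos.2 hσ0, (sq_sqrt hσ0.le).symm⟩
  have hT := (Tb_lim hβ σ hσ0).pow 2
  rw [one_pow] at hT
  rw [Metric.tendsto_nhds]
  intro e he
  obtain ⟨ε, ⟨h1, h2⟩, hε, hε1⟩ : ∃ ε, ((1 - ε) / (2 * (1 + √ε)) > 1/2 - e ∧ 1 - (1 - ε) / (2 * (1 + √ε)) < hlf + e) ∧ 0 < ε ∧ ε < 1 := by
    have : ContinuousAt (fun ε ↦ (1 - ε) / (2 * (1 + √ε))) 0 := by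
      refine ContinuousAt.div fz fz sz
    have h := this.tendsto
    simp only [sub_zero, sqrt_zero, add_zero, mul_one] at h
    have h' := (h.mono_left (nhdsWithin_le_nhds (s := Ioi 0)))
    obtain ⟨ε, h1, h2⟩ := ((h'.eventually (lt_mem_nhds (show 1/2 - e < hlf by linarith))).and (Ioo_mem_nhdsGT (zero_lt_one' ℝ))).exists
    exact ⟨ε, ⟨h1, lz⟩, h2⟩
  have hg : Tendsto (fun N : ℕ ↦ (1 - ε) / (2 * (1 + √(1 - (1 - ε) / Tb (bbN) σ ^ 2)))) atTop (𝓝 ((1 - ε) / (2 * (1 + √(1 - (1 - ε) / 1))))) := by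
    refine Tendsto.div tendsto_const_nhds (((((tendsto_const_nhds.div hT one_ne_zero).const_sub 1).sqrt).const_add 1).const_mul 2) pz
  rw [div_one, sub_sub_cancel] at hg
  filter_upwards [hg.eventually (lt_mem_nhds h1), (hT.sub hg).eventually (gt_mem_nhds h2), star hβ hs hσ hε hε1 hP] with N g1 g2 ⟨ρ, hd, hρ, hst⟩
  have h := halves_core hβ hs hσ hε1 hP N ρ hd hρ hst (sqrt_nonneg (1 - (1 - ε) / Tb (bbN) σ ^ 2)) (by
      by_cases h0 : 0 ≤ 1 - (1 - ε) / Tb (bbN) σ ^ 2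
      · rw [sq_sqrt h0]
      · push Not at h0; exact h0.le.trans (sq_nonneg _))
  rw [Real.dist_eq, abs_lt]
  constructor <;> linarith [h.1, h.2]
lemma wM_rpoly {a : ℝ} (ha : -1 < a) (q : RX) :
    Integrable (fun x ↦ x ^ a * q.eval x) wB := by
  have h : Integrable (fun x ↦ ∑ i ∈ range (q.natDegree + 1), q.coeff i * (x ^ (a + i) * exp (0 * √x))) wB :=
    integrable_finsetSum _ fun i _ ↦ (wM_int hβ 0 (by linarith [i.cast_nonneg (α := ℝ)])).const_mul _
  refine h.congr ?_
  filter_upwards [wM_ae β] with x hx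
  rw [eval_eq_sum_range, mul_sum]
  refine sum_congr rfl fun i _ ↦ ?_
  rw [zero_mul, exp_zero, rpow_add hx, rpow_natCast]; ring
lemma wM_bdd {a : ℝ} (ha : -1 < a) (q : RX) {f : ℝ → ℝ} (hf : Measurable f) (c : ℝ)
    (hb : ∀ x > 0, |f x| ≤ c) : Integrable (fun x ↦ f x * (x ^ a * q.eval x)) wB :=
  Integrable.bdd_mul (wM_rpoly hβ ha q) hf.aestronglyMeasurable
    (by filter_upwards [wM_ae β] with x hx using hb x hx)
lemma wM_bdd0 (q : RX) {f : ℝ → ℝ} (hf : Measurable f) (c : ℝ)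
    (hb : ∀ x > 0, |f x| ≤ c) : Integrable (fun x ↦ f x * q.eval x) wB := by
  simpa using wM_bdd hβ (a := 0) nz q hf c hb
omit hβ
include hσ
lemma inv_bd {x : ℝ} (hx : 0 < x) : |1 / xsg| ≤ 1 / σ := by
  rw [abs_of_pos pz]
  exact one_div_le_one_div_of_le hσ lz
include hβ
lemma ibp (q : RX) :
    ∫ x, (1 / xsg) * (x ^ β * (C β * q).eval x) ∂wB =
    ∫ x, ((1 / xsg) * (X * derivative q).eval x + (σ / xsg ^ 2) * q.eval x) ∂wB := by
  have hm : Measurable fun x : ℝ ↦ 1 / xsg := fz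
  have hm2 : Measurable fun x : ℝ ↦ σ / xsg ^ 2 := fz
  have b2 : ∀ x > 0, |σ / xsg ^ 2| ≤ 1 / σ := fun x hx ↦ by
    rw [abs_of_pos pz, div_le_div_iff₀ pz hσ]; nlinarith
  have i1 : Integrable (fun x ↦ (1 / xsg) * (x ^ β * (C β * q).eval x)) wB :=
    wM_bdd hβ lz _ hm _ fun x hx ↦ inv_bd hσ hx
  have i2 : Integrable (fun x ↦ (1 / xsg) * (X * derivative q).eval x) wB :=
    wM_bdd0 hβ _ hm _ fun x hx ↦ inv_bd hσ hx
  have i3 : Integrable (fun x ↦ (σ / xsg ^ 2) * q.eval x) wB := wM_bdd0 hβ _ hm2 _ b2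
  have i4 : Integrable (fun x ↦ (1 / xsg) * (X * q).eval x) wB :=
    wM_bdd0 hβ _ hm _ fun x hx ↦ inv_bd hσ hx
  have i5 : Integrable (fun x ↦ (1 / xsg) * (X * derivative q).eval x + (σ / xsg ^ 2) * q.eval x) wB := i2.add i3
  have i6 : Integrable (fun x ↦ ((1 / xsg) * (X * derivative q).eval x + (σ / xsg ^ 2) * q.eval x) -
    (1 / xsg) * (x ^ β * (C β * q).eval x)) wB := i5.sub i1
  have hβ0 : 0 < β := lz
  have hd : ∀ x ∈ Ioi zr, HasDerivAt (fun x ↦ (1 / xsg) * (X * q).eval x * exp (-(x ^ β)))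
      ((((1 / xsg) * (X * derivative q).eval x + (σ / xsg ^ 2) * q.eval x) -
    (1 / xsg) * (x ^ β * (C β * q).eval x)) * exp (-(x ^ β))) x := by
    intro x hx
    have hx : 0 < x := hx
    have d1 := (((hasDerivAt_id x).add_const σ).inv (by simp; linarith)).mul ((X * q).hasDerivAt x)
    have d2 := ((hasDerivAt_rpow_const (p := β) (Or.inl hx.ne')).neg).exp
    refine HasDerivAt.congr_deriv (f := fun x ↦ (1 / xsg) * (X * q).eval x * exp (-(x ^ β)))
      ((d1.mul d2).congr_of_eventuallyEq (by filter_upwards with y; simp)) ?_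
    have e : x ^ β = x * x ^ bm1 := by
      nth_rewrite 2 [← rpow_one x]; rw [← rpow_add hx]; ring_nf
    have : x + σ ≠ 0 := pz
    simp only [derivative_mul, derivative_X, eval_add, eval_mul, eval_X, eval_C, id, e, one_mul, Pi.inv_apply, Pi.mul_apply, Pi.neg_apply]
    field_simp
    ring
  have I1 := (wM_integrable β _).1 i6
  have I2 := (wM_integrable β _).1 i4
  have hc : ContinuousWithinAt (fun x ↦ (1 / xsg) * (X * q).eval x * exp (-(x ^ β))) (Ici 0) 0 := by
    refine ContinuousAt.continuousWithinAt ?_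
    refine ContinuousAt.mul (ContinuousAt.mul ?_ (X * q).continuous.continuousAt) ?_
    · exact ContinuousAt.div continuousAt_const fz (by simp; exact hσ.ne')
    · exact (continuousAt_rpow_const _ _ (Or.inr hβ0.le)).neg.rexp
  have ht := tendsto_zero_of_hasDerivAt_of_integrableOn_Ioi hd I1 I2
  have hI := integral_Ioi_of_hasDerivAt_of_tendsto hc hd I1 ht
  rw [← wM_integral, integral_sub i5 i1] at hI
  simp only [eval_mul, eval_X, zero_mul, mul_zero, sub_zero] at hI
  simp only [eval_mul, eval_X]
  linarith
omit hβ hσ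
lemma st_deriv {ν : Measure ℝ} (h0 : ∀ᵐ x ∂ν, 0 < x) {g : ℝ → ℝ} (hg : Integrable g ν) (hσ : 0 < σ) :
    Integrable (fun x ↦ g x / xsg ^ 2) ν ∧
    HasDerivAt (fun s ↦ ∫ x, g x / (x + s) ∂ν) (-∫ x, g x / xsg ^ 2 ∂ν) σ := by
  have key := hasDerivAt_integral_of_dominated_loc_of_deriv_le (μ := ν) (F := fun s x ↦ g x / (x + s))
    (F' := fun s x ↦ -(g x / (x + s) ^ 2)) (x₀ := σ) (s := Metric.ball σ (σ / 2)) (bound := fun x ↦ |g x| / (σ / 2) ^ 2)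
    (Metric.ball_mem_nhds _ pz)
    (by filter_upwards with s
        exact (hg.aestronglyMeasurable.aemeasurable.div fz).aestronglyMeasurable)
    (by have h1 : Integrable (fun x ↦ (1 / xsg) * g x) ν :=
          Integrable.bdd_mul (c := 1 / σ) hg (mas fz)
            (by filter_upwards [h0] with x hx using inv_bd hσ hx)
        refine h1.congr (by filter_upwards with x; ring))
    ((hg.aestronglyMeasurable.aemeasurable.div fz).neg.aestronglyMeasurable)
    (by filter_upwards [h0] with x hx s hs
        have : σ / 2 < s := by rw [Metric.mem_ball, Real.dist_eq, abs_lt] at hs; linarith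
        rw [norm_neg, norm_div, norm_of_nonneg (r := (x + s) ^ 2) pz]
        rw [norm_eq_abs]
        gcongr; linarith)
    (hg.abs.div_const _)
    (by filter_upwards [h0] with x hx s hs
        have : σ / 2 < s := by rw [Metric.mem_ball, Real.dist_eq, abs_lt] at hs; linarith
        have hne : x + s ≠ 0 := lz
        have d := ((hasDerivAt_id s).const_add x).inv hne
        refine HasDerivAt.congr_deriv (f := fun s ↦ g x / (x + s)) ((d.const_mul (g x)).congr_of_eventuallyEq ?_) ?_
        · filter_upwards with y; simp [div_eq_mul_inv]
        · simp; field_simp)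
  refine ⟨by simpa using key.1.neg, ?_⟩
  have := key.2
  rwa [integral_neg] at this
def Hst (β : ℝ) (p : RX) (σ : ℝ) : ℝ := ∫ x, β * x ^ β * p.eval x ^ 2 / xsg ∂wB
def RN (β : ℝ) (P : ℕ → RX) (N : ℕ) (σ : ℝ) : ℝ := Hst β (P N) σ / Ist β (P N) σ
include hβ hσ
lemma Hst_int (p : RX) :
    Integrable (fun x ↦ β * x ^ β * p.eval x ^ 2 / xsg) wB := by
  refine (wM_bdd hβ (a := β) lz (C β * p ^ 2) (f := fun x ↦ 1 / xsg) fz _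
    fun x hx ↦ inv_bd hσ hx).congr (by filter_upwards with x; simp; ring)
include hP
lemma HN_eq (N : ℕ) (hne : PE (-σ) ≠ 0) :
    Hst β (P N) σ = -2 * σ * ((derivative (P N)).eval (-σ) / PE (-σ)) * Ist β (P N) σ +
      σ * ∫ x, PE x ^ 2 / xsg ^ 2 ∂wB := by
  have h1 := ibp hβ hσ (P N ^ 2)
  have h2 := onp_eval hβ hσ hP N (X * derivative (P N)) (by
    by_cases h : derivative (P N) = 0
    · simp [h]
    refine natDegree_mul_le.trans ?_
    have := natDegree_derivative_le (P N)
    rw [natDegree_X]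
    rcases Nat.eq_zero_or_pos N with h0 | h0
    · exfalso; apply h
      have := hP.1 N; rw [h0] at this; rw [h0]
      exact derivative_of_natDegree_zero this
    · rw [hP.1] at this; omega)
  have i0 := wM_psq_div hβ hσ (P N)
  have i1 := (st_deriv (wM_ae β) (wM_psq hβ (P N)) hσ).1
  have i2 : Integrable (fun x ↦ PE x * (X * derivative (P N)).eval x / xsg) wB := by
    have := wM_poly_div hβ hσ (P N * (X * derivative (P N)))
    simp only [eval_mul] at this ⊢; exact this
  have e1 : Hst β (P N) σ = ∫ x, (1 / xsg) * (x ^ β * (C β * P N ^ 2).eval x) ∂wB := by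
    rw [Hst]; congr 1; ext x; simp; ring
  rw [e1, h1]
  have e2 : ∫ x, ((1 / xsg) * (X * derivative (P N ^ 2)).eval x + (σ / xsg ^ 2) * (P N ^ 2).eval x) ∂wB
    = ∫ x, (2 * (PE x * (X * derivative (P N)).eval x / xsg) + σ * (PE x ^ 2 / xsg ^ 2)) ∂wB := by
    congr 1; ext x; simp [derivative_pow]; ring
  rw [e2, iad (i2.const_mul 2) (i1.const_mul σ), icm, icm]
  congr 1
  generalize (∫ x, PE x * (X * derivative (P N)).eval x / xsg ∂wB) = Z at h2 ⊢
  simp only [eval_mul, eval_X] at h2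
  field_simp
  linarith
lemma logK_deriv (N : ℕ) :
    HasDerivAt (fun s ↦ log (KN β P N s)) (RN β P N σ / σ) σ := by
  have hne := onp_ne hβ hσ hP N
  have hI := Ist_pos hβ hσ (onp_ne0 hP N)
  have d1 : HasDerivAt (fun s ↦ PE (-s) ^ 2) (2 * PE (-σ) * -(derivative (P N)).eval (-σ)) σ := by
    have := (((P N).hasDerivAt (-σ)).comp σ (hasDerivAt_neg σ)).pow 2
    refine HasDerivAt.congr_deriv (f := fun s ↦ PE (-s) ^ 2) this ?_
    simp
  have d2 := (st_deriv (wM_ae β) (wM_psq hβ (P N)) hσ).2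
  have d3 := (d1.div d2 hI.ne').log (div_ne_zero (pow_ne_zero 2 hne) hI.ne')
  refine HasDerivAt.congr_deriv (f := fun s ↦ log (KN β P N s)) d3 ?_
  rw [RN, HN_eq hβ hσ hP N hne]
  change _ / (_ / Ist β (P N) σ) = _
  simp only [← show Ist β (P N) σ = ∫ x, PE x ^ 2 / xsg ∂wB from rfl]
  field_simp
  ring
omit hP
lemma Hst_pos {p : RX} (hp : p ≠ 0) : 0 < Hst β p σ :=
  have hβ0 : 0 < β := lz
  wM_pos hp (Hst_int hβ hσ p) (fun x hx ↦ by positivity) (fun x hx h ↦ by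
    have h1 : x ^ β ≠ 0 := (rpow_pos_of_pos hx _).ne'
    have h2 : x + σ ≠ 0 := pz
    simpa [h1, h2, hβ0.ne'] using h)
include hP
lemma RN_pos (N : ℕ) : 0 < RN β P N σ :=
  div_pos (Hst_pos hβ hσ (onp_ne0 hP N)) (Ist_pos hβ hσ (onp_ne0 hP N))
omit hσ hP
lemma RN_mono {s t : ℝ} (hs : 0 < s) (hst : s ≤ t) (hP : ONP β P) (N : ℕ) :
    RN β P N s ≤ RN β P N t := by
  have hβ0 : 0 < β := lz
  have ht : 0 < t := lz
  set c := (RN β P N s / β) ^ (1 / β)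
  have hR := RN_pos hβ hs hP N
  have hc0 : 0 < c := pz
  have hc : β * c ^ β = RN β P N s := by
    rw [← rpow_mul pz, one_div_mul_cancel hβ0.ne', rpow_one]; field_simp
  have hI := Ist_pos hβ ht (onp_ne0 hP N)
  have hI' := Ist_pos hβ hs (onp_ne0 hP N)
  have a1 := Hst_int hβ ht (P N)
  have a2 := wM_psq_div hβ ht (P N)
  have a3 := Hst_int hβ hs (P N)
  have a4 := wM_psq_div hβ hs (P N)
  set k := (c + s) / (c + t)
  have i1 := a1.sub (a2.const_mul (β * c ^ β))
  have i2 := (a3.sub (a4.const_mul (β * c ^ β))).const_mul k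
  have e2 : ∫ x, k * (β * x ^ β * PE x ^ 2 / (x + s) - β * c ^ β * (PE x ^ 2 / (x + s))) ∂wB = 0 := by
    rw [icm, integral_sub a3 (a4.const_mul _), icm, hc]
    change k * (Hst β (P N) s - RN β P N s * Ist β (P N) s) = 0
    rw [RN, div_mul_cancel₀ _ hI'.ne']; ring
  have key : ∫ x, k * (β * x ^ β * PE x ^ 2 / (x + s) - β * c ^ β * (PE x ^ 2 / (x + s))) ∂wB
    ≤ ∫ x, (β * x ^ β * PE x ^ 2 / (x + t) - β * c ^ β * (PE x ^ 2 / (x + t))) ∂wB := by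
    refine integral_mono_ae i2 i1 ?_
    filter_upwards [wM_ae β] with x hx
    show k * (β * x ^ β * PE x ^ 2 / (x + s) - β * c ^ β * (PE x ^ 2 / (x + s))) ≤ (β * x ^ β * PE x ^ 2 / (x + t) - β * c ^ β * (PE x ^ 2 / (x + t)))
    have hm : 0 ≤ (x ^ β - c ^ β) * (x - c) := by
      rcases le_total x c with h | h
      · exact mul_nonneg_of_nonpos_of_nonpos (sub_nonpos.2 (rpow_le_rpow hx.le h hβ0.le)) (sub_nonpos.2 h)
      · exact mul_nonneg (sub_nonneg.2 (rpow_le_rpow hc0.le h hβ0.le)) (sub_nonneg.2 h)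
    have e : (β * x ^ β * PE x ^ 2 / (x + t) - β * c ^ β * (PE x ^ 2 / (x + t))) - k * (β * x ^ β * PE x ^ 2 / (x + s) - β * c ^ β * (PE x ^ 2 / (x + s)))
      = β * PE x ^ 2 * (t - s) * ((x ^ β - c ^ β) * (x - c)) / ((x + t) * (x + s) * (c + t)) := by
      simp only [k]; field_simp; ring
    have : 0 ≤ t - s := lz
    have : 0 ≤ β * PE x ^ 2 * (t - s) * ((x ^ β - c ^ β) * (x - c)) / ((x + t) * (x + s) * (c + t)) := pz
    linarith
  rw [e2, integral_sub a1 (a2.const_mul _), icm, hc] at key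
  change 0 ≤ Hst β (P N) t - RN β P N s * Ist β (P N) t at key
  rw [RN, RN, le_div_iff₀ hI]
  rw [RN] at key; linarith
lemma RN_mvt {s t : ℝ} (hs : 0 < s) (hst : s < t) (hP : ONP β P) (N : ℕ) :
    RN β P N s * log (t / s) ≤ log (KN β P N t) - log (KN β P N s) ∧
    log (KN β P N t) - log (KN β P N s) ≤ RN β P N t * log (t / s) := by
  have ht : 0 < t := lz
  have hl : log s < log t := log_lt_log hs hst
  have hd : ∀ θ, HasDerivAt (fun θ ↦ log (KN β P N (exp θ))) (RN β P N (exp θ)) θ := by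
    intro θ
    have := (logK_deriv hβ (exp_pos θ) hP N).comp θ (Real.hasDerivAt_exp θ)
    refine HasDerivAt.congr_deriv (f := fun θ ↦ log (KN β P N (exp θ))) this ?_
    have := exp_pos θ
    field_simp
  obtain ⟨θ, ⟨h1, h2⟩, h3⟩ := exists_hasDerivAt_eq_slope (fun θ ↦ log (KN β P N (exp θ))) (fun θ ↦ RN β P N (exp θ)) hl
    (fun θ _ ↦ (hd θ).continuousAt.continuousWithinAt) (fun θ _ ↦ hd θ)
  have hp : 0 < log t - log s := lz
  rw [eq_div_iff hp.ne', exp_log hs, exp_log ht] at h3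
  rw [log_div ht.ne' hs.ne', ← h3]
  have m1 := RN_mono hβ hs (t := exp θ) (by rw [← exp_log hs]; exact exp_le_exp.2 h1.le) hP N
  have m2 := RN_mono hβ (exp_pos θ) (t := t) (by rw [← exp_log ht]; exact exp_le_exp.2 h2.le) hP N
  exact ⟨by gcongr, by gcongr⟩
omit hβ
lemma ars_mvt {z w : ℝ} (hz : 0 < z) (hw : z < w) :
    1/2 * √(z / (1 + z)) * log (w / z) ≤ arsinh (√w) - arsinh (√z) ∧
    arsinh (√w) - arsinh (√z) ≤ 1/2 * √(w / (1 + w)) * log (w / z) := by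
  have hw0 : 0 < w := hz.trans hw
  have hl : log z < log w := log_lt_log hz hw
  have hd : ∀ θ, HasDerivAt (fun θ ↦ arsinh (exp (θ / 2))) (hlf * √(exp θ / (1 + exp θ))) θ := by
    intro θ
    have := ((hasDerivAt_arsinh (exp (θ / 2))).comp θ (((hasDerivAt_id θ).div_const 2).exp))
    refine HasDerivAt.congr_deriv (f := fun θ ↦ arsinh (exp (θ / 2))) this ?_
    have e : exp θ = exp (θ / 2) ^ 2 := by rw [← exp_nat_mul]; congr 1; push_cast; ring
    rw [e, sqrt_div pz, sqrt_sq (exp_pos _).le]; simp only [id]; ring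
  have he : ∀ y : ℝ, 0 < y → exp (log y / 2) = √y := fun y hy ↦ by
    rw [sqrt_eq_rpow, rpow_def_of_pos hy]; ring_nf
  obtain ⟨θ, ⟨h1, h2⟩, h3⟩ := exists_hasDerivAt_eq_slope (fun θ ↦ arsinh (exp (θ / 2))) _ hl
    (fun θ _ ↦ (hd θ).continuousAt.continuousWithinAt) (fun θ _ ↦ hd θ)
  have hp : 0 < log w - log z := lz
  rw [eq_div_iff hp.ne', he _ hz, he _ hw0] at h3
  rw [log_div hw0.ne' hz.ne', ← h3]
  have a1 : z < exp θ := by rw [← exp_log hz]; exact exp_lt_exp.2 h1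
  have a2 : exp θ < w := by rw [← exp_log hw0]; exact exp_lt_exp.2 h2
  have m : ∀ x y : ℝ, 0 < x → x < y → x / (1 + x) ≤ y / (1 + y) := fun x y hx hy ↦ by
    rw [div_le_div_iff₀ lz lz]; nlinarith
  have n1 := sqrt_le_sqrt (m _ _ hz a1)
  have n2 := sqrt_le_sqrt (m _ _ (exp_pos θ) a2)
  exact ⟨by gcongr, by gcongr⟩
def Dk (β κ : ℝ) : ℝ := 2 * β * √κ * Jk β κ
include hβ hκ
lemma Dk_mH :
    Integrable (fun u ↦ √(κ / ukp)) (mH β) ∧ ∫ u, √(κ / ukp) ∂(mH β) = Dk β κ / 2 := by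
  have hβ0 : 0 < β := lz
  have e : ∀ u ∈ J01, β * √κ * (u ^ bm1 / √ukp) = β * u ^ bm1 * √(κ / ukp) := by
    intro u hu
    rw [sqrt_div hκ.le]; ring
  have hi := (Jk_int hβ hκ).const_mul (β * √κ)
  constructor
  · rw [mH_integrable hβ0]
    exact (integrableOn_congr_fun e mIoo).1 hi
  · rw [mH_integral hβ0, ← setIntegral_congr_fun mIoo e, icm, Dk, Jk]; ring
lemma eK_mvt {Λ : ℝ} (hΛ : 1 < Λ) :
    log Λ * Dk β κ ≤ eK β (Λ * κ) - eK β κ ∧ eK β (Λ * κ) - eK β κ ≤ log Λ * Dk β (Λ * κ) := by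
  have hΛ0 : 0 < Λ := lz
  have hκ' : 0 < Λ * κ := pz
  obtain ⟨a1, a2⟩ := Dk_mH hβ hκ
  obtain ⟨b1, b2⟩ := Dk_mH hβ hκ'
  have c1 := (eK_eq hβ hκ).1
  have c2 := (eK_eq hβ hκ').1
  have e : eK β (Λ * κ) - eK β κ = ∫ u, (4 * arsinh (√(Λ * κ / u)) - 4 * arsinh (√(κ / u))) ∂(mH β) := by
    rw [integral_sub (c2.const_mul 4) (c1.const_mul 4)]; rfl
  have f1 : log Λ * Dk β κ = ∫ u, 2 * log Λ * √(κ / ukp) ∂(mH β) := by rw [icm, a2]; ring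
  have f2 : log Λ * Dk β (Λ * κ) = ∫ u, 2 * log Λ * √(Λ * κ / (u + Λ * κ)) ∂(mH β) := by rw [icm, b2]; ring
  have key : ∀ u ∈ J01, 2 * log Λ * √(κ / ukp) ≤ 4 * arsinh (√(Λ * κ / u)) - 4 * arsinh (√(κ / u)) ∧
      4 * arsinh (√(Λ * κ / u)) - 4 * arsinh (√(κ / u)) ≤ 2 * log Λ * √(Λ * κ / (u + Λ * κ)) := by
    intro u hu
    have hu0 := hu.1
    obtain ⟨h1, h2⟩ := ars_mvt (z := κ / u) (w := Λ * κ / u) pz (by gcongr; nlinarith)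
    have g1 : Λ * κ / u / (κ / u) = Λ := by field_simp
    have g2 : κ / u / (1 + κ / u) = κ / ukp := by field_simp
    have g3 : Λ * κ / u / (1 + Λ * κ / u) = Λ * κ / (u + Λ * κ) := by field_simp
    rw [g1, g2] at h1; rw [g1, g3] at h2
    constructor <;> linarith
  rw [e, f1, f2]
  exact ⟨integral_mono_ae (a1.const_mul _) ((c2.const_mul 4).sub (c1.const_mul 4)) ((mH_ae β).mono fun u hu ↦ (key u hu).1),
    integral_mono_ae ((c2.const_mul 4).sub (c1.const_mul 4)) (b1.const_mul _) ((mH_ae β).mono fun u hu ↦ (key u hu).2)⟩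
lemma Jk_anti {κ' : ℝ} (h : κ ≤ κ') : Jk β κ' ≤ Jk β κ := by
  refine setIntegral_mono_on (Jk_int hβ lz) (Jk_int hβ hκ) mIoo fun u hu ↦ ?_
  have := hu.1
  gcongr
lemma Jk_ge : 1 / (β * √(1 + κ)) ≤ Jk β κ := by
  have hβ0 : 0 < β := lz
  obtain ⟨h1, h2⟩ := rpow_int01 hβ0
  calc 1 / (β * √(1 + κ)) = ∫ u in J01, u ^ bm1 / √(1 + κ) := by
        rw [integral_div, h2]; field_simp
    _ ≤ Jk β κ := setIntegral_mono_on (h1.div_const _) (Jk_int hβ hκ) mIoo fun u hu ↦ by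
        have := hu.1
        have : u ≤ 1 := hu.2.le
        gcongr
lemma Jk_le : Jk β κ ≤ 1 / bmh := by
  obtain ⟨h1, h2⟩ := rpow_int01 (β := β - hlf) lz
  rw [← h2]
  refine setIntegral_mono_on (Jk_int hβ hκ) h1 mIoo fun u hu ↦ ?_
  have := hu.1
  rw [show β - hlf - 1 = bm1 - hlf by ring, rpow_sub this bm1, ← sqrt_eq_rpow]
  gcongr
  linarith
lemma Dk_ge : 2 * √κ / √(1 + κ) ≤ Dk β κ := by
  have hβ0 : 0 < β := lz
  have := mul_le_mul_of_nonneg_left (Jk_ge hβ hκ) (show 0 ≤ 2 * β * √κ by positivity)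
  rw [Dk]; refine le_trans (le_of_eq ?_) this
  field_simp
lemma Dk_scale {Λ : ℝ} (hΛ : 1 ≤ Λ) : Dk β (Λ * κ) ≤ √Λ * Dk β κ := by
  have hβ0 : 0 < β := lz
  have := Jk_anti hβ hκ (show κ ≤ Λ * κ by nlinarith)
  rw [Dk, Dk, sqrt_mul lz]
  calc 2 * β * (√Λ * √κ) * Jk β (Λ * κ) ≤ 2 * β * (√Λ * √κ) * Jk β κ := by gcongr
    _ = _ := by ring
omit hκ
include hσ hP
lemma KN_pos (N : ℕ) : 0 < KN β P N σ :=
  div_pos (by have := onp_ne hβ hσ hP N; positivity) (Ist_pos hβ hσ (onp_ne0 hP N))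
lemma KN_upper {κ₁ : ℝ} {N : ℕ} (hN : 0 < N)
    (hκ : σ ≤ κ₁ * bbN) : log (KN β P N σ) - EN β N σ ≤ 2 * log (√(1 + κ₁) + √κ₁) := by
  have hb := bN_pos hβ (x := N) (by exact_mod_cast hN)
  have hI := Ist_pos hβ hσ (onp_ne0 hP N)
  have hκ0 : 0 < κ₁ := by by_contra h; nlinarith
  have h := U1c hβ (sqrt_pos.2 hσ) (sq_sqrt hσ.le).symm hN (P N) 0 (hP.1 N).le (Or.inl rfl) 1 0
  have h1 : KN β P N σ ≤ exp (EN β N σ) / π * Tb (bbN) σ ^ 2 := by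
    rw [KN, div_le_iff₀ hI]; simpa using h
  have h2 : Tb (bbN) σ ≤ √(1 + κ₁) + √κ₁ := by
    rw [Tb, div_le_iff₀ pz, add_mul, ← sqrt_mul pz, ← sqrt_mul hκ0.le]
    gcongr; linarith
  have h0 : 0 < Tb (bbN) σ := by linarith [Tb_ge hb hσ]
  have h3 : KN β P N σ ≤ exp (EN β N σ) * (√(1 + κ₁) + √κ₁) ^ 2 := by
    refine h1.trans ?_
    have : exp (EN β N σ) / π ≤ exp (EN β N σ) := div_le_self (exp_pos _).le (by linarith [pi_gt_three])
    gcongr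
  have := log_le_log (KN_pos hβ hσ hP N) h3
  rw [log_mul (exp_pos _).ne' pz, log_exp, log_pow] at this
  push_cast at this; linarith
omit hσ hP
lemma KN_lower : ∃ c > 0, ∀ P : ℕ → RX, ONP β P → ∀ σ > 0, ∀ N : ℕ, 2 ≤ N →
    EN β N σ - log (KN β P N σ) ≤ eK β (σ / bbN) + log (c * N ^ 4 * bbN / σ) := by
  obtain ⟨c, hc, h⟩ := Gpoly hβ
  refine ⟨c, hc, fun P hP σ hσ N hN ↦ ?_⟩
  obtain ⟨n, rfl⟩ : ∃ n, N = n + 1 := ⟨N - 1, oz⟩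
  have hb := bN_pos hβ (x := (n + 1 : ℕ)) pz
  set b := bN β (n + 1 : ℕ)
  obtain ⟨G, g1, g2, g3, g4⟩ := h n oz b hb (by rw [bN_eq hβ pz]; push_cast; ring)
  have g5 := g4 (σ / b) pz
  rw [div_mul_cancel₀ _ hb.ne'] at g5
  have hI := Ist_pos hβ hσ (onp_ne0 hP (n + 1))
  have hG := Ist_pos hβ hσ g1.ne_zero
  have k1 := onp_E1 hβ hσ hP (n + 1) G oz
  have k2 : G.eval (-σ) ^ 2 / Ist β G σ ≤ KN β P (n + 1) σ := by
    rw [KN, div_le_div_iff₀ hG hI]; exact k1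
  have k3 : Ist β G σ ≤ c * (n + 1 : ℕ) ^ 4 * b / σ * Lam β n b := by
    have : Ist β G σ ≤ ∫ x, G.eval x ^ 2 / σ ∂wB := by
      refine integral_mono_ae (wM_psq_div hβ hσ G) ((wM_psq hβ G).div_const σ) ((wM_ae β).mono fun x hx ↦ ?_)
      show G.eval x ^ 2 / xsg ≤ G.eval x ^ 2 / σ
      gcongr; linarith
    rw [integral_div] at this
    refine this.trans ?_
    rw [div_mul_eq_mul_div]
    gcongr
    refine g3.trans ?_
    have hL : 0 < Lam β n b := exp_pos _
    gcongr; omega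
  have hL : 0 < Lam β n b := exp_pos _
  have k4 : exp (n * eK β (σ / b)) / (c * (n + 1 : ℕ) ^ 4 * b / σ) ≤ KN β P (n + 1) σ := by
    refine le_trans ?_ k2
    rw [div_le_div_iff₀ pz hG]
    calc exp (n * eK β (σ / b)) * Ist β G σ ≤ exp (n * eK β (σ / b)) * (c * (n + 1 : ℕ) ^ 4 * b / σ * Lam β n b) := by gcongr
      _ = (Lam β n b * exp (n * eK β (σ / b))) * (c * (n + 1 : ℕ) ^ 4 * b / σ) := by ring
      _ ≤ _ := by gcongr
  have := log_le_log pz k4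
  rw [log_div (exp_pos _).ne' pz, log_exp] at this
  have e : EN β (n + 1) σ = n * eK β (σ / b) + eK β (σ / b) := by rw [EN]; push_cast; simp only [b]; push_cast; ring
  rw [e]; linarith
include hκ
lemma eK_le {κ₁ : ℝ} (h : κ ≤ κ₁) : eK β κ ≤ 4 * √κ₁ + 2 * √κ₁ * (1 / bmh) := by
  rw [(eK_eq hβ hκ).2]
  have h1 := arsinh_le_self (sqrt_nonneg κ)
  have h2 := sqrt_le_sqrt h
  have h3 := Jk_le hβ hκ
  have h4 : 0 ≤ 1 / bmh := by apply one_div_nonneg.2; linarith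
  have : √κ * Jk β κ ≤ √κ₁ * (1 / bmh) := (mul_le_mul_of_nonneg_left h3 (sqrt_nonneg _)).trans (by gcongr)
  linarith
omit hκ
lemma bNn_lim : Tendsto (fun N : ℕ ↦ bbN) atTop atTop := (bN_lim hβ).comp tendsto_natCast_atTop_atTop
lemma crude_lim (A B : ℝ) :
    Tendsto (fun N : ℕ ↦ (A + 4 * log N + B * log (bbN)) / (N / √(bbN))) atTop (𝓝 0) := by
  have hβ0 : 0 < β := lz
  have hm := m0_pos hβ
  set c := β * m0 β / 2
  have hc : 0 < c := pz
  have h0 : Tendsto (fun b : ℝ ↦ (A + 4 * log c) / c * b ^ (-bmh) + (4 * β + B) / c * (log b / b ^ bmh)) atTop (𝓝 0) := by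
    have h1 := (tendsto_rpow_neg_atTop (show 0 < β - hlf by linarith)).const_mul ((A + 4 * log c) / c)
    have h2 := ((isLittleO_log_rpow_atTop (show 0 < β - hlf by linarith)).tendsto_div_nhds_zero).const_mul ((4 * β + B) / c)
    simpa using h1.add h2
  refine (h0.comp (bNn_lim hβ)).congr' ?_
  filter_upwards [egt 0] with N hN
  have hb := bN_pos hβ (x := N) (by exact_mod_cast hN)
  have e : (N:ℝ) = c * bbN ^ β := by
    have := bN_eq hβ (x := N) pz
    simp only [c]; linarith
  simp only [Function.comp]
  have e2 : (N:ℝ) / √(bbN) = c * bbN ^ bmh := by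
    rw [rpow_sub hb, ← sqrt_eq_rpow, ← mul_div_assoc, ← e]
  have e3 : log N = log c + β * log (bbN) := by
    rw [e, log_mul hc.ne' pz, log_rpow hb, ← e]
  rw [e2, e3, rpow_neg hb.le]
  have : 0 < bbN ^ bmh := pz
  field_simp
  ring
include hP
lemma crude {σ₀ κ₁ ε : ℝ} (hσ : 0 < σ₀) (hε : 0 < ε) :
    ∀ᶠ N : ℕ in atTop, ∀ σ, σ₀ ≤ σ → σ ≤ κ₁ * bbN → |log (KN β P N σ) - EN β N σ| ≤ ε * (N * √(σ / bbN)) := by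
  obtain ⟨c, hc, hl⟩ := KN_lower hβ
  set M := 4 * √κ₁ + 2 * √κ₁ * (1 / bmh)
  have l1 := crude_lim hβ (2 * log (√(1 + κ₁) + √κ₁)) 0
  have l2 := crude_lim hβ (M + log c - log σ₀) 1
  have hs : 0 < √σ₀ := sqrt_pos.2 hσ
  filter_upwards [l1.eventually (gt_mem_nhds (show 0 < ε * √σ₀ by positivity)),
    l2.eventually (gt_mem_nhds (show 0 < ε * √σ₀ by positivity)), eventually_ge_atTop 2] with N h1 h2 hN σ s1 s2
  have hN0 : zr < N := pz
  have hb := bN_pos hβ hN0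
  have hσ' : 0 < σ := lz
  have hq : 0 < (N:ℝ) / √(bbN) := pz
  rw [div_lt_iff₀ hq] at h1 h2
  have hfin : ε * √σ₀ * (N / √(bbN)) ≤ ε * (N * √(σ / bbN)) := by
    rw [sqrt_div hσ'.le, mul_assoc]
    have : √σ₀ ≤ √σ := sqrt_le_sqrt s1
    calc ε * (√σ₀ * (N / √(bbN))) ≤ ε * (√σ * (N / √(bbN))) := by gcongr
      _ = _ := by ring
  have hlN : 0 ≤ log N := log_nonneg (by exact_mod_cast (by omega : 1 ≤ N))
  rw [abs_le]
  constructor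
  · have a := hl P hP σ hσ' N hN
    have a2 := eK_le hβ (κ := σ / bbN) (κ₁ := κ₁) pz (by rwa [div_le_iff₀ hb])
    rw [log_div pz hσ'.ne', log_mul pz hb.ne', log_mul hc.ne' pz, log_pow] at a
    push_cast at a
    have : log σ₀ ≤ log σ := log_le_log hσ s1
    linarith
  · have := KN_upper hβ hσ' hP (by omega : 0 < N) s2
    linarith
omit hβ hP
lemma alg_up {R L N ε D D1 e : ℝ} (hL : 0 < L) (hN : 0 ≤ N) (_hε : 0 ≤ ε) (h1 : e ≤ L * D1) (h2 : D1 ≤ (1 + ε / 2) * D)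
    (h : R * L ≤ N * e + 2 * (ε * L / 4 * (N * D))) : R ≤ (1 + ε) * (N * D) := by
  have h3 : N * e ≤ N * (L * ((1 + ε / 2) * D)) := by gcongr; exact h1.trans (by gcongr)
  refine le_of_mul_le_mul_right ?_ hL
  linarith
lemma alg_lo {R L N ε D D1 e : ℝ} (hL : 0 < L) (hN : 0 ≤ N) (hε : 0 < ε) (hD : 0 < D) (hD1 : 0 ≤ D1) (h1 : L * D1 ≤ e)
    (h2 : D ≤ (1 + ε / 2) * D1)
    (h : N * e - 2 * (ε * L / 4 * (N * D)) ≤ R * L) : (1 - ε) * (N * D) ≤ R := by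
  have d3 : (1 - ε / 2) * D ≤ D1 := by
    rcases le_total (1 - ε / 2) 0 with h | h
    · exact le_trans (mul_nonpos_of_nonpos_of_nonneg h hD.le) hD1
    · nlinarith [mul_le_mul_of_nonneg_left h2 h, sq_nonneg ε]
  have h3 : N * (L * ((1 - ε / 2) * D)) ≤ N * e := by gcongr; exact le_trans (by gcongr) h1
  refine le_of_mul_le_mul_right ?_ hL
  linarith
include hβ hP
lemma R_unif {σ₀ κ₁ ε : ℝ} (hσ : 0 < σ₀) (hκ : 0 < κ₁) (hε : 0 < ε) :
    ∀ᶠ N : ℕ in atTop, ∀ σ, σ₀ ≤ σ → σ ≤ κ₁ * bbN →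
      |RN β P N σ - N * Dk β (σ / bbN)| ≤ ε * (N * Dk β (σ / bbN)) := by
  obtain ⟨Λ, hΛ, hΛ2⟩ : ∃ Λ : ℝ, 1 < Λ ∧ √Λ = 1 + ε / 2 := ⟨(1 + ε / 2) ^ 2, by nlinarith, sqrt_sq lz⟩
  have hΛ0 : 0 < Λ := lz
  have hL : 0 < log Λ := log_pos hΛ
  set η := ε * log Λ / (4 * √(1 + κ₁ * Λ) * √Λ) with hη
  have hη0 : 0 < η := pz
  filter_upwards [crude hβ hP (σ₀ := σ₀ / Λ) (κ₁ := κ₁ * Λ) (ε := η) pz hη0,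
    egt 0] with N hN hN1 σ s1 s2
  have hN0 : zr < N := pz
  have hb := bN_pos hβ hN0
  have hσ' : 0 < σ := lz
  set b := bbN
  have hκ' : 0 < σ / b := pz
  set κ := σ / b
  have hκ1 : κ ≤ κ₁ := by rw [div_le_iff₀ hb]; exact s2
  have hD := Dk_ge hβ hκ'
  have hD0 : 0 < Dk β κ := lt_of_lt_of_le pz hD
  have er : ∀ τ, σ / Λ ≤ τ → τ ≤ Λ * σ → |log (KN β P N τ) - EN β N τ| ≤ ε * log Λ / 4 * (N * Dk β κ) := by
    intro τ t1 t2
    have hτ : 0 < τ := lt_of_lt_of_le pz t1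
    refine (hN τ ?_ ?_).trans ?_
    · refine le_trans ?_ t1; gcongr
    · refine t2.trans ?_; nlinarith
    · have w1 : √(τ / b) ≤ √Λ * √κ := by
        rw [← sqrt_mul hΛ0.le]; refine sqrt_le_sqrt ?_
        rw [div_le_iff₀ hb, mul_assoc, div_mul_cancel₀ _ hb.ne']; exact t2
      have w2 : √κ ≤ √(1 + κ₁ * Λ) * Dk β κ := by
        have : √(1 + κ) ≤ √(1 + κ₁ * Λ) := sqrt_le_sqrt (by nlinarith)
        rw [div_le_iff₀ pz] at hD
        have : Dk β κ * √(1 + κ) ≤ Dk β κ * √(1 + κ₁ * Λ) := by gcongr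
        linarith [sqrt_nonneg κ]
      calc η * (N * √(τ / b)) ≤ η * (N * (√Λ * (√(1 + κ₁ * Λ) * Dk β κ))) := by
            gcongr; exact w1.trans (by gcongr)
        _ = _ := by rw [hη]; field_simp
  have e0 := abs_le.1 (er σ (div_le_self hσ'.le hΛ.le) (by nlinarith))
  have e1 := abs_le.1 (er (Λ * σ) ((div_le_self hσ'.le hΛ.le).trans (by nlinarith)) le_rfl)
  have e2 := abs_le.1 (er (σ / Λ) le_rfl ((div_le_self hσ'.le hΛ.le).trans (by nlinarith)))
  have m1 := (RN_mvt hβ hσ' (t := Λ * σ) (by nlinarith) hP N).1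
  have m2 := (RN_mvt hβ (s := σ / Λ) (t := σ) pz (div_lt_self hσ' hΛ) hP N).2
  rw [show Λ * σ / σ = Λ by field_simp] at m1
  rw [show σ / (σ / Λ) = Λ by field_simp] at m2
  have k1 := (eK_mvt hβ hκ' hΛ).2
  have k2 := (eK_mvt hβ (κ := κ / Λ) pz hΛ).1
  rw [show Λ * (κ / Λ) = κ by field_simp] at k2
  have d1 := Dk_scale hβ hκ' hΛ.le
  have d2 := Dk_scale hβ (κ := κ / Λ) pz hΛ.le
  rw [show Λ * (κ / Λ) = κ by field_simp] at d2
  rw [hΛ2] at d1 d2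
  have f0 : EN β N σ = N * eK β κ := rfl
  have f1 : EN β N (Λ * σ) = N * eK β (Λ * κ) := by rw [EN]; congr 2; simp only [κ, b]; ring
  have f2 : EN β N (σ / Λ) = N * eK β (κ / Λ) := by rw [EN]; congr 2; simp only [κ, b]; ring
  rw [f0] at e0; rw [f1] at e1; rw [f2] at e2
  have v1 := alg_up hL hN0.le lz k1 d1 (m1.trans (by linarith [e0.1, e1.2]))
  have v2 := alg_lo hL hN0.le hε hD0 (le_trans pz (Dk_ge hβ pz)) k2 d2 (le_trans (by linarith [e0.1, e2.2]) m2)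
  rw [abs_le]; constructor <;> linarith
omit hβ hP
lemma pow_st_deriv {ν : Measure ℝ} [IsFiniteMeasure ν] (h0 : ∀ᵐ x ∂ν, 0 ≤ x) (n : ℕ) (hσ : 0 < σ) :
    HasDerivAt (fun s ↦ ∫ x, ((x + s) ^ n)⁻¹ ∂ν) (∫ x, -(n:ℝ) * (xsg ^ (n + 1))⁻¹ ∂ν) σ := by
  refine (hasDerivAt_integral_of_dominated_loc_of_deriv_le (μ := ν) (F := fun s x ↦ ((x + s) ^ n)⁻¹)
    (F' := fun s x ↦ -(n:ℝ) * ((x + s) ^ (n + 1))⁻¹) (x₀ := σ) (s := Metric.ball σ (σ / 2)) (bound := fun x ↦ n * ((σ / 2) ^ (n + 1))⁻¹)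
    (Metric.ball_mem_nhds _ pz)
    (by filter_upwards with s; exact mas fz)
    (Integrable.of_bound (mas fz) ((σ ^ n)⁻¹) ?_)
    (mas fz) ?_ (icn _) ?_).2
  · filter_upwards [h0] with x hx
    rw [nonn pz]
    gcongr; linarith
  · filter_upwards [h0] with x hx s hs
    have : σ / 2 < s := by rw [Metric.mem_ball, Real.dist_eq, abs_lt] at hs; linarith
    have h2 : 0 < x + s := lz
    rw [norm_mul, norm_neg, nonn (n.cast_nonneg), nonn pz]
    gcongr; linarith
  · filter_upwards [h0] with x hx s hs
    have : σ / 2 < s := by rw [Metric.mem_ball, Real.dist_eq, abs_lt] at hs; linarith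
    have hne : x + s ≠ 0 := lz
    have d := (((hasDerivAt_id s).const_add x).pow n).inv (pow_ne_zero n hne)
    refine HasDerivAt.congr_deriv (f := fun s ↦ ((x + s) ^ n)⁻¹) d ?_
    rcases n with _ | n
    · simp
    · simp; field_simp; ring
lemma st_moments {ν ν' : Measure ℝ} [IsFiniteMeasure ν] [IsFiniteMeasure ν'] (h0 : ∀ᵐ x ∂ν, 0 ≤ x) (h0' : ∀ᵐ x ∂ν', 0 ≤ x)
    (h : ∀ κ > 0, ∫ x, (x + κ)⁻¹ ∂ν = ∫ x, (x + κ)⁻¹ ∂ν') (n : ℕ) :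
    ∀ κ > 0, ∫ x, ((x + κ) ^ (n + 1))⁻¹ ∂ν = ∫ x, ((x + κ) ^ (n + 1))⁻¹ ∂ν' := by
  induction n with
  | zero => simpa using h
  | succ n ih =>
    intro κ hκ
    have d1 := pow_st_deriv h0 (n + 1) hκ
    have d2 := pow_st_deriv h0' (n + 1) hκ
    have e : (fun s ↦ ∫ x, ((x + s) ^ (n + 1))⁻¹ ∂ν) =ᶠ[𝓝 κ] fun s ↦ ∫ x, ((x + s) ^ (n + 1))⁻¹ ∂ν' := by
      filter_upwards [lt_mem_nhds hκ] with s hs using ih s hs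
    have := (d1.congr_of_eventuallyEq e.symm).unique d2
    rw [icm, icm] at this
    exact mul_left_cancel₀ (neg_ne_zero.2 pz) this
def phiB : BoundedContinuousFunction NNReal ℝ :=
  BoundedContinuousFunction.ofNormedAddCommGroup (fun x : NNReal ↦ ((x:ℝ) + 1)⁻¹)
    (Continuous.inv₀ fz (fun x ↦ by positivity)) 1
    (fun x ↦ by rw [nonn pz]; exact inv_le_one_of_one_le₀ (by linarith [x.coe_nonneg]))
lemma st_unique {ν ν' : Measure ℝ} [IsFiniteMeasure ν] [IsFiniteMeasure ν'] (h0 : ∀ᵐ x ∂ν, 0 ≤ x) (h0' : ∀ᵐ x ∂ν', 0 ≤ x)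
    (h1 : ν Set.univ = ν' Set.univ)
    (h : ∀ κ > 0, ∫ x, (x + κ)⁻¹ ∂ν = ∫ x, (x + κ)⁻¹ ∂ν') : ν = ν' := by
  have hm : Measurable Real.toNNReal := measurable_real_toNNReal
  have hfin : ∀ m : Measure ℝ, IsFiniteMeasure m → IsFiniteMeasure (m.map Real.toNNReal) := fun m _ ↦ inferInstance
  let A : StarSubalgebra ℝ (BoundedContinuousFunction NNReal ℝ) :=
    { (aeval phiB : RX →ₐ[ℝ] BoundedContinuousFunction NNReal ℝ).range with
      star_mem' := fun {a} ha ↦ by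
        have : star a = a := by ext x; simp
        rw [this]; exact ha }
  have hpow : ∀ n : ℕ, ∫ x, (phiB ^ n) x ∂(ν.map Real.toNNReal) = ∫ x, (phiB ^ n) x ∂(ν'.map Real.toNNReal) := by
    intro n
    have key : ∀ m : Measure ℝ, (∀ᵐ x ∂m, 0 ≤ x) → ∫ x, (phiB ^ n) x ∂(m.map Real.toNNReal) = ∫ x, ((x + 1) ^ n)⁻¹ ∂m := by
      intro m hm0
      rw [integral_map hm.aemeasurable (phiB ^ n).continuous.aestronglyMeasurable]
      refine icae ?_
      filter_upwards [hm0] with x hx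
      simp [phiB, Real.coe_toNNReal x hx]
    rw [key ν h0, key ν' h0']
    rcases n with _ | n
    · simp [Measure.real, h1]
    · exact st_moments h0 h0' h n 1 one_pos
  have hEq : ν.map Real.toNNReal = ν'.map Real.toNNReal := by
    refine ext_of_forall_mem_subalgebra_integral_eq_of_polish (𝕜 := ℝ) (A := A) ?_ ?_
    · intro x y hxy
      refine ⟨_, ⟨BoundedContinuousFunction.toContinuousMap phiB, ⟨phiB, ⟨X, sz⟩, rfl⟩, rfl⟩, ?_⟩
      simp only [phiB, BoundedContinuousFunction.coe_toContinuousMap, BoundedContinuousFunction.coe_ofNormedAddCommGroup]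
      intro he
      apply hxy
      have := inv_injective he
      exact_mod_cast add_right_cancel this
    · rintro g ⟨p, rfl⟩
      have e : ∀ x, (aeval phiB p : BoundedContinuousFunction NNReal ℝ) x = ∑ i ∈ range (p.natDegree + 1), p.coeff i * (phiB ^ i) x := by
        intro x
        rw [aeval_eq_sum_range]
        simp [BoundedContinuousFunction.coe_sum]
      have key : ∀ m : Measure NNReal, IsFiniteMeasure m → ∫ x, (aeval phiB p : BoundedContinuousFunction NNReal ℝ) x ∂m =
          ∑ i ∈ range (p.natDegree + 1), p.coeff i * ∫ x, (phiB ^ i) x ∂m := by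
        intro m _
        simp_rw [e]
        rw [integral_finsetSum _ fun i _ ↦ ((phiB ^ i).integrable m).const_mul _]
        simp_rw [icm]
      change ∫ x, (aeval phiB p : BoundedContinuousFunction NNReal ℝ) x ∂_ = ∫ x, (aeval phiB p : BoundedContinuousFunction NNReal ℝ) x ∂_
      rw [key _ (hfin ν inferInstance), key _ (hfin ν' inferInstance)]
      simp_rw [hpow]
  have back : ∀ m : Measure ℝ, (∀ᵐ x ∂m, 0 ≤ x) → (m.map Real.toNNReal).map (fun x : NNReal ↦ (x:ℝ)) = m := by
    intro m hm0
    rw [Measure.map_map fz hm]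
    calc m.map _ = m.map id := Measure.map_congr (by filter_upwards [hm0] with x hx; simp [hx])
      _ = m := Measure.map_id
  rw [← back ν h0, ← back ν' h0', hEq]
def sl (β x y : ℝ) : ℝ := (y ^ β - x ^ β) / (y - x)
lemma sl_comm (β x y : ℝ) : sl β x y = sl β y x := by
  rw [sl, sl, ← neg_div_neg_eq, neg_sub, neg_sub]
lemma sl_pos {x y : ℝ} (hβ : 0 < β) (hx : 0 ≤ x) (hy : 0 ≤ y) (hne : x ≠ y) : 0 < sl β x y := by
  rcases lt_or_gt_of_ne hne with h | h
  · exact div_pos (sub_pos.2 (rpow_lt_rpow hx h hβ)) (sub_pos.2 h)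
  · exact div_pos_of_neg_of_neg (sub_neg.2 (rpow_lt_rpow hy h hβ)) (sub_neg.2 h)
lemma sl_nonneg {x y : ℝ} (hβ : 0 < β) (hx : 0 ≤ x) (hy : 0 ≤ y) : 0 ≤ sl β x y := by
  rcases eq_or_ne x y with h | h
  · simp [sl, h]
  · exact (sl_pos hβ hx hy h).le
lemma sl_le_aux {m M : ℝ} (hβ : 0 < β) (hm : 0 ≤ m) (h : m < M) : sl β m M ≤ max β 1 * M ^ bm1 := by
  have hM : 0 < M := lz
  have hMp : 0 < M ^ bm1 := pz
  have e : M ^ β = M * M ^ bm1 := by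
    nth_rewrite 2 [← rpow_one M]; rw [← rpow_add hM]; ring_nf
  rw [sl, div_le_iff₀ lz]
  rcases le_total β 1 with h1 | h1
  · rw [max_eq_right h1]
    have : m * M ^ bm1 ≤ m ^ β := by
      rcases hm.eq_or_lt with h0 | h0
      · rw [← h0]; simp [zero_rpow hβ.ne']
      · have e2 : m ^ β = m * m ^ bm1 := by
          nth_rewrite 2 [← rpow_one m]; rw [← rpow_add h0]; ring_nf
        rw [e2]; gcongr 1
        exact rpow_le_rpow_of_nonpos h0 h.le lz
    nlinarith
  · rw [max_eq_left h1]
    have b := one_add_mul_self_le_rpow_one_add (s := m / M - 1) (by linarith [div_nonneg hm hM.le]) h1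
    rw [show 1 + (m / M - 1) = m / M by ring, div_rpow hm hM.le, le_div_iff₀ pz, e] at b
    have : (1 + β * (m / M - 1)) * (M * M ^ bm1) = M * M ^ bm1 + β * (m - M) * M ^ bm1 := by
      field_simp
    nlinarith
lemma sl_le {x y : ℝ} (hβ : 0 < β) (hx : 0 < x) (hx1 : x < 1) (hy : 0 ≤ y) :
    sl β x y ≤ max β 1 * (x ^ bm1 + (1 + y ^ β)) := by
  have hy' : 0 ≤ y ^ β := pz
  have hx' : 0 < x ^ bm1 := pz
  have hb : 0 < max β 1 := lt_max_of_lt_left hβ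
  have key : ∀ M, x ≤ M → M ≤ max 1 y → M ^ bm1 ≤ x ^ bm1 + (1 + y ^ β) := by
    intro M h1 h2
    rcases le_total β 1 with h | h
    · have := rpow_le_rpow_of_nonpos hx h1 (by linarith : β - 1 ≤ 0)
      linarith
    · have : M ^ bm1 ≤ (max 1 y) ^ bm1 := by gcongr; linarith
      have h3 : (max 1 y) ^ bm1 ≤ (max 1 y) ^ β := rpow_le_rpow_of_exponent_le (le_max_left _ _) lz
      have h4 : (max 1 y) ^ β ≤ 1 + y ^ β := by
        rcases max_cases 1 y with ⟨h, _⟩ | ⟨h, _⟩ <;> rw [h]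
        · rw [one_rpow]; linarith
        · linarith
      linarith
  rcases lt_trichotomy x y with h | h | h
  · exact (sl_le_aux hβ hx.le h).trans (by gcongr; exact key y h.le (le_max_right _ _))
  · rw [h, sl]; simp only [sub_self, zero_div]; rw [← h] at *; positivity
  · rw [sl_comm]
    exact (sl_le_aux hβ hy h).trans (by gcongr; exact key x le_rfl (hx1.le.trans (le_max_left _ _)))
lemma sl_meas (β : ℝ) : Measurable (fun p : ℝ × ℝ ↦ sl β p.1 p.2) := by unfold sl; fun_prop
def GM (β : ℝ) (μ : Measure ℝ) : Measure (ℝ × ℝ) := (arcM.prod μ).withDensity (fun p ↦ ofReal (sl β p.1 p.2))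
include hβ
lemma sl_int {μ : Measure ℝ} [IsProbabilityMeasure μ] (h0 : ∀ᵐ y ∂μ, 0 ≤ y)
    (hi : Integrable (fun y ↦ y ^ β) μ) : Integrable (fun p : ℝ × ℝ ↦ sl β p.1 p.2) (arcM.prod μ) := by
  have hβ0 : 0 < β := lz
  have i1 : Integrable (fun p : ℝ × ℝ ↦ p.1 ^ bm1) (arcM.prod μ) := (arc_rpow (β := β - 1) lz).1.comp_fst μ
  have i2 : Integrable (fun p : ℝ × ℝ ↦ 1 + p.2 ^ β) (arcM.prod μ) := ((icn (1:ℝ)).add hi).comp_snd arcM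
  refine Integrable.mono' ((i1.add i2).const_mul (max β 1)) (sl_meas β).aestronglyMeasurable ?_
  have a1 : ∀ᵐ p ∂(arcM.prod μ), p.1 ∈ J01 := Measure.quasiMeasurePreserving_fst.ae arc_ae
  have a2 : ∀ᵐ p ∂(arcM.prod μ), 0 ≤ p.2 := Measure.quasiMeasurePreserving_snd.ae h0
  filter_upwards [a1, a2] with p h1 h2
  rw [nonn (sl_nonneg hβ0 h1.1.le h2)]
  exact sl_le hβ0 h1.1 h1.2 h2
lemma GM_fin {μ : Measure ℝ} [IsProbabilityMeasure μ] (h0 : ∀ᵐ y ∂μ, 0 ≤ y)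
    (hi : Integrable (fun y ↦ y ^ β) μ) : IsFiniteMeasure (GM β μ) := by
  refine isFiniteMeasure_withDensity_ofReal (sl_int hβ h0 hi).2
lemma GM_integral {μ : Measure ℝ} [IsProbabilityMeasure μ] (h0 : ∀ᵐ y ∂μ, 0 ≤ y) (f : ℝ × ℝ → ℝ) :
    ∫ p, f p ∂(GM β μ) = ∫ p, sl β p.1 p.2 * f p ∂(arcM.prod μ) := by
  have hm := sl_meas β
  have a1 : ∀ᵐ p ∂(arcM.prod μ), p.1 ∈ J01 := Measure.quasiMeasurePreserving_fst.ae arc_ae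
  have a2 : ∀ᵐ p ∂(arcM.prod μ), 0 ≤ p.2 := Measure.quasiMeasurePreserving_snd.ae h0
  rw [GM, integral_withDensity_eq_integral_toReal_smul fz (ae_of_all _ fun _ ↦ ofReal_lt_top)]
  refine icae ?_
  filter_upwards [a1, a2] with p h1 h2
  rw [toReal_ofReal (sl_nonneg lz h1.1.le h2), smul_eq_mul]
omit hβ
lemma st_bd_int {μ : Measure ℝ} [IsFiniteMeasure μ] (h0 : ∀ᵐ y ∂μ, 0 ≤ y) (hκ : 0 < κ) {f : ℝ → ℝ} (hf : Integrable f μ) :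
    Integrable (fun y ↦ f y * ykp) μ := by
  have : Integrable (fun y ↦ ykp * f y) μ := Integrable.bdd_mul (c := κ⁻¹) hf (mas fz)
    (by filter_upwards [h0] with y hy
        rw [nonn pz]; gcongr; linarith)
  simpa only [mul_comm] using this
include hβ
lemma GM_marg {μ : Measure ℝ} [IsProbabilityMeasure μ] (h0 : ∀ᵐ y ∂μ, 0 ≤ y)
    (hi : Integrable (fun y ↦ y ^ β) μ)
    (hS : ∀ κ > 0, (∫ y, y ^ β * ykp ∂μ) * (∫ x, (x + κ)⁻¹ ∂arcM) = (∫ x, x ^ β * (x + κ)⁻¹ ∂arcM) * ∫ y, ykp ∂μ) :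
    (GM β μ).map Prod.fst = (GM β μ).map Prod.snd := by
  have := GM_fin hβ h0 hi
  have ac : GM β μ ≪ arcM.prod μ := withDensity_absolutelyContinuous _ _
  have a1 : ∀ᵐ p ∂(arcM.prod μ), p.1 ∈ J01 := Measure.quasiMeasurePreserving_fst.ae arc_ae
  have a2 : ∀ᵐ p ∂(arcM.prod μ), 0 ≤ p.2 := Measure.quasiMeasurePreserving_snd.ae h0
  have n1 : ∀ᵐ x ∂((GM β μ).map Prod.fst), 0 ≤ x := by
    rw [ae_map_iff measurable_fst.aemeasurable measurableSet_Ici]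
    exact ac.ae_le (a1.mono fun p h ↦ h.1.le)
  have n2 : ∀ᵐ x ∂((GM β μ).map Prod.snd), 0 ≤ x := by
    rw [ae_map_iff measurable_snd.aemeasurable measurableSet_Ici]
    exact ac.ae_le a2
  refine st_unique n1 n2 ?_ ?_
  · rw [Measure.map_apply measurable_fst MeasurableSet.univ, Measure.map_apply measurable_snd MeasurableSet.univ]; rfl
  · intro κ hκ
    have hA0 : ∀ᵐ x ∂arcM, 0 ≤ x := arc_ae.mono fun x h ↦ h.1.le
    have hmm : Measurable (fun x : ℝ ↦ (x + κ)⁻¹) := fz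
    rw [integral_map measurable_fst.aemeasurable hmm.aestronglyMeasurable,
      integral_map measurable_snd.aemeasurable hmm.aestronglyMeasurable, GM_integral hβ h0, GM_integral hβ h0, ← sub_eq_zero]
    have sI := sl_int hβ h0 hi
    have j1 : Integrable (fun p : ℝ × ℝ ↦ sl β p.1 p.2 * (p.1 + κ)⁻¹) (arcM.prod μ) := by
      refine sI.mul_bdd (c := κ⁻¹) (mas fz) ?_
      filter_upwards [a1] with p h
      have := h.1
      rw [nonn pz]; gcongr; linarith
    have j2 : Integrable (fun p : ℝ × ℝ ↦ sl β p.1 p.2 * (p.2 + κ)⁻¹) (arcM.prod μ) := by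
      refine sI.mul_bdd (c := κ⁻¹) (mas fz) ?_
      filter_upwards [a2] with p h
      rw [nonn pz]; gcongr; linarith
    rw [← integral_sub j1 j2]
    have c1 : Integrable (fun x : ℝ ↦ (x + κ)⁻¹) arcM := by
      simpa using st_bd_int hA0 hκ (icn (1:ℝ))
    have c2 : Integrable (fun x : ℝ ↦ (x + κ)⁻¹) μ := by
      simpa using st_bd_int h0 hκ (icn (1:ℝ))
    have c3 := st_bd_int hA0 hκ (arc_rpow (β := β) lz).1
    have c4 := st_bd_int h0 hκ hi
    have k1 : Integrable (fun p : ℝ × ℝ ↦ (p.1 + κ)⁻¹ * (p.2 ^ β * (p.2 + κ)⁻¹)) (arcM.prod μ) := c1.mul_prod c4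
    have k2 : Integrable (fun p : ℝ × ℝ ↦ (p.1 ^ β * (p.1 + κ)⁻¹) * (p.2 + κ)⁻¹) (arcM.prod μ) := c3.mul_prod c2
    calc _ = ∫ p : ℝ × ℝ, ((p.1 + κ)⁻¹ * (p.2 ^ β * (p.2 + κ)⁻¹) - (p.1 ^ β * (p.1 + κ)⁻¹) * (p.2 + κ)⁻¹) ∂(arcM.prod μ) := by
          refine icae ?_
          filter_upwards [a1, a2] with p h1 h2
          have h3 : p.1 + κ ≠ 0 := by linarith [h1.1]
          have h4 : p.2 + κ ≠ 0 := lz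
          rw [sl]
          rcases eq_or_ne p.1 p.2 with h | h
          · rw [h]; simp; ring
          · have h5 : p.2 - p.1 ≠ 0 := sub_ne_zero.2 h.symm
            field_simp; ring
      _ = _ := by
          rw [integral_sub k1 k2, integral_prod_mul (fun x : ℝ ↦ (x + κ)⁻¹) (fun y : ℝ ↦ y ^ β * ykp),
            integral_prod_mul (fun x : ℝ ↦ x ^ β * (x + κ)⁻¹) (fun y : ℝ ↦ ykp), ← hS κ hκ]; ring
lemma mu_ac {μ : Measure ℝ} [IsProbabilityMeasure μ] (h0 : ∀ᵐ y ∂μ, 0 ≤ y)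
    (hm : (GM β μ).map Prod.fst = (GM β μ).map Prod.snd) : μ ≪ arcM := by
  have hslm := sl_meas β
  refine Measure.AbsolutelyContinuous.mk fun s hs h ↦ ?_
  have ac : GM β μ ≪ arcM.prod μ := withDensity_absolutelyContinuous _ _
  have h1 : (GM β μ).map Prod.fst s = 0 := by
    rw [Measure.map_apply measurable_fst hs]
    refine ac ?_
    exact Measure.quasiMeasurePreserving_fst.preimage_null h
  rw [hm, Measure.map_apply measurable_snd hs, GM, withDensity_apply _ (measurable_snd hs),
    lintegral_eq_zero_iff fz] at h1
  have h2 := (ae_restrict_iff' (measurable_snd hs)).1 h1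
  have a1 : ∀ᵐ p ∂(arcM.prod μ), p.1 ∈ J01 := Measure.quasiMeasurePreserving_fst.ae arc_ae
  have a2 : ∀ᵐ p ∂(arcM.prod μ), 0 ≤ p.2 := Measure.quasiMeasurePreserving_snd.ae h0
  have hd : ∀ᵐ p ∂(arcM.prod μ), p.1 ≠ p.2 := by
    rw [← Measure.prod_swap, ae_map_iff measurable_swap.aemeasurable]
    · have hms : MeasurableSet {p : ℝ × ℝ | p.swap.1 ≠ p.swap.2} := (measurableSet_eq_fun fz fz).compl
      rw [Measure.ae_prod_iff_ae_ae hms]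
      filter_upwards with y
      have := arc_singleton y
      rw [ae_iff]; refine measure_mono_null (fun x hx ↦ ?_) this
      simpa using hx
    · exact (measurableSet_eq_fun fz fz).compl
  have h3 : ∀ᵐ p ∂(arcM.prod μ), p.2 ∉ s := by
    filter_upwards [h2, a1, a2, hd] with p e1 e2 e3 e4 e5
    have := e1 e5
    simp only [Pi.zero_apply, ENNReal.ofReal_eq_zero] at this
    exact absurd (sl_pos lz e2.1.le e3 e4) (not_lt.2 this)
  have h4 : (arcM.prod μ) (Set.univ ×ˢ s) = 0 := by
    refine measure_mono_null ?_ h3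
    intro p hp; simpa using hp.2
  rw [Measure.prod_prod] at h4
  simpa using h4
omit hβ
lemma psi_alg {a b : ℝ} (ha : 0 ≤ a) (hb : 0 ≤ b) : (b - a) * (b / (1 + b) - a / (1 + a)) = (b - a) ^ 2 / ((1 + a) * (1 + b)) := by
  have : 1 + a ≠ 0 := pz
  have : 1 + b ≠ 0 := pz
  field_simp; ring
include hβ
lemma mu_eq {μ : Measure ℝ} [IsProbabilityMeasure μ] (h0 : ∀ᵐ y ∂μ, 0 ≤ y)
    (hi : Integrable (fun y ↦ y ^ β) μ)
    (hm : (GM β μ).map Prod.fst = (GM β μ).map Prod.snd) : μ = arcM := by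
  have ac := mu_ac hβ h0 hm
  have hfin := GM_fin hβ h0 hi
  set ρ := μ.rnDeriv arcM with hρ
  have hρm : Measurable ρ := Measure.measurable_rnDeriv _ _
  have hρt : ∀ᵐ x ∂arcM, ρ x < ⊤ := Measure.rnDeriv_lt_top _ _
  have hμ : arcM.withDensity ρ = μ := Measure.withDensity_rnDeriv_eq _ _ ac
  set h : ℝ → ℝ := fun y ↦ (ρ y).toReal with hh
  have hhm : Measurable h := hρm.ennreal_toReal
  have hh0 : ∀ y, 0 ≤ h y := fun y ↦ ENNReal.toReal_nonneg
  set ψ : ℝ → ℝ := fun y ↦ h y / (1 + h y) with hψ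
  have hψm : Measurable ψ := fz
  have hψb : ∀ y, ‖ψ y‖ ≤ 1 := fun y ↦ by
    have := hh0 y
    rw [nonn pz]; exact (div_le_one pz).2 lz
  have hpr : arcM.prod μ = (arcM.prod arcM).withDensity (fun p ↦ ρ p.2) := by
    nth_rewrite 1 [← hμ]; exact prod_withDensity_right hρm
  have hρt2 : ∀ᵐ p ∂(arcM.prod arcM), ρ p.2 < ⊤ := Measure.quasiMeasurePreserving_snd.ae hρt
  have sI : Integrable (fun p : ℝ × ℝ ↦ h p.2 * sl β p.1 p.2) (arcM.prod arcM) := by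
    have := sl_int hβ h0 hi
    rw [hpr, integrable_withDensity_iff_integrable_smul' fz hρt2] at this
    exact this
  have hslm := sl_meas β
  have hz : ∫ p, sl β p.1 p.2 * (ψ p.1 - ψ p.2) ∂(arcM.prod μ) = 0 := by
    rw [← GM_integral hβ h0 (fun p ↦ ψ p.1 - ψ p.2), integral_sub, sub_eq_zero]
    · rw [← integral_map (φ := Prod.fst) (f := ψ) measurable_fst.aemeasurable hψm.aestronglyMeasurable, hm,
        integral_map measurable_snd.aemeasurable hψm.aestronglyMeasurable]
    · exact Integrable.of_bound (hψm.comp measurable_fst).aestronglyMeasurable 1 (ae_of_all _ fun p ↦ hψb p.1)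
    · exact Integrable.of_bound (hψm.comp measurable_snd).aestronglyMeasurable 1 (ae_of_all _ fun p ↦ hψb p.2)
  set F : ℝ × ℝ → ℝ := fun p ↦ h p.2 * sl β p.1 p.2 * (ψ p.1 - ψ p.2) with hF
  have hFi : Integrable F (arcM.prod arcM) := sI.mul_bdd (c := 2) fz
    (ae_of_all _ fun p ↦ (norm_sub_le _ _).trans (by linarith [hψb p.1, hψb p.2]))
  have hz1 : ∫ p, F p ∂(arcM.prod arcM) = 0 := by
    rw [hpr, integral_withDensity_eq_integral_toReal_smul fz hρt2] at hz
    rw [← hz]; refine icae (ae_of_all _ fun p ↦ ?_)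
    simp only [hF, hh, smul_eq_mul, mul_assoc]
  have hFs : Integrable (fun p ↦ F p.swap) (arcM.prod arcM) := hFi.swap
  have hz2 : ∫ p, F p.swap ∂(arcM.prod arcM) = 0 := by rw [integral_prod_swap, hz1]
  have a1 : ∀ᵐ p ∂(arcM.prod arcM), p.1 ∈ J01 := Measure.quasiMeasurePreserving_fst.ae arc_ae
  have a2 : ∀ᵐ p ∂(arcM.prod arcM), p.2 ∈ J01 := Measure.quasiMeasurePreserving_snd.ae arc_ae
  have hG : ∀ p : ℝ × ℝ, -(F p + F p.swap) = sl β p.1 p.2 * ((h p.2 - h p.1) ^ 2 / ((1 + h p.1) * (1 + h p.2))) := by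
    intro p
    rw [← psi_alg (hh0 _) (hh0 _)]
    simp only [hF, Prod.fst_swap, Prod.snd_swap, sl_comm β p.2 p.1, hψ]; ring
  have hint : ∫ p, -(F p + F p.swap) ∂(arcM.prod arcM) = 0 := by
    rw [integral_neg, iad hFi hFs, hz1, hz2]; simp
  rw [integral_eq_zero_iff_of_nonneg_ae] at hint
  rotate_left
  · filter_upwards [a1, a2] with p h1 h2
    show 0 ≤ -(F p + F p.swap)
    rw [hG]
    have := sl_nonneg (by linarith : 0 < β) h1.1.le h2.1.le
    have := hh0 p.1
    have := hh0 p.2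
    positivity
  · exact (hFi.add hFs).neg
  have hd : ∀ᵐ p ∂(arcM.prod arcM), h p.2 = h p.1 := by
    filter_upwards [hint, a1, a2] with p h1 h2 h3
    have h1 : -(F p + F p.swap) = 0 := h1
    rw [hG] at h1
    rcases eq_or_ne p.1 p.2 with e | e
    · rw [e]
    · have := sl_pos (by linarith : 0 < β) h2.1.le h3.1.le e
      have g1 := hh0 p.1
      have g2 := hh0 p.2
      have h4 := (mul_eq_zero.1 h1).resolve_left this.ne'
      rw [div_eq_zero_iff] at h4
      have h5 := h4.resolve_right pz
      have := pow_eq_zero_iff (two_ne_zero) |>.1 h5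
      linarith
  obtain ⟨x, hx⟩ := (Measure.ae_ae_of_ae_prod hd).exists
  have h1 : ∫ y, h y ∂arcM = 1 := by
    have := Measure.integral_toReal_rnDeriv ac
    rw [hh, hρ, this]; simp
  have h2 : ∫ y, h y ∂arcM = h x := by
    rw [integral_congr_ae (g := fun _ ↦ h x) hx]; simp
  rw [← hμ]
  have : ρ =ᵐ[arcM] 1 := by
    filter_upwards [hx, hρt] with y e1 e2
    have e3 : (ρ y).toReal = 1 := by
      have : h y = 1 := by rw [← h1, h2]; exact e1
      exact this
    rw [← ENNReal.ofReal_toReal e2.ne, e3]; simp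
  rw [withDensity_congr_ae this, withDensity_one]
omit hβ
include hκ
lemma arc_st {f : ℝ → ℝ} (hf : Measurable f) (h0 : ∀ x, 0 < x → 0 ≤ f x) :
    ∫ v, f (mob 1 κ v) ∂arcM = √κ * √(1 + κ) * ∫ x, f x * (x + κ)⁻¹ ∂arcM := by
  have hmm := mob_meas 1 κ
  have e1 : ∫ v, f (mob 1 κ v) ∂arcM = (∫⁻ v, ofReal (f (mob 1 κ v)) ∂arcM).toReal := by
    refine integral_eq_lintegral_of_nonneg_ae ?_ (mas (hf.comp hmm))
    filter_upwards [arc_ae] with v hv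
    exact h0 _ (mob_mem one_pos hκ hv).1
  have e2 : ∫ x, f x * (x + κ)⁻¹ ∂arcM = (∫⁻ x, ofReal (f x * (x + κ)⁻¹) ∂arcM).toReal := by
    refine integral_eq_lintegral_of_nonneg_ae ?_ (mas fz)
    filter_upwards [arc_ae] with v hv
    have := h0 v hv.1
    have := hv.1
    show 0 ≤ f v * (v + κ)⁻¹
    positivity
  have hc : 0 ≤ √κ * √(1 + κ) := pz
  rw [e1, e2, mob_law one_pos hκ (fun x ↦ ofReal (f x)) fz, arc_lintegral _ fz,
    ← toReal_ofReal hc, ← ENNReal.toReal_mul, ← lintegral_const_mul _ fz, toReal_ofReal hc]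
  congr 1
  refine setLIntegral_congr_fun mIoo fun x hx ↦ ?_
  have h1 := hx.1
  have h2 : 0 < 1 - x := by linarith [hx.2]
  have h3 := h0 x h1
  rw [← ofReal_mul pz, ← ofReal_mul pz, ← ofReal_mul hc]
  congr 1
  have : √(x * (1 - x)) ≠ 0 := pz
  field_simp
lemma arc_st1 : ∫ x, (x + κ)⁻¹ ∂arcM = 1 / (√κ * √(1 + κ)) := by
  have := arc_st hκ (f := fun _ ↦ 1) measurable_const (fun _ _ ↦ zero_le_one)
  simp only [integral_const, one_mul] at this
  have h : 0 < √κ * √(1 + κ) := pz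
  rw [eq_div_iff h.ne', mul_comm, ← this]; simp
include hβ
lemma arc_stb :
    ∫ x, x ^ β * (x + κ)⁻¹ ∂arcM = m0 β * Dk β κ / 2 * ∫ x, (x + κ)⁻¹ ∂arcM := by
  have := arc_st hκ (f := fun x ↦ x ^ β) fz (fun _ h ↦ by positivity)
  rw [(mob1_rpow hβ hκ).2] at this
  have h : 0 < √κ * √(1 + κ) := pz
  rw [arc_st1 hκ, Dk]
  field_simp at this ⊢
  linarith
omit hκ
lemma uniq {μ : Measure ℝ} [IsProbabilityMeasure μ] (h0 : ∀ᵐ y ∂μ, 0 ≤ y)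
    (hi : Integrable (fun y ↦ y ^ β) μ)
    (hS : ∀ κ > 0, ∫ y, y ^ β * ykp ∂μ = m0 β * Dk β κ / 2 * ∫ y, ykp ∂μ) : μ = arcM := by
  refine mu_eq hβ h0 hi (GM_marg hβ h0 hi fun κ hκ ↦ ?_)
  rw [hS κ hκ, arc_stb hβ hκ]; ring
omit hβ
def fT (β k y : ℝ) : ℝ := min ((max y 0) ^ β) (k ^ β)
lemma fT_cont (hβ : 0 < β) (k : ℝ) : Continuous (fT β k) := by
  unfold fT
  exact ((continuous_id.max continuous_const).rpow_const (fun _ ↦ Or.inr hβ.le)).min continuous_const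
lemma fT_bd {k y : ℝ} (hk : 0 ≤ k) : 0 ≤ fT β k y ∧ fT β k y ≤ k ^ β :=
  ⟨le_min pz pz, min_le_right _ _⟩
lemma fT_le {k y : ℝ} (hy : 0 ≤ y) : fT β k y ≤ y ^ β := by
  rw [fT, max_eq_left hy]; exact min_le_left _ _
lemma fT_diff {k y : ℝ} (hβ : 0 < β) (hk : 0 < k) (hκ : 0 < κ) (hy : 0 ≤ y) :
    |y ^ β * ykp - fT β k y * (max y 0 + κ)⁻¹| ≤ k⁻¹ * y ^ β := by
  have hb : 0 ≤ y ^ β := pz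
  rw [max_eq_left hy, ← sub_mul, abs_mul, abs_of_nonneg (sub_nonneg.2 (fT_le hy)), abs_of_nonneg pz]
  rcases le_or_gt y k with h | h
  · have : fT β k y = y ^ β := by
      rw [fT, max_eq_left hy]; exact min_eq_left (rpow_le_rpow hy h hβ.le)
    rw [this]; simp; positivity
  · have h1 := (fT_bd (β := β) (y := y) hk.le).1
    have h2 : ykp ≤ k⁻¹ := by gcongr; linarith
    calc _ ≤ y ^ β * k⁻¹ := by gcongr; linarith
      _ = _ := mul_comm _ _
lemma tight_of {C : ℝ} (hβ : 0 < β) {μ : ℕ → ProbabilityMeasure ℝ}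
    (h0 : ∀ n, ∀ᵐ y ∂(μ n : Measure ℝ), 0 ≤ y)
    (hi : ∀ n, Integrable (fun y ↦ y ^ β) (μ n : Measure ℝ)) (hC : ∀ n, ∫ y, y ^ β ∂(μ n : Measure ℝ) ≤ C) :
    IsTightMeasureSet {((ν : ProbabilityMeasure ℝ) : Measure ℝ) | ν ∈ Set.range μ} := by
  rw [isTightMeasureSet_iff_exists_isCompact_measure_compl_le]
  intro ε hε
  have hC0 : 0 ≤ C := le_trans (integral_nonneg_of_ae ((h0 0).mono fun y hy ↦ by show 0 ≤ y ^ β; positivity)) (hC 0)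
  obtain ⟨k, hk, hk0⟩ : ∃ k : ℝ, ofReal (C / k ^ β) ≤ ε ∧ 0 < k := by
    have : Tendsto (fun k : ℝ ↦ ofReal (C / k ^ β)) atTop (𝓝 0) := by
      rw [← ENNReal.ofReal_zero]
      exact (ENNReal.continuous_ofReal.tendsto _).comp (tendsto_const_nhds.div_atTop (tendsto_rpow_atTop hβ))
    exact ((this.eventually_le_const hε).and (egt 0)).exists
  refine ⟨Icc 0 k, isCompact_Icc, ?_⟩
  rintro _ ⟨_, ⟨n, rfl⟩, rfl⟩
  have hkp : 0 < k ^ β := pz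
  have m := mul_meas_ge_le_integral_of_nonneg (μ := (μ n : Measure ℝ)) (f := fun y ↦ y ^ β)
    ((h0 n).mono fun y hy ↦ by show 0 ≤ y ^ β; positivity) (hi n) (k ^ β)
  refine le_trans ?_ hk
  have : (μ n : Measure ℝ) (Icc 0 k)ᶜ ≤ (μ n : Measure ℝ) {y | k ^ β ≤ y ^ β} := by
    refine measure_mono_ae ?_
    filter_upwards [h0 n] with y hy h
    have : k < y := by
      by_contra h'
      exact h ⟨hy, not_lt.1 h'⟩
    exact rpow_le_rpow hk0.le this.le hβ.le
  refine this.trans ?_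
  rw [← ENNReal.ofReal_toReal (measure_ne_top (μ n : Measure ℝ) {y | k ^ β ≤ y ^ β})]
  refine ENNReal.ofReal_le_ofReal ?_
  rw [le_div_iff₀ hkp, mul_comm]
  exact m.trans (hC n)
include hβ
lemma lim_st {C : ℝ} {μ : ℕ → ProbabilityMeasure ℝ}
    (h0 : ∀ n, ∀ᵐ y ∂(μ n : Measure ℝ), 0 ≤ y)
    (hi : ∀ n, Integrable (fun y ↦ y ^ β) (μ n : Measure ℝ)) (hC : ∀ n, ∫ y, y ^ β ∂(μ n : Measure ℝ) ≤ C)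
    (hS : ∀ κ > 0, Tendsto (fun n ↦ ∫ y, y ^ β * ykp ∂(μ n : Measure ℝ) - m0 β * Dk β κ / 2 * ∫ y, ykp ∂(μ n : Measure ℝ))
      atTop (𝓝 0)) (hκ : 0 < κ) :
    Tendsto (fun n ↦ ∫ y, ykp ∂(μ n : Measure ℝ)) atTop (𝓝 (1 / (√κ * √(1 + κ)))) := by
  have hβ0 : 0 < β := lz
  have hC0 : 0 ≤ C := le_trans (integral_nonneg_of_ae ((h0 0).mono fun y hy ↦ by show 0 ≤ y ^ β; positivity)) (hC 0)
  rw [tendsto_iff_ultrafilter]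
  intro g hg
  have hK := isCompact_closure_of_isTightMeasureSet (tight_of hβ0 h0 hi hC)
  obtain ⟨ν, -, hν⟩ := hK.ultrafilter_le_nhds (g.map μ) (by
    rw [le_principal_iff]; exact Filter.mem_of_superset (Filter.range_mem_map) subset_closure)
  have hν : Tendsto μ g (𝓝 ν) := hν
  have T : ∀ f : ℝ → ℝ, Continuous f → ∀ K, (∀ y, |f y| ≤ K) →
      Tendsto (fun n ↦ ∫ y, f y ∂(μ n : Measure ℝ)) g (𝓝 (∫ y, f y ∂(ν : Measure ℝ))) := fun f hf K hK ↦
    (ProbabilityMeasure.tendsto_iff_forall_integral_tendsto.1 hν) (BoundedContinuousFunction.ofNormedAddCommGroup f hf K hK)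
  have n0 : ∀ᵐ y ∂(ν : Measure ℝ), 0 ≤ y := by
    set f : ℝ → ℝ := fun y ↦ min (max (-y) 0) 1 with hf
    have hc : Continuous f := fz
    have hb : ∀ y, |f y| ≤ 1 := fun y ↦ by
      rw [abs_of_nonneg (le_min (le_max_right _ _) zero_le_one)]; exact min_le_right _ _
    have t := T f hc 1 hb
    have z : ∀ n, ∫ y, f y ∂(μ n : Measure ℝ) = 0 := fun n ↦ by
      refine integral_eq_zero_of_ae ((h0 n).mono fun y hy ↦ ?_)
      show min (max (-y) 0) 1 = 0
      rw [max_eq_right lz]; simp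
    simp only [z] at t
    have e := tendsto_nhds_unique tendsto_const_nhds t
    have e2 := (integral_eq_zero_iff_of_nonneg_ae (ae_of_all _ fun y ↦ le_min (le_max_right _ _) zero_le_one)
      (Integrable.of_bound hc.aestronglyMeasurable 1 (ae_of_all _ hb))).1 e.symm
    filter_upwards [e2] with y hy
    by_contra h
    have h : y < 0 := not_le.1 h
    have hy : min (max (-y) 0) 1 = 0 := hy
    have : 0 < min (max (-y) 0) 1 := lt_min (lt_max_of_lt_left lz) one_pos
    linarith
  have fI : ∀ (ρ : Measure ℝ) [IsProbabilityMeasure ρ] (k : ℕ), Integrable (fT β k) ρ := fun ρ _ k ↦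
    Integrable.of_bound (fT_cont hβ0 k).aestronglyMeasurable ((k:ℝ) ^ β) (ae_of_all _ fun y ↦ by
      have := fT_bd (β := β) (y := y) (Nat.cast_nonneg k)
      rw [nonn this.1]; exact this.2)
  have hM : ∀ k : ℕ, ∫ y, fT β k y ∂(ν : Measure ℝ) ≤ C := fun k ↦ by
    refine le_of_tendsto (T (fT β k) (fT_cont hβ0 k) ((k:ℝ) ^ β) fun y ↦ ?_) (Eventually.of_forall fun n ↦ ?_)
    · have := fT_bd (β := β) (y := y) (Nat.cast_nonneg k)
      rw [abs_of_nonneg this.1]; exact this.2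
    · refine le_trans (integral_mono_ae (fI _ k) (hi n) ?_) (hC n)
      filter_upwards [h0 n] with y hy
      exact fT_le hy
  have ni : ∫⁻ y, ofReal (y ^ β) ∂(ν : Measure ℝ) ≤ ofReal C := by
    calc _ = ∫⁻ y, liminf (fun k : ℕ ↦ ofReal (fT β k y)) atTop ∂(ν : Measure ℝ) := by
          refine lintegral_congr_ae ?_
          filter_upwards [n0] with y hy
          refine (Tendsto.liminf_eq (tendsto_const_nhds.congr' ?_)).symm
          filter_upwards [tendsto_natCast_atTop_atTop.eventually_ge_atTop y] with k hk
          rw [fT, max_eq_left hy, min_eq_left (rpow_le_rpow hy hk hβ0.le)]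
      _ ≤ liminf (fun k : ℕ ↦ ∫⁻ y, ofReal (fT β k y) ∂(ν : Measure ℝ)) atTop :=
          lintegral_liminf_le fun k ↦ ENNReal.measurable_ofReal.comp (fT_cont hβ0 k).measurable
      _ ≤ liminf (fun _ : ℕ ↦ ofReal C) atTop := by
          refine liminf_le_liminf (Eventually.of_forall fun k ↦ ?_)
          show ∫⁻ y, ofReal (fT β k y) ∂(ν : Measure ℝ) ≤ ofReal C
          rw [← ofReal_integral_eq_lintegral_ofReal (fI _ k) (ae_of_all _ fun y ↦ (fT_bd (Nat.cast_nonneg k)).1)]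
          exact ENNReal.ofReal_le_ofReal (hM k)
      _ = _ := sz
  have nint : Integrable (fun y ↦ y ^ β) (ν : Measure ℝ) := by
    refine ⟨mas fz, ?_⟩
    rw [hasFiniteIntegral_iff_ofReal (n0.mono fun y hy ↦ by show 0 ≤ y ^ β; positivity)]
    exact ni.trans_lt ofReal_lt_top
  have nC : ∫ y, y ^ β ∂(ν : Measure ℝ) ≤ C := by
    rw [integral_eq_lintegral_of_nonneg_ae (n0.mono fun y hy ↦ by show 0 ≤ y ^ β; positivity) nint.1]
    exact ENNReal.toReal_le_of_le_ofReal hC0 ni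
  have mx : ∀ κ > 0, Continuous fun y : ℝ ↦ (max y 0 + κ)⁻¹ := fun κ hκ ↦
    Continuous.inv₀ fz fun y ↦ by positivity
  have mxb : ∀ κ > 0, ∀ y : ℝ, |(max y 0 + κ)⁻¹| ≤ κ⁻¹ := fun κ hκ y ↦ by
    rw [abs_of_nonneg pz]; gcongr; simp
  have t1 : ∀ κ > 0, Tendsto (fun n ↦ ∫ y, ykp ∂(μ n : Measure ℝ)) g (𝓝 (∫ y, ykp ∂(ν : Measure ℝ))) := by
    intro κ hκ
    have e : ∀ ρ : Measure ℝ, (∀ᵐ y ∂ρ, 0 ≤ y) → ∫ y, (max y 0 + κ)⁻¹ ∂ρ = ∫ y, ykp ∂ρ := fun ρ h ↦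
      icae (h.mono fun y hy ↦ by show (max y 0 + κ)⁻¹ = ykp; rw [max_eq_left hy])
    have := T _ (mx κ hκ) _ (mxb κ hκ)
    rw [e _ n0] at this
    exact this.congr fun n ↦ e _ (h0 n)
  have d : ∀ κ > 0, ∀ (ρ : Measure ℝ) [IsProbabilityMeasure ρ], (∀ᵐ y ∂ρ, 0 ≤ y) → Integrable (fun y ↦ y ^ β) ρ → ∫ y, y ^ β ∂ρ ≤ C →
      ∀ k : ℕ, 0 < k → |∫ y, y ^ β * ykp ∂ρ - ∫ y, fT β k y * (max y 0 + κ)⁻¹ ∂ρ| ≤ (k:ℝ)⁻¹ * C := by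
    intro κ hκ ρ _ h0 hi hC k hk
    have hk' : zr < k := Nat.cast_pos.2 hk
    rw [← integral_sub (st_bd_int h0 hκ hi) ((fI ρ k).mul_bdd (c := κ⁻¹) (mx κ hκ).aestronglyMeasurable (ae_of_all _ (mxb κ hκ)))]
    calc _ ≤ ∫ y, (k:ℝ)⁻¹ * y ^ β ∂ρ := by
          rw [← norm_eq_abs]; refine norm_integral_le_of_norm_le (hi.const_mul _) ?_
          filter_upwards [h0] with y hy
          exact fT_diff hβ0 hk' hκ hy
      _ ≤ _ := by rw [icm]; gcongr
  have t2 : ∀ κ > 0, Tendsto (fun n ↦ ∫ y, y ^ β * ykp ∂(μ n : Measure ℝ)) g (𝓝 (∫ y, y ^ β * ykp ∂(ν : Measure ℝ))) := by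
    intro κ hκ
    rw [Metric.tendsto_nhds]
    intro ε hε
    obtain ⟨k, hk, hk0⟩ : ∃ k : ℕ, (k:ℝ)⁻¹ * C < ε / 3 ∧ 0 < k := by
      have : Tendsto (fun k : ℕ ↦ (k:ℝ)⁻¹ * C) atTop (𝓝 (0 * C)) := tendsto_inv_atTop_nhds_zero_nat.mul_const C
      rw [zero_mul] at this
      exact ((this.eventually_lt_const pz).and (egt 0)).exists
    have t := T (fun y ↦ fT β k y * (max y 0 + κ)⁻¹) ((fT_cont hβ0 k).mul (mx κ hκ)) ((k:ℝ) ^ β * κ⁻¹) fun y ↦ by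
      have := fT_bd (β := β) (y := y) (Nat.cast_nonneg k)
      rw [abs_mul, abs_of_nonneg this.1]; gcongr
      · exact this.2
      · exact mxb κ hκ y
    rw [Metric.tendsto_nhds] at t
    filter_upwards [t (ε / 3) pz] with n hn
    have a1 := d κ hκ (μ n) (h0 n) (hi n) (hC n) k hk0
    have a2 := d κ hκ ν n0 nint nC k hk0
    rw [Real.dist_eq] at hn ⊢
    rw [abs_le] at a1 a2
    rw [abs_lt] at hn ⊢
    constructor <;> linarith
  have hu : (ν : Measure ℝ) = arcM := by
    refine uniq hβ n0 nint fun κ hκ ↦ ?_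
    have := (t2 κ hκ).sub ((t1 κ hκ).const_mul (m0 β * Dk β κ / 2))
    exact sub_eq_zero.1 (tendsto_nhds_unique this ((hS κ hκ).mono_left hg))
  rw [← arc_st1 hκ, ← hu]
  exact t1 κ hκ
include hP
lemma onp_mom (N : ℕ) :
    ∫ x, β * (x ^ β * PE x ^ 2) ∂wB = 2 * N + 1 := by
  have h1 := ibp hβ one_pos ((X + C 1) * P N ^ 2)
  have hlow := onp_low hβ hP N N le_rfl (X * derivative (P N) - C (N:ℝ) * P N) (by
    rw [degree_lt_iff_coeff_zero]
    intro m hm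
    rw [coeff_sub, coeff_C_mul]
    rcases m with _ | k
    · have : N = 0 := by simpa using hm
      simp [this]
    · rw [coeff_X_mul, coeff_derivative]
      rcases hm.eq_or_lt with e | e
      · rw [e]; push_cast; ring
      · rw [coeff_eq_zero_of_natDegree_lt (by rw [hP.1]; exact e)]; simp)
  have i1 : Integrable (fun x ↦ PE x * (X * derivative (P N)).eval x) wB := wM_pmul hβ _ _
  have i2 : Integrable (fun x ↦ PE x * PE x) wB := wM_pmul hβ _ _
  have hn := hP.2.2 N N
  rw [if_pos rfl] at hn
  have e3 : ∫ x, PE x * (X * derivative (P N)).eval x ∂wB = N := by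
    have : ∫ x, (PE x * (X * derivative (P N)).eval x - N * (PE x * PE x)) ∂wB = 0 := by
      rw [← hlow]; congr 1; ext x; simp; ring
    rw [integral_sub i1 (i2.const_mul _), icm, hn] at this; linarith
  calc _ = ∫ x, (1 / (x + 1)) * (x ^ β * (C β * ((X + C 1) * P N ^ 2)).eval x) ∂wB := by
        refine icae ?_
        filter_upwards [wM_ae β] with x hx
        have : x + 1 ≠ 0 := pz
        simp; field_simp
    _ = ∫ x, (2 * (PE x * (X * derivative (P N)).eval x) + PE x * PE x) ∂wB := by
        rw [h1]
        refine icae ?_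
        filter_upwards [wM_ae β] with x hx
        have : x + 1 ≠ 0 := pz
        simp [derivative_pow]; field_simp; ring
    _ = _ := by rw [iad (i1.const_mul 2) i2, icm, e3, hn]
omit hβ hP
def nuM (β : ℝ) (p : RX) (b : ℝ) : Measure ℝ :=
  ((wM β).withDensity fun x ↦ ofReal (p.eval x ^ 2)).map fun x ↦ x / b
lemma nu_int {b : ℝ} (p : RX) {f : ℝ → ℝ} (hf : Measurable f) :
    (Integrable f (nuM β p b) ↔ Integrable (fun x ↦ p.eval x ^ 2 * f (x / b)) wB) ∧
    ∫ y, f y ∂(nuM β p b) = ∫ x, p.eval x ^ 2 * f (x / b) ∂wB := by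
  have hm : Measurable fun x : ℝ ↦ x / b := fz
  have hpm : Measurable fun x : ℝ ↦ p.eval x := p.continuous.measurable
  have hd : Measurable fun x : ℝ ↦ ofReal (p.eval x ^ 2) := fz
  have e : ∀ x, (ofReal (p.eval x ^ 2)).toReal = p.eval x ^ 2 := fun x ↦ toReal_ofReal pz
  constructor
  · rw [nuM, integrable_map_measure hf.aestronglyMeasurable hm.aemeasurable,
      integrable_withDensity_iff_integrable_smul' hd (ae_of_all _ fun _ ↦ ofReal_lt_top)]
    simp only [e, smul_eq_mul, Function.comp]
  · rw [nuM, integral_map hm.aemeasurable hf.aestronglyMeasurable,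
      integral_withDensity_eq_integral_toReal_smul hd (ae_of_all _ fun _ ↦ ofReal_lt_top)]
    simp only [e, smul_eq_mul]
include hβ hP
lemma nu_prob {b : ℝ} (N : ℕ) : IsProbabilityMeasure (nuM β (P N) b) := by
  have hm : Measurable fun x : ℝ ↦ x / b := fz
  have : IsProbabilityMeasure ((wM β).withDensity fun x ↦ ofReal (PE x ^ 2)) := by
    constructor
    rw [withDensity_apply _ MeasurableSet.univ, setLIntegral_univ,
      ← ofReal_integral_eq_lintegral_ofReal (wM_psq hβ _) (ae_of_all _ fun _ ↦ sq_nonneg _)]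
    have := hP.2.2 N N
    rw [if_pos rfl] at this
    simp only [sq, this, ENNReal.ofReal_one]
  exact Measure.isProbabilityMeasure_map hm.aemeasurable
omit hβ hP
lemma nu_ae {b : ℝ} (hb : 0 < b) (p : RX) : ∀ᵐ y ∂(nuM β p b), 0 ≤ y := by
  have hm : Measurable fun x : ℝ ↦ x / b := fz
  rw [nuM, ae_map_iff hm.aemeasurable measurableSet_Ici]
  refine (withDensity_absolutelyContinuous _ _).ae_le ?_
  filter_upwards [wM_ae β] with x hx
  exact (div_pos hx hb).le
include hβ
lemma nu_b {b : ℝ} (hb : 0 < b) (p : RX) : Integrable (fun y ↦ y ^ β) (nuM β p b) ∧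
    ∫ y, y ^ β ∂(nuM β p b) = (β * b ^ β)⁻¹ * ∫ x, β * (x ^ β * p.eval x ^ 2) ∂wB := by
  have hβ0 : β ≠ 0 := lz
  have h := nu_int (β := β) (b := b) p (f := fun y ↦ y ^ β) fz
  have e : (fun x ↦ p.eval x ^ 2 * (x / b) ^ β) =ᵐ[wM β] fun x ↦ (β * b ^ β)⁻¹ * (β * (x ^ β * p.eval x ^ 2)) := by
    filter_upwards [wM_ae β] with x hx
    rw [div_rpow hx.le hb.le]; field_simp
  have hi : Integrable (fun x ↦ x ^ β * p.eval x ^ 2) wB := by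
    have := wM_rpoly hβ (a := β) lz (p ^ 2)
    simp only [eval_pow] at this; exact this
  constructor
  · rw [h.1]; exact ((hi.const_mul β).const_mul _).congr e.symm
  · rw [h.2, icae e, icm]
lemma nu_s {b : ℝ} (hb : 0 < b) (hκ : 0 < κ) (p : RX) :
    ∫ y, ykp ∂(nuM β p b) = b * Ist β p (κ * b) ∧
    ∫ y, y ^ β * ykp ∂(nuM β p b) = b * (β * b ^ β)⁻¹ * Hst β p (κ * b) := by
  have hβ0 : β ≠ 0 := lz
  rw [(nu_int p (f := fun y ↦ ykp) fz).2, (nu_int p (f := fun y ↦ y ^ β * ykp) fz).2,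
    Ist, Hst, ← icm, ← icm]
  constructor <;> refine icae ?_ <;> filter_upwards [wM_ae β] with x hx
  · have : x / b + κ ≠ 0 := pz
    have : x + κ * b ≠ 0 := pz
    field_simp
  · have : x / b + κ ≠ 0 := pz
    have : x + κ * b ≠ 0 := pz
    have : b ^ β ≠ 0 := pz
    rw [div_rpow hx.le hb.le]
    field_simp
include hP hκ
lemma RN_lim :
    Tendsto (fun N : ℕ ↦ RN β P N (κ * bbN) / N) atTop (𝓝 (Dk β κ)) := by
  have hD : 0 < Dk β κ := lt_of_lt_of_le pz (Dk_ge hβ hκ)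
  rw [Metric.tendsto_nhds]
  intro ε hε
  have hε' : 0 < ε / (2 * Dk β κ) := pz
  filter_upwards [R_unif hβ hP one_pos hκ hε', (bNn_lim hβ).eventually_ge_atTop (1 / κ), egt 0] with N h1 h2 h3
  have hN : zr < N := Nat.cast_pos.2 h3
  have hb := bN_pos hβ hN
  have := h1 (κ * bbN) (by rw [div_le_iff₀ hκ] at h2; linarith) le_rfl
  rw [mul_div_cancel_right₀ _ hb.ne'] at this
  rw [Real.dist_eq, show RN β P N (κ * bbN) / N - Dk β κ = (RN β P N (κ * bbN) - N * Dk β κ) / N by field_simp,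
    abs_div, abs_of_pos hN, div_lt_iff₀ hN]
  refine this.trans_lt ?_
  rw [show ε / (2 * Dk β κ) * (N * Dk β κ) = ε * N / 2 by field_simp]
  linarith [mul_pos hε hN]
lemma Ist_lim :
    Tendsto (fun N : ℕ ↦ bbN * Ist β (P N) (κ * bbN)) atTop (𝓝 (1 / (√κ * √(1 + κ)))) := by
  have hβ0 : 0 < β := lz
  have hm := m0_pos hβ
  rw [← tendsto_add_atTop_iff_nat 1]
  have hb : ∀ n : ℕ, 0 < bN β nSr := fun n ↦ bN_pos hβ pz
  have hbe : ∀ n : ℕ, (β * bN β nSr ^ β)⁻¹ = m0 β / (2 * nSr) := fun n ↦ by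
    have := bN_eq hβ (x := nSr) pz
    have : 0 < bN β nSr ^ β := rpow_pos_of_pos (hb n) _
    rw [eq_div_iff pz, inv_mul_eq_iff_eq_mul₀ pz]; linarith
  have key := lim_st hβ (C := 2 * m0 β) (μ := fun n ↦ ⟨nuM β (P (n + 1)) (bN β nSr), nu_prob hβ hP _⟩)
    (fun n ↦ nu_ae (hb n) _) (fun n ↦ (nu_b hβ (hb n) _).1) (fun n ↦ by
      show ∫ y, y ^ β ∂(nuM β (P (n + 1)) (bN β nSr)) ≤ 2 * m0 β
      rw [(nu_b hβ (hb n) _).2, onp_mom hβ hP, hbe, div_mul_eq_mul_div, div_le_iff₀ pz]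
      push_cast
      nlinarith [n.cast_nonneg (α := ℝ)]) (fun κ hκ ↦ ?_) hκ
  · refine key.congr fun n ↦ ?_
    exact (nu_s hβ (hb n) hκ _).1
  · have hR := (tendsto_add_atTop_iff_nat 1).2 (RN_lim hβ hP hκ)
    have h0 : Tendsto (fun n : ℕ ↦ m0 β / 2 * |RN β P (n + 1) (κ * bN β nSr) / nSr - Dk β κ| * κ⁻¹) atTop (𝓝 0) := by
      have := (((hR.sub_const (Dk β κ)).abs).const_mul (m0 β / 2)).mul_const κ⁻¹
      simpa using this
    refine squeeze_zero_norm (fun n ↦ ?_) h0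
    have hs := nu_s hβ (hb n) hκ (P (n + 1))
    have hpr := nu_prob (b := bN β nSr) hβ hP (n + 1)
    have hle : |∫ y, ykp ∂(nuM β (P (n + 1)) (bN β nSr))| ≤ κ⁻¹ := by
      have := norm_integral_le_of_norm_le_const (μ := nuM β (P (n + 1)) (bN β nSr)) (f := fun y : ℝ ↦ ykp) (C := κ⁻¹) (by
        filter_upwards [nu_ae (hb n) (P (n + 1))] with y hy
        rw [nonn pz]; gcongr; linarith)
      rwa [probReal_univ, mul_one] at this
    show ‖∫ y, y ^ β * ykp ∂(nuM β (P (n + 1)) (bN β nSr)) - m0 β * Dk β κ / 2 *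
      ∫ y, ykp ∂(nuM β (P (n + 1)) (bN β nSr))‖ ≤ _
    have hI := Ist_pos hβ (σ := κ * bN β nSr) (mul_pos hκ (hb n)) (onp_ne0 hP (n + 1))
    have hH : Hst β (P (n + 1)) (κ * bN β nSr) = RN β P (n + 1) (κ * bN β nSr) * Ist β (P (n + 1)) (κ * bN β nSr) := by
      rw [RN, div_mul_cancel₀ _ hI.ne']
    have e : ∫ y, y ^ β * ykp ∂(nuM β (P (n + 1)) (bN β nSr)) - m0 β * Dk β κ / 2 *
      ∫ y, ykp ∂(nuM β (P (n + 1)) (bN β nSr)) = m0 β / 2 * (RN β P (n + 1) (κ * bN β nSr) / nSr - Dk β κ) *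
        ∫ y, ykp ∂(nuM β (P (n + 1)) (bN β nSr)) := by
      rw [hs.1, hs.2, hbe, hH]
      have : nSr ≠ 0 := pz
      field_simp
    rw [e, norm_mul, norm_mul, norm_eq_abs, norm_eq_abs, norm_eq_abs, abs_of_pos (by positivity : 0 < m0 β / 2)]
    gcongr
omit hP hκ
include hσ
lemma Hst_deriv (p : RX) :
    Integrable (fun x ↦ β * x ^ β * p.eval x ^ 2 / xsg ^ 2) wB ∧
    HasDerivAt (Hst β p) (-∫ x, β * x ^ β * p.eval x ^ 2 / xsg ^ 2 ∂wB) σ := by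
  have hi : Integrable (fun x ↦ β * x ^ β * p.eval x ^ 2) wB := by
    have := (wM_rpoly hβ (a := β) lz (p ^ 2)).const_mul β
    simp only [eval_pow, ← mul_assoc] at this; exact this
  exact st_deriv (wM_ae β) hi hσ
omit hβ hσ
lemma rp_pt {θ Z x : ℝ} (hθ : 0 < θ) (h1 : θ ≤ 1) (hβ : 0 < β) (h2 : β * θ ≤ 1) (hZ : 0 < Z) (hσ : 0 < σ) (hx : 0 < x) :
    x ^ β / xsg ^ 2 ≤ σ ^ (β * θ - 1) * Z ^ (1 - θ) * (1 / xsg + x ^ β / Z / xsg) := by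
  have a1 : x ^ (β * θ) / xsg ≤ σ ^ (β * θ - 1) := by
    calc _ ≤ xsg ^ (β * θ) / xsg := by gcongr; linarith
      _ = xsg ^ (β * θ - 1) := by rw [rpow_sub_one pz]
      _ ≤ _ := rpow_le_rpow_of_nonpos hσ lz lz
  have a2 : x ^ (β * (1 - θ)) ≤ Z ^ (1 - θ) * (1 + x ^ β / Z) := by
    have e : x ^ (β * (1 - θ)) = Z ^ (1 - θ) * (x ^ β / Z) ^ (1 - θ) := by
      rw [div_rpow pz hZ.le, ← rpow_mul hx.le]; field_simp
    rw [e]; gcongr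
    have hy : 0 ≤ x ^ β / Z := pz
    rcases le_total (x ^ β / Z) 1 with h | h
    · exact (rpow_le_one hy h lz).trans lz
    · have := rpow_le_rpow_of_exponent_le h (by linarith : 1 - θ ≤ 1)
      rw [rpow_one] at this; linarith
  calc x ^ β / xsg ^ 2 = (x ^ (β * θ) / xsg) * (x ^ (β * (1 - θ)) / xsg) := by
        rw [div_mul_div_comm, ← rpow_add hx, sq]; ring_nf
    _ ≤ σ ^ (β * θ - 1) * (Z ^ (1 - θ) * (1 + x ^ β / Z) / xsg) := by gcongr
    _ = _ := by ring
include hβ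
lemma Hst_dbd {θ : ℝ} (hθ : 0 < θ) (h1 : θ ≤ 1) (h2 : β * θ ≤ 1) (hσ : 0 < σ) (hP : ONP β P) (N : ℕ) :
    ∫ x, β * x ^ β * PE x ^ 2 / xsg ^ 2 ∂wB ≤ 2 * σ ^ (β * θ - 1) * (RN β P N σ / β) ^ (-θ) * Hst β (P N) σ := by
  have hβ0 : 0 < β := lz
  have hR := RN_pos hβ hσ hP N
  have hI := Ist_pos hβ hσ (onp_ne0 hP N)
  have hH : Hst β (P N) σ = RN β P N σ * Ist β (P N) σ := by rw [RN, div_mul_cancel₀ _ hI.ne']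
  set Z := RN β P N σ / β with hZ
  have hZ0 : 0 < Z := pz
  have i1 := (Hst_deriv hβ hσ (P N)).1
  have i2 := wM_psq_div hβ hσ (P N)
  have i3 := Hst_int hβ hσ (P N)
  set A := σ ^ (β * θ - 1) * Z ^ (1 - θ) with hA
  have hA0 : 0 < A := pz
  calc _ ≤ ∫ x, (A * β * (PE x ^ 2 / xsg) + A / Z * (β * x ^ β * PE x ^ 2 / xsg)) ∂wB := by
        refine integral_mono_ae i1 ((i2.const_mul _).add (i3.const_mul _)) ?_
        filter_upwards [wM_ae β] with x hx
        show β * x ^ β * PE x ^ 2 / xsg ^ 2 ≤ A * β * (PE x ^ 2 / xsg) + A / Z * (β * x ^ β * PE x ^ 2 / xsg)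
        have := mul_le_mul_of_nonneg_left (rp_pt hθ h1 hβ0 h2 hZ0 hσ hx) (by positivity : 0 ≤ β * PE x ^ 2)
        calc _ = β * PE x ^ 2 * (x ^ β / xsg ^ 2) := by ring
          _ ≤ _ := this
          _ = _ := by rw [hA]; ring
    _ = A * β * Ist β (P N) σ + A / Z * Hst β (P N) σ := by
        rw [iad (i2.const_mul _) (i3.const_mul _), icm, icm]; rfl
    _ = _ := by
        have e : Z ^ (1 - θ) = Z * Z ^ (-θ) := by rw [show 1 - θ = 1 + -θ by ring, rpow_add hZ0, rpow_one]
        have e2 : RN β P N σ = β * Z := by rw [hZ]; field_simp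
        rw [hH, e2, hA, e]; field_simp; ring
lemma Hst_anti {s t : ℝ} (hs : 0 < s) (hst : s ≤ t) (p : RX) : Hst β p t ≤ Hst β p s := by
  refine integral_mono_ae (Hst_int hβ lz p) (Hst_int hβ hs p) ?_
  filter_upwards [wM_ae β] with x hx
  have : 0 < β := lz
  show β * x ^ β * p.eval x ^ 2 / (x + t) ≤ β * x ^ β * p.eval x ^ 2 / (x + s)
  gcongr
include hP
lemma R_lower {σ₀ : ℝ} (hσ : 0 < σ₀) :
    ∀ᶠ N : ℕ in atTop, ∀ σ, σ₀ ≤ σ → σ ≤ bbN → N * √(σ / bbN) / 2 ≤ RN β P N σ := by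
  filter_upwards [R_unif hβ hP hσ one_pos (ε := 1/4) nz, egt 0] with N h h0 σ s1 s2
  have hN : zr < N := Nat.cast_pos.2 h0
  have hb := bN_pos hβ hN
  have hσ0 : 0 < σ := lz
  have hk : 0 < σ / bbN := pz
  have hk1 : σ / bbN ≤ 1 := (div_le_one hb).2 s2
  have h1 := (abs_le.1 (h σ s1 lz)).1
  have hD := Dk_ge hβ hk
  have : √(1 + σ / bbN) ≤ 3 / 2 := by
    rw [sqrt_le_left nz]; norm_num; linarith
  have h3 : 4 / 3 * √(σ / bbN) ≤ Dk β (σ / bbN) := by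
    refine le_trans ?_ hD
    rw [le_div_iff₀ pz]
    nlinarith [sqrt_nonneg (σ / bbN)]
  have : N * (4 / 3 * √(σ / bbN)) ≤ N * Dk β (σ / bbN) := by gcongr
  have : 0 ≤ N * √(σ / bbN) := pz
  linarith
omit hβ hP
lemma dH_alg {θ b N R : ℝ} (hβ : 0 < β) (hθ : 0 < θ) (hσ : 0 < σ) (hb : 0 < b) (hm : 0 < m0 β)
    (hN : N = β * m0 β * b ^ β / 2) (hR : N * √(σ / b) / 2 ≤ R) :
    2 * σ ^ (β * θ - 1) * (R / β) ^ (-θ) ≤ 2 * (m0 β / 4) ^ (-θ) * ((σ / b) ^ (θ * bmh - 1) * b⁻¹) := by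
  have hN0 : 0 < N := by rw [hN]; positivity
  have hl : m0 β / 4 * (b ^ β * (σ / b) ^ (hlf : ℝ)) ≤ R / β := by
    rw [le_div_iff₀ hβ, ← sqrt_eq_rpow]; refine le_trans (le_of_eq ?_) hR; rw [hN]; ring
  have := rpow_le_rpow_of_nonpos pz hl (by linarith : -θ ≤ 0)
  calc _ ≤ 2 * σ ^ (β * θ - 1) * (m0 β / 4 * (b ^ β * (σ / b) ^ (hlf : ℝ))) ^ (-θ) := by gcongr
    _ = _ := by
      have hs : 0 < σ / b := pz
      rw [mul_rpow pz pz, mul_rpow pz pz, ← rpow_mul hb.le, ← rpow_mul hs.le]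
      have e1 : σ ^ (β * θ - 1) = (σ / b) ^ (β * θ - 1) * b ^ (β * θ - 1) := by
        rw [← mul_rpow hs.le hb.le, div_mul_cancel₀ _ hb.ne']
      have e2 : (σ / b) ^ (θ * bmh - 1) = (σ / b) ^ (β * θ - 1) * (σ / b) ^ (hlf * -θ) := by
        rw [← rpow_add hs]; ring_nf
      have e3 : b⁻¹ = b ^ (β * θ - 1) * b ^ (β * -θ) := by
        rw [← rpow_add hb, ← rpow_neg_one]; ring_nf
      rw [e1, e2, e3]; ring
include hβ
lemma H_trans : ∃ B > 0, ∃ δ > zr, ∀ P : ℕ → RX, ONP β P → ∀ σ₀ > 0,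
    ∀ᶠ N : ℕ in atTop, ∀ κ ≤ 1, σ₀ ≤ κ * bbN → Hst β (P N) σ₀ ≤ exp (B * κ ^ δ) * Hst β (P N) (κ * bbN) := by
  have hβ0 : 0 < β := lz
  have hm := m0_pos hβ
  set θ := min 1 (1 / β) with hθd
  have hθ : 0 < θ := lt_min one_pos pz
  have h1 : θ ≤ 1 := min_le_left _ _
  have h2 : β * θ ≤ 1 := by
    calc β * θ ≤ β * (1 / β) := by gcongr; exact min_le_right _ _
      _ = 1 := by field_simp
  set δ := θ * bmh with hδ
  have hδ0 : 0 < δ := mul_pos hθ lz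
  set B := 2 * (m0 β / 4) ^ (-θ) / δ with hB
  have hB0 : 0 < B := pz
  refine ⟨B, hB0, δ, hδ0, fun P hP σ₀ hσ ↦ ?_⟩
  filter_upwards [R_lower hβ hP hσ, egt 0] with N hR h0 κ hκ hs
  have hN : zr < N := Nat.cast_pos.2 h0
  have hb := bN_pos hβ hN
  have hNe : (N:ℝ) = β * m0 β * bbN ^ β / 2 := by rw [bN_eq hβ hN.le]; ring
  set b := bbN
  have hHp : ∀ σ > 0, 0 < Hst β (P N) σ := fun σ h ↦ Hst_pos hβ h (onp_ne0 hP N)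
  set F : ℝ → ℝ := fun σ ↦ log (Hst β (P N) σ) + B * (σ / b) ^ δ with hF
  have hd : ∀ σ > 0, HasDerivAt F ((-∫ x, β * x ^ β * PE x ^ 2 / xsg ^ 2 ∂wB) / Hst β (P N) σ
      + B * (1 / b * δ * (σ / b) ^ (δ - 1))) σ := fun σ h ↦ by
    refine ((Hst_deriv hβ h (P N)).2.log (hHp σ h).ne').add (HasDerivAt.const_mul B ?_)
    exact ((hasDerivAt_id σ).div_const b).rpow_const (Or.inl (by have : 0 < σ / b := pz
                                                                 exact this.ne'))
  have mono : MonotoneOn F (Icc σ₀ (κ * b)) := by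
    refine monotoneOn_of_deriv_nonneg (convex_Icc _ _) (fun σ h ↦ (hd σ (hσ.trans_le h.1)).continuousAt.continuousWithinAt)
      (fun σ h ↦ ?_) (fun σ h ↦ ?_)
    · rw [interior_Icc] at h; exact (hd σ (hσ.trans h.1)).differentiableAt.differentiableWithinAt
    · rw [interior_Icc] at h
      have hσ' := hσ.trans h.1
      rw [(hd σ hσ').deriv, neg_div]
      have h3 : (∫ x, β * x ^ β * PE x ^ 2 / xsg ^ 2 ∂wB) / Hst β (P N) σ ≤ 2 * σ ^ (β * θ - 1) * (RN β P N σ / β) ^ (-θ) := by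
        rw [div_le_iff₀ (hHp σ hσ')]; exact Hst_dbd hβ hθ h1 h2 hσ' hP N
      have h4 := dH_alg hβ0 hθ hσ' hb hm hNe (hR σ h.1.le (h.2.le.trans (by nlinarith)))
      have h5 : B * (1 / b * δ * (σ / b) ^ (δ - 1)) = 2 * (m0 β / 4) ^ (-θ) * ((σ / b) ^ (δ - 1) * b⁻¹) := by
        rw [hB]; field_simp
      rw [h5]; linarith
  have hm := mono ⟨le_rfl, hs⟩ ⟨hs, le_rfl⟩ hs
  simp only [hF] at hm
  rw [mul_div_cancel_right₀ _ hb.ne'] at hm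
  have hp : 0 ≤ B * (σ₀ / b) ^ δ := pz
  rw [← exp_log (hHp σ₀ hσ), ← exp_log (hHp (κ * b) (hσ.trans_le hs)), ← exp_add]
  exact exp_le_exp.2 lz
lemma Jk_lim : Tendsto (Jk β) (𝓝[>] 0) (𝓝 (1 / bmh)) := by
  obtain ⟨h1, h2⟩ := rpow_int01 (β := β - hlf) lz
  rw [← h2]
  refine tendsto_integral_filter_of_dominated_convergence _ ?_ ?_ h1 ?_
  · exact Eventually.of_forall fun κ ↦ mas fz
  · filter_upwards [self_mem_nhdsWithin] with κ hκ
    have hκ : 0 < κ := hκ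
    filter_upwards [ae_restrict_mem mIoo] with u hu
    have := hu.1
    rw [nonn pz, show β - hlf - 1 = bm1 - hlf by ring, rpow_sub this bm1, ← sqrt_eq_rpow]
    gcongr
    linarith
  · filter_upwards [ae_restrict_mem mIoo] with u hu
    have := hu.1
    rw [show β - hlf - 1 = bm1 - hlf by ring, rpow_sub this bm1, ← sqrt_eq_rpow]
    have : Tendsto (fun κ : ℝ ↦ u ^ bm1 / √ukp) (𝓝 0) (𝓝 (u ^ bm1 / √(u + 0))) := by
      refine ContinuousAt.tendsto (f := fun κ : ℝ ↦ u ^ bm1 / √ukp) (ContinuousAt.div fz fz ?_)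
      simp; positivity
    rw [add_zero] at this
    exact this.mono_left nhdsWithin_le_nhds
lemma Dk_lim : Tendsto (fun κ ↦ Dk β κ / √κ) (𝓝[>] 0) (𝓝 (2 * β / bmh)) := by
  have := (Jk_lim hβ).const_mul (2 * β)
  rw [mul_one_div] at this
  refine this.congr' ?_
  filter_upwards [self_mem_nhdsWithin] with κ hκ
  have hκ : 0 < κ := hκ
  have : 0 < √κ := pz
  rw [Dk]; field_simp
include hP hκ
lemma H_lim1 :
    Tendsto (fun N : ℕ ↦ bbN * Hst β (P N) (κ * bbN) / N) atTop (𝓝 (Dk β κ / √κ / √(1 + κ))) := by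
  have := (RN_lim hβ hP hκ).mul (Ist_lim hβ hP hκ)
  rw [show Dk β κ * (1 / (√κ * √(1 + κ))) = Dk β κ / √κ / √(1 + κ) by field_simp] at this
  refine this.congr' ?_
  filter_upwards [egt 0] with N hN
  have hN : zr < N := Nat.cast_pos.2 hN
  have hb := bN_pos hβ hN
  have := Ist_pos hβ (mul_pos hκ hb) (onp_ne0 hP N)
  rw [RN]; field_simp
omit hκ
lemma H_lim (hσ : 0 < σ) :
    Tendsto (fun N : ℕ ↦ bbN * Hst β (P N) σ / N) atTop (𝓝 (2 * β / bmh)) := by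
  obtain ⟨B, hB, δ, hδ, hT⟩ := H_trans hβ
  have hs1 : Tendsto (fun κ : ℝ ↦ √(1 + κ)) (𝓝[>] 0) (𝓝 1) := by
    have : Tendsto (fun κ : ℝ ↦ √(1 + κ)) (𝓝 0) (𝓝 (√(1 + 0))) := ContinuousAt.tendsto (f := fun κ : ℝ ↦ √(1 + κ)) fz
    rw [add_zero, sqrt_one] at this
    exact this.mono_left nhdsWithin_le_nhds
  have l1 : Tendsto (fun κ ↦ Dk β κ / √κ / √(1 + κ)) (𝓝[>] 0) (𝓝 (2 * β / bmh)) := by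
    have := (Dk_lim hβ).div hs1 one_ne_zero
    rw [div_one] at this; exact this
  have l2 : Tendsto (fun κ ↦ exp (B * κ ^ δ) * (Dk β κ / √κ / √(1 + κ))) (𝓝[>] 0) (𝓝 (2 * β / bmh)) := by
    have e : Tendsto (fun κ : ℝ ↦ exp (B * κ ^ δ)) (𝓝[>] 0) (𝓝 1) := by
      have : Tendsto (fun κ : ℝ ↦ exp (B * κ ^ δ)) (𝓝 0) (𝓝 (exp (B * 0 ^ δ))) :=
        ContinuousAt.tendsto (f := fun κ : ℝ ↦ exp (B * κ ^ δ)) ((continuousAt_rpow_const 0 δ (Or.inr hδ.le)).const_mul B |>.rexp)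
      rw [zero_rpow hδ.ne', mul_zero, exp_zero] at this
      exact this.mono_left nhdsWithin_le_nhds
    have := e.mul l1
    rw [one_mul] at this; exact this
  have hlt : ∀ κ > 0, ∀ᶠ N : ℕ in atTop, σ ≤ κ * bbN := fun κ hκ ↦ by
    filter_upwards [(bNn_lim hβ).eventually_ge_atTop (σ / κ)] with N h
    rw [div_le_iff₀ hκ] at h; linarith
  have h01 : ∀ᶠ κ : ℝ in 𝓝[>] 0, 0 < κ ∧ κ ≤ 1 := by
    filter_upwards [Ioc_mem_nhdsGT one_pos] with κ h using h
  refine tendsto_order.2 ⟨fun a ha ↦ ?_, fun a ha ↦ ?_⟩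
  · obtain ⟨κ, h1, h2, h3⟩ := ((l1.eventually_const_lt ha).and h01).exists
    filter_upwards [(H_lim1 hβ hP h2).eventually_const_lt h1, hlt κ h2, egt 0] with N e1 e2 e3
    have hN : zr < N := Nat.cast_pos.2 e3
    have hb := bN_pos hβ hN
    refine e1.trans_le ?_
    have := Hst_anti hβ hσ e2 (P N)
    gcongr
  · obtain ⟨κ, h1, h2, h3⟩ := ((l2.eventually_lt_const ha).and h01).exists
    filter_upwards [((H_lim1 hβ hP h2).const_mul (exp (B * κ ^ δ))).eventually_lt_const h1, hlt κ h2, hT P hP σ hσ, egt 0] with N e1 e2 e4 e3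
    have hN : zr < N := Nat.cast_pos.2 e3
    have hb := bN_pos hβ hN
    refine lt_of_le_of_lt ?_ e1
    have := e4 κ h3 e2
    calc _ ≤ bbN * (exp (B * κ ^ δ) * Hst β (P N) (κ * bbN)) / N := by gcongr
      _ = _ := by ring
lemma R_lim (hσ : 0 < σ) :
    Tendsto (fun N : ℕ ↦ RN β P N σ / (N * √(σ / bbN))) atTop (𝓝 (2 * β / bmh)) := by
  have hk : Tendsto (fun N : ℕ ↦ σ / bbN) atTop (𝓝[>] 0) := by
    refine tendsto_nhdsWithin_iff.2 ⟨tendsto_const_nhds.div_atTop (bNn_lim hβ), ?_⟩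
    filter_upwards [egt 0] with N hN
    exact div_pos hσ (bN_pos hβ (Nat.cast_pos.2 hN))
  have l := (Dk_lim hβ).comp hk
  have l2 : Tendsto (fun N : ℕ ↦ RN β P N σ / (N * Dk β (σ / bbN))) atTop (𝓝 1) := by
    rw [Metric.tendsto_nhds]
    intro ε hε
    filter_upwards [R_unif hβ hP hσ one_pos (half_pos hε), (bNn_lim hβ).eventually_ge_atTop σ, egt 0] with N h1 h2 h3
    have hN : zr < N := Nat.cast_pos.2 h3
    have hb := bN_pos hβ hN
    have hκ : 0 < σ / bbN := pz
    have hD : 0 < Dk β (σ / bbN) := lt_of_lt_of_le pz (Dk_ge hβ hκ)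
    have := h1 σ le_rfl lz
    have hp : 0 < N * Dk β (σ / bbN) := pz
    rw [Real.dist_eq, div_sub_one hp.ne', abs_div, abs_of_pos hp, div_lt_iff₀ hp]
    refine this.trans_lt ?_
    linarith [mul_pos hε hp]
  have := l2.mul l
  rw [one_mul] at this
  refine this.congr' ?_
  filter_upwards [egt 0] with N h3
  have hN : zr < N := Nat.cast_pos.2 h3
  have hb := bN_pos hβ hN
  have hκ : 0 < σ / bbN := pz
  have hD : 0 < Dk β (σ / bbN) := lt_of_lt_of_le pz (Dk_ge hβ hκ)
  have : 0 < √(σ / bbN) := pz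
  show RN β P N σ / (N * Dk β (σ / bbN)) * (Dk β (σ / bbN) / √(σ / bbN)) = _
  field_simp
lemma I_lim (hσ : 0 < σ) :
    Tendsto (fun N : ℕ ↦ Ist β (P N) σ * √(σ * bbN)) atTop (𝓝 1) := by
  have hD : 2 * β / bmh ≠ 0 := (div_pos lz lz).ne'
  have := (H_lim hβ hP hσ).div (R_lim hβ hP hσ) hD
  rw [div_self hD] at this
  refine this.congr' ?_
  filter_upwards [egt 0] with N h3
  have hN : zr < N := Nat.cast_pos.2 h3
  have hb := bN_pos hβ hN
  have hI := Ist_pos hβ hσ (onp_ne0 hP N)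
  have hH := Hst_pos hβ hσ (onp_ne0 hP N)
  have s1 : 0 < √σ := pz
  have s2 : 0 < √(bbN) := pz
  show bbN * Hst β (P N) σ / N / (RN β P N σ / (N * √(σ / bbN))) = _
  rw [RN, sqrt_div hσ.le, sqrt_mul hσ.le]
  have e : bbN = √(bbN) * √(bbN) := (mul_self_sqrt hb.le).symm
  field_simp
  rw [sq]; linear_combination e
lemma P_lim (hσ : 0 < σ) :
    Tendsto (fun N : ℕ ↦ PE (-σ) ^ 2 * √(σ * bbN) / exp (EN β N σ)) atTop (𝓝 (1 / (2 * π))) := by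
  have := ((KN_lim hβ hσ hP).mul (I_lim hβ hP hσ)).mul_const (1 / π)
  rw [show (1:ℝ) / 2 * 1 * (1 / π) = 1 / (2 * π) by field_simp] at this
  refine this.congr fun N ↦ ?_
  have hI := Ist_pos hβ hσ (onp_ne0 hP N)
  have := exp_pos (EN β N σ)
  rw [KN]; field_simp
omit hβ hP
lemma choose_rec (a : ℝ) (n : ℕ) :
    ((n : ℝ) + 1) * Ring.choose a (n + 1) = (a - n) * Ring.choose a n := by
  have h1 := Ring.descPochhammer_eq_factorial_smul_choose a n
  have h2 := Ring.descPochhammer_eq_factorial_smul_choose a (n + 1)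
  rw [descPochhammer_succ_right, Polynomial.smeval_mul] at h2
  rw [h1] at h2
  simp only [nsmul_eq_mul, Nat.factorial_succ, Nat.cast_mul] at h2
  have h3 : ((X - (n : ℤ[X])).smeval a : ℝ) = a - n := by
    simp [Polynomial.smeval_sub, Polynomial.smeval_natCast]
  rw [h3] at h2
  push_cast at h2
  have hf : (n.factorial : ℝ) ≠ 0 := pz
  apply mul_left_cancel₀ hf
  linear_combination -h2
lemma choose_half (s : ℕ) : Ring.choose (hlf : ℝ) s =
    (-1) ^ s * Gamma ((s : ℝ) - hlf) / (-2 * √π * Gamma ((s : ℝ) + 1)) := by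
  have hpi : √π ≠ 0 := pz
  induction s with
  | zero =>
    have h := Gamma_add_one (s := -(hlf : ℝ)) nz
    have e : (-(hlf) + 1 : ℝ) = hlf := nz
    rw [e, Real.Gamma_one_half_eq] at h
    have e2 : Gamma (((0:ℕ):ℝ) - hlf) = -2 * √π := by
      rw [show (((0:ℕ):ℝ) - hlf) = -(hlf) by norm_num]; linarith
    rw [e2, Ring.choose_zero_right]
    simp [hpi]
  | succ s ih =>
    have h := choose_rec (hlf) s
    have g1 := Gamma_add_one (s := (s : ℝ) - hlf) (by
      intro h
      have h' : (2 * s : ℝ) = 1 := lz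
      have h'' : 2 * s = 1 := by exact_mod_cast h'
      omega)
    have g2 := Gamma_add_one (s := (s : ℝ) + 1) pz
    have hG : Gamma ((s : ℝ) + 1) ≠ 0 := (Gamma_pos_of_pos pz).ne'
    push_cast
    rw [show (s : ℝ) + 1 - hlf = s - hlf + 1 by ring, g1, g2]
    rw [ih] at h
    have hs : (s : ℝ) + 1 ≠ 0 := pz
    apply mul_left_cancel₀ hs
    rw [h]
    field_simp
    ring
lemma choose_nhalf (s : ℕ) : Ring.choose (-(hlf) : ℝ) s =
    (-1) ^ s * Gamma ((s : ℝ) + hlf) / (√π * Gamma ((s : ℝ) + 1)) := by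
  have hpi : √π ≠ 0 := pz
  induction s with
  | zero =>
    have e2 : Gamma (((0:ℕ):ℝ) + hlf) = √π := by
      rw [show (((0:ℕ):ℝ) + hlf) = hlf by norm_num, Real.Gamma_one_half_eq]
    rw [e2, Ring.choose_zero_right]
    simp [hpi]
  | succ s ih =>
    have h := choose_rec (-(hlf)) s
    have g1 := Gamma_add_one (s := (s : ℝ) + hlf) pz
    have g2 := Gamma_add_one (s := (s : ℝ) + 1) pz
    have hG : Gamma ((s : ℝ) + 1) ≠ 0 := (Gamma_pos_of_pos pz).ne'
    push_cast
    rw [show (s : ℝ) + 1 + hlf = s + hlf + 1 by ring, g1, g2]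
    rw [ih] at h
    have hs : (s : ℝ) + 1 ≠ 0 := pz
    apply mul_left_cancel₀ hs
    rw [h]
    field_simp
    ring
lemma binom_taylor (a : ℝ) (n : ℕ) : ∃ K > 0, ∃ δ > 0, ∀ x : ℝ, |x| < δ →
    |(1 + x) ^ a - ∑ s ∈ range n, Ring.choose a s * x ^ s| ≤ K * |x| ^ n := by
  have h := (Real.one_add_rpow_hasFPowerSeriesAt_zero (a := a)).isBigO_sub_partialSum_pow n
  obtain ⟨K, hK, h⟩ := h.exists_pos
  rw [Asymptotics.IsBigOWith, Metric.eventually_nhds_iff] at h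
  obtain ⟨δ, hδ, h⟩ := h
  refine ⟨K, hK, δ, hδ, fun x hx ↦ ?_⟩
  have := h (y := x) (by simpa using hx)
  simp only [FormalMultilinearSeries.partialSum, binomialSeries_apply, List.ofFn_const,
    List.prod_replicate, zero_add, smul_eq_mul, norm_pow, norm_norm, norm_eq_abs, abs_abs] at this
  exact this
lemma arsinh_taylor (n : ℕ) : ∃ K > 0, ∃ δ > 0, ∀ y : ℝ, 0 < y → y < δ →
    |4 * arsinh y - ∑ s ∈ range n,
      2 * Ring.choose (-(hlf) : ℝ) s / ((s : ℝ) + hlf) * y ^ (2 * s + 1)| ≤ K * y ^ (2 * n + 1) := by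
  obtain ⟨K, hK, δ, hδ, h⟩ := binom_taylor (-(hlf)) n
  refine ⟨4 * K, pz, √δ, pz, fun y hy hyδ ↦ ?_⟩
  set F : ℝ → ℝ := fun y ↦ 4 * arsinh y - ∑ s ∈ range n,
      2 * Ring.choose (-(hlf) : ℝ) s / ((s : ℝ) + hlf) * y ^ (2 * s + 1) with hF
  have hd : ∀ x : ℝ, HasDerivAt F (4 * ((1 + x ^ 2) ^ (-(hlf) : ℝ) -
      ∑ s ∈ range n, Ring.choose (-(hlf) : ℝ) s * (x ^ 2) ^ s)) x := by
    intro x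
    have h1 := (Real.hasDerivAt_arsinh x).const_mul 4
    have h2 : HasDerivAt (fun y : ℝ ↦ ∑ s ∈ range n,
      2 * Ring.choose (-(hlf) : ℝ) s / ((s : ℝ) + hlf) * y ^ (2 * s + 1))
      (∑ s ∈ range n, 4 * (Ring.choose (-(hlf) : ℝ) s * (x ^ 2) ^ s)) x := by
      apply HasDerivAt.fun_sum
      intro s _
      refine ((hasDerivAt_pow (2 * s + 1) x).const_mul _).congr_deriv ?_
      have : (s : ℝ) + hlf ≠ 0 := pz
      rw [← pow_mul]
      push_cast
      try simp only [Nat.add_sub_cancel]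
      field_simp
      ring
    refine (h1.sub h2).congr_deriv ?_
    rw [← mul_sum, Real.rpow_neg pz, ← Real.sqrt_eq_rpow]
    ring
  have hF0 : F 0 = 0 := by
    simp [hF]
  obtain ⟨c, hc, hc2⟩ := exists_hasDerivAt_eq_slope F _ hy
    (fun x _ ↦ (hd x).continuousAt.continuousWithinAt) (fun x _ ↦ hd x)
  have hb := h (c ^ 2) (by
    rw [abs_of_nonneg pz]
    calc c ^ 2 < y ^ 2 := by nlinarith [hc.1, hc.2]
      _ < (√δ) ^ 2 := by nlinarith [hc.1, hc.2]
      _ = δ := Real.sq_sqrt hδ.le)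
  rw [hF0, sub_zero, sub_zero, eq_div_iff hy.ne'] at hc2
  show |F y| ≤ _
  rw [← hc2, abs_mul, abs_mul, abs_of_pos hy, abs_of_pos (by norm_num : zr < 4)]
  have h3 : |c ^ 2| ^ n ≤ y ^ (2 * n) := by
    rw [abs_of_nonneg pz, pow_mul]
    have : c ^ 2 ≤ y ^ 2 := by nlinarith [hc.1, hc.2]
    gcongr
  calc _ ≤ 4 * (K * y ^ (2 * n)) * y := by
        gcongr
        exact hb.trans (by gcongr)
    _ = _ := by ring
lemma choose_lim (a p : ℝ) (n : ℕ) (hp : p < n) :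
    Tendsto (fun κ : ℝ ↦ ((1 + κ) ^ a - ∑ s ∈ range n, Ring.choose a s * κ ^ s) / κ ^ p)
      (𝓝[>] 0) (𝓝 0) := by
  obtain ⟨K, hK, δ, hδ, h⟩ := binom_taylor a n
  have hz : Tendsto (fun κ : ℝ ↦ K * κ ^ ((n : ℝ) - p)) (𝓝[>] 0) (𝓝 0) := by
    have : Tendsto (fun κ : ℝ ↦ κ ^ ((n : ℝ) - p)) (𝓝[>] 0) (𝓝 0) := by
      have h0 := (Real.continuousAt_rpow_const 0 ((n : ℝ) - p) (Or.inr lz)).tendsto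
      rw [Real.zero_rpow lz] at h0
      exact h0.mono_left nhdsWithin_le_nhds
    simpa using this.const_mul K
  refine squeeze_zero_norm' ?_ hz
  filter_upwards [Ioo_mem_nhdsGT hδ] with κ hκ
  have h1 := h κ (by rw [abs_of_pos hκ.1]; exact hκ.2)
  rw [abs_of_pos hκ.1] at h1
  have hp0 := rpow_pos_of_pos hκ.1 p
  rw [norm_div, norm_eq_abs, norm_eq_abs, abs_of_pos hp0, rpow_sub hκ.1, rpow_natCast,
    ← mul_div_assoc]
  gcongr
lemma arsinh_lim (p : ℝ) (n : ℕ) (hp : p < n) :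
    Tendsto (fun κ : ℝ ↦ (4 * arsinh √κ - ∑ s ∈ range n,
      2 * Ring.choose (-(hlf) : ℝ) s / ((s : ℝ) + hlf) * (√κ * κ ^ s)) / (√κ * κ ^ p))
      (𝓝[>] 0) (𝓝 0) := by
  obtain ⟨K, hK, δ, hδ, h⟩ := arsinh_taylor n
  have hz : Tendsto (fun κ : ℝ ↦ K * κ ^ ((n : ℝ) - p)) (𝓝[>] 0) (𝓝 0) := by
    have : Tendsto (fun κ : ℝ ↦ κ ^ ((n : ℝ) - p)) (𝓝[>] 0) (𝓝 0) := by
      have h0 := (Real.continuousAt_rpow_const 0 ((n : ℝ) - p) (Or.inr lz)).tendsto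
      rw [Real.zero_rpow lz] at h0
      exact h0.mono_left nhdsWithin_le_nhds
    simpa using this.const_mul K
  refine squeeze_zero_norm' ?_ hz
  filter_upwards [Ioo_mem_nhdsGT (show 0 < δ ^ 2 by positivity)] with κ hκ
  have hs : 0 < √κ := Real.sqrt_pos.2 hκ.1
  have h1 := h √κ hs (by rw [← Real.sqrt_sq hδ.le]; exact Real.sqrt_lt_sqrt hκ.1.le hκ.2)
  have e : ∀ s : ℕ, √κ ^ (2 * s + 1) = √κ * κ ^ s := by
    intro s
    rw [pow_succ, pow_mul, Real.sq_sqrt hκ.1.le, mul_comm]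
  simp only [e] at h1
  have hp0 := rpow_pos_of_pos hκ.1 p
  rw [norm_div, norm_eq_abs, norm_eq_abs, abs_of_pos (mul_pos hs hp0), rpow_sub hκ.1,
    rpow_natCast, div_le_iff₀ (mul_pos hs hp0)]
  refine h1.trans (le_of_eq ?_)
  field_simp
include hβ hκ
lemma Jk_rec :
    (β + hlf) * Jk (β + 1) κ + κ * β * Jk β κ = √(1 + κ) := by
  have hβ0 : 0 < β := lz
  have hi1 := Jk_int (β := β + 1) lz hκ
  have hi0 := Jk_int hβ hκ
  rw [show β + 1 - 1 = β by ring] at hi1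
  have e1 : ∀ u : ℝ, u ^ β * (-(hlf) / √ukp) = (-(hlf)) * (u ^ β / √ukp) := fun u ↦ by ring
  have := byparts hβ (fun u ↦ √ukp) (fun u ↦ -(hlf) / √ukp) (√(1 + κ)) (√(1 + κ)) fz
    (fun u hu ↦ ?_) (fun u hu ↦ ⟨pz, ?_⟩) ?_ ?_
  · have h := this.2
    rw [mH_integral hβ0] at h
    simp only [e1] at h
    rw [icm] at h
    have e2 : ∫ u in J01, β * u ^ bm1 * √ukp
        = ∫ u in J01, (β * (u ^ β / √ukp) + β * κ * (u ^ bm1 / √ukp)) := by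
      refine setIntegral_congr_fun mIoo fun u hu ↦ ?_
      have h1 := hu.1
      have h5 : 0 < √ukp := pz
      have h6 : √ukp ^ 2 = u + κ := sq_sqrt pz
      have h7 : u ^ β = u ^ bm1 * u := by rw [← rpow_add_one h1.ne']; congr 1; ring
      show β * u ^ bm1 * √ukp = β * (u ^ β / √ukp) + β * κ * (u ^ bm1 / √ukp)
      rw [h7]
      field_simp
      rw [h6]
    rw [e2, iad (hi1.const_mul _) (hi0.const_mul _), icm, icm] at h
    rw [Jk, Jk, show β + 1 - 1 = β by ring]
    linarith
  · have h1 := hu.1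
    have d := (((hasDerivAt_id u).add_const κ).sqrt (by simp only [id]; positivity))
    simp only [id] at d
    refine d.congr_deriv ?_
    have h5 : 0 < √ukp := pz
    field_simp
  · have h1 := hu.1
    have h2 : 1 ≤ u ^ (-(hlf) : ℝ) := one_le_rpow_of_pos_of_le_one_of_nonpos h1 hu.2.le nz
    calc √ukp ≤ √(1 + κ) * 1 := by rw [mul_one]; exact sqrt_le_sqrt (by linarith [hu.2])
      _ ≤ _ := by gcongr
  · have : ContinuousAt (fun u ↦ √ukp) 1 := fz
    exact this.tendsto.mono_left nhdsWithin_le_nhds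
  · simp only [e1]
    exact hi1.const_mul _
omit hβ
lemma M_sub :
    ∫ u in J01, u ^ bm1 / (ukp * √ukp) =
      κ ^ (β - 3/2) * ∫ w in Ioo zr (1 / (1 + κ)), w ^ bm1 * (1 - w) ^ (hlf - β) := by
  set f : ℝ → ℝ := fun w ↦ κ * w / (1 - w)
  have hw1 : ∀ w ∈ Ioo zr (1 / (1 + κ)), 0 < 1 - w ∧ κ * w < 1 - w := by
    intro w hw
    have h2 := hw.2
    rw [lt_div_iff₀ pz] at h2
    constructor <;> nlinarith [hw.1]
  have him : f '' Ioo zr (1 / (1 + κ)) = Ioo 0 1 := by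
    ext u
    constructor
    · rintro ⟨w, hw, rfl⟩
      obtain ⟨h1, h2⟩ := hw1 w hw
      have h0 := hw.1
      exact ⟨pz, by rw [div_lt_one h1]; exact h2⟩
    · intro hu
      have h0 := hu.1
      refine ⟨u / ukp, ⟨pz, ?_⟩, ?_⟩
      · rw [div_lt_div_iff₀ pz pz]
        nlinarith [hu.2]
      · show κ * (u / ukp) / (1 - u / ukp) = u
        rw [show 1 - u / ukp = κ / ukp by field_simp; ring]
        field_simp
  have hinj : Set.InjOn f (Ioo zr (1 / (1 + κ))) := by
    intro a ha b hb hab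
    have h1 := (hw1 a ha).1
    have h2 := (hw1 b hb).1
    have : κ * a / (1 - a) = κ * b / (1 - b) := hab
    rw [div_eq_div_iff h1.ne' h2.ne'] at this
    apply mul_left_cancel₀ hκ.ne'
    linarith
  have := integral_image_eq_integral_abs_deriv_smul (f' := fun w ↦ κ / (1 - w) ^ 2) mIoo
    (fun w hw ↦ (?_ : HasDerivAt f _ w).hasDerivWithinAt) hinj
    (fun u ↦ u ^ bm1 / (ukp * √ukp))
  · rw [him] at this
    rw [this, ← icm]
    refine setIntegral_congr_fun mIoo fun w hw ↦ ?_
    obtain ⟨h1, h2⟩ := hw1 w hw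
    have h0 := hw.1
    show |κ / (1 - w) ^ 2| • ((κ * w / (1 - w)) ^ bm1 /
      ((κ * w / (1 - w) + κ) * √(κ * w / (1 - w) + κ))) = κ ^ (β - 3/2) * (w ^ bm1 * (1 - w) ^ (hlf - β))
    rw [abs_of_pos pz, show κ * w / (1 - w) + κ = κ / (1 - w) by field_simp; ring,
      div_rpow pz h1.le, mul_rpow hκ.le h0.le, sqrt_div hκ.le, smul_eq_mul,
      show β - 3/2 = bm1 - hlf by ring, rpow_sub hκ bm1, ← sqrt_eq_rpow,
      show 1/2 - β = -bm1 - hlf by ring, rpow_sub h1 (-bm1), rpow_neg h1.le, ← sqrt_eq_rpow]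
    have h3 : 0 < √(1 - w) := pz
    have h4 : √(1 - w) ^ 2 = 1 - w := sq_sqrt h1.le
    have h5 : 0 < (1 - w) ^ bm1 := rpow_pos_of_pos h1 _
    have h6 : 0 < √κ := pz
    field_simp
    rw [h4]
  · have h1 := (hw1 w hw).1
    refine (((hasDerivAt_id w).const_mul κ).div ((hasDerivAt_id w).const_sub 1)
      (by simp only [id]; exact h1.ne')).congr_deriv ?_
    simp only [id]
    field_simp
    ring
omit hκ
lemma M_lim (h1 : 1/2 < β) (h2 : β < 3/2) :
    Tendsto (fun κ : ℝ ↦ ∫ w in Ioo zr (1 / (1 + κ)), w ^ bm1 * (1 - w) ^ (hlf - β))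
      (𝓝[>] 0) (𝓝 (Gamma β * Gamma (3/2 - β) / (√π / 2))) := by
  obtain ⟨hi, hv⟩ := beta_int (α := β) (γ := 3/2 - β) lz lz
  rw [show 3/2 - β - 1 = hlf - β by ring] at hi hv
  have hG : Gamma (β + (3/2 - β)) = √π / 2 := by
    rw [show β + (3/2 - β) = hlf + 1 by ring, Gamma_add_one nz, Gamma_one_half_eq]; ring
  rw [hG] at hv
  have hc := intervalIntegral.continuousOn_primitive_interval' (a := 0)
    ((intervalIntegrable_iff_integrableOn_Ioo_of_le (zero_le_one (α := ℝ))).2 hi) sz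
  have hc1 := hc 1 sz
  rw [ContinuousWithinAt, intervalIntegral.integral_of_le zero_le_one, integral_Ioc_eq_integral_Ioo, hv] at hc1
  have ht : Tendsto (fun κ : ℝ ↦ 1 / (1 + κ)) (𝓝[>] 0) (𝓝[Set.uIcc 0 1] 1) := by
    refine tendsto_nhdsWithin_iff.2 ⟨?_, ?_⟩
    · have : ContinuousAt (fun κ : ℝ ↦ 1 / (1 + κ)) 0 := by
        refine continuousAt_const.div fz nz
      have h := this.tendsto
      simp only [add_zero, div_one] at h
      exact h.mono_left nhdsWithin_le_nhds
    · filter_upwards [self_mem_nhdsWithin] with κ (hκ : 0 < κ)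
      rw [Set.uIcc_of_le zero_le_one]
      exact ⟨pz, by rw [div_le_one pz]; linarith⟩
  refine (hc1.comp ht).congr' ?_
  filter_upwards [self_mem_nhdsWithin] with κ (hκ : 0 < κ)
  simp only [Function.comp]
  rw [intervalIntegral.integral_of_le pz, integral_Ioc_eq_integral_Ioo]
lemma Jk_base_eq (h1 : 1/2 < β) (hκ : 0 < κ) :
    bmh * Jk β κ = (1 + κ) ^ (-(hlf) : ℝ) -
      κ / 2 * ∫ u in J01, u ^ bm1 / (ukp * √ukp) := by
  have hs : 0 < √κ := pz
  obtain ⟨hi, h⟩ := Jk_parts h1 hκ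
  have hi0 := Jk_int h1 hκ
  have hpt : ∀ u ∈ J01, κ * (u ^ bm1 / (ukp * √ukp)) =
      u ^ bm1 / √ukp - 2 / √κ * (u ^ β * kap κ u) := by
    intro u hu
    have h0 := hu.1
    have h5 : 0 < √ukp := pz
    have h7 : u ^ β = u ^ bm1 * u := by rw [← rpow_add_one h0.ne']; congr 1; ring
    rw [kap, h7]
    field_simp
    ring
  have e : κ * ∫ u in J01, u ^ bm1 / (ukp * √ukp) =
      Jk β κ - 2 / √κ * ∫ u in J01, u ^ β * kap κ u := by
    rw [← icm, setIntegral_congr_fun mIoo hpt,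
      integral_sub hi0 (hi.const_mul _), icm, Jk]
  have h' : ∫ u in J01, u ^ β * kap κ u = β * (√κ * Jk β κ) - √κ / √(1 + κ) := lz
  rw [h'] at e
  have h8 : 0 < √(1 + κ) := pz
  rw [rpow_neg pz, ← sqrt_eq_rpow]
  have e2 : 2 / √κ * (β * (√κ * Jk β κ) - √κ / √(1 + κ)) = 2 * β * Jk β κ - 2 * (√(1 + κ))⁻¹ := by
    field_simp
  rw [e2] at e
  linarith
lemma Jk_base (h1 : 1/2 < β) (h2 : β < 3/2) :
    Tendsto (fun κ : ℝ ↦ (Jk β κ - 1 / bmh) / κ ^ bmh)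
      (𝓝[>] 0) (𝓝 (Gamma β * Gamma (hlf - β) / √π)) := by
  have hpi : √π ≠ 0 := pz
  have hb : β - hlf ≠ 0 := lz
  have t1 := choose_lim (-(hlf)) bmh 1 (by norm_num; linarith)
  have t := (t1.sub ((M_lim h1 h2).const_mul (hlf))).const_mul (1 / bmh)
  have hg := Gamma_add_one (s := 1/2 - β) lz
  have hv : 1 / bmh * (0 - 1/2 * (Gamma β * Gamma (3/2 - β) / (√π / 2))) =
      Gamma β * Gamma (hlf - β) / √π := by
    rw [show 3/2 - β = hlf - β + 1 by ring, hg]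
    generalize Gamma (hlf - β) = G
    rw [show 1/2 - β = -bmh by ring]
    generalize β - hlf = d at hb
    field_simp
    ring
  rw [hv] at t
  refine t.congr' ?_
  filter_upwards [self_mem_nhdsWithin] with κ (hκ : 0 < κ)
  have hJ := Jk_base_eq h1 hκ
  rw [M_sub hκ] at hJ
  have hk : 0 < κ ^ bmh := rpow_pos_of_pos hκ _
  have hk2 : κ * κ ^ (β - 3/2) = κ ^ bmh := by
    rw [mul_comm, ← rpow_add_one hκ.ne']; congr 1; ring
  simp only [Finset.range_one, Finset.sum_singleton, Ring.choose_zero_right, pow_zero, mul_one]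
  set I := ∫ w in Ioo zr (1 / (1 + κ)), w ^ bm1 * (1 - w) ^ (hlf - β)
  rw [eq_div_iff hk.ne']
  apply mul_left_cancel₀ hb
  have : bmh * (Jk β κ - 1 / bmh) = bmh * Jk β κ - 1 := by
    rw [mul_sub, mul_one_div_cancel hb]
  rw [this, hJ, ← mul_assoc, ← mul_assoc, mul_one_div_cancel hb, one_mul, sub_mul,
    div_mul_cancel₀ _ hk.ne', ← hk2]
  ring
def jC (β : ℝ) (r : ℕ) : ℝ := (√π)⁻¹ * ((-1) ^ r * (ACoef β r - aCoef r))
lemma Gamma_half_ne {m : ℕ} (h1 : (m : ℝ) < β - hlf) (h2 : β - hlf < m + 1) :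
    Gamma (hlf - β) ≠ 0 := by
  apply Real.Gamma_ne_zero
  intro k hk
  have h3 : (m : ℝ) < k := lz
  have h4 : (k : ℝ) < m + 1 := lz
  have h5 : m < k := by exact_mod_cast h3
  have h6 : k < m + 1 := by exact_mod_cast h4
  omega
lemma jC_zero {m : ℕ} (h1 : (m : ℝ) < β - hlf) (h2 : β - hlf < m + 1) :
    jC β 0 = 1 / bmh := by
  have hG := Gamma_half_ne h1 h2
  have hb : β - hlf ≠ 0 := by linarith [(Nat.cast_nonneg m : zr ≤ m)]
  have hq := choose_half 0
  rw [Ring.choose_zero_right] at hq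
  have hpi : √π ≠ 0 := pz
  have hg := Gamma_add_one (s := 1/2 - β) (by intro h; apply hb; linarith)
  have e1 : Gamma (((0:ℕ):ℝ) + 1) = 1 := sz
  rw [e1] at hq
  rw [jC, ACoef]
  simp only [zero_add, Finset.range_one, Finset.sum_singleton, Gamma_one, Nat.sub_self, ascPochhammer_zero,
    eval_one, pow_zero, Nat.cast_zero, add_zero] at hq ⊢
  rw [show 3/2 - β = hlf - β + 1 by ring, hg]
  generalize Gamma (0 - hlf) = g at hq ⊢
  have hq' : g = -2 * √π := by
    field_simp at hq; linarith
  rw [hq']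
  generalize Gamma (hlf - β) = G at hG
  rw [show 1/2 - β = -bmh by ring]
  generalize β - hlf = d at hb
  field_simp
  ring
lemma A_rec (r : ℕ) :
    ∑ s ∈ range (r + 1 + 1),
      (Gamma ((s : ℝ) - hlf) / Gamma ((s : ℝ) + 1)) *
        (ascPochhammer ℝ (r + 1 - s)).eval (1 - (β + 1)) /
        Gamma (3/2 - (β + 1) + ((r + 1 - s : ℕ) : ℝ)) =
    -β * ∑ s ∈ range (r + 1),
      (Gamma ((s : ℝ) - hlf) / Gamma ((s : ℝ) + 1)) *
        (ascPochhammer ℝ (r - s)).eval (1 - β) /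
        Gamma (3/2 - β + ((r - s : ℕ) : ℝ)) +
    (Gamma (((r + 1 : ℕ) : ℝ) - hlf) / Gamma (((r + 1 : ℕ) : ℝ) + 1)) / Gamma (hlf - β) := by
  rw [sum_range_succ, mul_sum]
  congr 1
  · refine sum_congr rfl fun s hs ↦ ?_
    have : r + 1 - s = (r - s) + 1 := by have := Finset.mem_range.1 hs; omega
    rw [this, ascPochhammer_succ_left, eval_mul, eval_comp]
    simp only [eval_X, eval_add, eval_one]
    rw [show 1 - (β + 1) + 1 = 1 - β by ring]
    push_cast
    rw [show 3/2 - (β + 1) + (((r - s : ℕ) : ℝ) + 1) = 3/2 - β + ((r - s : ℕ) : ℝ) by ring]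
    ring
  · rw [Nat.sub_self, ascPochhammer_zero, eval_one, Nat.cast_zero, mul_one,
      show 3/2 - (β + 1) + 0 = hlf - β by ring]
lemma jC_rec {m : ℕ} (h1 : (m : ℝ) < β - hlf) (h2 : β - hlf < m + 1) (r : ℕ) :
    (β + hlf) * jC (β + 1) (r + 1) + β * jC β r = Ring.choose (hlf : ℝ) (r + 1) := by
  have hG := Gamma_half_ne h1 h2
  have hm : zr ≤ m := pz
  have hg := Gamma_add_one (s := -1/2 - β) lz
  rw [show -1/2 - β + 1 = hlf - β by ring] at hg
  have hpi : √π ≠ 0 := pz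
  rw [jC, jC, ACoef, ACoef, A_rec, choose_half, show 1/2 - (β + 1) = -1/2 - β by ring]
  generalize (∑ s ∈ range (r + 1), _ : ℝ) = S
  rw [add_sub_cancel_left, add_sub_cancel_left]
  have hg' : Gamma (hlf - β) = -((β + hlf) * Gamma (-1/2 - β)) := by rw [hg]; ring
  rw [hg'] at hG ⊢
  generalize Gamma (-1/2 - β) = G at *
  have hp : (β + hlf) ≠ 0 := lz
  have hG0 : G ≠ 0 := by rintro rfl; simp at hG
  have hH : Gamma (((r + 1 : ℕ) : ℝ) + 1) ≠ 0 := (Gamma_pos_of_pos pz).ne'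
  generalize β + hlf = p at hp
  field_simp
  ring
lemma J_exp (m : ℕ) : ∀ β : ℝ, (m : ℝ) < β - hlf → β - hlf < m + 1 →
    Tendsto (fun κ : ℝ ↦ (Jk β κ - ∑ r ∈ range (m + 1), jC β r * κ ^ r) / κ ^ bmh)
      (𝓝[>] 0) (𝓝 (Gamma β * Gamma (hlf - β) / √π)) := by
  induction m with
  | zero =>
    intro β h1 h2
    have := Jk_base (β := β) (by push_cast at h1; linarith) (by push_cast at h2; linarith)
    simp only [zero_add, Finset.range_one, Finset.sum_singleton, jC_zero h1 h2, pow_zero, mul_one]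
    exact this
  | succ m ih =>
    intro β' h1 h2
    obtain ⟨β, rfl⟩ : ∃ β, β' = β + 1 := ⟨β' - 1, by ring⟩
    have h1' : (m : ℝ) < β - hlf := by push_cast at h1; linarith
    have h2' : β - hlf < m + 1 := by push_cast at h2; linarith
    have hm : zr ≤ m := pz
    have hp : β + hlf ≠ 0 := lz
    have t1 := choose_lim (hlf) (β + hlf) (m + 2) (by push_cast; linarith)
    have t := (t1.sub ((ih β h1' h2').const_mul β)).const_mul (1 / (β + hlf))
    have hg := Gamma_add_one (s := -1/2 - β) lz
    rw [show -1/2 - β + 1 = hlf - β by ring] at hg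
    have hv : 1 / (β + hlf) * (0 - β * (Gamma β * Gamma (hlf - β) / √π)) =
        Gamma (β + 1) * Gamma (hlf - (β + 1)) / √π := by
      rw [Gamma_add_one lz, show 1/2 - (β + 1) = -1/2 - β by ring, hg,
        show -1/2 - β = -(β + hlf) by ring]
      generalize Gamma (-(β + hlf)) = G
      generalize β + hlf = p at hp
      field_simp
      ring
    rw [hv] at t
    refine t.congr' ?_
    filter_upwards [self_mem_nhdsWithin] with κ (hκ : 0 < κ)
    have hJ := Jk_rec (β := β) lz hκ
    have hk : 0 < κ ^ (β + hlf) := rpow_pos_of_pos hκ _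
    have hk0 : 0 < κ ^ bmh := rpow_pos_of_pos hκ _
    have hk2 : κ ^ (β + hlf) = κ ^ bmh * κ := by
      rw [← rpow_add_one hκ.ne']; congr 1; ring
    have hs : (β + hlf) * ∑ r ∈ range (m + 1 + 1), jC (β + 1) r * κ ^ r =
        ∑ s ∈ range (m + 2), Ring.choose (hlf : ℝ) s * κ ^ s -
          β * κ * ∑ r ∈ range (m + 1), jC β r * κ ^ r := by
      rw [Finset.sum_range_succ' _ (m + 1), Finset.sum_range_succ' _ (m + 1), jC_zero h1 h2,
        Ring.choose_zero_right, show β + 1 - hlf = β + hlf by ring, mul_add, mul_sum,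
        mul_sum]
      have : ∑ i ∈ range (m + 1), (β + hlf) * (jC (β + 1) (i + 1) * κ ^ (i + 1)) =
          ∑ i ∈ range (m + 1), (Ring.choose (hlf : ℝ) (i + 1) * κ ^ (i + 1)
            - β * κ * (jC β i * κ ^ i)) := by
        refine sum_congr rfl fun i _ ↦ ?_
        rw [← jC_rec h1' h2' i]
        ring
      rw [this, Finset.sum_sub_distrib, pow_zero, mul_one, mul_one_div_cancel hp]
      ring
    rw [show β + 1 - hlf = β + hlf by ring]
    rw [← Real.sqrt_eq_rpow, ← hJ]
    rw [eq_div_iff hk.ne']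
    apply mul_left_cancel₀ hp
    rw [mul_sub (β + hlf) (Jk (β + 1) κ), hs, ← mul_assoc, ← mul_assoc, mul_one_div_cancel hp, one_mul, sub_mul,
      div_mul_cancel₀ _ hk.ne', hk2]
    field_simp
    ring
lemma e_exp {m : ℕ} (h1 : (m : ℝ) < β - hlf) (h2 : β - hlf < m + 1) :
    Tendsto (fun κ : ℝ ↦ (eK β κ - ∑ r ∈ range (m + 1),
      2 / √π * ((-1) ^ r * ACoef β r) * (√κ * κ ^ r)) / κ ^ β)
      (𝓝[>] 0) (𝓝 (2 * (Gamma β * Gamma (hlf - β) / √π))) := by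
  have hm : zr ≤ m := pz
  have t := (arsinh_lim bmh (m + 1) (by push_cast; linarith)).add ((J_exp m β h1 h2).const_mul 2)
  rw [zero_add] at t
  refine t.congr' ?_
  filter_upwards [self_mem_nhdsWithin] with κ (hκ : 0 < κ)
  have hs : 0 < √κ := pz
  have hk : 0 < κ ^ bmh := rpow_pos_of_pos hκ _
  have hk2 : κ ^ β = √κ * κ ^ bmh := by
    rw [sqrt_eq_rpow, ← rpow_add hκ]; congr 1; ring
  rw [(eK_eq lz hκ).2, hk2]
  have hsum : ∑ r ∈ range (m + 1), 2 / √π * ((-1) ^ r * ACoef β r) * (√κ * κ ^ r) =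
      ∑ s ∈ range (m + 1), 2 * Ring.choose (-(hlf) : ℝ) s / ((s : ℝ) + hlf) * (√κ * κ ^ s) +
      2 * √κ * ∑ r ∈ range (m + 1), jC β r * κ ^ r := by
    rw [mul_sum, ← Finset.sum_add_distrib]
    refine sum_congr rfl fun r _ ↦ ?_
    have e : 2 * Ring.choose (-(hlf) : ℝ) r / ((r : ℝ) + hlf) = 2 / √π * ((-1) ^ r * aCoef r) := by
      rw [choose_nhalf, aCoef]
      have hH : Gamma ((r : ℝ) + 1) ≠ 0 := (Gamma_pos_of_pos pz).ne'
      have : (r : ℝ) + hlf ≠ 0 := pz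
      field_simp
    rw [e, jC]
    ring
  rw [hsum]
  generalize ∑ s ∈ range (m + 1), 2 * Ring.choose (-(hlf) : ℝ) s / ((s : ℝ) + hlf) * (√κ * κ ^ s) = S
  generalize ∑ r ∈ range (m + 1), jC β r * κ ^ r = T
  generalize κ ^ bmh = K at hk
  field_simp
  ring
include hβ
lemma D_eq : 2 / (β * m0 β) = 2 * √π * Gamma β / Gamma (β + hlf) := by
  rw [(arc_rpow lz).2, Gamma_add_one lz]
  have := Gamma_pos_of_pos (show 0 < β by linarith)
  have := Gamma_pos_of_pos (show 0 < β + hlf by linarith)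
  have : 0 < β := lz
  field_simp
lemma D_eq2 : 2 / (β * m0 β) = 4 ^ β * (Gamma β ^ 2 / Gamma (2 * β)) := by
  rw [D_eq hβ]
  have h := Gamma_mul_Gamma_add_half β
  have h1 := Gamma_pos_of_pos (show 0 < β by linarith)
  have h2 := Gamma_pos_of_pos (show 0 < β + hlf by linarith)
  have h3 := Gamma_pos_of_pos (show 0 < 2 * β by linarith)
  have e : (2:ℝ) ^ (1 - 2 * β) * 4 ^ β = 2 := by
    rw [show (4:ℝ) = 2 ^ (2:ℝ) by norm_num, ← rpow_mul nz, ← rpow_add nz]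
    norm_num
  rw [← mul_div_assoc, div_eq_div_iff h2.ne' h3.ne']
  linear_combination (-Gamma β * 4 ^ β) * h - Gamma β * Gamma (2 * β) * √π * e
lemma bN_C {x : ℝ} (hx : 0 ≤ x) : bN β x = Ccoef β * x ^ (1 / β) := by
  have h3 := Gamma_pos_of_pos (show 0 < 2 * β by linarith)
  have hβ0 : 0 < β := lz
  rw [bN, show 2 * x / (β * m0 β) = 2 / (β * m0 β) * x by ring, D_eq2 hβ,
    mul_rpow pz hx, mul_rpow pz pz, ← rpow_mul nz,
    mul_one_div_cancel hβ0.ne', rpow_one, Ccoef]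
lemma C_pos : 0 < Ccoef β := by
  have h1 := Gamma_pos_of_pos (show 0 < β by linarith)
  have h3 := Gamma_pos_of_pos (show 0 < 2 * β by linarith)
  rw [Ccoef]; positivity
omit hβ
include hσ
lemma EN_exp {m : ℕ} (h1 : (m : ℝ) < β - hlf) (h2 : β - hlf < m + 1) :
    Tendsto (fun N : ℕ ↦ EN β N σ - N * ∑ r ∈ range (m + 1),
      2 / √π * ((-1) ^ r * ACoef β r) * (√(σ / bbN) * (σ / bbN) ^ r))
      atTop (𝓝 (σ ^ β * (1 / cos (π * β)))) := by
  have hm : zr ≤ m := pz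
  have hβ : 1/2 < β := lz
  have hβ0 : 0 < β := lz
  have hk : Tendsto (fun N : ℕ ↦ σ / bbN) atTop (𝓝[>] 0) := by
    refine tendsto_nhdsWithin_iff.2 ⟨(bNn_lim hβ).const_div_atTop σ, ?_⟩
    filter_upwards [egt 0] with N hN
    have := bN_pos hβ (x := N) (by exact_mod_cast hN)
    exact div_pos hσ this
  have t := ((e_exp h1 h2).comp hk).const_mul (σ ^ β * (β * m0 β / 2))
  have hv : σ ^ β * (β * m0 β / 2) * (2 * (Gamma β * Gamma (hlf - β) / √π)) = σ ^ β * (1 / cos (π * β)) := by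
    have hD := D_eq hβ
    have hm0 := m0_pos hβ
    have g1 := Gamma_pos_of_pos (show 0 < β by linarith)
    have g2 := Gamma_pos_of_pos (show 0 < β + hlf by linarith)
    have hD' : β * m0 β / 2 = Gamma (β + hlf) / (2 * √π * Gamma β) := by
      rw [← inv_inj, inv_div, inv_div, hD]
    have hr := Gamma_mul_Gamma_one_sub (β + hlf)
    rw [show 1 - (β + hlf) = hlf - β by ring, show π * (β + hlf) = π * β + π / 2 by ring, sin_add_pi_div_two] at hr
    have hpi : √π * √π = π := mul_self_sqrt pi_pos.le
    rw [hD', mul_assoc]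
    congr 1
    calc Gamma (β + hlf) / (2 * √π * Gamma β) * (2 * (Gamma β * Gamma (hlf - β) / √π))
        = Gamma (β + hlf) * Gamma (hlf - β) / (√π * √π) := by field_simp
      _ = 1 / cos (π * β) := by
        rw [hr, hpi]; field_simp
  rw [hv] at t
  refine t.congr' ?_
  filter_upwards [egt 0] with N hN
  have hN' : zr < N := by exact_mod_cast hN
  have hb := bN_pos hβ hN'
  have hbe := bN_eq hβ hN'.le
  simp only [Function.comp]
  rw [EN, ← mul_sub, div_rpow hσ.le hb.le]
  have hbb := rpow_pos_of_pos hb β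
  have hss := rpow_pos_of_pos hσ β
  generalize (eK β _ - _ : ℝ) = Y
  generalize bbN = b at *
  rw [show (N : ℝ) = β * m0 β / 2 * b ^ β by linarith]
  field_simp
include hβ
lemma sum_match {N : ℕ} (hN : 0 < N) (m : ℕ) :
    (N : ℝ) * ∑ r ∈ range (m + 1),
      2 / √π * ((-1) ^ r * ACoef β r) * (√(σ / bbN) * (σ / bbN) ^ r) =
    2 * (((N : ℝ) ^ (1 - 1 / (2 * β)) / sqrt (π * Ccoef β)) *
            ∑ r ∈ range (m + 1),
              (-1 : ℝ) ^ r * ACoef β r * σ ^ ((r : ℝ) + hlf) *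
                (Ccoef β * (N : ℝ) ^ (1 / β)) ^ (-(r : ℝ))) := by
  have hN' : zr < N := by exact_mod_cast hN
  have hb := bN_pos hβ hN'
  have hC := C_pos hβ
  rw [← bN_C hβ hN'.le, mul_sum, mul_sum, mul_sum]
  refine sum_congr rfl fun r _ ↦ ?_
  have hn : 0 < (N : ℝ) ^ (1 / (2 * β)) := rpow_pos_of_pos hN' _
  have hsb : √(bbN) = √(Ccoef β) * (N : ℝ) ^ (1 / (2 * β)) := by
    rw [bN_C hβ hN'.le, sqrt_mul hC.le, sqrt_eq_rpow ((N : ℝ) ^ (1 / β)), ← rpow_mul hN'.le]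
    congr 2
    field_simp
  have hsC : 0 < √(Ccoef β) := pz
  have hpi : 0 < √π := pz
  rw [rpow_neg hb.le, rpow_natCast, rpow_add hσ, rpow_natCast, ← sqrt_eq_rpow, sqrt_div hσ.le, hsb,
    sqrt_mul pi_pos.le, rpow_sub hN', rpow_one, div_pow]
  have hbr := pow_pos hb r
  field_simp
include hP
lemma onp_sign {N : ℕ} (hN : 0 < N) :
    0 < (-1) ^ N * PE (-σ) := by
  set q : RX := C ((-1) ^ N) * (P N).comp (-X) with hq
  have he : ∀ x, q.eval x = (-1) ^ N * PE (-x) := fun x ↦ by simp [hq]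
  have hpow : ((-1 : ℝ) ^ N) * (-1) ^ N = 1 := by rw [← mul_pow]; simp
  have hnX : (-X : RX).natDegree = 1 := sz
  have hlead : q.leadingCoeff = (P N).leadingCoeff := by
    rw [hq, leadingCoeff_mul, leadingCoeff_C, leadingCoeff_comp sz, hP.1 N, leadingCoeff_neg,
      leadingCoeff_X, mul_left_comm, hpow, mul_one]
  have hdeg : q.natDegree = N := by
    rw [hq, natDegree_C_mul pz, natDegree_comp, hP.1 N]; simp
  have ht := q.tendsto_atTop_of_leadingCoeff_nonneg (natDegree_pos_iff_degree_pos.1 oz)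
    (by rw [hlead]; exact (hP.2.1 N).le)
  rw [← he]
  by_contra hneg
  push Not at hneg
  obtain ⟨x, hx1, hx2⟩ := ((ht.eventually_gt_atTop 0).and (egt σ)).exists
  obtain ⟨c, hc, hc2⟩ := intermediate_value_Icc hx2.le q.continuous.continuousOn ⟨hneg, hx1.le⟩
  have := onp_ne hβ (lt_of_lt_of_le hσ hc.1) hP N
  have hc2 : q.eval c = 0 := hc2
  rw [he] at hc2
  rcases mul_eq_zero.1 hc2 with h | h
  · simp at h
  · exact this h
omit hβ hσ hP
theorem final_main
    (β : ℝ) (hβ : 1/2 < β) (hβ' : ∀ n : ℕ, 1 ≤ n → β ≠ (n : ℝ) + hlf)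
    (P : ℕ → Polynomial ℝ) (hP : ONP β P)
    (t : ℝ) (ht : t < 0) :
    Tendsto (fun N : ℕ ↦
      PE t /
        ((-1 : ℝ) ^ N * (sqrt (2 * π))⁻¹ *
          (-t * Ccoef β * (N : ℝ) ^ (1 / β)) ^ (-(1/4) : ℝ) *
          exp ((-t) ^ β * (1 / cos (π * β)) / 2) *
          exp (((N : ℝ) ^ (1 - 1 / (2 * β)) / sqrt (π * Ccoef β)) *
            ∑ r ∈ range (Nat.floor bmh + 1),
              (-1 : ℝ) ^ r * ACoef β r * (-t) ^ ((r : ℝ) + hlf) *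
                (Ccoef β * (N : ℝ) ^ (1 / β)) ^ (-(r : ℝ)))))
      atTop (nhds 1) := by
  obtain ⟨σ, rfl⟩ : ∃ σ, t = -σ := ⟨-t, by ring⟩
  have hσ : 0 < σ := lz
  rw [neg_neg]
  set m := Nat.floor bmh with hm
  have h2 : β - hlf < m + 1 := Nat.lt_floor_add_one _
  have h1 : (m : ℝ) < β - hlf := by
    have h0 : (m : ℝ) ≤ β - hlf := Nat.floor_le lz
    rcases h0.lt_or_eq with h | h
    · exact h
    · exfalso
      rcases Nat.eq_zero_or_pos m with h3 | h3
      · rw [h3] at h; push_cast at h; linarith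
      · exact hβ' m h3 lz
  set L := σ ^ β * (1 / cos (π * β)) with hL
  have tE := (EN_exp hσ h1 h2)
  have tP := P_lim hβ hP hσ
  have tX := (continuous_exp.tendsto (L - L)).comp (tE.sub_const L)
  rw [sub_self, exp_zero] at tX
  have tY := (tP.mul tX).const_mul (2 * π)
  have e1 : 2 * π * (1 / (2 * π) * 1) = 1 := by
    have := pi_pos
    field_simp
  rw [e1] at tY
  have tZ := (continuous_sqrt.tendsto 1).comp tY
  rw [sqrt_one] at tZ
  refine tZ.congr' ?_
  filter_upwards [egt 0] with N hN
  have hN' : zr < N := by exact_mod_cast hN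
  have hb := bN_pos hβ hN'
  have hs := onp_sign hβ hσ hP hN
  simp only [Function.comp]
  rw [sum_match hβ hσ hN m, mul_assoc σ, ← bN_C hβ hN'.le]
  set S := ((N : ℝ) ^ (1 - 1 / (2 * β)) / sqrt (π * Ccoef β)) *
            ∑ r ∈ range (m + 1),
              (-1 : ℝ) ^ r * ACoef β r * σ ^ ((r : ℝ) + hlf) *
                (bbN) ^ (-(r : ℝ)) with hS
  have hpow : ((-1 : ℝ) ^ N) * (-1) ^ N = 1 := by rw [← mul_pow]; simp
  have hq : 0 < (σ * bbN) ^ (1/4 : ℝ) := pz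
  have hq2 : √(σ * bbN) = ((σ * bbN) ^ (1/4 : ℝ)) ^ 2 := by
    rw [← rpow_natCast, ← rpow_mul pz, sqrt_eq_rpow]; norm_num
  have h2pi : 0 < √(2 * π) := pz
  have h2pi2 : √(2 * π) ^ 2 = 2 * π := sq_sqrt pz
  rw [rpow_neg pz]
  have key : PE (-σ) / ((-1 : ℝ) ^ N * (√(2 * π))⁻¹ * ((σ * bbN) ^ (1/4 : ℝ))⁻¹ * exp (L / 2) * exp S)
      = ((-1) ^ N * PE (-σ)) * √(2 * π) * (σ * bbN) ^ (1/4 : ℝ) * exp (-(L / 2) - S) := by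
    rw [exp_sub, exp_neg]
    have hne : ((-1 : ℝ) ^ N) ≠ 0 := sz
    have : (-1 : ℝ) ^ N = 1 / (-1) ^ N := by rw [eq_div_iff hne, hpow]
    rw [div_eq_iff pz]
    have e1 := exp_pos (L / 2)
    have e2 := exp_pos S
    calc PE (-σ) = ((-1 : ℝ) ^ N * (-1) ^ N) * PE (-σ) := by rw [hpow, one_mul]
      _ = _ := by field_simp
  rw [key, ← sqrt_sq (show 0 ≤ ((-1) ^ N * PE (-σ)) * √(2 * π) * (σ * bbN) ^ (1/4 : ℝ) * exp (-(L / 2) - S) by positivity)]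
  congr 1
  rw [mul_pow, mul_pow, mul_pow, mul_pow, h2pi2, ← hq2, ← exp_nat_mul, ← pow_mul, mul_comm N 2, pow_mul]
  rw [show EN β N σ - 2 * S - L = EN β N σ + (2 : ℕ) * (-(L / 2) - S) by push_cast; ring, exp_add]
  have := exp_pos (EN β N σ)
  field_simp
  norm_num
end

/-- Strong asymptotics, for fixed `t < 0`, of the polynomials
orthonormal with respect to `exp(−x^β)` on `[0,∞)`, when `β > 1/2` is not of
the form `n + 1/2` with `n ≥ 1`:
`P_N(t) ≃ (−1)^N (2π)^{−1/2} (−tCN^{1/β})^{−1/4} exp((−t)^β sec(πβ)/2)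
  exp((N^{1−1/(2β)}/√(πC)) ∑_{r=0}^{⌊β−1/2⌋} (−1)^r A_r (−t)^{r+1/2} (CN^{1/β})^{−r})`. -/
theorem strong_asymptotics_nonhalfinteger
    (β : ℝ) (hβ : 1/2 < β) (hβ' : ∀ n : ℕ, 1 ≤ n → β ≠ (n : ℝ) + 1/2)
    (P : ℕ → Polynomial ℝ)
    (hdeg : ∀ n, (P n).natDegree = n)
    (hlead : ∀ n, 0 < (P n).leadingCoeff)
    (horth : ∀ m n, (∫ x in Set.Ioi (0:ℝ),
      (P m).eval x * (P n).eval x * Real.exp (-(x ^ β))) = if m = n then 1 else 0)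
    (t : ℝ) (ht : t < 0) :
    Tendsto (fun N : ℕ =>
      (P N).eval t /
        ((-1 : ℝ) ^ N * (Real.sqrt (2 * π))⁻¹ *
          (-t * Ccoef β * (N : ℝ) ^ (1 / β)) ^ (-(1/4) : ℝ) *
          Real.exp ((-t) ^ β * (1 / Real.cos (π * β)) / 2) *
          Real.exp (((N : ℝ) ^ (1 - 1 / (2 * β)) / Real.sqrt (π * Ccoef β)) *
            ∑ r ∈ Finset.range (Nat.floor (β - 1/2) + 1),
              (-1 : ℝ) ^ r * ACoef β r * (-t) ^ ((r : ℝ) + 1/2) *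
                (Ccoef β * (N : ℝ) ^ (1 / β)) ^ (-(r : ℝ)))))
      atTop (nhds 1) := by
  refine final_main β hβ hβ' P ⟨hdeg, hlead, fun m n => ?_⟩ t ht
  rw [wM_integral]
  exact horth m n
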